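/- For all fixed integers k ≥ 1 and A ≥ 0, there exist constants c_{k,A} > 0 and C_{k,A} > 0 such that for all R ≥ 3, |𝓜_{f_A,2k}(R) − c_{k,A}·(log R)^{𝓔_{k,A}}| ≤ C_{k,A}·(log R)^{𝓔_{k,A}−1}, where 𝓔_{k,A} := max{binom(2k,k) − 2k(A+1), −1}. -/

import Mathlib

/-- `f_A(t) = (1−t)^A` for `t ≤ 1` and `0` otherwise. -/
noncomputable def fA (A : ℕ) : ℝ → ℝ := fun t => if t ≤ 1 then (1 - t) ^ A else 0

/-- `𝓜_{f,k}(R) := Σ_{d_1,…,d_k ≥ 1} (∏_{j=1}^k μ(d_j) f(log d_j/log R)) / lcm(d_1,…,d_k)`.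
(The terms with some `d_j = 0` vanish since `μ(0) = 0`.) -/
noncomputable def momentM (f : ℝ → ℝ) (k : ℕ) (R : ℝ) : ℝ :=
  ∑' d : Fin k → ℕ,
    (∏ j, ((ArithmeticFunction.moebius (d j) : ℤ) : ℝ) *
      f (Real.log (d j) / Real.log R)) / ((Finset.univ.lcm d : ℕ) : ℝ)

noncomputable def zetaTerm (m : ℕ) (s : ℂ) : ℂ :=
  (s - 1) * ((m : ℂ) + 1) ^ (-s) + ((m : ℂ) + 1) ^ (1 - s) - (m : ℂ) ^ (1 - s)

lemma norm_cpow_neg_sub_le {m : ℕ} (hm : 1 ≤ m) {s : ℂ} (hs : 0 < s.re) {x : ℝ}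
    (hx : x ∈ Set.Icc (m : ℝ) (m + 1)) :
    ‖((m : ℂ) + 1) ^ (-s) - (x : ℂ) ^ (-s)‖ ≤ ‖s‖ * (m : ℝ) ^ (-s.re - 1) := by
  have hm0 : (0 : ℝ) < m := by exact_mod_cast hm
  have hx0 : 0 < x := hm0.trans_le hx.1
  have hs0 : -s ≠ 0 := by
    intro h; simp only [neg_eq_zero] at h; simp [h] at hs
  have key := norm_image_sub_le_of_norm_deriv_le_segment' (f := fun y : ℝ => (y : ℂ) ^ (-s))
    (f' := fun y => -s * (y : ℂ) ^ (-s - 1)) (a := x) (b := (m : ℝ) + 1)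
    (C := ‖s‖ * (m : ℝ) ^ (-s.re - 1)) ?_ ?_ (m + 1) ⟨hx.2, le_rfl⟩
  · have h2 : ((m : ℝ) + 1 - x) ≤ 1 := by linarith [hx.1]
    have h3 : 0 ≤ ‖s‖ * (m : ℝ) ^ (-s.re - 1) := by positivity
    push_cast at key
    refine key.trans ?_
    nlinarith
  · intro y hy
    exact (hasDerivAt_ofReal_cpow_const (by linarith [hy.1]) hs0).hasDerivWithinAt
  · intro y hy
    have hy0 : 0 < y := by linarith [hy.1]
    rw [norm_mul, norm_neg, Complex.norm_cpow_eq_rpow_re_of_pos hy0]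
    gcongr ?_ * ?_
    simp only [Complex.sub_re, Complex.neg_re, Complex.one_re]
    exact Real.rpow_le_rpow_of_nonpos hm0 (by linarith [hy.1, hx.1]) (by linarith)

lemma norm_zetaTerm_le {m : ℕ} (hm : 1 ≤ m) {s : ℂ} (hs : 0 < s.re) :
    ‖zetaTerm m s‖ ≤ ‖s - 1‖ * ‖s‖ * (m : ℝ) ^ (-s.re - 1) := by
  have hm0 : (0 : ℝ) < m := by exact_mod_cast hm
  rcases eq_or_ne s 1 with rfl | h1
  · simp [zetaTerm]
  have hs1 : 1 - s ≠ 0 := sub_ne_zero.2 h1.symm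
  have key := norm_image_sub_le_of_norm_deriv_le_segment'
    (f := fun y : ℝ => (s - 1) * ((m : ℂ) + 1) ^ (-s) * y + (y : ℂ) ^ (1 - s))
    (f' := fun y => (s - 1) * ((m : ℂ) + 1) ^ (-s) * (1 : ℂ) + (1 - s) * (y : ℂ) ^ (1 - s - 1))
    (a := m) (b := (m : ℝ) + 1)
    (C := ‖s - 1‖ * ‖s‖ * (m : ℝ) ^ (-s.re - 1)) ?_ ?_ (m + 1) ⟨by linarith, le_rfl⟩
  · simp only [add_sub_cancel_left, mul_one] at key
    refine le_trans (le_of_eq ?_) key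
    rw [zetaTerm]; push_cast; congr 1; ring
  · intro y hy
    have hy0 : 0 < y := by linarith [hy.1]
    refine HasDerivAt.hasDerivWithinAt ?_
    refine HasDerivAt.add ?_ (hasDerivAt_ofReal_cpow_const hy0.ne' hs1)
    exact (HasDerivAt.const_mul _ (Complex.ofRealCLM.hasDerivAt (x := y)))
  · intro y hy
    have : (s - 1) * ((m : ℂ) + 1) ^ (-s) * (1 : ℂ) + (1 - s) * (y : ℂ) ^ (1 - s - 1)
      = (s - 1) * (((m : ℂ) + 1) ^ (-s) - (y : ℂ) ^ (-s)) := by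
      rw [show 1 - s - 1 = -s by ring]; ring
    rw [this, norm_mul, mul_assoc]
    gcongr
    exact norm_cpow_neg_sub_le hm hs ⟨hy.1, hy.2.le⟩

lemma summable_nat_add_rpow {a : ℝ} (ha : 0 < a) (N : ℕ) :
    Summable fun i : ℕ => ((N + i : ℕ) : ℝ) ^ (-a - 1) := by
  have := (Real.summable_nat_rpow (p := -a - 1)).2 (by linarith)
  have h := (summable_nat_add_iff N).2 this
  simpa [add_comm] using h

lemma summable_zetaTerm {N : ℕ} (hN : 1 ≤ N) {s : ℂ} (hs : 0 < s.re) :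
    Summable fun i => zetaTerm (N + i) s :=
  Summable.of_norm_bounded ((summable_nat_add_rpow hs N).mul_left (‖s - 1‖ * ‖s‖))
    fun i => norm_zetaTerm_le (by omega) hs

lemma sum_zetaTerm (N K : ℕ) (s : ℂ) :
    ∑ i ∈ Finset.range K, zetaTerm (N + i) s =
      (s - 1) * (∑ n ∈ Finset.range (N + K), ((n : ℂ) + 1) ^ (-s) -
        ∑ n ∈ Finset.range N, ((n : ℂ) + 1) ^ (-s)) + ((N + K : ℕ) : ℂ) ^ (1 - s)
        - (N : ℂ) ^ (1 - s) := by
  induction K with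
  | zero => simp
  | succ K ih =>
    rw [Finset.sum_range_succ, ih, ← add_assoc, Finset.sum_range_succ, zetaTerm]
    push_cast; ring

lemma riemannZeta₁_eq_of_one_lt {N : ℕ} (hN : 1 ≤ N) {s : ℂ} (hs : 1 < s.re) :
    riemannZeta₁ s = (s - 1) * ∑ n ∈ Finset.range N, ((n : ℂ) + 1) ^ (-s) + (N : ℂ) ^ (1 - s)
      + ∑' i, zetaTerm (N + i) s := by
  have hs1 : s ≠ 1 := by rintro rfl; simp at hs
  have hz : riemannZeta₁ s = (s - 1) * riemannZeta s := by
    rw [riemannZeta_eq_inv_sub_mul hs1, mul_inv_cancel_left₀ (sub_ne_zero.2 hs1)]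
  have hsum : Summable fun n : ℕ => ((n : ℂ) + 1) ^ (-s) := by
    have := (Complex.summable_one_div_nat_cpow (p := s)).2 hs
    have h := (summable_nat_add_iff 1).2 this
    simpa [Complex.cpow_neg] using h
  have hzs : riemannZeta s = ∑' n : ℕ, ((n : ℂ) + 1) ^ (-s) := by
    rw [zeta_eq_tsum_one_div_nat_add_one_cpow hs]; simp [Complex.cpow_neg]
  have h1 := (summable_zetaTerm hN (s := s) (by linarith)).hasSum.tendsto_sum_nat
  have h2 : Filter.Tendsto (fun K : ℕ => N + K) Filter.atTop Filter.atTop :=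
    Filter.tendsto_atTop_mono (fun K => Nat.le_add_left K N) Filter.tendsto_id
  have h3 := hsum.hasSum.tendsto_sum_nat.comp h2
  have h4 : Filter.Tendsto (fun K : ℕ => ((N + K : ℕ) : ℂ) ^ (1 - s)) Filter.atTop (nhds 0) := by
    rw [tendsto_zero_iff_norm_tendsto_zero]
    have : Filter.Tendsto (fun K : ℕ => ((N + K : ℕ) : ℝ) ^ (-(s.re - 1))) Filter.atTop (nhds 0) :=
      (tendsto_rpow_neg_atTop (by linarith)).comp (tendsto_natCast_atTop_atTop.comp h2)
    refine this.congr fun K => ?_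
    rw [Complex.norm_natCast_cpow_of_pos (by omega)]
    congr 1; simp
  have h5 := tendsto_nhds_unique h1 (((((h3.sub_const
    (∑ n ∈ Finset.range N, ((n : ℂ) + 1) ^ (-s))).const_mul (s - 1)).add h4).sub_const
      ((N : ℂ) ^ (1 - s))).congr fun K => (sum_zetaTerm N K s).symm)
  rw [h5, hz, hzs]; ring

lemma riemannZeta₁_eq {N : ℕ} (hN : 1 ≤ N) {s : ℂ} (hs : 0 < s.re) :
    riemannZeta₁ s = (s - 1) * ∑ n ∈ Finset.range N, ((n : ℂ) + 1) ^ (-s) + (N : ℂ) ^ (1 - s)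
      + ∑' i, zetaTerm (N + i) s := by
  have hN0 : (N : ℂ) ≠ 0 := by exact_mod_cast (by omega : N ≠ 0)
  have hopen : IsOpen {s : ℂ | 0 < s.re} := isOpen_lt continuous_const Complex.continuous_re
  have hn0 : ∀ n : ℕ, (n : ℂ) + 1 ≠ 0 := fun n => by exact_mod_cast Nat.succ_ne_zero n
  have hterm : ∀ i, Differentiable ℂ (zetaTerm (N + i)) := by
    intro i
    have h1 : ((N + i : ℕ) : ℂ) ≠ 0 := by exact_mod_cast (by omega : N + i ≠ 0)
    unfold zetaTerm
    refine Differentiable.sub (Differentiable.add (Differentiable.mul (by fun_prop) ?_) ?_) ?_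
    · exact fun s => (differentiableAt_neg_iff.2 differentiableAt_id).const_cpow (Or.inl (hn0 _))
    · exact fun s => ((differentiableAt_const _).sub differentiableAt_id).const_cpow (Or.inl (hn0 _))
    · exact fun s => ((differentiableAt_const _).sub differentiableAt_id).const_cpow (Or.inl h1)
  have hdiff : DifferentiableOn ℂ (fun s => ∑' i, zetaTerm (N + i) s) {s : ℂ | 0 < s.re} := by
    intro s₀ hs₀
    have hs₀ : 0 < s₀.re := hs₀
    set U : Set ℂ := {s | s₀.re / 2 < s.re} ∩ Metric.ball s₀ 1
    have hU : IsOpen U := (isOpen_lt continuous_const Complex.continuous_re).inter Metric.isOpen_ball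
    have hsU : s₀ ∈ U := ⟨by simp; linarith, by simp⟩
    have := Complex.differentiableOn_tsum_of_summable_norm (F := fun i s => zetaTerm (N + i) s)
      (u := fun i => (‖s₀‖ + 2) * (‖s₀‖ + 1) * ((N + i : ℕ) : ℝ) ^ (-(s₀.re / 2) - 1)) (U := U)
      ((summable_nat_add_rpow (by linarith) N).mul_left _)
      (fun i => (hterm i).differentiableOn) hU ?_
    · exact (this.differentiableAt (hU.mem_nhds hsU)).differentiableWithinAt
    · rintro i w ⟨hw1, hw2⟩
      simp only [Set.mem_ofPred_eq] at hw1
      have hw : ‖w‖ ≤ ‖s₀‖ + 1 := by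
        have h1 : ‖w - s₀‖ < 1 := by simpa [dist_eq_norm] using hw2
        have h2 := norm_add_le (w - s₀) s₀
        rw [sub_add_cancel] at h2
        linarith
      refine (norm_zetaTerm_le (by omega) (by linarith)).trans ?_
      gcongr
      · refine (norm_sub_le _ _).trans ?_; simp; linarith
      · exact_mod_cast (by omega : 1 ≤ N + i)
  have hA : AnalyticOnNhd ℂ riemannZeta₁ {s : ℂ | 0 < s.re} :=
    differentiable_riemannZeta₁.differentiableOn.analyticOnNhd hopen
  have hB : AnalyticOnNhd ℂ (fun s => (s - 1) * ∑ n ∈ Finset.range N, ((n : ℂ) + 1) ^ (-s)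
      + (N : ℂ) ^ (1 - s) + ∑' i, zetaTerm (N + i) s) {s : ℂ | 0 < s.re} := by
    refine DifferentiableOn.analyticOnNhd (DifferentiableOn.add (Differentiable.differentiableOn
      (Differentiable.add (Differentiable.mul (by fun_prop) ?_) ?_)) hdiff) hopen
    · refine Differentiable.fun_sum fun n _ => fun s => ?_
      exact (differentiableAt_neg_iff.2 differentiableAt_id).const_cpow (Or.inl (hn0 _))
    · exact fun s => ((differentiableAt_const _).sub differentiableAt_id).const_cpow (Or.inl hN0)
  refine hA.eqOn_of_preconnected_of_eventuallyEq hB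
    (convex_halfSpace_re_gt 0).isPreconnected (z₀ := 2) (by simp) ?_ hs
  filter_upwards [(isOpen_lt continuous_const Complex.continuous_re).mem_nhds
    (show (2 : ℂ) ∈ {s : ℂ | 1 < s.re} by simp)] with s hs
  exact riemannZeta₁_eq_of_one_lt hN hs

lemma norm_riemannZeta₁_le {δ : ℝ} (hδ : 0 < δ) (hδ' : δ ≤ 1 / 2) :
    ∃ C : ℝ, 0 < C ∧ ∀ s : ℂ, 1 - δ ≤ s.re → s.re ≤ 3 →
      ‖riemannZeta₁ s‖ ≤ C * (2 + |s.im|) ^ (1 + 2 * δ) := by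
  have hsum : Summable fun n : ℕ => ((n + 1 : ℕ) : ℝ) ^ (-δ - 1) := by
    simpa [add_comm] using summable_nat_add_rpow hδ 1
  set S := ∑' n : ℕ, ((n + 1 : ℕ) : ℝ) ^ (-δ - 1) with hS
  have hS0 : 0 ≤ S := tsum_nonneg fun n => by positivity
  refine ⟨(6 * S + 1) * 2 ^ (2 * δ), by positivity, fun s h1 h2 => ?_⟩
  set T := 2 + |s.im| with hT
  have hT2 : 2 ≤ T := by simp [hT]
  set N := ⌈T⌉₊ with hN
  have hTN : T ≤ N := Nat.le_ceil T
  have hN2 : (N : ℝ) ≤ 2 * T := by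
    have := (Nat.ceil_lt_add_one (show 0 ≤ T by linarith)).le; linarith
  have hN1 : 1 ≤ N := by
    have : (1 : ℝ) ≤ N := by linarith
    exact_mod_cast this
  have hN0 : (0 : ℝ) < N := by linarith
  have hs : ‖s‖ ≤ 2 * T := by
    have := Complex.norm_le_abs_re_add_abs_im s
    rw [abs_of_nonneg (show 0 ≤ s.re by linarith)] at this
    simp only [hT]; linarith [abs_nonneg s.im]
  have hs1 : ‖s - 1‖ ≤ 2 * T := by
    have := Complex.norm_le_abs_re_add_abs_im (s - 1)
    have h3 : |(s - 1).re| ≤ 2 := by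
      rw [abs_le]; constructor <;> simp <;> linarith
    have h4 : (s - 1).im = s.im := by simp
    rw [h4] at this
    simp only [hT]; linarith [abs_nonneg s.im]
  have hA : ‖∑ n ∈ Finset.range N, ((n : ℂ) + 1) ^ (-s)‖ ≤ S * (N : ℝ) ^ (2 * δ) := by
    calc _ ≤ ∑ n ∈ Finset.range N, ((n + 1 : ℕ) : ℝ) ^ (-δ - 1) * (N : ℝ) ^ (2 * δ) := by
          refine norm_sum_le_of_le _ fun n hn => ?_
          have hn' : ((n + 1 : ℕ) : ℝ) ≤ N := by
            exact_mod_cast Finset.mem_range.1 hn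
          have h5 := Complex.norm_natCast_cpow_of_pos (Nat.succ_pos n) (-s)
          push_cast at h5
          rw [h5]
          calc ((n : ℝ) + 1) ^ (-s).re ≤ ((n : ℝ) + 1) ^ ((-δ - 1) + 2 * δ) := by
                apply Real.rpow_le_rpow_of_exponent_le
                · linarith [Nat.cast_nonneg (α := ℝ) n]
                · simp; linarith
            _ = ((n : ℝ) + 1) ^ (-δ - 1) * ((n : ℝ) + 1) ^ (2 * δ) := by
                rw [Real.rpow_add (by positivity)]
            _ ≤ _ := by
                push_cast at hn' ⊢
                gcongr
      _ = (∑ n ∈ Finset.range N, ((n + 1 : ℕ) : ℝ) ^ (-δ - 1)) * (N : ℝ) ^ (2 * δ) := by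
          rw [Finset.sum_mul]
      _ ≤ _ := by
          gcongr
          exact hsum.sum_le_tsum _ fun _ _ => by positivity
  have hB : ‖(N : ℂ) ^ (1 - s)‖ ≤ (N : ℝ) ^ (2 * δ) := by
    rw [Complex.norm_natCast_cpow_of_pos (by omega)]
    apply Real.rpow_le_rpow_of_exponent_le (by exact_mod_cast hN1)
    simp; linarith
  have hC : ‖∑' i, zetaTerm (N + i) s‖ ≤ 4 * T * (N : ℝ) ^ (2 * δ) * S := by
    refine tsum_of_norm_bounded (hsum.hasSum.mul_left _) fun i => ?_
    refine (norm_zetaTerm_le (by omega) (by linarith)).trans ?_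
    have hNi : (N : ℝ) ≤ ((N + i : ℕ) : ℝ) := by push_cast; linarith [Nat.cast_nonneg (α := ℝ) i]
    have hNi0 : (0 : ℝ) < ((N + i : ℕ) : ℝ) := by linarith
    have h6 : ((N + i : ℕ) : ℝ) ^ (-s.re - 1) ≤
        (N : ℝ) ^ (-1 + 2 * δ) * ((i + 1 : ℕ) : ℝ) ^ (-δ - 1) := by
      calc _ ≤ ((N + i : ℕ) : ℝ) ^ ((-1 + 2 * δ) + (-δ - 1)) := by
            apply Real.rpow_le_rpow_of_exponent_le
            · exact_mod_cast (by omega : 1 ≤ N + i)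
            · linarith
        _ = ((N + i : ℕ) : ℝ) ^ (-1 + 2 * δ) * ((N + i : ℕ) : ℝ) ^ (-δ - 1) := Real.rpow_add hNi0 _ _
        _ ≤ _ := by
            gcongr ?_ * ?_
            · exact Real.rpow_le_rpow_of_nonpos hN0 hNi (by linarith)
            · refine Real.rpow_le_rpow_of_nonpos (by positivity) ?_ (by linarith)
              exact_mod_cast (by omega : i + 1 ≤ N + i)
    calc _ ≤ 2 * T * (2 * T) * ((N : ℝ) ^ (-1 + 2 * δ) * ((i + 1 : ℕ) : ℝ) ^ (-δ - 1)) := by gcongr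
      _ = 4 * T * (T * ((N : ℝ) ^ (-1 + 2 * δ))) * ((i + 1 : ℕ) : ℝ) ^ (-δ - 1) := by ring
      _ ≤ 4 * T * (N : ℝ) ^ (2 * δ) * ((i + 1 : ℕ) : ℝ) ^ (-δ - 1) := by
          gcongr
          rw [Real.rpow_add hN0, ← mul_assoc, Real.rpow_neg_one]
          have : T * (N : ℝ)⁻¹ ≤ 1 := by rw [← div_eq_mul_inv, div_le_one hN0]; exact hTN
          exact mul_le_of_le_one_left (by positivity) this
  rw [riemannZeta₁_eq hN1 (by linarith : 0 < s.re)]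
  have hNT : (N : ℝ) ^ (2 * δ) ≤ 2 ^ (2 * δ) * T ^ (2 * δ) := by
    rw [← Real.mul_rpow (by norm_num) (by linarith)]
    gcongr
  calc _ ≤ ‖s - 1‖ * ‖∑ n ∈ Finset.range N, ((n : ℂ) + 1) ^ (-s)‖ + ‖(N : ℂ) ^ (1 - s)‖
        + ‖∑' i, zetaTerm (N + i) s‖ := by
        refine (norm_add₃_le).trans ?_
        rw [norm_mul]
    _ ≤ 2 * T * (S * (N : ℝ) ^ (2 * δ)) + (N : ℝ) ^ (2 * δ) + 4 * T * (N : ℝ) ^ (2 * δ) * S := by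
        gcongr
    _ = (6 * S * T + 1) * (N : ℝ) ^ (2 * δ) := by ring
    _ ≤ ((6 * S + 1) * T) * (2 ^ (2 * δ) * T ^ (2 * δ)) := by
        gcongr
        nlinarith
    _ = _ := by rw [Real.rpow_add (by linarith), Real.rpow_one]; ring

lemma norm_deriv_riemannZeta₁_le {δ : ℝ} (hδ : 0 < δ) (hδ' : δ ≤ 1 / 2) :
    ∃ C : ℝ, 0 < C ∧ ∀ s : ℂ, 1 - δ / 2 ≤ s.re → s.re ≤ 5 / 2 →
      ‖deriv riemannZeta₁ s‖ ≤ C * (2 + |s.im|) ^ (1 + 2 * δ) := by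
  obtain ⟨C, hC, h⟩ := norm_riemannZeta₁_le hδ hδ'
  refine ⟨C * 2 ^ (1 + 2 * δ) / (δ / 2), by positivity, fun s h1 h2 => ?_⟩
  have := Complex.norm_deriv_le_of_forall_mem_sphere_norm_le (c := s) (R := δ / 2)
    (C := C * 2 ^ (1 + 2 * δ) * (2 + |s.im|) ^ (1 + 2 * δ)) (f := riemannZeta₁) (by linarith)
    differentiable_riemannZeta₁.diffContOnCl ?_
  · refine this.trans (le_of_eq ?_); ring
  · intro z hz
    have hz' : ‖z - s‖ = δ / 2 := by simpa [dist_eq_norm] using hz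
    have hre := (abs_le.1 (Complex.abs_re_le_norm (z - s)))
    have him := (abs_le.1 (Complex.abs_im_le_norm (z - s)))
    rw [hz'] at hre him
    simp only [Complex.sub_re, Complex.sub_im] at hre him
    refine (h z (by linarith) (by linarith)).trans ?_
    rw [mul_assoc, ← Real.mul_rpow (by norm_num) (by positivity)]
    gcongr
    have : |z.im| ≤ |s.im| + 1 := by
      have := abs_sub_abs_le_abs_sub z.im s.im
      have h3 : |z.im - s.im| ≤ δ / 2 := abs_le.2 him
      linarith
    linarith [abs_nonneg s.im]

lemma riemannZeta₁_eq_mul {s : ℂ} (hs : s ≠ 1) : riemannZeta₁ s = (s - 1) * riemannZeta s := by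
  rw [riemannZeta_eq_inv_sub_mul hs, mul_inv_cancel_left₀ (sub_ne_zero.2 hs)]

lemma riemannZeta₁_ne_zero {s : ℂ} (hs : 1 ≤ s.re) : riemannZeta₁ s ≠ 0 := by
  rcases eq_or_ne s 1 with rfl | h
  · simp [riemannZeta₁_one]
  · rw [riemannZeta₁_eq_mul h]
    exact mul_ne_zero (sub_ne_zero.2 h) (riemannZeta_ne_zero_of_one_le_re hs)

lemma norm_riemannZeta_product_ge_one {x : ℝ} (hx : 0 < x) (y : ℝ) :
    1 ≤ ‖riemannZeta (1 + x)‖ ^ 3 * ‖riemannZeta (1 + x + Complex.I * y)‖ ^ 4 *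
      ‖riemannZeta (1 + x + 2 * Complex.I * y)‖ := by
  have := DirichletCharacter.norm_LFunction_product_ge_one (N := 1) 1 hx y
  simpa [DirichletCharacter.LFunctionTrivChar, DirichletCharacter.LFunction_modOne_eq] using this

lemma le_norm_riemannZeta₁_add {δ : ℝ} (hδ : 0 < δ) (hδ' : δ ≤ 1 / 2) :
    ∃ c : ℝ, 0 < c ∧ ∀ x y : ℝ, 0 < x → x ≤ 1 → 1 ≤ |y| →
      c * x ^ (3 / 4 : ℝ) * (2 + |y|) ^ (1 - δ / 2) ≤ ‖riemannZeta₁ (1 + x + Complex.I * y)‖ := by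
  obtain ⟨C, hC, h⟩ := norm_riemannZeta₁_le hδ hδ'
  set D := C * 2 ^ (1 + 2 * δ) with hD
  have hD0 : 0 < D := by positivity
  have h3D : (0 : ℝ) < 2 * D := by positivity
  refine ⟨(2 * D) ^ (-1 : ℝ) / 3, by positivity, fun x y hx hx1 hy => ?_⟩
  set T := 2 + |y| with hT
  have hT0 : 0 < T := by positivity
  have hTy : T ≤ 3 * |y| := by linarith
  have h341 := norm_riemannZeta_product_ge_one hx y
  set a := ‖riemannZeta₁ (1 + x + Complex.I * y)‖ with ha
  have e1 : ‖riemannZeta (1 + x)‖ ≤ D / x := by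
    have hne : (1 + x : ℂ) ≠ 1 := by simpa using hx.ne'
    rw [riemannZeta_eq_inv_sub_mul hne, norm_mul, norm_inv]
    have h1 : ‖(1 + x : ℂ) - 1‖ = x := by simp [abs_of_pos hx]
    rw [h1]
    have := h (1 + x) (by simp; linarith) (by simp; linarith)
    simp only [Complex.add_im, Complex.one_im, Complex.ofReal_im, add_zero, abs_zero] at this
    rw [inv_mul_eq_div]; gcongr
  have e2 : ‖riemannZeta (1 + x + Complex.I * y)‖ ≤ a / |y| := by
    have hyim : ((1 + x + Complex.I * y : ℂ) - 1).im = y := by simp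
    have hne : (1 + x + Complex.I * y : ℂ) ≠ 1 := by
      intro h0; rw [h0] at hyim; simp at hyim; rw [← hyim] at hy; norm_num at hy
    rw [riemannZeta_eq_inv_sub_mul hne, norm_mul, norm_inv, inv_mul_eq_div]
    gcongr
    have := Complex.abs_im_le_norm ((1 + x + Complex.I * y : ℂ) - 1)
    rwa [hyim] at this
  have e3 : ‖riemannZeta (1 + x + 2 * Complex.I * y)‖ ≤ D * T ^ (2 * δ) * 2 := by
    have hyim : ((1 + x + 2 * Complex.I * y : ℂ) - 1).im = 2 * y := by simp
    have hne : (1 + x + 2 * Complex.I * y : ℂ) ≠ 1 := by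
      intro h0; rw [h0] at hyim; simp at hyim; rw [hyim] at hy; norm_num at hy
    rw [riemannZeta_eq_inv_sub_mul hne, norm_mul, norm_inv, inv_mul_eq_div]
    have h1 := Complex.abs_im_le_norm ((1 + x + 2 * Complex.I * y : ℂ) - 1)
    rw [hyim, abs_mul, abs_two] at h1
    have h2 := h (1 + x + 2 * Complex.I * y) (by simp; linarith) (by simp; linarith)
    rw [div_le_iff₀ (by linarith)]
    refine h2.trans ?_
    have h3 : (1 + x + 2 * Complex.I * y : ℂ).im = 2 * y := by simp
    rw [h3, abs_mul, abs_two]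
    calc _ ≤ C * (2 * T) ^ (1 + 2 * δ) := by gcongr; linarith
      _ = D * T ^ (2 * δ) * T := by
          rw [Real.mul_rpow (by norm_num) hT0.le, Real.rpow_add hT0 1, Real.rpow_one]; ring
      _ ≤ D * T ^ (2 * δ) * 2 * (2 * |y|) := by
          have h4 : T ≤ 2 * (2 * |y|) := by linarith
          have h5 := mul_le_mul_of_nonneg_left h4 (by positivity : 0 ≤ D * T ^ (2 * δ))
          linarith
      _ ≤ _ := by gcongr
  have h4 : 1 ≤ (D / x) ^ 3 * (a / |y|) ^ 4 * (D * T ^ (2 * δ) * 2) := by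
    refine h341.trans ?_
    gcongr
  have h5 : (2 * D) ^ (-4 : ℝ) * x ^ (3 : ℝ) * T ^ (-(2 * δ)) ≤ (a / |y|) ^ 4 := by
    rw [Real.rpow_neg hT0.le, Real.rpow_neg h3D.le, ← div_eq_mul_inv, div_le_iff₀ (by positivity)]
    rw [inv_mul_le_iff₀ (by positivity)]
    norm_cast
    have : 1 * x ^ 3 ≤ (D / x) ^ 3 * (a / |y|) ^ 4 * (D * T ^ (2 * δ) * 2) * x ^ 3 := by gcongr
    calc x ^ 3 ≤ (D / x) ^ 3 * (a / |y|) ^ 4 * (D * T ^ (2 * δ) * 2) * x ^ 3 := by linarith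
      _ = 2 * D ^ 4 * ((a / |y|) ^ 4 * T ^ (2 * δ)) := by field_simp
      _ ≤ (2 * D) ^ 4 * ((a / |y|) ^ 4 * T ^ (2 * δ)) := by
          gcongr
          rw [mul_pow]; nlinarith [pow_pos hD0 4]
  have h6 : (2 * D) ^ (-1 : ℝ) * x ^ (3 / 4 : ℝ) * T ^ (-(δ / 2)) ≤ a / |y| := by
    refine le_of_pow_le_pow_left₀ (n := 4) (by norm_num) (by positivity) (le_trans (le_of_eq ?_) h5)
    rw [mul_pow, mul_pow, ← Real.rpow_natCast, ← Real.rpow_natCast, ← Real.rpow_natCast,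
      ← Real.rpow_mul h3D.le, ← Real.rpow_mul hx.le, ← Real.rpow_mul hT0.le]
    norm_num
    ring_nf
    simp
  rw [le_div_iff₀ (by linarith)] at h6
  refine le_trans ?_ h6
  rw [sub_eq_add_neg, Real.rpow_add hT0, Real.rpow_one]
  have : (2 * D) ^ (-1 : ℝ) / 3 * x ^ (3 / 4 : ℝ) * (T * T ^ (-(δ / 2))) =
    (2 * D) ^ (-1 : ℝ) * x ^ (3 / 4 : ℝ) * T ^ (-(δ / 2)) * (T / 3) := by ring
  rw [this]
  gcongr
  linarith

lemma le_norm_riemannZeta₁ {δ : ℝ} (hδ : 0 < δ) (hδ' : δ ≤ 1 / 20) :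
    ∃ c : ℝ, 0 < c ∧ ∀ s : ℂ, 1 ≤ s.re → s.re ≤ 2 →
      c * (2 + |s.im|) ^ (1 - 10 * δ) ≤ ‖riemannZeta₁ s‖ := by
  obtain ⟨c, hc, h⟩ := le_norm_riemannZeta₁_add hδ (by linarith)
  obtain ⟨C, hC, h'⟩ := norm_deriv_riemannZeta₁_le hδ (by linarith)
  set κ : ℝ := min 1 ((c / (2 * C)) ^ (4 : ℝ)) with hκ
  have hκ0 : 0 < κ := by positivity
  have hκ1 : κ ≤ 1 := min_le_left _ _
  have hκ2 : C * κ ≤ c / 2 * κ ^ (3 / 4 : ℝ) := by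
    have h1 : κ ^ (1 / 4 : ℝ) ≤ c / (2 * C) := by
      calc κ ^ (1 / 4 : ℝ) ≤ ((c / (2 * C)) ^ (4 : ℝ)) ^ (1 / 4 : ℝ) := by
            gcongr; exact min_le_right _ _
        _ = c / (2 * C) := by rw [← Real.rpow_mul (by positivity)]; norm_num
    have h2 : κ = κ ^ (3 / 4 : ℝ) * κ ^ (1 / 4 : ℝ) := by
      rw [← Real.rpow_add hκ0]; norm_num
    rw [le_div_iff₀ (by positivity)] at h1
    have h3 : 0 < κ ^ (3 / 4 : ℝ) := by positivity
    calc C * κ = κ ^ (3 / 4 : ℝ) * (κ ^ (1 / 4 : ℝ) * (2 * C)) / 2 := by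
          conv_lhs => rw [h2]
          ring
      _ ≤ κ ^ (3 / 4 : ℝ) * c / 2 := by gcongr
      _ = _ := by ring
  have hlarge : ∀ s : ℂ, 1 ≤ s.re → s.re ≤ 2 → 1 ≤ |s.im| →
      c / 2 * κ ^ (3 / 4 : ℝ) * (2 + |s.im|) ^ (1 - 10 * δ) ≤ ‖riemannZeta₁ s‖ := by
    intro s h1 h2 hy
    set T := 2 + |s.im| with hT
    have hT1 : 1 ≤ T := by linarith
    have hT0 : 0 < T := by linarith
    set x₀ := κ * T ^ (-(12 * δ)) with hx₀
    have hx₀0 : 0 < x₀ := by positivity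
    have hx₀1 : x₀ ≤ 1 :=
      mul_le_one₀ hκ1 (by positivity) (Real.rpow_le_one_of_one_le_of_nonpos hT1 (by linarith))
    have hx34 : x₀ ^ (3 / 4 : ℝ) * T ^ (1 - δ / 2) = κ ^ (3 / 4 : ℝ) * T ^ (1 - 19 / 2 * δ) := by
      rw [hx₀, Real.mul_rpow hκ0.le (by positivity), ← Real.rpow_mul hT0.le, mul_assoc,
        ← Real.rpow_add hT0]
      congr 2; ring
    have hT10 : T ^ (1 - 10 * δ) ≤ T ^ (1 - 19 / 2 * δ) :=
      Real.rpow_le_rpow_of_exponent_le hT1 (by linarith)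
    have hs : s = 1 + ((s.re - 1 : ℝ) : ℂ) + Complex.I * (s.im : ℂ) := by
      apply Complex.ext <;> simp
    rcases le_total x₀ (s.re - 1) with hx | hx
    · have h3 := h (s.re - 1) s.im (by linarith) (by linarith) hy
      rw [← hs] at h3
      refine le_trans ?_ h3
      calc _ ≤ c * (κ ^ (3 / 4 : ℝ) * T ^ (1 - 19 / 2 * δ)) := by
            rw [mul_assoc]; gcongr; linarith
        _ = c * x₀ ^ (3 / 4 : ℝ) * T ^ (1 - δ / 2) := by rw [← hx34]; ring
        _ ≤ _ := by gcongr
    · have h3 := h x₀ s.im hx₀0 hx₀1 hy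
      set s₁ : ℂ := 1 + (x₀ : ℂ) + Complex.I * (s.im : ℂ) with hs₁
      have hs₁re : s₁.re = 1 + x₀ := by simp [hs₁]
      have hs₁im : s₁.im = s.im := by simp [hs₁]
      have h4 := Convex.norm_image_sub_le_of_norm_deriv_le (f := riemannZeta₁) (x := s) (y := s₁)
        (s := {z | 1 ≤ z.re} ∩ {z | z.re ≤ 2} ∩ {z : ℂ | z.im = s.im}) (C := C * T ^ (1 + 2 * δ))
        (fun z _ => differentiable_riemannZeta₁ z) ?_ ?_ ⟨⟨h1, h2⟩, rfl⟩
        ⟨⟨by simp [hs₁re, hx₀0.le], by simp [hs₁re]; linarith⟩, by simp [hs₁im]⟩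
      · have h5 : ‖s₁ - s‖ ≤ x₀ := by
          have : s₁ - s = ((x₀ - (s.re - 1) : ℝ) : ℂ) := by
            apply Complex.ext
            · simp [hs₁re]; ring
            · simp [hs₁im]
          rw [this, Complex.norm_real, Real.norm_eq_abs, abs_of_nonneg (by linarith)]
          linarith
        have h6 : C * T ^ (1 + 2 * δ) * ‖s₁ - s‖ ≤ c / 2 * κ ^ (3 / 4 : ℝ) * T ^ (1 - 10 * δ) := by
          calc _ ≤ C * T ^ (1 + 2 * δ) * x₀ := by gcongr
            _ = C * κ * T ^ (1 - 10 * δ) := by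
              rw [hx₀, show 1 - 10 * δ = (1 + 2 * δ) + -(12 * δ) by ring, Real.rpow_add hT0 (1 + 2 * δ)]; ring
            _ ≤ _ := by gcongr
        have h7 := norm_sub_norm_le (riemannZeta₁ s₁) (riemannZeta₁ s)
        have h8 : c * κ ^ (3 / 4 : ℝ) * T ^ (1 - 10 * δ) ≤ ‖riemannZeta₁ s₁‖ := by
          refine le_trans ?_ h3
          rw [mul_assoc, mul_assoc, hx34]
          gcongr
        linarith
      · rintro z ⟨⟨hz1, hz2⟩, hz3⟩
        simp only [Set.mem_ofPred_eq] at hz1 hz2 hz3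
        have := h' z (by linarith) (by linarith)
        rwa [hz3] at this
      · exact ((convex_halfSpace_re_ge 1).inter (convex_halfSpace_re_le 2)).inter
          (convex_hyperplane (f := fun z : ℂ => z.im) Complex.imCLM.toLinearMap.isLinear s.im)
  have hcomp : IsCompact ({z : ℂ | 1 ≤ z.re} ∩ {z | z.re ≤ 2} ∩ {z : ℂ | |z.im| ≤ 1}) := by
    refine Metric.isCompact_of_isClosed_isBounded ?_ ?_
    · exact ((isClosed_le continuous_const Complex.continuous_re).inter
        (isClosed_le Complex.continuous_re continuous_const)).inter
        (isClosed_le (Complex.continuous_im.abs) continuous_const)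
    · refine (Metric.isBounded_closedBall (x := (0 : ℂ)) (r := 3)).subset ?_
      rintro z ⟨⟨h1, h2⟩, h3⟩
      simp only [Set.mem_ofPred_eq] at h1 h2 h3
      have := Complex.norm_le_abs_re_add_abs_im z
      rw [abs_of_nonneg (by linarith : 0 ≤ z.re)] at this
      simp; linarith
  obtain ⟨z₀, hz₀, hmin⟩ := hcomp.exists_isMinOn ⟨1, by simp⟩
    (differentiable_riemannZeta₁.continuous.norm.continuousOn)
  have hm : 0 < ‖riemannZeta₁ z₀‖ := norm_pos_iff.2 (riemannZeta₁_ne_zero hz₀.1.1)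
  refine ⟨min (c / 2 * κ ^ (3 / 4 : ℝ)) (‖riemannZeta₁ z₀‖ / 3), by positivity, fun s h1 h2 => ?_⟩
  rcases le_total 1 |s.im| with hy | hy
  · refine le_trans ?_ (hlarge s h1 h2 hy)
    gcongr
    exact min_le_left _ _
  · have h3 : ‖riemannZeta₁ z₀‖ ≤ ‖riemannZeta₁ s‖ := hmin ⟨⟨h1, h2⟩, hy⟩
    refine le_trans ?_ h3
    have h4 : (2 + |s.im|) ^ (1 - 10 * δ) ≤ 3 := by
      calc _ ≤ (2 + |s.im|) ^ (1 : ℝ) :=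
            Real.rpow_le_rpow_of_exponent_le (by linarith [abs_nonneg s.im]) (by linarith)
        _ ≤ 3 := by rw [Real.rpow_one]; linarith
    calc _ ≤ ‖riemannZeta₁ z₀‖ / 3 * 3 := by
          gcongr
          exact min_le_right _ _
      _ = _ := by ring

lemma norm_iteratedDeriv_inv_riemannZeta₁_le (B : ℕ) :
    ∃ C : ℝ, 0 < C ∧ ∀ s : ℂ, 1 ≤ s.re → s.re ≤ 2 →
      ‖iteratedDeriv B (fun z => (riemannZeta₁ z)⁻¹) s‖ ≤ C * (2 + |s.im|) ^ (-(1 / 2) : ℝ) := by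
  set δ : ℝ := 1 / (20 * (B + 1)) with hδd
  have hB0 : (0 : ℝ) ≤ B := Nat.cast_nonneg B
  have hδ : 0 < δ := by positivity
  have hδ' : δ ≤ 1 / 20 := by
    rw [hδd]; gcongr; linarith
  have hδB : δ * (20 * (B + 1)) = 1 := by rw [hδd]; field_simp
  obtain ⟨c, hc, h⟩ := le_norm_riemannZeta₁ (δ := δ / 2) (by linarith) (by linarith)
  obtain ⟨C, hC, h'⟩ := norm_deriv_riemannZeta₁_le (δ := δ) (by linarith) (by linarith)
  set C' := C * 2 ^ (1 + 2 * δ) with hC'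
  set κ : ℝ := min (δ / 2) (c / (2 * C')) with hκ
  have hC'0 : 0 < C' := by positivity
  have hκ0 : 0 < κ := by positivity
  refine ⟨B.factorial * (2 / c) / κ ^ B, by positivity, fun s h1 h2 => ?_⟩
  set T := 2 + |s.im| with hT
  have hT1 : 1 ≤ T := by linarith [abs_nonneg s.im]
  have hT0 : 0 < T := by linarith
  set r := κ * T ^ (-(7 * δ)) with hr
  have hr0 : 0 < r := by positivity
  have hrκ : r ≤ κ := mul_le_of_le_one_right hκ0.le
    (Real.rpow_le_one_of_one_le_of_nonpos hT1 (by linarith))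
  have hκδ : κ ≤ δ / 2 := min_le_left _ _
  have hball : ∀ z ∈ Metric.closedBall s r, c / 2 * T ^ (1 - 5 * δ) ≤ ‖riemannZeta₁ z‖ := by
    intro z hz
    have hd : ∀ w ∈ Metric.closedBall s r, ‖deriv riemannZeta₁ w‖ ≤ C' * T ^ (1 + 2 * δ) := by
      intro w hw
      have hw' : ‖w - s‖ ≤ r := by simpa [dist_eq_norm] using hw
      have hre := (abs_le.1 ((Complex.abs_re_le_norm (w - s)).trans hw'))
      have him := ((Complex.abs_im_le_norm (w - s)).trans hw')
      simp only [Complex.sub_re, Complex.sub_im] at hre him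
      refine (h' w (by linarith) (by linarith)).trans ?_
      rw [hC', mul_assoc, ← Real.mul_rpow (by norm_num) hT0.le]
      gcongr
      have := abs_sub_abs_le_abs_sub w.im s.im
      linarith [abs_nonneg s.im]
    have h3 := Convex.norm_image_sub_le_of_norm_deriv_le (f := riemannZeta₁) (x := z) (y := s)
      (fun z _ => differentiable_riemannZeta₁ z) hd (convex_closedBall s r) hz
      (Metric.mem_closedBall_self hr0.le)
    have h4 : ‖s - z‖ ≤ r := by rw [norm_sub_rev]; simpa [dist_eq_norm] using hz
    have h5 : C' * T ^ (1 + 2 * δ) * ‖s - z‖ ≤ c / 2 * T ^ (1 - 5 * δ) := by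
      calc _ ≤ C' * T ^ (1 + 2 * δ) * r := by gcongr
        _ = C' * κ * T ^ (1 - 5 * δ) := by
          rw [hr, show 1 - 5 * δ = (1 + 2 * δ) + -(7 * δ) by ring, Real.rpow_add hT0 (1 + 2 * δ)]; ring
        _ ≤ _ := by
          gcongr
          have : κ ≤ c / (2 * C') := min_le_right _ _
          rw [le_div_iff₀ (by positivity)] at this
          linarith
    have h6 := h s h1 h2
    rw [show 1 - 10 * (δ / 2) = 1 - 5 * δ by ring] at h6
    have h7 := norm_sub_norm_le (riemannZeta₁ s) (riemannZeta₁ z)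
    linarith
  have hpos : 0 < c / 2 * T ^ (1 - 5 * δ) := by positivity
  have key := Complex.norm_iteratedDeriv_le_of_forall_mem_sphere_norm_le (c := s) (R := r)
    (C := (c / 2 * T ^ (1 - 5 * δ))⁻¹) (f := fun z => (riemannZeta₁ z)⁻¹) B hr0 ?_ ?_
  · refine key.trans ?_
    have h8 : T ^ (-(1 - 5 * δ) + 7 * δ * B) ≤ T ^ (-(1 / 2) : ℝ) :=
      Real.rpow_le_rpow_of_exponent_le hT1 (by nlinarith)
    calc _ = B.factorial * (2 / c) / κ ^ B * T ^ (-(1 - 5 * δ) + 7 * δ * B) := by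
          rw [Real.rpow_add hT0, Real.rpow_neg hT0.le, hr, mul_pow,
            ← Real.rpow_natCast (T ^ (-(7 * δ))), ← Real.rpow_mul hT0.le,
            show -(7 * δ) * (B : ℝ) = -(7 * δ * B) by ring, Real.rpow_neg hT0.le]
          field_simp
      _ ≤ _ := by gcongr
  · refine DifferentiableOn.diffContOnCl_ball (U := Metric.closedBall s r) ?_ subset_rfl
    intro z hz
    have := hball z hz
    exact ((differentiable_riemannZeta₁ z).inv
      (norm_pos_iff.1 (hpos.trans_le this))).differentiableWithinAt
  · intro z hz
    rw [norm_inv]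
    exact inv_anti₀ hpos (hball z (Metric.sphere_subset_closedBall hz))

section

open MeasureTheory Set

lemma integral_gaussian_fourier {b : ℝ} (hb : 0 < b) (x : ℝ) :
    ∫ t : ℝ, (Real.exp (-b * t ^ 2) : ℂ) * Complex.exp (Complex.I * t * x) =
      (√(Real.pi / b) * Real.exp (-x ^ 2 / (4 * b)) : ℝ) := by
  have h := fourierIntegral_gaussian (b := (b : ℂ)) (by simpa using hb) x
  have e : ∀ t : ℝ, (Real.exp (-b * t ^ 2) : ℂ) * Complex.exp (Complex.I * t * x) =
      Complex.exp (Complex.I * x * t) * Complex.exp (-b * (t : ℂ) ^ 2) := by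
    intro t; push_cast; rw [mul_comm]; congr 2; ring
  simp_rw [e]
  rw [h, Real.sqrt_eq_rpow]
  push_cast
  rw [Complex.ofReal_cpow (by positivity)]
  push_cast; rfl

/-- Smoothing by a Gaussian, expressed through the Fourier transform. -/
lemma integral_fourier_mul_gaussian {f : ℝ → ℂ} (hf : Integrable f) {b : ℝ} (hb : 0 < b) (u : ℝ) :
    ∫ t : ℝ, (∫ v : ℝ, f v * Complex.exp (-(Complex.I * t * v))) *
      ((Real.exp (-b * t ^ 2) : ℂ) * Complex.exp (Complex.I * t * u)) =
      √(Real.pi / b) * ∫ v : ℝ, f v * (Real.exp (-(u - v) ^ 2 / (4 * b)) : ℂ) := by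
  have hint : Integrable (Function.uncurry fun t v : ℝ => f v * Complex.exp (-(Complex.I * t * v)) *
      ((Real.exp (-b * t ^ 2) : ℂ) * Complex.exp (Complex.I * t * u))) (volume.prod volume) := by
    have h0 : Integrable (fun t : ℝ => (Real.exp (-b * t ^ 2) : ℂ)) :=
      (integrable_exp_neg_mul_sq hb).ofReal
    have h1 := h0.mul_prod hf
    refine (h1.bdd_mul (c := 1) (f := fun z : ℝ × ℝ => Complex.exp (-(Complex.I * z.1 * z.2)) *
      Complex.exp (Complex.I * z.1 * u)) (by fun_prop) ?_).congr ?_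
    · refine Filter.Eventually.of_forall fun z => ?_
      rw [norm_mul, Complex.norm_exp, Complex.norm_exp]
      simp
    · refine Filter.Eventually.of_forall fun z => ?_
      simp only [Function.uncurry]; ring
  simp_rw [← integral_mul_const]
  rw [integral_integral_swap hint, ← integral_const_mul]
  congr 1; ext v
  have := integral_gaussian_fourier hb (u - v)
  calc _ = f v * ∫ t : ℝ, (Real.exp (-b * t ^ 2) : ℂ) * Complex.exp (Complex.I * t * (u - v : ℝ)) := by
        rw [← integral_const_mul]
        congr 1; ext t
        have : Complex.exp (Complex.I * t * (u - v : ℝ)) = Complex.exp (-(Complex.I * t * v)) *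
          Complex.exp (Complex.I * t * u) := by
          rw [← Complex.exp_add]; congr 1; push_cast; ring
        rw [this]; ring
    _ = _ := by rw [this]; push_cast; ring

/-- The Laplace transform of a function on `(0, ∞)`. -/
noncomputable def lap (f : ℝ → ℂ) (s : ℂ) : ℂ := ∫ u in Ioi (0 : ℝ), f u * Complex.exp (-s * u)

lemma integrableOn_pow_mul_exp (K : ℕ) {σ : ℝ} (hσ : 0 < σ) :
    IntegrableOn (fun u : ℝ => (1 + u) ^ K * Real.exp (-σ * u)) (Ioi 0) := by
  have e : (fun u : ℝ => (1 + u) ^ K * Real.exp (-σ * u)) = fun u =>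
      ∑ j ∈ Finset.range (K + 1), (K.choose j : ℝ) * (u ^ j * Real.exp (-σ * u)) := by
    ext u
    rw [add_comm, add_pow, Finset.sum_mul]
    refine Finset.sum_congr rfl fun j _ => ?_
    simp; ring
  rw [e]
  refine integrable_finsetSum _ fun j _ => Integrable.const_mul ?_ _
  have := integrableOn_rpow_mul_exp_neg_mul_rpow (p := 1) (s := j) (b := σ)
    (by linarith [Nat.cast_nonneg (α := ℝ) j]) one_pos hσ
  simpa [IntegrableOn] using this

lemma integrableOn_lap {f : ℝ → ℂ} (hf : Measurable f) {C : ℝ} {K : ℕ}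
    (hC : ∀ u, 0 < u → ‖f u‖ ≤ C * (1 + u) ^ K) {s : ℂ} (hs : 0 < s.re) :
    IntegrableOn (fun u : ℝ => f u * Complex.exp (-s * u)) (Ioi 0) := by
  refine Integrable.mono' ((integrableOn_pow_mul_exp K hs).const_mul C)
    (by fun_prop) ?_
  filter_upwards [ae_restrict_mem measurableSet_Ioi] with u hu
  rw [norm_mul, Complex.norm_exp]
  have : (-s * (u : ℂ)).re = -s.re * u := by simp
  rw [this, ← mul_assoc]
  gcongr
  exact hC u hu

lemma hasDerivAt_lap {f : ℝ → ℂ} (hf : Measurable f) {C : ℝ} {K : ℕ}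
    (hC : ∀ u, 0 < u → ‖f u‖ ≤ C * (1 + u) ^ K) {s : ℂ} (hs : 0 < s.re) :
    HasDerivAt (lap f) (lap (fun u => -u * f u) s) s := by
  have hC0 : 0 ≤ C := by
    have := (norm_nonneg _).trans (hC 1 one_pos)
    exact nonneg_of_mul_nonneg_left this (by positivity)
  have := hasDerivAt_integral_of_dominated_loc_of_deriv_le (μ := volume.restrict (Ioi (0 : ℝ)))
    (F := fun s u => f u * Complex.exp (-s * (u : ℂ)))
    (F' := fun s u => -(u : ℂ) * f u * Complex.exp (-s * u))
    (bound := fun u => C * ((1 + u) ^ (K + 1) * Real.exp (-(s.re / 2) * u)))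
    (s := {z : ℂ | s.re / 2 < z.re}) (x₀ := s) ?_ ?_ ?_ ?_ ?_ ?_ ?_
  · exact this.2
  · exact (isOpen_lt continuous_const Complex.continuous_re).mem_nhds (by simp; linarith)
  · exact Filter.Eventually.of_forall fun z => by fun_prop
  · exact integrableOn_lap hf hC hs
  · fun_prop
  · filter_upwards [ae_restrict_mem measurableSet_Ioi] with u hu z hz
    have hu : 0 < u := hu
    have hz : s.re / 2 < z.re := hz
    rw [norm_mul, norm_mul, norm_neg, Complex.norm_exp, Complex.norm_real, Real.norm_eq_abs,
      abs_of_pos hu]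
    have : (-z * (u : ℂ)).re = -z.re * u := by simp
    rw [this, pow_succ]
    calc u * ‖f u‖ * Real.exp (-z.re * u) ≤ (1 + u) * (C * (1 + u) ^ K) * Real.exp (-(s.re / 2) * u) := by
          gcongr
          · linarith
          · exact hC u hu
      _ = _ := by ring
  · exact (integrableOn_pow_mul_exp (K + 1) (by linarith)).const_mul C
  · refine Filter.Eventually.of_forall fun u z _ => ?_
    have h1 : HasDerivAt (fun z : ℂ => -z * (u : ℂ)) (-(u : ℂ)) z := by
      simpa using (hasDerivAt_id z).neg.mul_const (u : ℂ)
    have := (h1.cexp).const_mul (f u)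
    exact this.congr_deriv (by ring)

lemma iteratedDeriv_eq_lap {f : ℝ → ℂ} (hf : Measurable f) {C : ℝ} {K : ℕ}
    (hC : ∀ u, 0 < u → ‖f u‖ ≤ C * (1 + u) ^ K) {Q : ℂ → ℂ}
    (hQ : ∀ s : ℂ, 0 < s.re → lap f s = Q s) (B : ℕ) {s : ℂ} (hs : 0 < s.re) :
    iteratedDeriv B Q s = lap (fun u => (-u : ℂ) ^ B * f u) s := by
  have hC0 : 0 ≤ C := by
    have := (norm_nonneg _).trans (hC 1 one_pos)
    exact nonneg_of_mul_nonneg_left this (by positivity)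
  induction B generalizing s with
  | zero => simp [hQ s hs]
  | succ B ih =>
    rw [iteratedDeriv_succ]
    have hev : iteratedDeriv B Q =ᶠ[nhds s] lap (fun u => (-u : ℂ) ^ B * f u) := by
      filter_upwards [(isOpen_lt continuous_const Complex.continuous_re).mem_nhds
        (show s ∈ {z : ℂ | 0 < z.re} from hs)] with z hz using ih hz
    rw [hev.deriv_eq]
    have := hasDerivAt_lap (f := fun u => (-u : ℂ) ^ B * f u) (by fun_prop) (C := C) (K := B + K) ?_ hs
    · rw [this.deriv]
      congr 1; ext u; ring
    · intro u hu
      rw [norm_mul, norm_pow, norm_neg, Complex.norm_real, Real.norm_eq_abs, abs_of_pos hu, pow_add]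
      calc _ ≤ (1 + u) ^ B * (C * (1 + u) ^ K) := by
            gcongr
            · linarith
            · exact hC u hu
        _ = _ := by ring

lemma sum_Icc_one_eq {M : Type*} [AddCommMonoid M] (w : ℕ → M) (N : ℕ) :
    ∑ a ∈ Finset.Icc 1 N, w a = ∑ a ∈ Finset.range N, w (a + 1) := by
  induction N with
  | zero => simp
  | succ N ih => rw [Finset.sum_Icc_succ_top (by omega), ih, Finset.sum_range_succ]

/-- The Laplace transform of the summatory function of `w` on the logarithmic scale. -/
lemma lap_summatory {w : ℕ → ℝ} {s : ℂ} (hs : 0 < s.re)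
    (hw : Summable fun a : ℕ => |w (a + 1)| * ((a + 1 : ℕ) : ℝ) ^ (-s.re)) :
    lap (fun u => ((∑ a ∈ Finset.Icc 1 ⌊Real.exp u⌋₊, w a : ℝ) : ℂ)) s =
      (∑' a : ℕ, (w (a + 1) : ℂ) * ((a + 1 : ℕ) : ℂ) ^ (-s)) / s := by
  have hs0 : s ≠ 0 := by rintro rfl; simp at hs
  set F : ℕ → ℝ → ℂ := fun a => (Ioi (Real.log (a + 1 : ℕ))).indicator
    (fun u => (w (a + 1) : ℂ) * Complex.exp (-s * u)) with hF
  have hlog : ∀ a : ℕ, 0 ≤ Real.log (a + 1 : ℕ) := fun a => Real.log_natCast_nonneg _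
  have hsub : ∀ a : ℕ, Ioi (Real.log (a + 1 : ℕ)) ∩ Ioi 0 = Ioi (Real.log (a + 1 : ℕ)) := by
    intro a; rw [Ioi_inter_Ioi, sup_eq_left.2 (hlog a)]
  have hexp : ∀ a : ℕ, Complex.exp (-s * (Real.log (a + 1 : ℕ) : ℝ)) = ((a + 1 : ℕ) : ℂ) ^ (-s) := by
    intro a
    rw [Complex.cpow_def_of_ne_zero (by exact_mod_cast a.succ_ne_zero), ← Complex.ofReal_natCast,
      ← Complex.ofReal_log (by positivity)]
    congr 1; ring
  have hI : ∀ a : ℕ, Integrable (F a) (volume.restrict (Ioi 0)) := by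
    intro a
    rw [hF]
    refine (Integrable.indicator ?_ measurableSet_Ioi)
    exact (integrableOn_exp_mul_complex_Ioi (by simpa using hs) 0).const_mul _
  have hint : ∀ a, ∫ u in Ioi (0 : ℝ), F a u = (w (a + 1) : ℂ) * ((a + 1 : ℕ) : ℂ) ^ (-s) / s := by
    intro a
    simp only [hF]
    rw [setIntegral_indicator measurableSet_Ioi, inter_comm, hsub, integral_const_mul,
      integral_exp_mul_complex_Ioi (by simpa using hs), hexp]
    field_simp
  have hnorm : ∀ a, ∫ u in Ioi (0 : ℝ), ‖F a u‖ =
      |w (a + 1)| * ((a + 1 : ℕ) : ℝ) ^ (-s.re) / s.re := by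
    intro a
    have : ∀ u, ‖F a u‖ = (Ioi (Real.log (a + 1 : ℕ))).indicator
        (fun u => |w (a + 1)| * Real.exp (-s.re * u)) u := by
      intro u
      simp only [hF, norm_indicator_eq_indicator_norm]
      congr 1; ext v
      rw [norm_mul, Complex.norm_exp, Complex.norm_real, Real.norm_eq_abs]; simp
    simp_rw [this]
    rw [setIntegral_indicator measurableSet_Ioi, inter_comm, hsub, integral_const_mul]
    have h1 := integral_exp_mul_Ioi (a := -s.re) (by linarith) (Real.log (a + 1 : ℕ))
    rw [h1, Real.rpow_def_of_pos (by positivity)]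
    rw [mul_comm (-s.re)]
    field_simp
  have hS := hasSum_integral_of_summable_integral_norm hI
    (by simp_rw [hnorm]; exact hw.div_const _)
  simp_rw [hint] at hS
  rw [← tsum_div_const, hS.tsum_eq, lap]
  refine setIntegral_congr_ae measurableSet_Ioi ?_
  have hnull : ∀ᵐ u : ℝ, u ∉ range (fun a : ℕ => Real.log (a + 1 : ℕ)) :=
    (countable_range _).ae_notMem volume
  filter_upwards [hnull] with u hu _
  have hiff : ∀ a : ℕ, Real.log (a + 1 : ℕ) < u ↔ a < ⌊Real.exp u⌋₊ := by
    intro a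
    rw [← Nat.succ_le_iff, Nat.le_floor_iff (Real.exp_pos u).le,
      ← Real.log_le_iff_le_exp (by positivity)]
    refine ⟨fun h => h.le, fun h => lt_of_le_of_ne h fun h' => hu ⟨a, h'⟩⟩
  rw [tsum_eq_sum (s := Finset.range ⌊Real.exp u⌋₊), sum_Icc_one_eq]
  · push_cast
    rw [Finset.sum_mul]
    refine Finset.sum_congr rfl fun a ha => ?_
    rw [hF]
    simp only
    rw [indicator_of_mem (s := Ioi _) ((hiff a).2 (Finset.mem_range.1 ha))]
  · intro a ha
    simp only [hF]
    rw [indicator_of_notMem]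
    rw [mem_Ioi, hiff]
    simpa using ha

/-- `∑_{a ≤ e^u} μ(a)/a`. -/
noncomputable def mertensLog (u : ℝ) : ℝ :=
  ∑ a ∈ Finset.Icc 1 ⌊Real.exp u⌋₊, ((ArithmeticFunction.moebius a : ℤ) : ℝ) / a

lemma abs_moebius_div_le (a : ℕ) : |((ArithmeticFunction.moebius a : ℤ) : ℝ) / a| ≤ 1 / a := by
  rw [abs_div, Nat.abs_cast]
  gcongr
  exact_mod_cast ArithmeticFunction.abs_moebius_le_one

lemma sum_one_div_le {m n : ℕ} (hm : 1 ≤ m) (h : m ≤ n) :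
    ∑ a ∈ Finset.Ioc m n, (1 : ℝ) / a ≤ Real.log n - Real.log m := by
  induction n, h using Nat.le_induction with
  | base => simp
  | succ n h ih =>
    rw [← Finset.insert_Ioc_right_eq_Ioc_add_one (by omega), Finset.sum_insert (by simp)]
    have hn : (0 : ℝ) < n := by exact_mod_cast (by omega : 0 < n)
    have h1 := Real.one_sub_inv_le_log_of_pos (x := ((n + 1 : ℕ) : ℝ) / n) (by positivity)
    rw [Real.log_div (by positivity) hn.ne'] at h1
    have h2 : 1 - (((n + 1 : ℕ) : ℝ) / n)⁻¹ = 1 / ((n + 1 : ℕ) : ℝ) := by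
      field_simp; push_cast; ring
    rw [h2] at h1
    linarith

lemma sum_Icc_one_div_le (n : ℕ) (hn : 1 ≤ n) :
    ∑ a ∈ Finset.Icc 1 n, (1 : ℝ) / a ≤ 1 + Real.log n := by
  have h := sum_one_div_le le_rfl hn
  rw [← Finset.Ioc_insert_left hn, Finset.sum_insert (by simp)]
  simp at h ⊢
  linarith

lemma sum_Icc_floor_exp_le {u : ℝ} (hu : 0 ≤ u) :
    ∑ a ∈ Finset.Icc 1 ⌊Real.exp u⌋₊, (1 : ℝ) / a ≤ 1 + u := by
  have h1 : 1 ≤ ⌊Real.exp u⌋₊ := Nat.one_le_floor_iff _ |>.2 (Real.one_le_exp hu)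
  refine (sum_Icc_one_div_le _ h1).trans ?_
  gcongr
  rw [Real.log_le_iff_le_exp (by exact_mod_cast h1)]
  exact Nat.floor_le (Real.exp_pos u).le

lemma abs_mertensLog_le {u : ℝ} (hu : 0 ≤ u) : |mertensLog u| ≤ 1 + u :=
  (Finset.abs_sum_le_sum_abs _ _).trans ((Finset.sum_le_sum fun a _ => abs_moebius_div_le a).trans
    (sum_Icc_floor_exp_le hu))

lemma abs_mertensLog_sub_le {u v : ℝ} (hu : 0 ≤ u) (huv : u ≤ v) :
    |mertensLog v - mertensLog u| ≤ v - u + 2 * Real.exp (-u) := by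
  have h1 : 1 ≤ ⌊Real.exp u⌋₊ := Nat.one_le_floor_iff _ |>.2 (Real.one_le_exp hu)
  have h2 : ⌊Real.exp u⌋₊ ≤ ⌊Real.exp v⌋₊ := Nat.floor_mono (Real.exp_le_exp.2 huv)
  have hd : mertensLog v - mertensLog u = ∑ a ∈ Finset.Ioc ⌊Real.exp u⌋₊ ⌊Real.exp v⌋₊,
      ((ArithmeticFunction.moebius a : ℤ) : ℝ) / a := by
    rw [mertensLog, mertensLog, sub_eq_iff_eq_add, ← Finset.sum_union]
    · congr 1; ext a; simp; omega
    · rw [Finset.disjoint_left]; intro a; simp; omega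
  have hm : (1 : ℝ) ≤ ⌊Real.exp u⌋₊ := by exact_mod_cast h1
  have hn : (1 : ℝ) ≤ ⌊Real.exp v⌋₊ := by exact_mod_cast h1.trans h2
  rw [hd]
  refine (Finset.abs_sum_le_sum_abs _ _).trans ((Finset.sum_le_sum fun a _ =>
    abs_moebius_div_le a).trans ((sum_one_div_le h1 h2).trans ?_))
  have h3 : Real.log ⌊Real.exp v⌋₊ ≤ v := by
    rw [Real.log_le_iff_le_exp (by linarith)]
    exact Nat.floor_le (Real.exp_pos v).le
  have h4 : u - 2 * Real.exp (-u) ≤ Real.log ⌊Real.exp u⌋₊ := by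
    have h5 := (Nat.lt_floor_add_one (Real.exp u)).le
    have h6 := Real.one_sub_inv_le_log_of_pos (x := (⌊Real.exp u⌋₊ : ℝ) / Real.exp u) (by positivity)
    rw [Real.log_div (by positivity) (by positivity), Real.log_exp, inv_div] at h6
    have h7 : Real.exp u / (⌊Real.exp u⌋₊ : ℝ) - 1 ≤ 2 * Real.exp (-u) := by
      rw [Real.exp_neg, div_sub_one (by positivity), div_le_iff₀ (by positivity)]
      have : 1 ≤ 2 * (Real.exp u)⁻¹ * (⌊Real.exp u⌋₊ : ℝ) := by
        rw [mul_right_comm, ← div_eq_mul_inv, le_div_iff₀ (by positivity)]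
        linarith
      linarith
    linarith
  linarith

lemma measurable_summatory (w : ℕ → ℝ) :
    Measurable fun u : ℝ => ∑ a ∈ Finset.Icc 1 ⌊Real.exp u⌋₊, w a :=
  (measurable_from_nat (f := fun n => ∑ a ∈ Finset.Icc 1 n, w a)).comp
    (Nat.measurable_floor.comp Real.measurable_exp)

lemma lap_mertensLog {s : ℂ} (hs : 0 < s.re) :
    lap (fun u => (mertensLog u : ℂ)) s = (riemannZeta₁ (1 + s))⁻¹ := by
  have hs1 : 1 < (1 + s).re := by simpa using hs
  have hne : (1 + s) ≠ 1 := by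
    intro h; rw [h] at hs1; simp at hs1
  have hsum := (ArithmeticFunction.LSeriesSummable_moebius_iff).2 hs1
  have hterm : ∀ a : ℕ, LSeries.term (fun n => ((ArithmeticFunction.moebius n : ℤ) : ℂ)) (1 + s) (a + 1)
      = ((((ArithmeticFunction.moebius (a + 1) : ℤ) : ℝ) / ((a + 1 : ℕ) : ℝ) : ℝ) : ℂ) *
        ((a + 1 : ℕ) : ℂ) ^ (-s) := by
    intro a
    have h0 : ((a + 1 : ℕ) : ℂ) ≠ 0 := by exact_mod_cast a.succ_ne_zero
    rw [LSeries.term_of_ne_zero a.succ_ne_zero, Complex.cpow_add _ _ h0, Complex.cpow_one,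
      Complex.cpow_neg]
    push_cast
    field_simp
  have hL : LSeries (fun n => ((ArithmeticFunction.moebius n : ℤ) : ℂ)) (1 + s) =
      ∑' a : ℕ, ((((ArithmeticFunction.moebius (a + 1) : ℤ) : ℝ) / ((a + 1 : ℕ) : ℝ) : ℝ) : ℂ) *
        ((a + 1 : ℕ) : ℂ) ^ (-s) := by
    rw [LSeries, hsum.tsum_eq_zero_add]
    simp only [LSeries.term_zero, zero_add, hterm]
  have h1 := ArithmeticFunction.LSeries_zeta_mul_Lseries_moebius hs1
  rw [ArithmeticFunction.LSeries_zeta_eq_riemannZeta hs1] at h1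
  have h2 := lap_summatory (w := fun a => ((ArithmeticFunction.moebius a : ℤ) : ℝ) / a) hs ?_
  · rw [show (fun u => (mertensLog u : ℂ)) = fun u => ((∑ a ∈ Finset.Icc 1 ⌊Real.exp u⌋₊,
      ((ArithmeticFunction.moebius a : ℤ) : ℝ) / a : ℝ) : ℂ) from rfl, h2, ← hL,
      riemannZeta₁_eq_mul hne, eq_inv_of_mul_eq_one_right h1, mul_inv]
    simp only [add_sub_cancel_left]
    rw [div_eq_mul_inv, mul_comm]
  · have h3 := ((summable_nat_add_iff 1).2 hsum).norm
    refine h3.congr fun a => ?_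
    rw [hterm, norm_mul, Complex.norm_natCast_cpow_of_pos a.succ_pos, Complex.norm_real]
    simp [abs_div]

lemma measurable_mertensLog : Measurable mertensLog :=
  measurable_summatory fun a => ((ArithmeticFunction.moebius a : ℤ) : ℝ) / a

lemma norm_integral_mertensLog_mul_gaussian_le (B : ℕ) :
    ∃ C : ℝ, 0 < C ∧ ∀ σ b u : ℝ, 0 < σ → σ ≤ 1 → 0 < b →
      |∫ v in Ioi (0 : ℝ), v ^ B * mertensLog v * Real.exp (-σ * v) *
        Real.exp (-(u - v) ^ 2 / (4 * b))| ≤ C := by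
  obtain ⟨C, hC, h⟩ := norm_iteratedDeriv_inv_riemannZeta₁_le B
  refine ⟨C, hC, fun σ b u hσ hσ1 hb => ?_⟩
  have hM : ∀ u : ℝ, 0 < u → ‖(mertensLog u : ℂ)‖ ≤ 1 * (1 + u) ^ 1 := by
    intro u hu
    rw [Complex.norm_real, Real.norm_eq_abs]; simpa using abs_mertensLog_le hu.le
  have hmeas : Measurable fun u => (mertensLog u : ℂ) :=
    Complex.measurable_ofReal.comp measurable_mertensLog
  set g : ℝ → ℂ := fun v => (-v : ℂ) ^ B * mertensLog v with hg
  have hgm : Measurable g := by fun_prop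
  have hgb : ∀ u : ℝ, 0 < u → ‖g u‖ ≤ 1 * (1 + u) ^ (B + 1) := by
    intro u hu
    rw [hg, norm_mul, norm_pow, norm_neg, Complex.norm_real, Real.norm_eq_abs, abs_of_pos hu,
      pow_succ, one_mul]
    gcongr
    · linarith
    · simpa using hM u hu
  have hlap : ∀ s : ℂ, 0 < s.re → s.re ≤ 1 → ‖lap g s‖ ≤ C := by
    intro s hs hs1
    have h1 := iteratedDeriv_eq_lap hmeas hM (Q := fun s => (riemannZeta₁ (1 + s))⁻¹)
      (fun s hs => lap_mertensLog hs) B hs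
    rw [← h1, iteratedDeriv_comp_const_add B (fun z => (riemannZeta₁ z)⁻¹)]
    refine (h (1 + s) (by simp; linarith) (by simp; linarith)).trans ?_
    apply mul_le_of_le_one_right hC.le
    exact Real.rpow_le_one_of_one_le_of_nonpos (by linarith [abs_nonneg (1 + s).im]) (by norm_num)
  set f : ℝ → ℂ := (Ioi 0).indicator fun v => g v * Complex.exp (-(σ : ℂ) * v) with hf
  have hfi : Integrable f := by
    rw [hf, integrable_indicator_iff measurableSet_Ioi]
    exact integrableOn_lap hgm hgb (s := σ) (by simpa using hσ)
  have hrep := integral_fourier_mul_gaussian hfi hb u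
  have hft : ∀ t : ℝ, ∫ v : ℝ, f v * Complex.exp (-(Complex.I * t * v)) = lap g (σ + Complex.I * t) := by
    intro t
    rw [lap, ← integral_indicator measurableSet_Ioi]
    congr 1; ext v
    by_cases hv : v ∈ Ioi (0 : ℝ)
    · rw [hf, indicator_of_mem hv, indicator_of_mem hv, mul_assoc, ← Complex.exp_add]
      congr 2; ring
    · rw [hf, indicator_of_notMem hv, indicator_of_notMem hv, zero_mul]
  have hright : ∫ v : ℝ, f v * (Real.exp (-(u - v) ^ 2 / (4 * b)) : ℂ) =
      (((-1) ^ B * ∫ v in Ioi (0 : ℝ), v ^ B * mertensLog v * Real.exp (-σ * v) *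
        Real.exp (-(u - v) ^ 2 / (4 * b)) : ℝ) : ℂ) := by
    rw [← integral_const_mul, ← integral_indicator measurableSet_Ioi, ← integral_complex_ofReal]
    congr 1; ext v
    by_cases hv : v ∈ Ioi (0 : ℝ)
    · rw [hf, indicator_of_mem hv, indicator_of_mem hv, hg]
      push_cast
      rw [neg_pow]; ring
    · rw [hf, indicator_of_notMem hv, indicator_of_notMem hv]; simp
  rw [hright] at hrep
  simp_rw [hft] at hrep
  have hsq : 0 < √(Real.pi / b) := by positivity
  have hbound : ‖∫ t : ℝ, lap g (σ + Complex.I * t) *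
      ((Real.exp (-b * t ^ 2) : ℂ) * Complex.exp (Complex.I * t * u))‖ ≤ C * √(Real.pi / b) := by
    rw [← integral_gaussian, ← integral_const_mul]
    refine norm_integral_le_of_norm_le ((integrable_exp_neg_mul_sq hb).const_mul C) ?_
    refine Filter.Eventually.of_forall fun t => ?_
    rw [norm_mul, norm_mul, Complex.norm_real, Complex.norm_exp, Real.norm_eq_abs,
      abs_of_pos (Real.exp_pos _)]
    have h3 := hlap (σ + Complex.I * t) (by simpa using hσ) (by simpa using hσ1)
    have h4 : (Complex.I * (t : ℂ) * u).re = 0 := by simp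
    rw [h4, Real.exp_zero, mul_one]
    gcongr
  rw [hrep, norm_mul, Complex.norm_real, Complex.norm_real, Real.norm_eq_abs, Real.norm_eq_abs,
    abs_of_pos hsq, abs_mul, abs_pow, abs_neg, abs_one, one_pow, one_mul, mul_comm] at hbound
  exact le_of_mul_le_mul_right hbound hsq

lemma abs_mertensLog_sub_le' {u v : ℝ} (hu : 1 ≤ u) (hv : 0 ≤ v) :
    |mertensLog u - mertensLog v| ≤ 8 * |v - u| + 2 * Real.exp (-(u / 2)) := by
  have he := (Real.exp_pos (-(u / 2))).le
  rcases lt_or_ge v (u / 2) with h | h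
  · have h1 := abs_mertensLog_le hv
    have h2 := abs_mertensLog_le (show 0 ≤ u by linarith)
    have h3 := abs_sub (mertensLog u) (mertensLog v)
    rw [abs_of_neg (by linarith : v - u < 0)]
    linarith
  · rcases le_total u v with h' | h'
    · rw [abs_sub_comm]
      refine (abs_mertensLog_sub_le (by linarith) h').trans ?_
      rw [abs_of_nonneg (by linarith)]
      have : Real.exp (-u) ≤ Real.exp (-(u / 2)) := Real.exp_le_exp.2 (by linarith)
      linarith
    · refine (abs_mertensLog_sub_le hv h').trans ?_
      rw [abs_of_nonpos (by linarith)]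
      have : Real.exp (-v) ≤ Real.exp (-(u / 2)) := Real.exp_le_exp.2 (by linarith)
      linarith

lemma integrable_one_add_abs_pow_mul_gaussian (K : ℕ) {b : ℝ} (hb : 0 < b) :
    Integrable fun y : ℝ => (1 + |y|) ^ K * Real.exp (-b * y ^ 2) := by
  have e : (fun y : ℝ => (1 + |y|) ^ K * Real.exp (-b * y ^ 2)) = fun y =>
      ∑ j ∈ Finset.range (K + 1), (K.choose j : ℝ) * ‖y ^ (j : ℝ) * Real.exp (-b * y ^ 2)‖ := by
    ext y
    rw [add_comm, add_pow, Finset.sum_mul]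
    refine Finset.sum_congr rfl fun j _ => ?_
    simp; ring
  rw [e]
  exact integrable_finsetSum _ fun j _ => ((integrable_rpow_mul_exp_neg_mul_sq hb
    (by linarith [Nat.cast_nonneg (α := ℝ) j])).norm).const_mul _

/-- The strong form of the prime number theorem for `∑ μ(a)/a`: decay faster than any power of
the logarithm. -/
theorem exists_pow_mul_abs_mertensLog_le (B : ℕ) :
    ∃ C : ℝ, 0 < C ∧ ∀ u : ℝ, 1 ≤ u → u ^ B * |mertensLog u| ≤ C := by
  obtain ⟨C, hC, h⟩ := norm_integral_mertensLog_mul_gaussian_le (2 * B)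
  set C₂ := ∫ y : ℝ, 8 * ((1 + |y|) ^ (2 * B + 1) * Real.exp (-(1 / 4) * y ^ 2)) with hC₂
  have hC₂0 : 0 ≤ C₂ := integral_nonneg fun y => by positivity
  obtain ⟨C₃, hC₃0, hC₃⟩ : ∃ C₃ : ℝ, 0 < C₃ ∧ ∀ u : ℝ, 1 ≤ u → u ^ B * Real.exp (-(u / 2)) ≤ C₃ := by
    refine ⟨2 ^ B * B.factorial, by positivity, fun u hu => ?_⟩
    have := Real.pow_div_factorial_le_exp (x := u / 2) (by linarith) B
    rw [Real.exp_neg, ← div_eq_mul_inv, div_le_iff₀ (Real.exp_pos _)]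
    rw [div_le_iff₀ (by positivity), div_pow, div_le_iff₀ (by positivity)] at this
    linarith
  refine ⟨Real.exp (5 / 4) * (C + C₂ * (1 + C₃)), by positivity, fun u hu => ?_⟩
  have hu0 : 0 < u := by linarith
  set η : ℝ := (u ^ B)⁻¹ with hη
  have hη0 : 0 < η := by positivity
  have hη1 : η ≤ 1 := inv_le_one_of_one_le₀ (one_le_pow₀ hu)
  set W : ℝ → ℝ := fun v => v ^ (2 * B) * Real.exp (-(1 / (u + 1)) * v) *
    Real.exp (-(u - v) ^ 2 / (4 * η ^ 2)) with hW
  have hWm : Measurable W := by fun_prop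
  have hW0 : ∀ v, 0 ≤ W v := fun v => by simp only [hW]; rw [pow_mul]; positivity
  set G : ℝ → ℝ := fun x => u ^ (2 * B) * ((1 + |x / η|) ^ (2 * B) *
    (8 * (η + Real.exp (-(u / 2))) * (1 + |x / η|)) * Real.exp (-(1 / 4) * (x / η) ^ 2)) with hG
  have hGi0 : Integrable (fun y : ℝ => u ^ (2 * B) * ((1 + |y|) ^ (2 * B) *
    (8 * (η + Real.exp (-(u / 2))) * (1 + |y|)) * Real.exp (-(1 / 4) * y ^ 2))) := by
    refine ((integrable_one_add_abs_pow_mul_gaussian (2 * B + 1)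
      (b := 1 / 4) (by norm_num)).const_mul (u ^ (2 * B) * 8 * (η + Real.exp (-(u / 2))))).congr ?_
    refine Filter.Eventually.of_forall fun y => ?_
    simp only; rw [pow_succ]; ring
  have hGi : Integrable G := hGi0.comp_div hη0.ne'
  have hGint : ∫ x, G x = u ^ (2 * B) * η * (η + Real.exp (-(u / 2))) * C₂ := by
    rw [hG, Measure.integral_comp_div (fun y : ℝ => u ^ (2 * B) * ((1 + |y|) ^ (2 * B) *
      (8 * (η + Real.exp (-(u / 2))) * (1 + |y|)) * Real.exp (-(1 / 4) * y ^ 2))) η, hC₂,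
      ← integral_const_mul, smul_eq_mul, ← integral_const_mul, abs_of_pos hη0]
    congr 1; ext y; rw [pow_succ]; ring
  have hbase : ∀ v, 0 < v → v ^ (2 * B) ≤ u ^ (2 * B) * (1 + |(v - u) / η|) ^ (2 * B) := by
    intro v hv
    rw [← mul_pow]
    gcongr
    have h1 : |v - u| ≤ |(v - u) / η| := by
      rw [abs_div, abs_of_pos hη0, le_div_iff₀ hη0]
      exact mul_le_of_le_one_right (abs_nonneg _) hη1
    nlinarith [le_abs_self (v - u), abs_nonneg (v - u)]
  have hgauss : ∀ v, Real.exp (-(u - v) ^ 2 / (4 * η ^ 2)) = Real.exp (-(1 / 4) * ((v - u) / η) ^ 2) := by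
    intro v; congr 1; field_simp; ring
  have hGu : Integrable fun v => G (v - u) := hGi.comp_sub_right u
  have hexp1 : ∀ v, 0 < v → Real.exp (-(1 / (u + 1)) * v) ≤ 1 := by
    intro v hv
    rw [Real.exp_le_one_iff]
    have : 0 < 1 / (u + 1) * v := by positivity
    linarith
  have hMG : ∀ v, 0 < v → W v * |mertensLog u - mertensLog v| ≤ G (v - u) := by
    intro v hv
    have h1 := abs_mertensLog_sub_le' hu hv.le
    have h2 : 8 * |v - u| + 2 * Real.exp (-(u / 2)) ≤
        8 * (η + Real.exp (-(u / 2))) * (1 + |(v - u) / η|) := by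
      have h3 : |v - u| = η * |(v - u) / η| := by
        rw [abs_div, abs_of_pos hη0]; field_simp
      have h4 := (Real.exp_pos (-(u / 2))).le
      rw [h3]
      nlinarith [abs_nonneg ((v - u) / η), mul_nonneg h4 (abs_nonneg ((v - u) / η))]
    calc W v * |mertensLog u - mertensLog v|
        ≤ (u ^ (2 * B) * (1 + |(v - u) / η|) ^ (2 * B)) * 1 *
          Real.exp (-(1 / 4) * ((v - u) / η) ^ 2) *
          (8 * (η + Real.exp (-(u / 2))) * (1 + |(v - u) / η|)) := by
          rw [hW]; simp only
          rw [hgauss]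
          gcongr
          · exact hbase v hv
          · exact hexp1 v hv
          · exact h1.trans h2
      _ = G (v - u) := by rw [hG]; ring
  have hWi : IntegrableOn W (Ioi 0) := by
    have := (((integrable_one_add_abs_pow_mul_gaussian (2 * B) (b := 1 / 4) (by norm_num)).comp_div
      hη0.ne').comp_sub_right u).const_mul (u ^ (2 * B))
    refine Integrable.mono' this.integrableOn hWm.aestronglyMeasurable ?_
    filter_upwards [ae_restrict_mem measurableSet_Ioi] with v hv
    rw [Real.norm_of_nonneg (hW0 v)]
    calc W v ≤ (u ^ (2 * B) * (1 + |(v - u) / η|) ^ (2 * B)) * 1 *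
          Real.exp (-(1 / 4) * ((v - u) / η) ^ 2) := by
          rw [hW]; simp only
          rw [hgauss]
          gcongr
          · exact hbase v hv
          · exact hexp1 v hv
      _ = _ := by ring
  have hWM : IntegrableOn (fun v => W v * (mertensLog u - mertensLog v)) (Ioi 0) := by
    refine Integrable.mono' hGu.integrableOn
      (hWm.mul (measurable_const.sub measurable_mertensLog)).aestronglyMeasurable ?_
    filter_upwards [ae_restrict_mem measurableSet_Ioi] with v hv
    rw [Real.norm_eq_abs, abs_mul, abs_of_nonneg (hW0 v)]
    exact hMG v hv
  have herr : |∫ v in Ioi (0 : ℝ), W v * (mertensLog u - mertensLog v)| ≤ ∫ x, G x := by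
    rw [← integral_sub_right_eq_self G u, ← Real.norm_eq_abs]
    refine (norm_integral_le_of_norm_le (μ := volume.restrict (Ioi 0)) hGu.integrableOn ?_).trans
      (setIntegral_le_integral hGu (Filter.Eventually.of_forall fun v => ?_))
    · filter_upwards [ae_restrict_mem measurableSet_Ioi] with v hv
      rw [Real.norm_eq_abs, abs_mul, abs_of_nonneg (hW0 v)]
      exact hMG v hv
    · rw [hG]; simp only [Pi.zero_apply]; positivity
  have hlow : u ^ (2 * B) * Real.exp (-(5 / 4)) * η ≤ ∫ v in Ioi (0 : ℝ), W v := by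
    have h1 : ∫ v in Ioc u (u + η), u ^ (2 * B) * Real.exp (-(5 / 4)) ≤ ∫ v in Ioc u (u + η), W v := by
      refine setIntegral_mono_on (integrableOn_const (by simp)) (hWi.mono_set fun v hv => hu0.trans hv.1)
        measurableSet_Ioc fun v hv => ?_
      have hv0 : 0 < v := hu0.trans hv.1
      rw [hW]; simp only
      rw [mul_assoc, ← Real.exp_add]
      have h2 : 1 / (u + 1) * v ≤ 1 := by
        rw [one_div, inv_mul_le_iff₀ (by linarith)]
        linarith [hv.2]
      have h3 : ((v - u) / η) ^ 2 ≤ 1 := by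
        rw [sq_le_one_iff₀ (div_nonneg (by linarith [hv.1]) hη0.le), div_le_one hη0]
        linarith [hv.2]
      have h4 : -(u - v) ^ 2 / (4 * η ^ 2) = -(1 / 4) * ((v - u) / η) ^ 2 := by field_simp; ring
      gcongr
      · exact hv.1.le
      · rw [h4]; linarith
    have h2 : ∫ v in Ioc u (u + η), W v ≤ ∫ v in Ioi (0 : ℝ), W v :=
      setIntegral_mono_set hWi (Filter.Eventually.of_forall hW0)
        (LE.le.eventuallyLE fun v hv => hu0.trans hv.1)
    refine le_trans (le_of_eq ?_) (h1.trans h2)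
    simp [hη0.le]; ring
  have hmain := h (1 / (u + 1)) (η ^ 2) u (by positivity)
    (by rw [div_le_one (by linarith)]; linarith) (by positivity)
  have hsplit : mertensLog u * ∫ v in Ioi (0 : ℝ), W v =
      (∫ v in Ioi (0 : ℝ), W v * (mertensLog u - mertensLog v)) +
      ∫ v in Ioi (0 : ℝ), v ^ (2 * B) * mertensLog v * Real.exp (-(1 / (u + 1)) * v) *
        Real.exp (-(u - v) ^ 2 / (4 * η ^ 2)) := by
    rw [← integral_const_mul, ← integral_add hWM]
    · congr 1; ext v; rw [hW]; ring
    · refine ((hWi.mul_const (mertensLog u)).sub hWM).congr ?_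
      refine Filter.Eventually.of_forall fun v => ?_
      simp only [hW, Pi.sub_apply]; ring
  have h5 : |mertensLog u| * (u ^ (2 * B) * Real.exp (-(5 / 4)) * η) ≤
      C + u ^ (2 * B) * η * (η + Real.exp (-(u / 2))) * C₂ := by
    calc _ ≤ |mertensLog u| * ∫ v in Ioi (0 : ℝ), W v := by gcongr
      _ = |mertensLog u * ∫ v in Ioi (0 : ℝ), W v| := by
          rw [abs_mul, abs_of_nonneg (integral_nonneg fun v => hW0 v)]
      _ ≤ _ := by
          rw [hsplit]
          refine (abs_add_le _ _).trans ?_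
          rw [← hGint]; linarith
  have hη2 : u ^ (2 * B) * η = u ^ B := by
    rw [hη, two_mul, pow_add]; field_simp
  have h6 : u ^ (2 * B) * η * (η + Real.exp (-(u / 2))) ≤ 1 + C₃ := by
    rw [hη2, mul_add]
    have := hC₃ u hu
    have h7 : u ^ B * η = 1 := by rw [hη]; field_simp
    linarith
  have h8 : u ^ (2 * B) * Real.exp (-(5 / 4)) * η = u ^ B * Real.exp (-(5 / 4)) := by
    rw [← hη2]; ring
  rw [h8] at h5
  have h9 : Real.exp (5 / 4) * Real.exp (-(5 / 4)) = 1 := by rw [← Real.exp_add]; simp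
  calc u ^ B * |mertensLog u| =
        Real.exp (5 / 4) * (|mertensLog u| * (u ^ B * Real.exp (-(5 / 4)))) := by
        linear_combination -(u ^ B * |mertensLog u|) * h9
    _ ≤ Real.exp (5 / 4) * (C + C₂ * (1 + C₃)) := by
        gcongr
        nlinarith

lemma eq_of_sq_mul_eq_sq_mul {a a' b b' : ℕ} (hb : 0 < b) (ha : Squarefree a)
    (ha' : Squarefree a') (h : b ^ 2 * a = b' ^ 2 * a') : b = b' ∧ a = a' := by
  have ha0 : 0 < a := Nat.pos_of_ne_zero ha.ne_zero
  have ha0' : 0 < a' := Nat.pos_of_ne_zero ha'.ne_zero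
  have h1 : b ^ 2 ∣ (b' * a') ^ 2 := ⟨a * a', by rw [mul_pow, ← mul_assoc, h]; ring⟩
  obtain ⟨c, hc⟩ := (Nat.pow_dvd_pow_iff two_ne_zero).1 h1
  have h2 : a * a' = c ^ 2 := by
    have : b ^ 2 * (a * a') = b ^ 2 * c ^ 2 := by
      rw [← mul_assoc, h, ← mul_pow, ← hc]; ring
    exact Nat.eq_of_mul_eq_mul_left (by positivity) this
  have h3 : a ∣ c := (ha.dvd_pow_iff_dvd two_ne_zero).1 ⟨a', h2.symm⟩
  obtain ⟨e, rfl⟩ := h3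
  have h4 : a' = a * (e * e) := by
    refine Nat.eq_of_mul_eq_mul_left ha0 ?_
    rw [h2]; ring
  have h5 : IsUnit e := ha' e (h4 ▸ Dvd.intro_left _ rfl)
  rw [Nat.isUnit_iff] at h5
  subst h5
  simp at h4
  subst h4
  refine ⟨?_, rfl⟩
  have := Nat.eq_of_mul_eq_mul_right ha0 h
  exact Nat.pow_left_injective two_ne_zero this

lemma liouville_sq_mul {a b : ℕ} (hb : b ≠ 0) (ha : Squarefree a) :
    ArithmeticFunction.liouville (b ^ 2 * a) = ArithmeticFunction.moebius a := by
  rw [ArithmeticFunction.liouville_apply_mul, sq, ArithmeticFunction.liouville_apply_mul,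
    ArithmeticFunction.liouville_apply hb, ArithmeticFunction.liouville_apply ha.ne_zero,
    ArithmeticFunction.moebius_apply_of_squarefree ha, ← pow_add, Even.neg_one_pow ⟨_, rfl⟩,
    one_mul]

/-- `∑_{a ≤ e^u} λ(a)/a`. -/
noncomputable def liouvilleLog (u : ℝ) : ℝ :=
  ∑ a ∈ Finset.Icc 1 ⌊Real.exp u⌋₊, ((ArithmeticFunction.liouville a : ℤ) : ℝ) / a

lemma liouvilleLog_eq (u : ℝ) : liouvilleLog u = ∑ b ∈ Finset.Icc 1 ⌊Real.exp u⌋₊,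
    1 / (b : ℝ) ^ 2 * mertensLog (u - 2 * Real.log b) := by
  set N := ⌊Real.exp u⌋₊ with hN
  have h1 : ∀ b ∈ Finset.Icc 1 N, 1 / (b : ℝ) ^ 2 * mertensLog (u - 2 * Real.log b) =
      ∑ a ∈ (Finset.Icc 1 (N / b ^ 2)).filter Squarefree,
        ((ArithmeticFunction.liouville (b ^ 2 * a) : ℤ) : ℝ) / ((b ^ 2 * a : ℕ) : ℝ) := by
    intro b hb
    have hb0 : 0 < b := (Finset.mem_Icc.1 hb).1
    have hb' : (0 : ℝ) < b := by exact_mod_cast hb0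
    have he : Real.exp (u - 2 * Real.log b) = Real.exp u / ((b ^ 2 : ℕ) : ℝ) := by
      rw [Real.exp_sub, two_mul, Real.exp_add, Real.exp_log hb']; push_cast; ring
    rw [mertensLog, he, Nat.floor_div_natCast, ← hN, Finset.mul_sum, Finset.sum_filter]
    refine Finset.sum_congr rfl fun a ha => ?_
    split_ifs with hs
    · rw [liouville_sq_mul hb0.ne' hs]; push_cast; field_simp
    · rw [ArithmeticFunction.moebius_eq_zero_of_not_squarefree hs]; simp
  rw [Finset.sum_congr rfl h1, Finset.sum_sigma', liouvilleLog]
  symm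
  refine Finset.sum_bij (fun p _ => p.1 ^ 2 * p.2) ?_ ?_ ?_ ?_
  · rintro ⟨b, a⟩ h
    simp only [Finset.mem_sigma, Finset.mem_Icc, Finset.mem_filter] at h ⊢
    obtain ⟨hb, ha, -⟩ := h
    refine ⟨Nat.mul_pos (pow_pos hb.1 2) ha.1, ?_⟩
    rw [mul_comm]
    exact (Nat.le_div_iff_mul_le (pow_pos hb.1 2)).1 ha.2
  · rintro ⟨b, a⟩ h ⟨b', a'⟩ h' he
    simp only [Finset.mem_sigma, Finset.mem_Icc, Finset.mem_filter] at h h'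
    obtain ⟨rfl, rfl⟩ := eq_of_sq_mul_eq_sq_mul h.1.1 h.2.2 h'.2.2 he
    rfl
  · intro n hn
    rw [Finset.mem_Icc] at hn
    obtain ⟨a, b, ha, hb, hab, hs⟩ := Nat.sq_mul_squarefree_of_pos hn.1
    refine ⟨⟨b, a⟩, ?_, hab⟩
    simp only [Finset.mem_sigma, Finset.mem_Icc, Finset.mem_filter]
    have h2 : b ≤ n := by rw [← hab]; nlinarith
    refine ⟨⟨hb, h2.trans hn.2⟩, ⟨ha, ?_⟩, hs⟩
    rw [Nat.le_div_iff_mul_le (pow_pos hb 2), mul_comm, hab]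
    exact hn.2
  · rintro ⟨b, a⟩ h
    rfl

lemma exists_pow_mul_abs_liouvilleLog_le (B : ℕ) :
    ∃ C : ℝ, 0 < C ∧ ∀ u : ℝ, 0 ≤ u → u ^ B * |liouvilleLog u| ≤ C := by
  have key : ∀ B : ℕ, ∃ C : ℝ, 0 < C ∧ ∀ u : ℝ, 0 ≤ u → u ^ B * |mertensLog u| ≤ C := by
    intro B
    obtain ⟨C, hC, h⟩ := exists_pow_mul_abs_mertensLog_le B
    refine ⟨C + 2, by positivity, fun u hu => ?_⟩
    rcases le_total 1 u with h1 | h1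
    · linarith [h u h1]
    · have h2 := abs_mertensLog_le hu
      have h3 : u ^ B ≤ 1 := pow_le_one₀ hu h1
      calc _ ≤ 1 * (1 + u) := by gcongr
        _ ≤ _ := by linarith
  obtain ⟨C₁, hC₁, h₁⟩ := key B
  obtain ⟨C₀, hC₀, h₀⟩ := key 0
  obtain ⟨C₂, hC₂, h₂⟩ : ∃ C₂ : ℝ, 0 < C₂ ∧ ∀ b : ℕ, 1 ≤ b →
      (2 * Real.log b) ^ B ≤ C₂ * (b : ℝ) ^ (1 / 2 : ℝ) := by
    refine ⟨4 ^ B * B.factorial, by positivity, fun b hb => ?_⟩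
    have hb' : (1 : ℝ) ≤ b := by exact_mod_cast hb
    have hl := Real.log_nonneg hb'
    have := Real.pow_div_factorial_le_exp (Real.log b / 2) (by positivity) B
    rw [div_le_iff₀ (by positivity)] at this
    rw [Real.rpow_def_of_pos (by positivity)]
    calc (2 * Real.log b) ^ B = 4 ^ B * (Real.log b / 2) ^ B := by rw [← mul_pow]; ring
      _ ≤ 4 ^ B * (Real.exp (Real.log b / 2) * B.factorial) := by gcongr
      _ = _ := by rw [show Real.log b * (1 / 2) = Real.log b / 2 by ring]; ring
  have hs : Summable fun b : ℕ => 1 / (b : ℝ) ^ (3 / 2 : ℝ) :=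
    Real.summable_one_div_nat_rpow.2 (by norm_num)
  refine ⟨2 ^ B * (C₁ + C₂ * C₀) * (∑' b : ℕ, 1 / (b : ℝ) ^ (3 / 2 : ℝ) + 1), ?_, fun u hu => ?_⟩
  · have : 0 ≤ ∑' b : ℕ, 1 / (b : ℝ) ^ (3 / 2 : ℝ) := tsum_nonneg fun b => by positivity
    positivity
  rw [liouvilleLog_eq]
  have hterm : ∀ b ∈ Finset.Icc 1 ⌊Real.exp u⌋₊,
      u ^ B * |1 / (b : ℝ) ^ 2 * mertensLog (u - 2 * Real.log b)| ≤
        2 ^ B * (C₁ + C₂ * C₀) * (1 / (b : ℝ) ^ (3 / 2 : ℝ)) := by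
    intro b hb
    have hb1 : 1 ≤ b := (Finset.mem_Icc.1 hb).1
    have hb' : (1 : ℝ) ≤ b := by exact_mod_cast hb1
    have hb0 : (0 : ℝ) < b := by linarith
    have hl := Real.log_nonneg hb'
    rw [abs_mul, abs_of_nonneg (by positivity : 0 ≤ 1 / (b : ℝ) ^ 2)]
    rcases lt_or_ge (u - 2 * Real.log b) 0 with hneg | hpos
    · have : mertensLog (u - 2 * Real.log b) = 0 := by
        rw [mertensLog, Nat.floor_eq_zero.2 (by simpa using hneg)]
        simp
      rw [this]
      simp only [abs_zero, mul_zero]; positivity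
    set v := u - 2 * Real.log b with hv
    have hu' : u = v + 2 * Real.log b := by rw [hv]; ring
    have h3 : u ^ B ≤ 2 ^ B * (v ^ B + (2 * Real.log b) ^ B) := by
      rw [hu']
      rcases Nat.eq_zero_or_pos B with rfl | hB
      · simp
      refine (add_pow_le hpos (by positivity) B).trans ?_
      gcongr
      · norm_num
      · omega
    have hr1 : (1 : ℝ) ≤ (b : ℝ) ^ (1 / 2 : ℝ) := Real.one_le_rpow hb' (by norm_num)
    have hr : (b : ℝ) ^ (1 / 2 : ℝ) * (1 / (b : ℝ) ^ 2) = 1 / (b : ℝ) ^ (3 / 2 : ℝ) := by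
      rw [show (b : ℝ) ^ 2 = (b : ℝ) ^ (1 / 2 : ℝ) * (b : ℝ) ^ (3 / 2 : ℝ) by
        rw [← Real.rpow_add hb0]; norm_num]
      field_simp
    have h0 := h₀ v hpos
    have h1 := h₁ v hpos
    simp only [pow_zero, one_mul] at h0
    have h4 : u ^ B * |mertensLog v| ≤ 2 ^ B * (C₁ + C₂ * C₀) * (b : ℝ) ^ (1 / 2 : ℝ) := by
      calc u ^ B * |mertensLog v| ≤ 2 ^ B * (v ^ B + (2 * Real.log b) ^ B) * |mertensLog v| := by
            gcongr
        _ = 2 ^ B * (v ^ B * |mertensLog v| + (2 * Real.log b) ^ B * |mertensLog v|) := by ring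
        _ ≤ 2 ^ B * (C₁ * (b : ℝ) ^ (1 / 2 : ℝ) + (C₂ * (b : ℝ) ^ (1 / 2 : ℝ)) * C₀) := by
            have h5 : v ^ B * |mertensLog v| ≤ C₁ * (b : ℝ) ^ (1 / 2 : ℝ) := by nlinarith
            have h6 := mul_le_mul (h₂ b hb1) h0 (abs_nonneg _) (by positivity)
            gcongr
        _ = _ := by ring
    calc _ = u ^ B * |mertensLog v| * (1 / (b : ℝ) ^ 2) := by ring
      _ ≤ 2 ^ B * (C₁ + C₂ * C₀) * (b : ℝ) ^ (1 / 2 : ℝ) * (1 / (b : ℝ) ^ 2) := by gcongr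
      _ = _ := by rw [mul_assoc, hr]
  calc _ ≤ u ^ B * ∑ b ∈ Finset.Icc 1 ⌊Real.exp u⌋₊,
        |1 / (b : ℝ) ^ 2 * mertensLog (u - 2 * Real.log b)| := by
        gcongr; exact Finset.abs_sum_le_sum_abs _ _
    _ ≤ ∑ b ∈ Finset.Icc 1 ⌊Real.exp u⌋₊,
        2 ^ B * (C₁ + C₂ * C₀) * (1 / (b : ℝ) ^ (3 / 2 : ℝ)) := by
        rw [Finset.mul_sum]; exact Finset.sum_le_sum hterm
    _ ≤ 2 ^ B * (C₁ + C₂ * C₀) * (∑' b : ℕ, 1 / (b : ℝ) ^ (3 / 2 : ℝ)) := by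
        rw [← Finset.mul_sum]
        gcongr
        exact hs.sum_le_tsum _ fun b _ => by positivity
    _ ≤ _ := by gcongr; linarith

/-- The truncated power `u_+^A`, with `u_+^0` the indicator of `u ≥ 0`. -/
noncomputable def posPow (A : ℕ) (u : ℝ) : ℝ := if 0 ≤ u then u ^ A else 0

/-- The probability of `S` when each `p ∈ P` is selected independently with probability `1/p`. -/
noncomputable def wt (P S : Finset ℕ) : ℝ := (∏ p ∈ S, (1 / p : ℝ)) * ∏ p ∈ P \ S, (1 - 1 / p : ℝ)

/-- The sieve weight `∑_{T ⊆ S} (-1)^{|T|} (u - ∑_{p ∈ T} log p)_+^A`. -/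
noncomputable def sieveSum (A : ℕ) (S : Finset ℕ) (u : ℝ) : ℝ :=
  ∑ T ∈ S.powerset, (-1 : ℝ) ^ T.card * posPow A (u - ∑ p ∈ T, Real.log p)

/-- The `n`-th moment of the sieve weight under the random selection of primes from `P`. -/
noncomputable def sieveMoment (A n : ℕ) (P : Finset ℕ) (u : ℝ) : ℝ :=
  ∑ S ∈ P.powerset, wt P S * sieveSum A S u ^ n

lemma wt_nonneg (P S : Finset ℕ) : 0 ≤ wt P S := by
  refine mul_nonneg (Finset.prod_nonneg fun p _ => by positivity)
    (Finset.prod_nonneg fun p _ => ?_)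
  rcases Nat.eq_zero_or_pos p with rfl | hp
  · simp
  · have : (1 : ℝ) ≤ p := by exact_mod_cast hp
    rw [sub_nonneg, div_le_one (by linarith)]; exact this

lemma sum_wt_smul_prod {R : Type*} [CommRing R] [Algebra ℝ R] (P : Finset ℕ) (y : ℕ → R) :
    ∑ S ∈ P.powerset, wt P S • ∏ p ∈ S, y p = ∏ p ∈ P, (1 + (1 / p : ℝ) • (y p - 1)) := by
  have h : ∀ p ∈ P, (1 + (1 / p : ℝ) • (y p - 1)) =
      (1 / p : ℝ) • y p + (1 - 1 / p : ℝ) • (1 : R) := by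
    intro p _; rw [smul_sub, sub_smul, one_smul]; ring
  rw [Finset.prod_congr rfl h, Finset.prod_add]
  refine Finset.sum_congr rfl fun S _ => ?_
  rw [wt, Finset.prod_smul, Finset.prod_smul, smul_mul_smul_comm, Finset.prod_const_one, mul_one]

lemma sum_wt_filter_superset {P U : Finset ℕ} (h : U ⊆ P) :
    ∑ S ∈ P.powerset with U ⊆ S, wt P S = ∏ p ∈ U, (1 / p : ℝ) := by
  have key := Finset.prod_add (fun p : ℕ => (1 / p : ℝ))
    (fun p : ℕ => if p ∈ U then (0 : ℝ) else (1 - 1 / p)) P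
  have hl : ∏ p ∈ P, ((1 / p : ℝ) + if p ∈ U then (0 : ℝ) else (1 - 1 / p)) =
      ∏ p ∈ U, (1 / p : ℝ) := by
    rw [← Finset.prod_subset h (f := fun p : ℕ => (1 / p : ℝ) + if p ∈ U then (0 : ℝ) else (1 - 1 / p))]
    · exact Finset.prod_congr rfl fun p hp => by simp [hp]
    · intro p _ hp; simp [hp]
  rw [← hl, key, Finset.sum_filter]
  refine Finset.sum_congr rfl fun S _ => ?_
  split_ifs with hU
  · rw [wt]; congr 1
    refine Finset.prod_congr rfl fun p hp => ?_
    rw [if_neg fun hpU => (Finset.mem_sdiff.1 hp).2 (hU hpU)]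
  · obtain ⟨p, hpU, hpS⟩ := Finset.not_subset.1 hU
    rw [Finset.prod_eq_zero (s := P \ S) (i := p) (Finset.mem_sdiff.2 ⟨h hpU, hpS⟩) (by simp [hpU]),
      mul_zero]

lemma lcm_prod_primes {n : ℕ} (T : Fin n → Finset ℕ) (hT : ∀ j, ∀ p ∈ T j, p.Prime) :
    (Finset.univ.lcm fun j => ∏ p ∈ T j, p) = ∏ p ∈ Finset.univ.biUnion T, p := by
  refine Nat.dvd_antisymm (Finset.lcm_dvd fun j hj => Finset.prod_dvd_prod_of_subset _ _ _
    (Finset.subset_biUnion_of_mem T hj)) (Finset.prod_primes_dvd _ ?_ ?_)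
  · intro p hp
    obtain ⟨j, -, hj⟩ := Finset.mem_biUnion.1 hp
    exact (hT j p hj).prime
  · intro p hp
    obtain ⟨j, hj', hj⟩ := Finset.mem_biUnion.1 hp
    exact (Finset.dvd_prod_of_mem (fun p => p) hj).trans
      (Finset.dvd_lcm (f := fun j => ∏ p ∈ T j, p) hj')

lemma moebius_prod_primes {T : Finset ℕ} (hT : ∀ p ∈ T, p.Prime) :
    ArithmeticFunction.moebius (∏ p ∈ T, p) = (-1) ^ T.card := by
  rw [ArithmeticFunction.isMultiplicative_moebius.map_prod (fun p => p) T]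
  · rw [Finset.prod_congr rfl fun p hp => ArithmeticFunction.moebius_apply_prime (hT p hp),
      Finset.prod_const]
  · intro p hp q hq hpq
    exact (Nat.coprime_primes (hT p hp) (hT q hq)).2 hpq

lemma fA_log_div {A d : ℕ} {L : ℝ} (hL : 0 < L) :
    fA A (Real.log d / L) = posPow A (L - Real.log d) / L ^ A := by
  rw [fA, posPow]
  simp only [div_le_one hL, sub_nonneg]
  split_ifs
  · rw [← div_pow]; congr 1; field_simp
  · simp

lemma momentM_mul_pow (A n : ℕ) {R : ℝ} (hR : 1 < R) {P : Finset ℕ} (hP : ∀ p ∈ P, p.Prime)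
    (hPR : ∀ p : ℕ, p.Prime → (p : ℝ) ≤ R → p ∈ P) :
    momentM (fA A) n R * Real.log R ^ (n * A) = sieveMoment A n P (Real.log R) := by
  set L := Real.log R with hLdef
  have hL : 0 < L := Real.log_pos hR
  have hprime : ∀ T ∈ Fintype.piFinset fun _ : Fin n => P.powerset, ∀ j, ∀ p ∈ T j, p.Prime := by
    intro T hT j p hp
    exact hP p (Finset.mem_powerset.1 (Fintype.mem_piFinset.1 hT j) hp)
  set F : (Fin n → Finset ℕ) → (Fin n → ℕ) := fun T j => ∏ p ∈ T j, p with hF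
  have hinj : Set.InjOn F (Fintype.piFinset fun _ : Fin n => P.powerset) := by
    intro T hT T' hT' h
    funext j
    have := congrArg Nat.primeFactors (congrFun h j)
    simp only [hF] at this
    rwa [Nat.primeFactors_prod (hprime T hT j), Nat.primeFactors_prod (hprime T' hT' j)] at this
  have hmom : momentM (fA A) n R = ∑ T ∈ Fintype.piFinset fun _ : Fin n => P.powerset,
      (∏ j, ((-1 : ℝ) ^ (T j).card * (posPow A (L - ∑ p ∈ T j, Real.log p) / L ^ A))) *
        ∏ p ∈ Finset.univ.biUnion T, (1 / p : ℝ) := by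
    rw [momentM, tsum_eq_sum (s := (Fintype.piFinset fun _ : Fin n => P.powerset).image F),
      Finset.sum_image hinj]
    · refine Finset.sum_congr rfl fun T hT => ?_
      simp only [hF]
      rw [lcm_prod_primes T (hprime T hT), div_eq_mul_inv]
      congr 1
      · refine Finset.prod_congr rfl fun j _ => ?_
        rw [moebius_prod_primes (hprime T hT j), fA_log_div hL, Nat.cast_prod, Real.log_prod]
        · push_cast; rfl
        · intro p hp; exact_mod_cast (hprime T hT j p hp).ne_zero
      · rw [Nat.cast_prod, ← Finset.prod_inv_distrib]; simp
    · intro d hd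
      by_contra hne
      apply hd
      have hne1 : ∀ j, ((ArithmeticFunction.moebius (d j) : ℤ) : ℝ) *
          fA A (Real.log (d j) / Real.log R) ≠ 0 := by
        intro j hj
        apply hne
        rw [Finset.prod_eq_zero (Finset.mem_univ j) hj, zero_div]
      have hsq : ∀ j, Squarefree (d j) := by
        intro j
        by_contra hs
        apply hne1 j
        rw [ArithmeticFunction.moebius_eq_zero_of_not_squarefree hs]; simp
      have hle : ∀ j, (d j : ℝ) ≤ R := by
        intro j
        by_contra! hs
        apply hne1 j
        rw [fA, if_neg, mul_zero]
        rw [div_le_one hL, not_le]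
        exact Real.log_lt_log (by linarith) hs
      refine Finset.mem_image.2 ⟨fun j => (d j).primeFactors, ?_, ?_⟩
      · refine Fintype.mem_piFinset.2 fun j => Finset.mem_powerset.2 fun p hp => ?_
        refine hPR p (Nat.prime_of_mem_primeFactors hp) (le_trans ?_ (hle j))
        exact_mod_cast Nat.le_of_dvd (Nat.pos_of_ne_zero (hsq j).ne_zero)
          (Nat.dvd_of_mem_primeFactors hp)
      · funext j
        exact Nat.prod_primeFactors_of_squarefree (hsq j)
  have hmom2 : momentM (fA A) n R * L ^ (n * A) =
      ∑ T ∈ Fintype.piFinset fun _ : Fin n => P.powerset,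
      (∏ j, ((-1 : ℝ) ^ (T j).card * posPow A (L - ∑ p ∈ T j, Real.log p))) *
        ∏ p ∈ Finset.univ.biUnion T, (1 / p : ℝ) := by
    rw [hmom, Finset.sum_mul]
    refine Finset.sum_congr rfl fun T _ => ?_
    have : L ^ (n * A) ≠ 0 := by positivity
    have h1 : ∏ j, ((-1 : ℝ) ^ (T j).card * (posPow A (L - ∑ p ∈ T j, Real.log p) / L ^ A)) =
        (∏ j, ((-1 : ℝ) ^ (T j).card * posPow A (L - ∑ p ∈ T j, Real.log p))) / L ^ (n * A) := by
      rw [eq_div_iff this, show L ^ (n * A) = ∏ _j : Fin n, L ^ A by simp [← pow_mul, mul_comm],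
        ← Finset.prod_mul_distrib]
      exact Finset.prod_congr rfl fun j _ => by field_simp
    rw [h1]; field_simp
  rw [hmom2, sieveMoment]
  have h3 : ∀ S ∈ P.powerset, wt P S * sieveSum A S L ^ n =
      ∑ T ∈ Fintype.piFinset fun _ : Fin n => P.powerset, if Finset.univ.biUnion T ⊆ S then
        (∏ j, ((-1 : ℝ) ^ (T j).card * posPow A (L - ∑ p ∈ T j, Real.log p))) * wt P S else 0 := by
    intro S hS
    rw [← Finset.sum_filter, ← Finset.sum_mul, mul_comm, sieveSum,
      show (∑ T ∈ S.powerset, (-1 : ℝ) ^ T.card * posPow A (L - ∑ p ∈ T, Real.log p)) ^ n =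
        ∏ _j : Fin n, (∑ T ∈ S.powerset, (-1 : ℝ) ^ T.card * posPow A (L - ∑ p ∈ T, Real.log p))
        by simp, Finset.prod_univ_sum]
    congr 1
    refine Finset.sum_congr ?_ fun _ _ => rfl
    ext T
    simp only [Fintype.mem_piFinset, Finset.mem_powerset, Finset.mem_filter,
      Finset.biUnion_subset_iff_forall_subset, Finset.mem_univ, forall_true_left]
    rw [Finset.mem_powerset] at hS
    exact ⟨fun h => ⟨fun j => (h j).trans hS, h⟩, fun h => h.2⟩
  rw [Finset.sum_congr rfl h3, Finset.sum_comm]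
  refine Finset.sum_congr rfl fun T hT => ?_
  rw [← Finset.sum_filter, ← Finset.mul_sum, sum_wt_filter_superset]
  exact Finset.biUnion_subset_iff_forall_subset.2 fun j _ =>
    Finset.mem_powerset.1 (Fintype.mem_piFinset.1 hT j)

end

section

open MeasureTheory Set
open scoped NNReal

/-- Finite real combinations of translations by vectors of the nonnegative orthant. -/
abbrev Shift (n : ℕ) := AddMonoidAlgebra ℝ (Fin n → ℝ≥0)

/-- Translation of functions on `ℝⁿ`. -/
noncomputable def shiftHom (n : ℕ) :
    Multiplicative (Fin n → ℝ≥0) →* Module.End ℝ ((Fin n → ℝ) → ℝ) where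
  toFun v :=
    { toFun := fun F u => F (u - fun j => (v.toAdd j : ℝ))
      map_add' := fun _ _ => rfl
      map_smul' := fun _ _ => rfl }
  map_one' := by ext F u; simp; exact congrArg F (sub_zero u)
  map_mul' v w := by
    ext F u
    simp only [LinearMap.coe_mk, AddHom.coe_mk, Module.End.mul_apply, toAdd_mul]
    congr 1
    ext j
    simp only [Pi.sub_apply, Pi.add_apply, NNReal.coe_add]
    ring

/-- The action of `Shift n` on functions on `ℝⁿ`. -/
noncomputable def act {n : ℕ} : Shift n →ₐ[ℝ] Module.End ℝ ((Fin n → ℝ) → ℝ) :=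
  AddMonoidAlgebra.lift ℝ _ _ (shiftHom n)

section

variable {n : ℕ}

lemma act_single (v : Fin n → ℝ≥0) (c : ℝ) (F : (Fin n → ℝ) → ℝ) (u : Fin n → ℝ) :
    act (AddMonoidAlgebra.single v c) F u = c * F (u - fun j => (v j : ℝ)) := by
  rw [act, AddMonoidAlgebra.lift_single]; rfl

lemma act_apply (r : Shift n) (F : (Fin n → ℝ) → ℝ) (u : Fin n → ℝ) :
    act r F u = ∑ v ∈ r.coeff.support, r.coeff v * F (u - fun j => (v j : ℝ)) := by
  rw [act, AddMonoidAlgebra.lift_apply, Finsupp.sum, LinearMap.sum_apply, Finset.sum_apply]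
  rfl

/-- The weighted `ℓ¹` norm on `Shift n`. -/
noncomputable def mass (δ : ℝ) (r : Shift n) : ℝ :=
  r.coeff.sum fun v c => |c| * Real.exp (δ * ∑ j, (v j : ℝ))

lemma mass_nonneg (δ : ℝ) (r : Shift n) : 0 ≤ mass δ r :=
  Finset.sum_nonneg fun _ _ => by positivity

@[simp] lemma mass_zero (δ : ℝ) : mass δ (0 : Shift n) = 0 := by simp [mass]

lemma mass_single (δ : ℝ) (v : Fin n → ℝ≥0) (c : ℝ) :
    mass δ (AddMonoidAlgebra.single v c) = |c| * Real.exp (δ * ∑ j, (v j : ℝ)) := by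
  rw [mass, AddMonoidAlgebra.coeff_single, Finsupp.sum_single_index (by simp)]

@[simp] lemma mass_one (δ : ℝ) : mass δ (1 : Shift n) = 1 := by
  rw [AddMonoidAlgebra.one_def, mass_single]; simp

lemma mass_eq_sum {δ : ℝ} {r : Shift n} {s : Finset (Fin n → ℝ≥0)} (h : r.coeff.support ⊆ s) :
    mass δ r = ∑ v ∈ s, |r.coeff v| * Real.exp (δ * ∑ j, (v j : ℝ)) :=
  Finsupp.sum_of_support_subset _ h _ (by simp)

lemma mass_add_le (δ : ℝ) (r s : Shift n) : mass δ (r + s) ≤ mass δ r + mass δ s := by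
  classical
  rw [mass_eq_sum (s := r.coeff.support ∪ s.coeff.support) (r := r + s) (by
    rw [AddMonoidAlgebra.coeff_add]; exact Finsupp.support_add),
    mass_eq_sum (r := r) Finset.subset_union_left,
    mass_eq_sum (r := s) Finset.subset_union_right, ← Finset.sum_add_distrib]
  refine Finset.sum_le_sum fun v _ => ?_
  rw [← add_mul, AddMonoidAlgebra.coeff_add, Finsupp.add_apply]
  gcongr
  exact abs_add_le _ _

lemma mass_smul (δ c : ℝ) (r : Shift n) : mass δ (c • r) = |c| * mass δ r := by
  rw [mass_eq_sum (s := r.coeff.support) (r := c • r), mass_eq_sum (r := r) subset_rfl,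
    Finset.mul_sum]
  · refine Finset.sum_congr rfl fun v _ => ?_
    rw [AddMonoidAlgebra.coeff_smul, Finsupp.smul_apply, smul_eq_mul, abs_mul, mul_assoc]
  · rw [AddMonoidAlgebra.coeff_smul]; exact Finsupp.support_smul

lemma mass_neg (δ : ℝ) (r : Shift n) : mass δ (-r) = mass δ r := by
  rw [← neg_one_smul ℝ r, mass_smul]; simp

lemma mass_sub_le (δ : ℝ) (r s : Shift n) : mass δ (r - s) ≤ mass δ r + mass δ s := by
  rw [sub_eq_add_neg, ← mass_neg δ s]; exact mass_add_le _ _ _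

lemma mass_sum_le {ι : Type*} (δ : ℝ) (s : Finset ι) (f : ι → Shift n) :
    mass δ (∑ i ∈ s, f i) ≤ ∑ i ∈ s, mass δ (f i) := by
  classical
  induction s using Finset.induction_on with
  | empty => simp
  | insert i s hi ih =>
    rw [Finset.sum_insert hi, Finset.sum_insert hi]
    exact (mass_add_le _ _ _).trans (by gcongr)

lemma mass_mul_le (δ : ℝ) (r s : Shift n) : mass δ (r * s) ≤ mass δ r * mass δ s := by
  rw [AddMonoidAlgebra.mul_def, Finsupp.sum]
  refine (mass_sum_le _ _ _).trans ?_
  rw [mass, Finsupp.sum, Finset.sum_mul]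
  refine Finset.sum_le_sum fun v _ => ?_
  rw [Finsupp.sum]
  refine (mass_sum_le _ _ _).trans ?_
  rw [mass, Finsupp.sum, Finset.mul_sum]
  refine Finset.sum_le_sum fun w _ => le_of_eq ?_
  rw [mass_single, abs_mul]
  simp only [Pi.add_apply, NNReal.coe_add]
  rw [Finset.sum_add_distrib, mul_add, Real.exp_add]; ring

lemma mass_prod_le {ι : Type*} (δ : ℝ) (s : Finset ι) (f : ι → Shift n) :
    mass δ (∏ i ∈ s, f i) ≤ ∏ i ∈ s, mass δ (f i) := by
  classical
  induction s using Finset.induction_on with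
  | empty => simp
  | insert i s hi ih =>
    rw [Finset.prod_insert hi, Finset.prod_insert hi]
    exact (mass_mul_le _ _ _).trans (mul_le_mul_of_nonneg_left ih (mass_nonneg _ _))

lemma abs_act_le {r : Shift n} {F : (Fin n → ℝ) → ℝ} {u : Fin n → ℝ} {K : ℝ}
    (h : ∀ w ≤ u, |F w| ≤ K) : |act r F u| ≤ mass 0 r * K := by
  rw [act_apply, mass, Finsupp.sum, Finset.sum_mul]
  refine (Finset.abs_sum_le_sum_abs _ _).trans (Finset.sum_le_sum fun v _ => ?_)
  rw [abs_mul, zero_mul, Real.exp_zero, mul_one]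
  gcongr
  exact h _ fun j => by simp

/-- `F` vanishes outside the nonnegative orthant. -/
def OrthantSupported (F : (Fin n → ℝ) → ℝ) : Prop := ∀ u : Fin n → ℝ, ∀ j, u j < 0 → F u = 0

lemma OrthantSupported.act {F : (Fin n → ℝ) → ℝ} (hF : OrthantSupported F) (r : Shift n) :
    OrthantSupported (act r F) := fun u j hu => by
  rw [act_apply]
  refine Finset.sum_eq_zero fun v _ => ?_
  rw [hF _ j, mul_zero]
  simp only [Pi.sub_apply]
  linarith [(v j).2]

/-- Elements that act trivially, at all points `u ≤ L`, on functions supported in the orthant. -/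
noncomputable def negligible (n : ℕ) (L : ℝ) : Ideal (Shift n) where
  carrier := {r | ∀ F : (Fin n → ℝ) → ℝ, OrthantSupported F →
    ∀ u : Fin n → ℝ, (∀ j, u j ≤ L) → act r F u = 0}
  zero_mem' := fun F _ u _ => by simp
  add_mem' := fun {r s} hr hs F hF u hu => by
    rw [map_add, LinearMap.add_apply, Pi.add_apply, hr F hF u hu, hs F hF u hu, add_zero]
  smul_mem' := fun s r hr F hF u hu => by
    rw [smul_eq_mul, map_mul, Module.End.mul_apply, act_apply]
    refine Finset.sum_eq_zero fun v _ => ?_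
    rw [hr F hF, mul_zero]
    intro j
    simp only [Pi.sub_apply]
    linarith [hu j, (v j).2]

lemma single_mem_negligible {L : ℝ} {v : Fin n → ℝ≥0} {j : Fin n} (h : L < v j) (c : ℝ) :
    AddMonoidAlgebra.single v c ∈ negligible n L := fun F hF u hu => by
  rw [act_single, hF _ j, mul_zero]
  simp only [Pi.sub_apply]
  linarith [hu j]

lemma act_eq_of_mk_eq {L : ℝ} {r s : Shift n}
    (h : Ideal.Quotient.mk (negligible n L) r = Ideal.Quotient.mk (negligible n L) s)
    {F : (Fin n → ℝ) → ℝ} (hF : OrthantSupported F) {u : Fin n → ℝ} (hu : ∀ j, u j ≤ L) :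
    act r F u = act s F u := by
  have := (Ideal.Quotient.eq.1 h) F hF u hu
  rw [map_sub, LinearMap.sub_apply, Pi.sub_apply] at this
  linarith

/-- The monomial `(log a)·1_I`. -/
noncomputable def mon (n a : ℕ) (I : Finset (Fin n)) : Shift n :=
  AddMonoidAlgebra.single (fun j => if j ∈ I then (Real.log a).toNNReal else 0) 1

lemma mon_one (I : Finset (Fin n)) : mon n 1 I = 1 := by
  rw [mon, AddMonoidAlgebra.one_def]
  congr 1; ext j; simp

lemma mon_mul {a b : ℕ} (ha : a ≠ 0) (hb : b ≠ 0) (I : Finset (Fin n)) :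
    mon n (a * b) I = mon n a I * mon n b I := by
  rw [mon, mon, mon, AddMonoidAlgebra.single_mul_single, one_mul]
  congr 1
  ext j
  simp only [Pi.add_apply]
  split_ifs
  · push_cast
    rw [Real.log_mul (by exact_mod_cast ha) (by exact_mod_cast hb),
      Real.coe_toNNReal _ (Real.log_natCast_nonneg a),
      Real.coe_toNNReal _ (Real.log_natCast_nonneg b),
      Real.coe_toNNReal _ (add_nonneg (Real.log_natCast_nonneg a) (Real.log_natCast_nonneg b))]
  · simp

lemma mon_prod {T : Finset ℕ} (hT : ∀ p ∈ T, p ≠ 0) (I : Finset (Fin n)) :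
    ∏ p ∈ T, mon n p I = mon n (∏ p ∈ T, p) I := by
  classical
  induction T using Finset.induction_on with
  | empty => simp [mon_one]
  | insert p T hp ih =>
    have h1 : ∀ q ∈ T, q ≠ 0 := fun q hq => hT q (Finset.mem_insert_of_mem hq)
    rw [Finset.prod_insert hp, Finset.prod_insert hp, ih h1,
      mon_mul (hT p (Finset.mem_insert_self _ _)) (Finset.prod_ne_zero_iff.2 h1)]

lemma prod_mon_singleton (a : ℕ) (I : Finset (Fin n)) :
    ∏ j ∈ I, mon n a {j} = mon n a I := by
  classical
  induction I using Finset.induction_on with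
  | empty => rw [mon, Finset.prod_empty, AddMonoidAlgebra.one_def]; congr 1
  | insert i I hi ih =>
    rw [Finset.prod_insert hi, ih, mon, mon, mon, AddMonoidAlgebra.single_mul_single, one_mul]
    congr 1
    ext j
    simp only [Pi.add_apply, Finset.mem_singleton, Finset.mem_insert]
    by_cases h1 : j = i
    · subst h1; simp [hi]
    · simp [h1]

lemma mass_mon_le {δ : ℝ} (hδ : 0 ≤ δ) {a : ℕ} (ha : a ≠ 0) (I : Finset (Fin n)) :
    mass δ (mon n a I) ≤ (a : ℝ) ^ (δ * n) := by
  have ha' : (0 : ℝ) < a := by exact_mod_cast Nat.pos_of_ne_zero ha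
  rw [mon, mass_single, abs_one, one_mul, Real.rpow_def_of_pos ha']
  refine Real.exp_le_exp.2 ?_
  have : ∑ j : Fin n, (((if j ∈ I then (Real.log a).toNNReal else 0 : ℝ≥0)) : ℝ) ≤
      ∑ _j : Fin n, Real.log a := by
    refine Finset.sum_le_sum fun j _ => ?_
    split_ifs
    · rw [Real.coe_toNNReal _ (Real.log_natCast_nonneg a)]
    · simpa using Real.log_natCast_nonneg a
  rw [Finset.sum_const, Finset.card_univ, Fintype.card_fin, nsmul_eq_mul] at this
  calc _ ≤ δ * (n * Real.log a) := by gcongr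
    _ = _ := by ring

lemma mass_prod_one_sub_le {ι : Type*} (s : Finset ι) : ∃ C : ℝ, 0 ≤ C ∧
    ∀ (δ t : ℝ) (y : ι → Shift n), 0 ≤ t → t ≤ 1 → (∀ i ∈ s, mass δ (y i) ≤ t) →
      mass δ (∏ i ∈ s, (1 - y i) - 1 + ∑ i ∈ s, y i) ≤ C * t ^ 2 := by
  classical
  induction s using Finset.induction_on with
  | empty => exact ⟨0, le_rfl, fun δ t y _ _ _ => by simp⟩
  | insert i s hi ih =>
    obtain ⟨C, hC, h⟩ := ih
    refine ⟨s.card + 2 * C, by positivity, fun δ t y ht ht1 hy => ?_⟩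
    have hy' : ∀ j ∈ s, mass δ (y j) ≤ t := fun j hj => hy j (Finset.mem_insert_of_mem hj)
    have hyi := hy i (Finset.mem_insert_self _ _)
    have h1 := h δ t y ht ht1 hy'
    set R := ∏ i ∈ s, (1 - y i) - 1 + ∑ i ∈ s, y i with hR
    have hP : ∏ i ∈ s, (1 - y i) = R + 1 - ∑ i ∈ s, y i := by rw [hR]; ring
    have h2 : ∏ j ∈ insert i s, (1 - y j) - 1 + ∑ j ∈ insert i s, y j =
        y i * ∑ j ∈ s, y j + (R - y i * R) := by
      rw [Finset.prod_insert hi, Finset.sum_insert hi, hP]; ring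
    have h3 : mass δ (∑ j ∈ s, y j) ≤ s.card * t := by
      refine (mass_sum_le _ _ _).trans ((Finset.sum_le_sum hy').trans ?_)
      simp
    rw [h2]
    refine (mass_add_le _ _ _).trans ?_
    have h4 : mass δ (y i * ∑ j ∈ s, y j) ≤ t * (s.card * t) :=
      (mass_mul_le _ _ _).trans (mul_le_mul hyi h3 (mass_nonneg _ _) ht)
    have h5 : mass δ (R - y i * R) ≤ C * t ^ 2 + 1 * (C * t ^ 2) :=
      (mass_sub_le _ _ _).trans (add_le_add h1 ((mass_mul_le _ _ _).trans
        (mul_le_mul (hyi.trans ht1) h1 (mass_nonneg _ _) zero_le_one)))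
    nlinarith

lemma mass_one_add_mul_prod_le {ι : Type*} (s : Finset ι) : ∃ C : ℝ, 0 ≤ C ∧
    ∀ (δ t : ℝ) (y : ι → Shift n), 0 ≤ t → t ≤ 1 → (∀ i ∈ s, mass δ (y i) ≤ t) →
      mass δ ((1 + ∑ i ∈ s, y i) * ∏ i ∈ s, (1 - y i)) ≤ 1 + C * t ^ 2 := by
  obtain ⟨C, hC, h⟩ := mass_prod_one_sub_le (n := n) s
  obtain ⟨c, hcs⟩ : ∃ c : ℝ, c = s.card := ⟨_, rfl⟩
  have hc : 0 ≤ c := hcs ▸ Nat.cast_nonneg _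
  refine ⟨c ^ 2 + (1 + c) * C, by positivity, fun δ t y ht ht1 hy => ?_⟩
  have h1 := h δ t y ht ht1 hy
  set R := ∏ i ∈ s, (1 - y i) - 1 + ∑ i ∈ s, y i with hR
  have hP : ∏ i ∈ s, (1 - y i) = R + 1 - ∑ i ∈ s, y i := by rw [hR]; ring
  have h3 : mass δ (∑ j ∈ s, y j) ≤ c * t := by
    refine (mass_sum_le _ _ _).trans ((Finset.sum_le_sum hy).trans ?_)
    simp [hcs]
  have h2 : (1 + ∑ i ∈ s, y i) * ∏ i ∈ s, (1 - y i) =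
      (1 - (∑ i ∈ s, y i) * ∑ i ∈ s, y i) + (1 + ∑ i ∈ s, y i) * R := by
    rw [hP]; ring
  rw [h2]
  have h4 : mass δ ((∑ i ∈ s, y i) * ∑ i ∈ s, y i) ≤ (c * t) * (c * t) :=
    (mass_mul_le _ _ _).trans (mul_le_mul h3 h3 (mass_nonneg _ _) (by positivity))
  have h5 : mass δ (1 + ∑ i ∈ s, y i) ≤ 1 + c := by
    refine (mass_add_le _ _ _).trans ?_
    rw [mass_one]
    nlinarith
  have h6 : mass δ ((1 + ∑ i ∈ s, y i) * R) ≤ (1 + c) * (C * t ^ 2) :=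
    (mass_mul_le _ _ _).trans (mul_le_mul h5 h1 (mass_nonneg _ _) (by positivity))
  have h7 := mass_sub_le δ (1 : Shift n) ((∑ i ∈ s, y i) * ∑ i ∈ s, y i)
  rw [mass_one] at h7
  refine (mass_add_le _ _ _).trans ?_
  nlinarith

end

section

variable {n : ℕ}

/-- The nonempty subsets of `Fin n`. -/
def nonemptySubsets (n : ℕ) : Finset (Finset (Fin n)) := Finset.univ.erase ∅

lemma prod_one_sub_eq {R ι : Type*} [CommRing R] [DecidableEq ι] (s : Finset ι) (x : ι → R) :
    ∏ j ∈ s, (1 - x j) = ∑ I ∈ s.powerset, (-1) ^ I.card * ∏ j ∈ I, x j := by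
  have h : ∀ j ∈ s, 1 - x j = -x j + 1 := fun j _ => by ring
  rw [Finset.prod_congr rfl h, Finset.prod_add]
  refine Finset.sum_congr rfl fun I _ => ?_
  rw [Finset.prod_neg, Finset.prod_const_one, mul_one]

lemma prod_univ_one_sub_sub_one {R : Type*} [CommRing R] (x : Fin n → R) :
    ∏ j, (1 - x j) - 1 = ∑ I ∈ nonemptySubsets n, (-1) ^ I.card * ∏ j ∈ I, x j := by
  rw [prod_one_sub_eq, Finset.powerset_univ, nonemptySubsets,
    ← Finset.add_sum_erase _ _ (Finset.mem_univ (∅ : Finset (Fin n)))]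
  simp

/-- The completely multiplicative sign attached to a subset `I`. -/
noncomputable def subsetSign (I : Finset (Fin n)) (a : ℕ) : ℝ :=
  if Even I.card then 1 else ((ArithmeticFunction.liouville a : ℤ) : ℝ)

lemma subsetSign_one (I : Finset (Fin n)) : subsetSign I 1 = 1 := by
  simp [subsetSign, ArithmeticFunction.liouville_apply_one]

lemma subsetSign_mul (I : Finset (Fin n)) (a b : ℕ) :
    subsetSign I (a * b) = subsetSign I a * subsetSign I b := by
  unfold subsetSign
  split_ifs
  · simp
  · rw [ArithmeticFunction.liouville_apply_mul]; push_cast; rfl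

lemma subsetSign_prime (I : Finset (Fin n)) {p : ℕ} (hp : p.Prime) :
    subsetSign I p = (-1) ^ I.card := by
  unfold subsetSign
  split_ifs with h
  · rw [h.neg_one_pow]
  · rw [Nat.not_even_iff_odd] at h
    rw [h.neg_one_pow, ArithmeticFunction.liouville_apply hp.ne_zero,
      ArithmeticFunction.cardFactors_apply_prime hp]; simp

lemma abs_subsetSign_le (I : Finset (Fin n)) (a : ℕ) : |subsetSign I a| ≤ 1 := by
  unfold subsetSign
  split_ifs
  · simp
  · rcases eq_or_ne a 0 with rfl | h
    · simp
    · rw [ArithmeticFunction.liouville_apply h]; simp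

lemma subsetSign_prod (I : Finset (Fin n)) {T : Finset ℕ} (hT : ∀ p ∈ T, p.Prime) :
    subsetSign I (∏ p ∈ T, p) = ∏ _p ∈ T, (-1) ^ I.card := by
  induction T using Finset.induction_on with
  | empty => simp [subsetSign_one]
  | insert p T hp ih =>
    rw [Finset.prod_insert hp, Finset.prod_insert hp, subsetSign_mul,
      ih fun q hq => hT q (Finset.mem_insert_of_mem hq),
      subsetSign_prime I (hT p (Finset.mem_insert_self _ _))]

/-- The truncated Dirichlet series attached to `I`. -/
noncomputable def truncZeta (n N : ℕ) (I : Finset (Fin n)) : Shift n :=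
  ∑ a ∈ Finset.Icc 1 N, (subsetSign I a / a) • mon n a I

/-- The finite Euler product inverse to `truncZeta`. -/
noncomputable def eulerInv (n : ℕ) (P : Finset ℕ) (I : Finset (Fin n)) : Shift n :=
  ∏ p ∈ P, (1 - ((-1) ^ I.card / p : ℝ) • mon n p I)

lemma eulerInv_eq {P : Finset ℕ} (hP : ∀ p ∈ P, p.Prime) (I : Finset (Fin n)) :
    eulerInv n P I = ∑ T ∈ P.powerset, ((-1 : ℝ) ^ T.card * (subsetSign I (∏ p ∈ T, p) /
      ((∏ p ∈ T, p : ℕ) : ℝ))) • mon n (∏ p ∈ T, p) I := by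
  rw [eulerInv, prod_one_sub_eq]
  refine Finset.sum_congr rfl fun T hT => ?_
  have hT' : ∀ p ∈ T, p.Prime := fun p hp => hP p (Finset.mem_powerset.1 hT hp)
  rw [Finset.prod_smul, mon_prod (fun p hp => (hT' p hp).ne_zero), Finset.prod_div_distrib,
    ← subsetSign_prod I hT', Nat.cast_prod, mul_smul]
  rw [show ((-1 : Shift n) ^ T.card) = algebraMap ℝ (Shift n) ((-1) ^ T.card) by
      rw [map_pow, map_neg, map_one],
    ← Algebra.smul_def]

lemma sum_neg_one_pow_prod_dvd {P : Finset ℕ} (hP : ∀ p ∈ P, p.Prime) {m : ℕ} (hm : m ≠ 0)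
    (hPm : m.primeFactors ⊆ P) :
    ∑ T ∈ P.powerset with (∏ p ∈ T, p) ∣ m, (-1 : ℝ) ^ T.card = if m = 1 then 1 else 0 := by
  have h1 : (P.powerset.filter fun T => (∏ p ∈ T, p) ∣ m) = m.primeFactors.powerset := by
    ext T
    simp only [Finset.mem_filter, Finset.mem_powerset]
    constructor
    · rintro ⟨h, hd⟩ p hp
      exact Nat.mem_primeFactors.2 ⟨hP p (h hp), (Finset.dvd_prod_of_mem _ hp).trans hd, hm⟩
    · intro h
      refine ⟨h.trans hPm, ?_⟩
      exact Finset.prod_primes_dvd m (fun p hp => (Nat.prime_of_mem_primeFactors (h hp)).prime)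
        fun p hp => Nat.dvd_of_mem_primeFactors (h hp)
  rw [h1]
  have h2 := Finset.sum_powerset_neg_one_pow_card (x := m.primeFactors)
  have h3 : (∑ T ∈ m.primeFactors.powerset, (-1 : ℝ) ^ T.card) =
      ((∑ T ∈ m.primeFactors.powerset, (-1 : ℤ) ^ T.card : ℤ) : ℝ) := by push_cast; rfl
  rw [h3, h2]
  have h4 : m.primeFactors = ∅ ↔ m = 1 := by
    rw [Nat.primeFactors_eq_empty]; omega
  simp only [h4]; split_ifs <;> simp

lemma mk_truncZeta_mul_eulerInv {L : ℝ} (hL : 0 ≤ L) {N : ℕ} (hN : L < Real.log (N + 1 : ℕ))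
    {P : Finset ℕ} (hP : ∀ p ∈ P, p.Prime) (hPN : ∀ p : ℕ, p.Prime → p ≤ N → p ∈ P)
    {I : Finset (Fin n)} (hI : I.Nonempty) :
    Ideal.Quotient.mk (negligible n L) (truncZeta n N I * eulerInv n P I) = 1 := by
  have hN1 : 1 ≤ N := by
    by_contra! h
    have : N = 0 := by omega
    subst this
    simp at hN; linarith
  have hmon : ∀ m : ℕ, N < m → Ideal.Quotient.mk (negligible n L) (mon n m I) = 0 := by
    intro m hm
    obtain ⟨j, hj⟩ := hI
    refine Ideal.Quotient.eq_zero_iff_mem.2 (single_mem_negligible (j := j) ?_ 1)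
    simp only [hj, if_true]
    rw [Real.coe_toNNReal _ (Real.log_natCast_nonneg m)]
    refine hN.trans_le (Real.log_le_log (by positivity) ?_)
    exact_mod_cast hm
  have hpos : ∀ T ∈ P.powerset, 0 < ∏ p ∈ T, p := fun T hT =>
    Finset.prod_pos fun p hp => (hP p (Finset.mem_powerset.1 hT hp)).pos
  have h1 : truncZeta n N I * eulerInv n P I =
      ∑ x ∈ (Finset.Icc 1 N) ×ˢ P.powerset, ((-1 : ℝ) ^ x.2.card *
        (subsetSign I (x.1 * ∏ p ∈ x.2, p) / ((x.1 * ∏ p ∈ x.2, p : ℕ) : ℝ))) •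
          mon n (x.1 * ∏ p ∈ x.2, p) I := by
    rw [truncZeta, eulerInv_eq hP, Finset.sum_mul_sum, ← Finset.sum_product']
    refine Finset.sum_congr rfl fun x hx => ?_
    rw [Finset.mem_product, Finset.mem_Icc] at hx
    rw [mon_mul (by omega) (hpos _ hx.2).ne', smul_mul_smul_comm, subsetSign_mul]
    congr 1
    push_cast
    ring
  have h2 : ∀ x ∈ (Finset.Icc 1 N) ×ˢ P.powerset, Ideal.Quotient.mk (negligible n L)
      (((-1 : ℝ) ^ x.2.card *
        (subsetSign I (x.1 * ∏ p ∈ x.2, p) / ((x.1 * ∏ p ∈ x.2, p : ℕ) : ℝ))) •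
          mon n (x.1 * ∏ p ∈ x.2, p) I) =
      ∑ m ∈ Finset.Icc 1 N, Ideal.Quotient.mk (negligible n L)
        ((if x.1 * ∏ p ∈ x.2, p = m then (-1 : ℝ) ^ x.2.card * (subsetSign I m / m) else 0) •
          mon n m I) := by
    intro x hx
    rw [Finset.mem_product, Finset.mem_Icc] at hx
    have hx0 : 0 < x.1 * ∏ p ∈ x.2, p := Nat.mul_pos hx.1.1 (hpos _ hx.2)
    rcases le_or_gt (x.1 * ∏ p ∈ x.2, p) N with h | h
    · rw [Finset.sum_eq_single (x.1 * ∏ p ∈ x.2, p)]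
      · rw [if_pos rfl]
      · intro m _ hm; rw [if_neg hm.symm]; simp
      · intro hm; exact absurd (Finset.mem_Icc.2 ⟨hx0, h⟩) hm
    · rw [Finset.sum_eq_zero, Algebra.smul_def, map_mul, hmon _ h, mul_zero]
      intro m hm
      rw [if_neg, zero_smul, map_zero]
      rw [Finset.mem_Icc] at hm
      omega
  rw [h1, map_sum, Finset.sum_congr rfl h2, Finset.sum_comm]
  simp_rw [← map_sum, ← Finset.sum_smul]
  have h3 : ∀ m ∈ Finset.Icc 1 N, ∑ x ∈ (Finset.Icc 1 N) ×ˢ P.powerset,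
      (if x.1 * ∏ p ∈ x.2, p = m then (-1 : ℝ) ^ x.2.card * (subsetSign I m / m) else 0) =
      if m = 1 then 1 else 0 := by
    intro m hm
    rw [Finset.mem_Icc] at hm
    rw [Finset.sum_product_right]
    have h4 : ∀ T ∈ P.powerset, ∑ a ∈ Finset.Icc 1 N, (if a * ∏ p ∈ T, p = m then
        (-1 : ℝ) ^ T.card * (subsetSign I m / m) else 0) =
        if (∏ p ∈ T, p) ∣ m then (-1 : ℝ) ^ T.card * (subsetSign I m / m) else 0 := by
      intro T hT
      split_ifs with hd
      · obtain ⟨a, ha⟩ := hd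
        have hpT := hpos T hT
        have ha0 : 0 < a := by
          rcases Nat.eq_zero_or_pos a with rfl | h
          · simp at ha; omega
          · exact h
        rw [Finset.sum_eq_single a]
        · rw [if_pos (by rw [ha, mul_comm])]
        · intro b _ hb
          rw [if_neg]
          intro hbm
          apply hb
          rw [ha, mul_comm] at hbm
          exact Nat.eq_of_mul_eq_mul_left hpT hbm
        · intro h
          exfalso; apply h
          rw [Finset.mem_Icc]
          refine ⟨ha0, le_trans ?_ hm.2⟩
          rw [ha]; exact Nat.le_mul_of_pos_left a hpT
      · refine Finset.sum_eq_zero fun a _ => ?_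
        rw [if_neg]
        rintro rfl
        exact hd (Dvd.intro_left a rfl)
    rw [Finset.sum_congr rfl h4, ← Finset.sum_filter, ← Finset.sum_mul,
      sum_neg_one_pow_prod_dvd hP (by omega)]
    · split_ifs with h
      · subst h; simp [subsetSign_one]
      · simp
    · intro p hp
      exact hPN p (Nat.prime_of_mem_primeFactors hp)
        ((Nat.le_of_dvd hm.1 (Nat.dvd_of_mem_primeFactors hp)).trans hm.2)
  have h5 : ∑ m ∈ Finset.Icc 1 N, (∑ x ∈ (Finset.Icc 1 N) ×ˢ P.powerset,
      (if x.1 * ∏ p ∈ x.2, p = m then (-1 : ℝ) ^ x.2.card * (subsetSign I m / m) else 0)) •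
        mon n m I = 1 := by
    rw [Finset.sum_congr rfl fun m hm => by rw [h3 m hm], Finset.sum_eq_single 1]
    · simp [mon_one]
    · intro m _ hm; simp [hm]
    · intro h; exact absurd (Finset.mem_Icc.2 ⟨le_rfl, hN1⟩) h
  rw [h5, map_one]

end

section

variable {n : ℕ}

/-- The truncated power on `ℝⁿ`. -/
noncomputable def posPowProd (A n : ℕ) (u : Fin n → ℝ) : ℝ := ∏ j, posPow A (u j)

lemma posPow_nonneg (A : ℕ) (u : ℝ) : 0 ≤ posPow A u := by
  unfold posPow; split_ifs with h
  · exact pow_nonneg h A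
  · exact le_rfl

lemma posPow_mono (A : ℕ) : Monotone (posPow A) := by
  intro u v h
  unfold posPow
  split_ifs with h1 h2 h2
  · exact pow_le_pow_left₀ h1 h A
  · exact absurd (h1.trans h) h2
  · exact pow_nonneg h2 A
  · exact le_rfl

lemma posPowProd_nonneg (A n : ℕ) (u : Fin n → ℝ) : 0 ≤ posPowProd A n u :=
  Finset.prod_nonneg fun _ _ => posPow_nonneg _ _

lemma posPowProd_mono (A n : ℕ) : Monotone (posPowProd A n) := fun _ _ h =>
  Finset.prod_le_prod (fun _ _ => posPow_nonneg _ _) fun j _ => posPow_mono A (h j)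

lemma orthantSupported_posPowProd (A n : ℕ) : OrthantSupported (posPowProd A n) :=
  fun u j hu => Finset.prod_eq_zero (Finset.mem_univ j) (by rw [posPow, if_neg (not_le.2 hu)])

lemma posPowProd_le {A : ℕ} {u : Fin n → ℝ} {L : ℝ} (hL : 0 ≤ L) (hu : ∀ j, u j ≤ L) :
    posPowProd A n u ≤ L ^ (n * A) := by
  refine (posPowProd_mono A n (b := fun _ => L) hu).trans (le_of_eq ?_)
  simp [posPowProd, posPow, hL, ← pow_mul, mul_comm]

/-- The element `ε_I x_p^I / p`. -/
noncomputable def localTerm (n p : ℕ) (I : Finset (Fin n)) : Shift n :=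
  ((-1) ^ I.card / p : ℝ) • mon n p I

lemma one_add_sum_localTerm (p : ℕ) :
    1 + ∑ I ∈ nonemptySubsets n, localTerm n p I =
      1 + (1 / p : ℝ) • (∏ j, (1 - mon n p {j}) - 1) := by
  rw [prod_univ_one_sub_sub_one, Finset.smul_sum]
  congr 1
  refine Finset.sum_congr rfl fun I _ => ?_
  rw [prod_mon_singleton, localTerm,
    show ((-1 : Shift n) ^ I.card) = algebraMap ℝ (Shift n) ((-1) ^ I.card) by
      rw [map_pow, map_neg, map_one], ← Algebra.smul_def, smul_smul]
  congr 1; ring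

lemma act_prod_prod {A : ℕ} {S : Finset ℕ} (hS : ∀ p ∈ S, p.Prime) (u : ℝ) :
    act (∏ p ∈ S, ∏ j, (1 - mon n p {j})) (posPowProd A n) (fun _ => u) =
      sieveSum A S u ^ n := by
  rw [Finset.prod_comm]
  have h1 : ∀ j : Fin n, ∏ p ∈ S, (1 - mon n p {j}) = ∑ T ∈ S.powerset,
      (AddMonoidAlgebra.single (fun i => if i = j then (Real.log ((∏ p ∈ T, p : ℕ) : ℝ)).toNNReal else 0)
        ((-1 : ℝ) ^ T.card) : Shift n) := by
    intro j
    rw [prod_one_sub_eq]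
    refine Finset.sum_congr rfl fun T hT => ?_
    rw [mon_prod fun p hp => (hS p (Finset.mem_powerset.1 hT hp)).ne_zero,
      show ((-1 : Shift n) ^ T.card) = algebraMap ℝ (Shift n) ((-1) ^ T.card) by
        rw [map_pow, map_neg, map_one], ← Algebra.smul_def, mon, AddMonoidAlgebra.smul_single]
    simp
  have h2 : ∀ (s : Finset (Fin n)) (v : Fin n → ℝ≥0) (c : Fin n → ℝ),
      ∏ j ∈ s, (AddMonoidAlgebra.single (fun i => if i = j then v j else 0) (c j) : Shift n) =
        AddMonoidAlgebra.single (fun i => if i ∈ s then v i else 0) (∏ j ∈ s, c j) := by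
    intro s v c
    induction s using Finset.induction_on with
    | empty => rw [Finset.prod_empty, Finset.prod_empty, AddMonoidAlgebra.one_def]; congr 1
    | insert i s hi ih =>
      rw [Finset.prod_insert hi, Finset.prod_insert hi, ih, AddMonoidAlgebra.single_mul_single]
      congr 1
      ext j
      simp only [Pi.add_apply, Finset.mem_insert]
      by_cases h1 : j = i
      · subst h1; simp [hi]
      · simp [h1]
  rw [Finset.prod_congr rfl fun j _ => h1 j, Finset.prod_univ_sum, map_sum, LinearMap.sum_apply,
    Finset.sum_apply]
  rw [show sieveSum A S u ^ n = ∏ _j : Fin n, sieveSum A S u by simp]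
  simp only [sieveSum]
  rw [Finset.prod_univ_sum]
  refine Finset.sum_congr rfl fun T hT => ?_
  rw [h2 Finset.univ (fun j => (Real.log ((∏ p ∈ T j, p : ℕ) : ℝ)).toNNReal) fun j => (-1) ^ (T j).card,
    act_single, Finset.prod_mul_distrib, posPowProd]
  congr 1
  refine Finset.prod_congr rfl fun j _ => ?_
  simp only [Finset.mem_univ, if_true, Pi.sub_apply]
  rw [Real.coe_toNNReal _ (Real.log_natCast_nonneg _), Nat.cast_prod, Real.log_prod]
  intro p hp
  exact_mod_cast (hS p (Finset.mem_powerset.1 (Fintype.mem_piFinset.1 hT j) hp)).ne_zero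

lemma sieveMoment_eq_act {A : ℕ} {P : Finset ℕ} (hP : ∀ p ∈ P, p.Prime) (u : ℝ) :
    sieveMoment A n P u = act (∏ p ∈ P, (1 + ∑ I ∈ nonemptySubsets n, localTerm n p I))
      (posPowProd A n) (fun _ => u) := by
  rw [Finset.prod_congr rfl fun p _ => one_add_sum_localTerm p, ← sum_wt_smul_prod, map_sum,
    LinearMap.sum_apply, Finset.sum_apply, sieveMoment]
  refine Finset.sum_congr rfl fun S hS => ?_
  rw [map_smul, LinearMap.smul_apply, Pi.smul_apply, smul_eq_mul,
    act_prod_prod fun p hp => hP p (Finset.mem_powerset.1 hS hp)]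

/-- The correction factor `∏_p (1 + ∑_I y_I) ∏_I (1 - y_I)`. -/
noncomputable def correction (n : ℕ) (P : Finset ℕ) : Shift n :=
  ∏ p ∈ P, ((1 + ∑ I ∈ nonemptySubsets n, localTerm n p I) *
    ∏ I ∈ nonemptySubsets n, (1 - localTerm n p I))

lemma sieveMoment_eq_act_correction {A : ℕ} {L : ℝ} (hL : 0 ≤ L) {N : ℕ}
    (hN : L < Real.log (N + 1 : ℕ)) {P : Finset ℕ} (hP : ∀ p ∈ P, p.Prime)
    (hPN : ∀ p : ℕ, p.Prime → p ≤ N → p ∈ P) {u : ℝ} (hu : u ≤ L) :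
    sieveMoment A n P u = act (correction n P) (act (∏ I ∈ nonemptySubsets n, truncZeta n N I)
      (posPowProd A n)) (fun _ => u) := by
  rw [sieveMoment_eq_act hP, ← Module.End.mul_apply, ← map_mul]
  refine act_eq_of_mk_eq (L := L) ?_ (orthantSupported_posPowProd A n) fun _ => hu
  have h1 : correction n P * ∏ I ∈ nonemptySubsets n, truncZeta n N I =
      (∏ p ∈ P, (1 + ∑ I ∈ nonemptySubsets n, localTerm n p I)) *
        ∏ I ∈ nonemptySubsets n, (truncZeta n N I * eulerInv n P I) := by
    rw [correction, Finset.prod_mul_distrib, Finset.prod_comm (s := P), Finset.prod_mul_distrib]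
    simp only [eulerInv, localTerm]
    ring
  rw [h1, map_mul, map_prod (Ideal.Quotient.mk (negligible n L)) (fun I => truncZeta n N I * eulerInv n P I),
    Finset.prod_eq_one (s := nonemptySubsets n) (f := fun I =>
      Ideal.Quotient.mk (negligible n L) (truncZeta n N I * eulerInv n P I)), mul_one]
  intro I hI
  refine mk_truncZeta_mul_eulerInv hL hN hP hPN (Finset.nonempty_iff_ne_empty.2 ?_)
  exact (Finset.mem_erase.1 hI).1

lemma exists_mass_correction_le (n : ℕ) : ∃ δ C : ℝ, 0 < δ ∧ 0 < C ∧
    ∀ P : Finset ℕ, (∀ p ∈ P, p.Prime) → mass δ (correction n P) ≤ C := by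
  obtain ⟨C, hC, h⟩ := mass_one_add_mul_prod_le (n := n) (nonemptySubsets n)
  set δ : ℝ := 1 / (4 * (n + 1)) with hδ
  have hδ0 : 0 < δ := by positivity
  have hδn : δ * n ≤ 1 / 4 := by
    rw [hδ, div_mul_eq_mul_div, div_le_div_iff₀ (by positivity) (by positivity)]; linarith
  have hs : Summable fun p : ℕ => 1 / (p : ℝ) ^ (3 / 2 : ℝ) :=
    Real.summable_one_div_nat_rpow.2 (by norm_num)
  refine ⟨δ, Real.exp (C * ∑' p : ℕ, 1 / (p : ℝ) ^ (3 / 2 : ℝ)), hδ0, Real.exp_pos _,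
    fun P hP => ?_⟩
  have hp1 : ∀ p ∈ P, mass δ ((1 + ∑ I ∈ nonemptySubsets n, localTerm n p I) *
      ∏ I ∈ nonemptySubsets n, (1 - localTerm n p I)) ≤
        Real.exp (C * (1 / (p : ℝ) ^ (3 / 2 : ℝ))) := by
    intro p hp
    have hp0 : (1 : ℝ) ≤ p := by exact_mod_cast (hP p hp).one_le
    have hp0' : (0 : ℝ) < p := by linarith
    set t : ℝ := (p : ℝ) ^ (-(3 / 4) : ℝ) with ht
    have ht0 : 0 ≤ t := by positivity
    have ht1 : t ≤ 1 := Real.rpow_le_one_of_one_le_of_nonpos hp0 (by norm_num)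
    have h1 := h δ t (localTerm n p) ht0 ht1 fun I _ => by
      rw [localTerm, mass_smul, abs_div, abs_pow, abs_neg, abs_one, one_pow, Nat.abs_cast]
      calc 1 / (p : ℝ) * mass δ (mon n p I) ≤ 1 / (p : ℝ) * (p : ℝ) ^ (δ * n) := by
            gcongr; exact mass_mon_le hδ0.le (hP p hp).ne_zero I
        _ ≤ (p : ℝ) ^ (-1 : ℝ) * (p : ℝ) ^ (1 / 4 : ℝ) := by
            rw [Real.rpow_neg_one, one_div]; gcongr
        _ = t := by rw [← Real.rpow_add hp0', ht]; norm_num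
    have h2 : t ^ 2 = 1 / (p : ℝ) ^ (3 / 2 : ℝ) := by
      rw [ht, ← Real.rpow_natCast, ← Real.rpow_mul hp0'.le, one_div, ← Real.rpow_neg hp0'.le]
      norm_num
    rw [h2] at h1
    refine h1.trans ?_
    rw [add_comm]
    exact Real.add_one_le_exp _
  refine (mass_prod_le _ _ _).trans ((Finset.prod_le_prod (fun _ _ => mass_nonneg _ _) hp1).trans ?_)
  rw [← Real.exp_sum, ← Finset.mul_sum]
  gcongr
  exact hs.sum_le_tsum _ fun p _ => by positivity

end

/-- Piecewise polynomial functions: the algebra generated by linear forms and indicators of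
half-spaces through the origin. -/
noncomputable def piecewisePoly (E : Type*) [AddCommGroup E] [Module ℝ E] : Subalgebra ℝ (E → ℝ) :=
  Algebra.adjoin ℝ (Set.range (fun ℓ : E →ₗ[ℝ] ℝ => (fun u => ℓ u : E → ℝ)) ∪
    Set.range (fun ℓ : E →ₗ[ℝ] ℝ => fun u => if 0 ≤ ℓ u then 1 else 0))

section PiecewisePoly

variable {E E' : Type*} [AddCommGroup E] [Module ℝ E] [AddCommGroup E'] [Module ℝ E']

lemma linear_mem_piecewisePoly (ℓ : E →ₗ[ℝ] ℝ) : (fun u => ℓ u) ∈ piecewisePoly E :=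
  Algebra.subset_adjoin (Or.inl ⟨ℓ, rfl⟩)

lemma ind_mem_piecewisePoly (ℓ : E →ₗ[ℝ] ℝ) :
    (fun u => if 0 ≤ ℓ u then (1 : ℝ) else 0) ∈ piecewisePoly E :=
  Algebra.subset_adjoin (Or.inr ⟨ℓ, rfl⟩)

lemma const_mem_piecewisePoly (c : ℝ) : (fun _ => c : E → ℝ) ∈ piecewisePoly E :=
  (piecewisePoly E).algebraMap_mem c

lemma comp_mem_piecewisePoly {T : E' → ℝ} (hT : T ∈ piecewisePoly E') (φ : E →ₗ[ℝ] E') :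
    (fun u => T (φ u)) ∈ piecewisePoly E := by
  induction hT using Algebra.adjoin_induction with
  | mem f hf =>
    rcases hf with ⟨ℓ, rfl⟩ | ⟨ℓ, rfl⟩
    · exact linear_mem_piecewisePoly (ℓ.comp φ)
    · exact ind_mem_piecewisePoly (ℓ.comp φ)
  | algebraMap c => exact const_mem_piecewisePoly c
  | add f g _ _ hf hg => exact add_mem hf hg
  | mul f g _ _ hf hg => exact mul_mem hf hg

/-- The functions `c(u) y^m 1[y ≥ α(u)]`. -/
def fiberTerms (E : Type*) [AddCommGroup E] [Module ℝ E] : Set (E → ℝ → ℝ) :=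
  {g | ∃ c ∈ piecewisePoly E, ∃ (m : ℕ) (α : E →ₗ[ℝ] ℝ),
    g = fun u y => c u * y ^ m * if α u ≤ y then 1 else 0}

lemma mul_mem_span_fiberTerms {g h : E → ℝ → ℝ} (hg : g ∈ Submodule.span ℝ (fiberTerms E))
    (hh : h ∈ Submodule.span ℝ (fiberTerms E)) : g * h ∈ Submodule.span ℝ (fiberTerms E) := by
  have h1 := Submodule.mul_mem_mul hg hh
  rw [Submodule.span_mul_span] at h1
  refine Submodule.span_le.2 ?_ h1
  rintro _ ⟨_, ⟨c, hc, m, α, rfl⟩, _, ⟨d, hd, k, β, rfl⟩, rfl⟩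
  have hcd := mul_mem hc hd
  have hi := ind_mem_piecewisePoly (α - β)
  have e : ((fun u y => c u * y ^ m * if α u ≤ y then (1 : ℝ) else 0) *
      (fun u y => d u * y ^ k * if β u ≤ y then (1 : ℝ) else 0) : E → ℝ → ℝ) =
      (fun u y => ((c * d) * (fun u => if 0 ≤ (α - β) u then (1 : ℝ) else 0)) u * y ^ (m + k) *
        if α u ≤ y then 1 else 0) +
      (fun u y => ((c * d) * (1 - fun u => if 0 ≤ (α - β) u then (1 : ℝ) else 0)) u * y ^ (m + k) *
        if β u ≤ y then 1 else 0) := by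
    funext u y
    simp only [Pi.mul_apply, Pi.add_apply, Pi.sub_apply, Pi.one_apply, LinearMap.sub_apply,
      sub_nonneg, pow_add]
    split_ifs <;> first | (exfalso; linarith) | ring1
  simp only [SetLike.mem_coe]
  have e' := e
  rw [show (HMul.hMul (fun u y => c u * y ^ m * if α u ≤ y then (1 : ℝ) else 0)
      (fun u y => d u * y ^ k * if β u ≤ y then (1 : ℝ) else 0) : E → ℝ → ℝ) = _ from e]
  refine add_mem (Submodule.subset_span ⟨_, mul_mem hcd hi, m + k, α, rfl⟩)
    (Submodule.subset_span ⟨_, mul_mem hcd (sub_mem (one_mem _) hi), m + k, β, rfl⟩)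

lemma coeff_mem_span_fiberTerms {c : E → ℝ} (hc : c ∈ piecewisePoly E) (m : ℕ) (α : E →ₗ[ℝ] ℝ) :
    (fun u y => c u * y ^ m * if α u ≤ y then 1 else 0) ∈ Submodule.span ℝ (fiberTerms E) :=
  Submodule.subset_span ⟨c, hc, m, α, rfl⟩

lemma exists_fiber_rep {f : E × ℝ → ℝ} (hf : f ∈ piecewisePoly (E × ℝ)) :
    ∃ g ∈ Submodule.span ℝ (fiberTerms E), ∀ u, ∀ᵐ y : ℝ, 0 < y → f (u, y) = g u y := by
  induction hf using Algebra.adjoin_induction with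
  | mem f hf =>
    rcases hf with ⟨ℓ, rfl⟩ | ⟨ℓ, rfl⟩
    all_goals
      set ℓ₁ : E →ₗ[ℝ] ℝ := ℓ.comp (LinearMap.inl ℝ E ℝ) with hℓ₁
      set a : ℝ := ℓ (0, 1) with ha
      have hℓ : ∀ u y, ℓ (u, y) = ℓ₁ u + a * y := by
        intro u y
        have : ((u, y) : E × ℝ) = (u, 0) + y • (0, 1) := by simp
        rw [this, map_add, map_smul, smul_eq_mul, mul_comm]; rfl
    · refine ⟨_, add_mem (coeff_mem_span_fiberTerms (linear_mem_piecewisePoly ℓ₁) 0 0)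
        (coeff_mem_span_fiberTerms (const_mem_piecewisePoly a) 1 0), fun u => ?_⟩
      refine Filter.Eventually.of_forall fun y hy => ?_
      simp [hy.le, hℓ]
    · rcases lt_trichotomy a 0 with h | h | h
      · refine ⟨_, sub_mem (coeff_mem_span_fiberTerms (const_mem_piecewisePoly 1) 0 0)
          (coeff_mem_span_fiberTerms (const_mem_piecewisePoly 1) 0 ((-a)⁻¹ • ℓ₁)), fun u => ?_⟩
        have hne : ∀ᵐ y : ℝ, y ≠ (-a)⁻¹ * ℓ₁ u := by
          have := (Set.finite_singleton ((-a)⁻¹ * ℓ₁ u)).measure_zero (volume : Measure ℝ)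
          exact measure_eq_zero_iff_ae_notMem.1 this
        filter_upwards [hne] with y hy hy0
        have h2 : (0 ≤ ℓ (u, y)) ↔ ¬ (-a)⁻¹ * ℓ₁ u ≤ y := by
          rw [hℓ, inv_mul_le_iff₀ (by linarith), not_le]
          have hy' : -a * y ≠ ℓ₁ u := fun h4 => hy (by
            rw [← h4, inv_mul_cancel_left₀ (neg_pos.2 h).ne'])
          constructor
          · intro h3
            exact lt_of_le_of_ne (by linarith) hy'
          · intro h3; linarith
        simp only [h2, Pi.sub_apply, LinearMap.smul_apply, smul_eq_mul, LinearMap.zero_apply, hy0.le]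
        by_cases h3 : (-a)⁻¹ * ℓ₁ u ≤ y
        · rw [if_neg (not_not.2 h3), if_pos trivial, if_pos h3]; ring
        · rw [if_pos h3, if_pos trivial, if_neg h3]; ring
      · refine ⟨_, coeff_mem_span_fiberTerms (ind_mem_piecewisePoly ℓ₁) 0 0, fun u => ?_⟩
        refine Filter.Eventually.of_forall fun y hy => ?_
        simp [hy.le, hℓ, h]
      · refine ⟨_, coeff_mem_span_fiberTerms (const_mem_piecewisePoly 1) 0 ((-a⁻¹) • ℓ₁),
          fun u => ?_⟩
        refine Filter.Eventually.of_forall fun y hy => ?_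
        have h2 : (0 ≤ ℓ (u, y)) ↔ (-a⁻¹) * ℓ₁ u ≤ y := by
          rw [hℓ, neg_mul, ← mul_neg, inv_mul_le_iff₀ h]
          constructor <;> intro h3 <;> linarith
        simp only [h2, LinearMap.smul_apply, smul_eq_mul]
        simp
  | algebraMap c =>
    refine ⟨_, coeff_mem_span_fiberTerms (const_mem_piecewisePoly c) 0 0, fun u => ?_⟩
    exact Filter.Eventually.of_forall fun y hy => by simp [hy.le]
  | add f g _ _ hf hg =>
    obtain ⟨f', hf', h1⟩ := hf
    obtain ⟨g', hg', h2⟩ := hg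
    refine ⟨_, add_mem hf' hg', fun u => ?_⟩
    filter_upwards [h1 u, h2 u] with y hy hy' h0
    simp [hy h0, hy' h0]
  | mul f g _ _ hf hg =>
    obtain ⟨f', hf', h1⟩ := hf
    obtain ⟨g', hg', h2⟩ := hg
    refine ⟨_, mul_mem_span_fiberTerms hf' hg', fun u => ?_⟩
    filter_upwards [h1 u, h2 u] with y hy hy' h0
    simp [hy h0, hy' h0]

lemma intervalIntegrable_fiberTerm (m : ℕ) (α a b : ℝ) :
    IntervalIntegrable (fun y : ℝ => y ^ m * if α ≤ y then 1 else 0) volume a b := by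
  have h := ((continuous_pow m : Continuous fun y : ℝ => y ^ m).intervalIntegrable
    (μ := volume) a b)
  rw [intervalIntegrable_iff] at h ⊢
  refine (h.indicator (measurableSet_Ici (a := α))).congr ?_
  refine Filter.Eventually.of_forall fun y => ?_
  simp only [Set.indicator, Set.mem_Ici]
  split_ifs <;> simp

lemma integral_fiberTerm (m : ℕ) (α : ℝ) {t : ℝ} (ht : 0 ≤ t) :
    ∫ y in (0 : ℝ)..t, y ^ m * (if α ≤ y then 1 else 0) =
      if α ≤ t then (t ^ (m + 1) - ((if 0 ≤ α then 1 else 0) * α) ^ (m + 1)) / (m + 1) else 0 := by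
  have hne : ∀ᵐ y : ℝ, y ≠ α := by
    have := (Set.finite_singleton α).measure_zero (volume : Measure ℝ)
    exact measure_eq_zero_iff_ae_notMem.1 this
  have hz : ∀ s, 0 ≤ s → s ≤ α → ∫ y in (0 : ℝ)..s, y ^ m * (if α ≤ y then (1 : ℝ) else 0) = 0 := by
    intro s hs hsα
    rw [intervalIntegral.integral_congr_ae (g := fun _ => (0 : ℝ)), intervalIntegral.integral_zero]
    filter_upwards [hne] with y hy hy'
    rw [Set.uIoc_of_le hs] at hy'
    rw [if_neg, mul_zero]
    intro h
    exact hy (le_antisymm (hy'.2.trans hsα) h)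
  have hp : ∀ s, α ≤ s → 0 ≤ s → s ≤ t → ∫ y in s..t, y ^ m * (if α ≤ y then (1 : ℝ) else 0) =
      (t ^ (m + 1) - s ^ (m + 1)) / (m + 1) := by
    intro s hs _ hst
    rw [← integral_pow]
    refine intervalIntegral.integral_congr fun y hy => ?_
    rw [Set.uIcc_of_le hst] at hy
    simp [hs.trans hy.1]
  split_ifs with h1 h2
  · rw [← intervalIntegral.integral_add_adjacent_intervals
      (intervalIntegrable_fiberTerm m α 0 α) (intervalIntegrable_fiberTerm m α α t),
      hz α h2 le_rfl, hp α le_rfl h2 h1]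
    simp
  · rw [hp 0 (not_le.1 h2).le le_rfl ht]; simp
  · exact hz t ht (not_le.1 h1).le

lemma span_fiberTerms_integral {g : E → ℝ → ℝ} (hg : g ∈ Submodule.span ℝ (fiberTerms E))
    (ℓ : E →ₗ[ℝ] ℝ) : (∀ u a b, IntervalIntegrable (g u) volume a b) ∧
      (fun u => if 0 ≤ ℓ u then ∫ y in (0 : ℝ)..ℓ u, g u y else 0) ∈ piecewisePoly E := by
  induction hg using Submodule.span_induction with
  | mem g hg =>
    obtain ⟨c, hc, m, α, rfl⟩ := hg
    refine ⟨fun u a b => ?_, ?_⟩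
    · simp_rw [mul_assoc]
      exact (intervalIntegrable_fiberTerm m (α u) a b).const_mul _
    · have h1 := mul_mem (mul_mem (mul_mem hc (ind_mem_piecewisePoly ℓ))
        (ind_mem_piecewisePoly (ℓ - α))) (mul_mem (sub_mem
          (pow_mem (linear_mem_piecewisePoly ℓ) (m + 1))
          (pow_mem (mul_mem (ind_mem_piecewisePoly α) (linear_mem_piecewisePoly α)) (m + 1)))
          (const_mem_piecewisePoly (E := E) ((m : ℝ) + 1)⁻¹))
      refine (congrArg (· ∈ piecewisePoly E) ?_).mp h1
      funext u
      simp only [Pi.mul_apply, Pi.sub_apply, Pi.pow_apply, LinearMap.sub_apply, sub_nonneg]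
      by_cases h0 : 0 ≤ ℓ u
      · simp only [h0, if_true]
        simp_rw [mul_assoc]
        rw [intervalIntegral.integral_const_mul, integral_fiberTerm m (α u) h0]
        by_cases h2 : α u ≤ ℓ u
        · simp only [h2, if_true]; ring
        · simp [h2]
      · simp [h0]
  | zero => exact ⟨fun u a b => intervalIntegrable_const,
      (congrArg (· ∈ piecewisePoly E) (by funext u; simp)).mp (zero_mem (piecewisePoly E))⟩
  | add f g _ _ hf hg =>
    refine ⟨fun u a b => (hf.1 u a b).add (hg.1 u a b), ?_⟩
    refine (congrArg (· ∈ piecewisePoly E) ?_).mp (add_mem hf.2 hg.2)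
    funext u
    simp only [Pi.add_apply]
    split_ifs
    · rw [intervalIntegral.integral_add (hf.1 _ _ _) (hg.1 _ _ _)]
    · simp
  | smul c f _ hf =>
    refine ⟨fun u a b => (hf.1 u a b).const_mul c, ?_⟩
    refine (congrArg (· ∈ piecewisePoly E) ?_).mp ((piecewisePoly E).smul_mem hf.2 c)
    funext u
    simp only [Pi.smul_apply, smul_eq_mul]
    split_ifs
    · rw [intervalIntegral.integral_const_mul]
    · simp

lemma piecewisePoly_integral {f : E × ℝ → ℝ} (hf : f ∈ piecewisePoly (E × ℝ)) (ℓ : E →ₗ[ℝ] ℝ) :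
    (∀ u t, 0 ≤ t → IntervalIntegrable (fun y => f (u, y)) volume 0 t) ∧
      (fun u => if 0 ≤ ℓ u then ∫ y in (0 : ℝ)..ℓ u, f (u, y) else 0) ∈ piecewisePoly E := by
  obtain ⟨g, hg, h⟩ := exists_fiber_rep hf
  obtain ⟨h1, h2⟩ := span_fiberTerms_integral hg ℓ
  have h3 : ∀ u t, 0 ≤ t → ∀ᵐ y : ℝ, y ∈ Set.uIoc 0 t → f (u, y) = g u y := by
    intro u t ht
    filter_upwards [h u] with y hy hy'
    rw [Set.uIoc_of_le ht] at hy'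
    exact hy hy'.1
  refine ⟨fun u t ht => (h1 u 0 t).congr_ae ?_, ?_⟩
  · rw [Filter.EventuallyEq, ae_restrict_iff' measurableSet_uIoc]
    filter_upwards [h3 u t ht] with y hy hy'
    exact (hy hy').symm
  · refine (congrArg (· ∈ piecewisePoly E) ?_).mp h2
    funext u
    split_ifs with h0
    · exact (intervalIntegral.integral_congr_ae (h3 u _ h0)).symm
    · rfl

end PiecewisePoly

lemma exists_polynomial_of_piecewisePoly {n : ℕ} {T : (Fin n → ℝ) → ℝ}
    (hT : T ∈ piecewisePoly (Fin n → ℝ)) :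
    ∃ (κ : ℝ) (D : ℕ), 0 ≤ κ ∧ ∀ v : Fin n → ℝ, ∃ p : Polynomial ℝ, p.natDegree ≤ D ∧
      ∀ L : ℝ, κ * (1 + ‖v‖) ≤ L → T ((fun _ => L) - v) = p.eval L := by
  induction hT using Algebra.adjoin_induction with
  | mem f hf =>
    rcases hf with ⟨ℓ, rfl⟩ | ⟨ℓ, rfl⟩
    all_goals
      set a : ℝ := ℓ (fun _ => 1) with ha
      have hℓ : ∀ (v : Fin n → ℝ) (L : ℝ), ℓ ((fun _ => L) - v) = a * L - ℓ v := by
        intro v L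
        have : ((fun _ => L) : Fin n → ℝ) = L • (fun _ => 1) := by ext; simp
        rw [map_sub, this, map_smul, smul_eq_mul, mul_comm]
    · refine ⟨0, 1, le_rfl, fun v => ⟨.C a * .X - .C (ℓ v), by compute_degree, fun L _ => ?_⟩⟩
      simp [hℓ]
    · obtain ⟨K, hK, hKv⟩ : ∃ K : ℝ, 0 ≤ K ∧ ∀ v, |ℓ v| ≤ K * ‖v‖ :=
        ⟨‖LinearMap.toContinuousLinearMap ℓ‖, norm_nonneg _, fun v =>
          (LinearMap.toContinuousLinearMap ℓ).le_opNorm v⟩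
      rcases lt_trichotomy a 0 with h | h | h
      · refine ⟨(K + 1) / -a, 0, div_nonneg (by linarith) (by linarith),
          fun v => ⟨0, by simp, fun L hL => ?_⟩⟩
        rw [div_mul_eq_mul_div, div_le_iff₀ (by linarith)] at hL
        have := (abs_le.1 (hKv v)).1
        simp only [hℓ]
        rw [if_neg]
        · simp
        · rw [not_le]
          nlinarith [norm_nonneg v]
      · refine ⟨0, 0, le_rfl, fun v => ?_⟩
        by_cases hv : ℓ v ≤ 0
        · exact ⟨1, by simp, fun L _ => by simp [hℓ, h, hv]⟩
        · exact ⟨0, by simp, fun L _ => by simp [hℓ, h, hv]⟩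
      · refine ⟨K / a, 0, by positivity, fun v => ⟨1, by simp, fun L hL => ?_⟩⟩
        rw [div_mul_eq_mul_div, div_le_iff₀ h] at hL
        have := (abs_le.1 (hKv v)).2
        simp only [hℓ]
        rw [if_pos]
        · simp
        · nlinarith [norm_nonneg v]
  | algebraMap c => exact ⟨0, 0, le_rfl, fun v => ⟨.C c, by simp, fun L _ => by simp⟩⟩
  | add f g _ _ hf hg =>
    obtain ⟨κ, D, hκ, h⟩ := hf
    obtain ⟨κ', D', hκ', h'⟩ := hg
    refine ⟨κ + κ', max D D', by positivity, fun v => ?_⟩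
    obtain ⟨p, hp, hpL⟩ := h v
    obtain ⟨q, hq, hqL⟩ := h' v
    refine ⟨p + q, (Polynomial.natDegree_add_le _ _).trans (max_le_max hp hq), fun L hL => ?_⟩
    have := norm_nonneg v
    rw [Pi.add_apply, hpL L (by nlinarith), hqL L (by nlinarith), Polynomial.eval_add]
  | mul f g _ _ hf hg =>
    obtain ⟨κ, D, hκ, h⟩ := hf
    obtain ⟨κ', D', hκ', h'⟩ := hg
    refine ⟨κ + κ', D + D', by positivity, fun v => ?_⟩
    obtain ⟨p, hp, hpL⟩ := h v
    obtain ⟨q, hq, hqL⟩ := h' v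
    refine ⟨p * q, Polynomial.natDegree_mul_le.trans (add_le_add hp hq), fun L hL => ?_⟩
    have := norm_nonneg v
    rw [Pi.mul_apply, hpL L (by nlinarith), hqL L (by nlinarith), Polynomial.eval_mul]

section TailIntegral

variable {n : ℕ}

/-- The indicator vector of `I`. -/
def indVec (I : Finset (Fin n)) : Fin n → ℝ := fun j => if j ∈ I then 1 else 0

lemma act_mon (a : ℕ) (I : Finset (Fin n)) (F : (Fin n → ℝ) → ℝ) (u : Fin n → ℝ) :
    act (mon n a I) F u = F (u - Real.log a • indVec I) := by
  rw [mon, act_single, one_mul]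
  congr 1
  ext j
  simp only [Pi.sub_apply, Pi.smul_apply, indVec, smul_eq_mul]
  split_ifs
  · rw [Real.coe_toNNReal _ (Real.log_natCast_nonneg a), mul_one]
  · simp

/-- Integration of translates of `F` in the direction `I`, beyond `W`. -/
noncomputable def tailInt (W : ℝ) (I : Finset (Fin n)) (F : (Fin n → ℝ) → ℝ) (u : Fin n → ℝ) : ℝ :=
  ∫ x in Ioi W, F (u - x • indVec I)

lemma tailInt_eq (W : ℝ) (I : Finset (Fin n)) (F : (Fin n → ℝ) → ℝ) (u : Fin n → ℝ) :
    tailInt W I F u = tailInt 0 I F (u - W • indVec I) := by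
  rw [tailInt, tailInt, ← integral_indicator measurableSet_Ioi,
    ← integral_indicator measurableSet_Ioi,
    ← integral_add_right_eq_self ((Ioi W).indicator fun x => F (u - x • indVec I)) W]
  congr 1
  ext x
  simp only [indicator, mem_Ioi, lt_add_iff_pos_left]
  congr 2
  rw [add_smul]; abel

lemma orthant_zero {F : (Fin n → ℝ) → ℝ} (hF : OrthantSupported F) {I : Finset (Fin n)}
    {j : Fin n} (hj : j ∈ I) {u : Fin n → ℝ} {x : ℝ} (hx : u j < x) : F (u - x • indVec I) = 0 := by
  refine hF _ j ?_
  simp [indVec, hj, hx]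

lemma integrableOn_translate {T : (Fin n → ℝ) → ℝ} (hT : T ∈ piecewisePoly (Fin n → ℝ))
    (hF : OrthantSupported T) {I : Finset (Fin n)} (hI : I.Nonempty) {W : ℝ} (hW : 0 ≤ W)
    (u : Fin n → ℝ) : IntegrableOn (fun x => T (u - x • indVec I)) (Ioi W) := by
  obtain ⟨j, hj⟩ := hI
  have h1 := comp_mem_piecewisePoly hT ((LinearMap.fst ℝ (Fin n → ℝ) ℝ) -
    (LinearMap.toSpanSingleton ℝ _ (indVec I)).comp (LinearMap.snd ℝ (Fin n → ℝ) ℝ))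
  have h2 := (piecewisePoly_integral h1 (LinearMap.proj j)).1 u (max (u j) 0) (le_max_right _ _)
  rw [intervalIntegrable_iff_integrableOn_Ioc_of_le (le_max_right _ _)] at h2
  refine IntegrableOn.mono_set ?_ (Ioi_subset_Ioi hW)
  rw [← Ioc_union_Ioi_eq_Ioi (le_max_right (u j) 0)]
  refine IntegrableOn.union h2 ?_
  refine (integrableOn_zero (s := Ioi (max (u j) 0))).congr_fun (fun x hx => ?_) measurableSet_Ioi
  exact (orthant_zero hF hj (lt_of_le_of_lt (le_max_left _ _) hx)).symm

lemma tailInt_zero_mem {T : (Fin n → ℝ) → ℝ} (hT : T ∈ piecewisePoly (Fin n → ℝ))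
    (hF : OrthantSupported T) {I : Finset (Fin n)} (hI : I.Nonempty) :
    tailInt 0 I T ∈ piecewisePoly (Fin n → ℝ) := by
  obtain ⟨j, hj⟩ := hI
  have h1 := comp_mem_piecewisePoly hT ((LinearMap.fst ℝ (Fin n → ℝ) ℝ) -
    (LinearMap.toSpanSingleton ℝ _ (indVec I)).comp (LinearMap.snd ℝ (Fin n → ℝ) ℝ))
  have h2 := (piecewisePoly_integral h1 (LinearMap.proj j)).2
  refine (congrArg (· ∈ piecewisePoly (Fin n → ℝ)) ?_).mp h2
  funext u
  have hint := integrableOn_translate hT hF ⟨j, hj⟩ le_rfl u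
  change (if 0 ≤ u j then ∫ y in (0 : ℝ)..u j, T (u - y • indVec I) else 0) = _
  by_cases h0 : 0 ≤ u j
  · rw [if_pos h0, tailInt, ← Ioc_union_Ioi_eq_Ioi h0, setIntegral_union (Ioc_disjoint_Ioi le_rfl)
      measurableSet_Ioi (hint.mono_set Ioc_subset_Ioi_self) (hint.mono_set (Ioi_subset_Ioi h0)),
      setIntegral_eq_zero_of_forall_eq_zero (t := Ioi (u j)) (fun x hx => orthant_zero hF hj hx),
      add_zero, intervalIntegral.integral_of_le h0]
  · rw [if_neg h0, tailInt, setIntegral_eq_zero_of_forall_eq_zero]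
    exact fun x hx => orthant_zero hF hj ((not_le.1 h0).trans hx)

lemma OrthantSupported.tailInt {F : (Fin n → ℝ) → ℝ} (hF : OrthantSupported F) {W : ℝ}
    (hW : 0 ≤ W) (I : Finset (Fin n)) : OrthantSupported (tailInt W I F) := fun u j hu => by
  refine setIntegral_eq_zero_of_forall_eq_zero fun x hx => hF _ j ?_
  have : 0 ≤ x * indVec I j := mul_nonneg (hW.trans (le_of_lt hx)) (by unfold indVec; split_ifs <;> simp)
  simp only [Pi.sub_apply, Pi.smul_apply, smul_eq_mul]
  linarith

lemma abs_tailInt_le {F : (Fin n → ℝ) → ℝ} (hF : OrthantSupported F) {I : Finset (Fin n)}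
    (hI : I.Nonempty) {W L K : ℝ} (hW : 0 ≤ W) (hL : 0 ≤ L) (hK : 0 ≤ K) {u : Fin n → ℝ}
    (hu : ∀ j, u j ≤ L) (h : ∀ w ≤ u, |F w| ≤ K) : |tailInt W I F u| ≤ K * L := by
  obtain ⟨j, hj⟩ := hI
  have h1 : tailInt W I F u = ∫ x in Ioc 0 L, (Ioi W).indicator (fun x => F (u - x • indVec I)) x := by
    rw [tailInt, ← integral_indicator measurableSet_Ioi, setIntegral_eq_integral_of_forall_compl_eq_zero]
    intro x hx
    rw [indicator_apply]
    split_ifs with hxW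
    · refine orthant_zero hF hj ((hu j).trans_lt ?_)
      by_contra hxL
      exact hx ⟨hW.trans_lt hxW, not_lt.1 hxL⟩
    · rfl
  rw [h1]
  have := norm_setIntegral_le_of_norm_le_const (μ := volume) (s := Ioc (0 : ℝ) L) (C := K)
    (f := (Ioi W).indicator (fun x => F (u - x • indVec I))) (by simp) fun x hx => by
      rw [indicator_apply]
      split_ifs with hxW
      · refine h _ fun i => ?_
        have : 0 ≤ x * indVec I i := mul_nonneg hx.1.le (by unfold indVec; split_ifs <;> simp)
        simp only [Pi.sub_apply, Pi.smul_apply, smul_eq_mul]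
        linarith
      · simpa using hK
  simpa [hL] using this

/-- The span of the translates of members of `𝒯` by vectors of size at most `R`. -/
def translateSpan (𝒯 : Set ((Fin n → ℝ) → ℝ)) (R : ℝ) : Submodule ℝ ((Fin n → ℝ) → ℝ) :=
  Submodule.span ℝ {F | ∃ T ∈ 𝒯, ∃ v : Fin n → ℝ≥0, (∀ j, (v j : ℝ) ≤ R) ∧
    F = fun u => T (u - fun j => (v j : ℝ))}

lemma translateSpan_mono {𝒯 𝒯' : Set ((Fin n → ℝ) → ℝ)} {R R' : ℝ} (h : 𝒯 ⊆ 𝒯') (hR : R ≤ R') :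
    translateSpan 𝒯 R ≤ translateSpan 𝒯' R' :=
  Submodule.span_mono fun _ ⟨T, hT, v, hv, e⟩ => ⟨T, h hT, v, fun j => (hv j).trans hR, e⟩

lemma translate_mem_translateSpan {𝒯 : Set ((Fin n → ℝ) → ℝ)} {R S : ℝ} {F : (Fin n → ℝ) → ℝ}
    (hF : F ∈ translateSpan 𝒯 R) {x : ℝ} (hx : 0 ≤ x) (hxS : R + x ≤ S) (I : Finset (Fin n)) :
    (fun u => F (u - x • indVec I)) ∈ translateSpan 𝒯 S := by
  induction hF using Submodule.span_induction with
  | mem F hF =>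
    obtain ⟨T, hT, v, hv, rfl⟩ := hF
    refine Submodule.subset_span ⟨T, hT, fun j => v j + if j ∈ I then x.toNNReal else 0,
      fun j => ?_, ?_⟩
    · push_cast
      split_ifs
      · rw [Real.coe_toNNReal _ hx]; linarith [hv j]
      · simp only [NNReal.coe_zero]; linarith [hv j]
    · funext u
      refine congrArg T (funext fun j => ?_)
      simp only [Pi.sub_apply, Pi.smul_apply, indVec, smul_eq_mul, NNReal.coe_add]
      split_ifs
      · rw [Real.coe_toNNReal _ hx]; ring
      · simp
  | zero => exact zero_mem _
  | add F G _ _ hF hG => exact add_mem hF hG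
  | smul c F _ hF => exact Submodule.smul_mem _ c hF

lemma truncZeta_mem_translateSpan {𝒯 : Set ((Fin n → ℝ) → ℝ)} {R : ℝ} {F : (Fin n → ℝ) → ℝ}
    (hF : F ∈ translateSpan 𝒯 R) (M : ℕ) (I : Finset (Fin n)) :
    act (truncZeta n M I) F ∈ translateSpan 𝒯 (R + Real.log M) := by
  rw [truncZeta, map_sum, LinearMap.sum_apply]
  refine sum_mem fun a ha => ?_
  obtain ⟨ha1, ha2⟩ := Finset.mem_Icc.1 ha
  rw [map_smul, LinearMap.smul_apply]
  refine Submodule.smul_mem _ _ ?_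
  rw [show act (mon n a I) F = _ from funext fun u => act_mon a I F u]
  refine translate_mem_translateSpan hF (Real.log_natCast_nonneg a) ?_ I
  have : Real.log a ≤ Real.log M := Real.log_le_log (by exact_mod_cast ha1) (by exact_mod_cast ha2)
  linarith

lemma tailInt_mem_translateSpan {𝒯 : Set ((Fin n → ℝ) → ℝ)} {R W : ℝ} (hW : 0 ≤ W)
    (h𝒯 : ∀ T ∈ 𝒯, T ∈ piecewisePoly (Fin n → ℝ) ∧ OrthantSupported T)
    {F : (Fin n → ℝ) → ℝ} (hF : F ∈ translateSpan 𝒯 R) {I : Finset (Fin n)} (hI : I.Nonempty) :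
    (∀ u, IntegrableOn (fun x => F (u - x • indVec I)) (Ioi W)) ∧
      tailInt W I F ∈ translateSpan (tailInt 0 I '' 𝒯) (R + W) := by
  induction hF using Submodule.span_induction with
  | mem F hF =>
    obtain ⟨T, hT, v, hv, rfl⟩ := hF
    have e : ∀ (u : Fin n → ℝ) (x : ℝ), u - x • indVec I - (fun j => (v j : ℝ)) =
        u - (fun j => (v j : ℝ)) - x • indVec I := fun u x => by abel
    constructor
    · intro u
      simp_rw [e]
      exact integrableOn_translate (h𝒯 T hT).1 (h𝒯 T hT).2 hI hW _
    · have h1 : (fun u => tailInt 0 I T (u - fun j => (v j : ℝ))) ∈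
          translateSpan (tailInt 0 I '' 𝒯) R := Submodule.subset_span ⟨_, ⟨T, hT, rfl⟩, v, hv, rfl⟩
      refine (congrArg (· ∈ _) ?_).mp (translate_mem_translateSpan h1 hW le_rfl I)
      funext u
      rw [e, ← tailInt_eq, tailInt, tailInt]
      simp_rw [e]
  | zero =>
    refine ⟨fun u => integrableOn_zero, ?_⟩
    rw [show tailInt W I (0 : (Fin n → ℝ) → ℝ) = 0 from funext fun u => by simp [tailInt]]
    exact zero_mem _
  | add F G _ _ hF hG =>
    refine ⟨fun u => (hF.1 u).add (hG.1 u), ?_⟩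
    rw [show tailInt W I (F + G) = tailInt W I F + tailInt W I G from
      funext fun u => integral_add (hF.1 u) (hG.1 u)]
    exact add_mem hF.2 hG.2
  | smul c F _ hF =>
    refine ⟨fun u => (hF.1 u).const_mul c, ?_⟩
    rw [show tailInt W I (c • F) = c • tailInt W I F from
      funext fun u => integral_const_mul c _]
    exact Submodule.smul_mem _ c hF.2

lemma orthantSupported_of_mem_translateSpan {𝒯 : Set ((Fin n → ℝ) → ℝ)} {R : ℝ}
    (h𝒯 : ∀ T ∈ 𝒯, OrthantSupported T) {F : (Fin n → ℝ) → ℝ} (hF : F ∈ translateSpan 𝒯 R) :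
    OrthantSupported F := by
  intro u j hu
  induction hF using Submodule.span_induction with
  | mem F hF =>
    obtain ⟨T, hT, v, hv, rfl⟩ := hF
    refine h𝒯 T hT _ j ?_
    simp only [Pi.sub_apply]
    linarith [(v j).2]
  | zero => rfl
  | add F G _ _ hF hG => rw [Pi.add_apply, hF, hG, add_zero]
  | smul c F _ hF => rw [Pi.smul_apply, hF, smul_zero]

lemma exists_polynomial_of_translateSpan {𝒯 : Set ((Fin n → ℝ) → ℝ)} (hfin : 𝒯.Finite)
    (h𝒯 : ∀ T ∈ 𝒯, T ∈ piecewisePoly (Fin n → ℝ)) :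
    ∃ (κ : ℝ) (D : ℕ), 0 ≤ κ ∧ ∀ R : ℝ, 0 ≤ R → ∀ F ∈ translateSpan 𝒯 R, ∀ w : Fin n → ℝ,
      ∃ p : Polynomial ℝ, p.natDegree ≤ D ∧
        ∀ L : ℝ, κ * (1 + R + ‖w‖) ≤ L → F ((fun _ => L) - w) = p.eval L := by
  have h1 : ∃ (κ : ℝ) (D : ℕ), 0 ≤ κ ∧ ∀ T ∈ 𝒯, ∀ v : Fin n → ℝ, ∃ p : Polynomial ℝ,
      p.natDegree ≤ D ∧ ∀ L : ℝ, κ * (1 + ‖v‖) ≤ L → T ((fun _ => L) - v) = p.eval L := by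
    induction 𝒯, hfin using Set.Finite.induction_on with
    | empty => exact ⟨0, 0, le_rfl, by simp⟩
    | @insert T 𝒯 _ _ ih =>
      obtain ⟨κ, D, hκ, h⟩ := ih fun T hT => h𝒯 T (mem_insert_of_mem _ hT)
      obtain ⟨κ', D', hκ', h'⟩ := exists_polynomial_of_piecewisePoly (h𝒯 T (mem_insert _ _))
      refine ⟨max κ κ', max D D', hκ.trans (le_max_left _ _), ?_⟩
      have hm : ∀ v : Fin n → ℝ, 0 ≤ 1 + ‖v‖ := fun v => by positivity
      rintro S (rfl | hS) v
      · obtain ⟨p, hp, hpL⟩ := h' v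
        exact ⟨p, hp.trans (le_max_right _ _), fun L hL => hpL L
          ((mul_le_mul_of_nonneg_right (le_max_right _ _) (hm v)).trans hL)⟩
      · obtain ⟨p, hp, hpL⟩ := h S hS v
        exact ⟨p, hp.trans (le_max_left _ _), fun L hL => hpL L
          ((mul_le_mul_of_nonneg_right (le_max_left _ _) (hm v)).trans hL)⟩
  obtain ⟨κ, D, hκ, h⟩ := h1
  refine ⟨κ, D, hκ, fun R hR F hF w => ?_⟩
  induction hF using Submodule.span_induction with
  | mem F hF =>
    obtain ⟨T, hT, v, hv, rfl⟩ := hF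
    obtain ⟨p, hp, hpL⟩ := h T hT (w + fun j => (v j : ℝ))
    refine ⟨p, hp, fun L hL => ?_⟩
    have h2 : ‖w + fun j => (v j : ℝ)‖ ≤ ‖w‖ + R := by
      refine (norm_add_le _ _).trans (add_le_add le_rfl ((pi_norm_le_iff_of_nonneg hR).2 fun j => ?_))
      exact (Real.norm_of_nonneg (v j).2).trans_le (hv j)
    have := hpL L ((mul_le_mul_of_nonneg_left (by linarith) hκ).trans hL)
    rw [← this]; exact congrArg T (sub_sub _ _ _)
  | zero => exact ⟨0, by simp, fun L _ => by simp⟩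
  | add F G _ _ hF hG =>
    obtain ⟨p, hp, hpL⟩ := hF
    obtain ⟨q, hq, hqL⟩ := hG
    refine ⟨p + q, (Polynomial.natDegree_add_le _ _).trans (max_le hp hq), fun L hL => ?_⟩
    rw [Pi.add_apply, hpL L hL, hqL L hL, Polynomial.eval_add]
  | smul c F _ hF =>
    obtain ⟨p, hp, hpL⟩ := hF
    refine ⟨c • p, (Polynomial.natDegree_smul_le _ _).trans hp, fun L hL => ?_⟩
    rw [Pi.smul_apply, hpL L hL, Polynomial.eval_smul]

end TailIntegral

lemma abs_sum_mul_antitone_le {b c : ℕ → ℝ} {m : ℕ} {K : ℝ} (hb : AntitoneOn b (Ici m))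
    (hb0 : ∀ a, 0 ≤ b a) (hK : ∀ N, m ≤ N → |∑ a ∈ Finset.Ioc m N, c a| ≤ K) {N : ℕ}
    (hN : m ≤ N) : |∑ a ∈ Finset.Ioc m N, c a * b a| ≤ K * b m := by
  have h : |∑ a ∈ Finset.Ioc m N, c a * b a - (∑ a ∈ Finset.Ioc m N, c a) * b N| ≤
      K * (b m - b N) := by
    induction N, hN using Nat.le_induction with
    | base => simp
    | succ N hN ih =>
      rw [← Finset.insert_Ioc_right_eq_Ioc_add_one hN, Finset.sum_insert (by simp),
        Finset.sum_insert (by simp)]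
      have h1 : b (N + 1) ≤ b N := hb hN (le_trans hN (Nat.le_succ N)) (Nat.le_succ N)
      have h2 : |(∑ a ∈ Finset.Ioc m N, c a) * (b N - b (N + 1))| ≤ K * (b N - b (N + 1)) := by
        rw [abs_mul, abs_of_nonneg (sub_nonneg.2 h1)]
        exact mul_le_mul_of_nonneg_right (hK N hN) (sub_nonneg.2 h1)
      have h3 := abs_add_le (∑ a ∈ Finset.Ioc m N, c a * b a - (∑ a ∈ Finset.Ioc m N, c a) * b N)
        ((∑ a ∈ Finset.Ioc m N, c a) * (b N - b (N + 1)))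
      refine le_trans (le_of_eq ?_) (h3.trans ((add_le_add ih h2).trans (by linarith)))
      congr 1; ring
  have h4 := mul_le_mul_of_nonneg_right (hK N hN) (hb0 N)
  rw [← abs_of_nonneg (hb0 N), ← abs_mul, abs_of_nonneg (hb0 N)] at h4
  have h5 := abs_add_le (∑ a ∈ Finset.Ioc m N, c a * b a - (∑ a ∈ Finset.Ioc m N, c a) * b N)
    ((∑ a ∈ Finset.Ioc m N, c a) * b N)
  rw [sub_add_cancel] at h5
  linarith

lemma integral_log_bounds {ψ : ℝ → ℝ} (hψ : Antitone ψ) (hψ0 : ∀ x, 0 ≤ ψ x) {a : ℕ} (ha : 1 ≤ a) :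
    ∫ x in Real.log a..Real.log (a + 1 : ℕ), ψ x ≤ ψ (Real.log a) / a ∧
      ψ (Real.log (a + 1 : ℕ)) / (a + 1 : ℕ) ≤ ∫ x in Real.log a..Real.log (a + 1 : ℕ), ψ x := by
  have ha0 : (0 : ℝ) < a := by exact_mod_cast ha
  have hle : Real.log a ≤ Real.log (a + 1 : ℕ) := Real.log_le_log ha0 (by push_cast; linarith)
  have hlen : Real.log (a + 1 : ℕ) - Real.log a = Real.log ((a + 1 : ℕ) / a) := by
    rw [Real.log_div (by positivity) ha0.ne']
  have hup : Real.log (a + 1 : ℕ) - Real.log a ≤ 1 / a := by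
    rw [hlen]
    refine (Real.log_le_sub_one_of_pos (by positivity)).trans (le_of_eq ?_)
    push_cast; field_simp; ring
  have hlow : 1 / ((a + 1 : ℕ) : ℝ) ≤ Real.log (a + 1 : ℕ) - Real.log a := by
    rw [hlen]
    have := Real.one_sub_inv_le_log_of_pos (x := ((a + 1 : ℕ) : ℝ) / a) (by positivity)
    refine le_trans (le_of_eq ?_) this
    push_cast; field_simp; ring
  have hint : IntervalIntegrable ψ volume (Real.log a) (Real.log (a + 1 : ℕ)) :=
    hψ.intervalIntegrable
  constructor
  · have := intervalIntegral.integral_mono_on hle hint intervalIntegrable_const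
      (fun x hx => hψ hx.1)
    rw [intervalIntegral.integral_const, smul_eq_mul] at this
    refine this.trans ?_
    rw [div_eq_mul_one_div, mul_comm]
    exact mul_le_mul_of_nonneg_left hup (hψ0 _)
  · have := intervalIntegral.integral_mono_on hle intervalIntegrable_const hint
      (fun x hx => hψ hx.2)
    rw [intervalIntegral.integral_const, smul_eq_mul] at this
    refine le_trans ?_ this
    rw [div_eq_mul_one_div, mul_comm]
    exact mul_le_mul_of_nonneg_right hlow (hψ0 _)

lemma abs_sum_sub_integral_le {ψ : ℝ → ℝ} (hψ : Antitone ψ) (hψ0 : ∀ x, 0 ≤ ψ x) {M N : ℕ}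
    (hM : 1 ≤ M) (hMN : M ≤ N) (hN : ψ (Real.log (N + 1 : ℕ)) = 0) :
    |∑ a ∈ Finset.Ioc M N, ψ (Real.log a) / a - ∫ x in Ioi (Real.log M), ψ x| ≤
      ψ (Real.log M) / M := by
  have hM0 : (0 : ℝ) < M := by exact_mod_cast hM
  have h0 : ∫ x in Ioi (Real.log M), ψ x = ∫ x in Real.log M..Real.log (N + 1 : ℕ), ψ x := by
    rw [intervalIntegral.integral_of_le (Real.log_le_log hM0 (by norm_cast; omega))]
    refine setIntegral_eq_of_subset_of_forall_sdiff_eq_zero measurableSet_Ioi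
      Ioc_subset_Ioi_self fun x hx => ?_
    have : Real.log (N + 1 : ℕ) ≤ x := by
      by_contra h
      exact hx.2 ⟨hx.1, (not_le.1 h).le⟩
    exact le_antisymm (hN ▸ hψ this) (hψ0 x)
  have h1 : ∫ x in Real.log M..Real.log (N + 1 : ℕ), ψ x =
      ∑ a ∈ Finset.Ico M (N + 1), ∫ x in Real.log a..Real.log (a + 1 : ℕ), ψ x := by
    rw [intervalIntegral.sum_integral_adjacent_intervals_Ico (a := fun a : ℕ => Real.log a)
      (by omega) (fun k _ => hψ.intervalIntegrable)]
  rw [h0, h1]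
  have h2 : ∑ a ∈ Finset.Ico M (N + 1), ∫ x in Real.log a..Real.log (a + 1 : ℕ), ψ x ≤
      ψ (Real.log M) / M + ∑ a ∈ Finset.Ioc M N, ψ (Real.log a) / a := by
    refine (Finset.sum_le_sum fun a ha => (integral_log_bounds hψ hψ0
      (hM.trans (Finset.mem_Ico.1 ha).1)).1).trans (le_of_eq ?_)
    rw [Finset.sum_eq_sum_Ico_succ_bot (by omega)]
    congr 1
    refine Finset.sum_congr (Finset.ext fun a => ?_) fun _ _ => rfl
    simp only [Finset.mem_Ioc, Finset.mem_Ico]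
    omega
  have h3 : ∑ a ∈ Finset.Ioc M N, ψ (Real.log a) / a ≤
      ∑ a ∈ Finset.Ico M (N + 1), ∫ x in Real.log a..Real.log (a + 1 : ℕ), ψ x := by
    refine le_trans ?_ (Finset.sum_le_sum fun a ha => (integral_log_bounds hψ hψ0
      (hM.trans (Finset.mem_Ico.1 ha).1)).2)
    rw [Finset.sum_Ico_add' (fun a : ℕ => ψ (Real.log a) / a) M (N + 1) 1]
    refine Finset.sum_le_sum_of_subset_of_nonneg ?_ fun a _ _ => div_nonneg (hψ0 _) (by positivity)
    intro a ha
    simp only [Finset.mem_Ioc, Finset.mem_Ico] at ha ⊢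
    omega
  rw [abs_le]
  constructor <;> linarith [div_nonneg (hψ0 (Real.log M)) hM0.le]

section Model

variable {n : ℕ}

lemma posPow_mem_piecewisePoly (A : ℕ) (j : Fin n) :
    (fun u => posPow A (u j)) ∈ piecewisePoly (Fin n → ℝ) := by
  refine (congrArg (· ∈ piecewisePoly (Fin n → ℝ)) ?_).mp
    (mul_mem (ind_mem_piecewisePoly (LinearMap.proj j : (Fin n → ℝ) →ₗ[ℝ] ℝ))
      (pow_mem (linear_mem_piecewisePoly (LinearMap.proj j : (Fin n → ℝ) →ₗ[ℝ] ℝ)) A))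
  funext u
  change (if 0 ≤ u j then (1 : ℝ) else 0) * (u j) ^ A = posPow A (u j)
  rw [posPow]
  split_ifs <;> simp

lemma posPowProd_mem_piecewisePoly (A n : ℕ) : posPowProd A n ∈ piecewisePoly (Fin n → ℝ) := by
  refine (congrArg (· ∈ piecewisePoly (Fin n → ℝ)) ?_).mp
    (prod_mem (S := piecewisePoly (Fin n → ℝ)) (t := Finset.univ)
      fun j _ => posPow_mem_piecewisePoly A j)
  funext u
  rw [Finset.prod_apply]; rfl

lemma indVec_nonneg (I : Finset (Fin n)) (j : Fin n) : 0 ≤ indVec I j := by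
  unfold indVec; split_ifs <;> simp

lemma mass_truncZeta_le (N : ℕ) (hN : 1 ≤ N) (I : Finset (Fin n)) :
    mass 0 (truncZeta n N I) ≤ 1 + Real.log N := by
  refine (mass_sum_le _ _ _).trans (le_trans (Finset.sum_le_sum fun a ha => ?_)
    (sum_Icc_one_div_le N hN))
  rw [mass_smul, mon, mass_single, zero_mul, Real.exp_zero, abs_one, mul_one, mul_one, abs_div,
    Nat.abs_cast]
  gcongr
  exact abs_subsetSign_le I a

lemma exists_sum_liouville_le (B : ℕ) : ∃ C > 0, ∀ M N : ℕ, 2 ≤ M → M ≤ N →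
    |∑ a ∈ Finset.Ioc M N, ((ArithmeticFunction.liouville a : ℤ) : ℝ) / a| ≤
      C / Real.log M ^ B := by
  obtain ⟨C, hC, h⟩ := exists_pow_mul_abs_liouvilleLog_le B
  refine ⟨2 * C, by positivity, fun M N hM hMN => ?_⟩
  have hM0 : 0 < Real.log M := Real.log_pos (by exact_mod_cast hM)
  have h1 : ∀ m : ℕ, M ≤ m → |liouvilleLog (Real.log m)| ≤ C / Real.log M ^ B := fun m hm => by
    rw [le_div_iff₀ (by positivity), mul_comm]
    refine le_trans ?_ (h (Real.log m) (Real.log_natCast_nonneg m))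
    gcongr
  have h2 : ∀ m : ℕ, 1 ≤ m → liouvilleLog (Real.log m) =
      ∑ a ∈ Finset.Ioc 0 m, ((ArithmeticFunction.liouville a : ℤ) : ℝ) / a := fun m hm => by
    rw [liouvilleLog, Real.exp_log (by exact_mod_cast hm), Nat.floor_natCast]
    rfl
  have h3 : ∑ a ∈ Finset.Ioc M N, ((ArithmeticFunction.liouville a : ℤ) : ℝ) / a =
      liouvilleLog (Real.log N) - liouvilleLog (Real.log M) := by
    rw [h2 N (by omega), h2 M (by omega), ← Finset.sum_Ioc_consecutive _ (Nat.zero_le M) hMN]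
    ring
  rw [h3]
  have := abs_sub (liouvilleLog (Real.log N)) (liouvilleLog (Real.log M))
  have := h1 N hMN
  have := h1 M le_rfl
  rw [mul_div_assoc]
  linarith

lemma exists_inv_le_log_pow (B : ℕ) : ∃ C > 0, ∀ M : ℕ, 2 ≤ M → 1 / (M : ℝ) ≤ C / Real.log M ^ B := by
  refine ⟨B.factorial, by positivity, fun M hM => ?_⟩
  have hM0 : 0 < Real.log M := Real.log_pos (by exact_mod_cast hM)
  have h1 := Real.pow_div_factorial_le_exp (Real.log M) hM0.le B
  rw [Real.exp_log (by positivity)] at h1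
  rw [div_le_div_iff₀ (by positivity) (by positivity), one_mul]
  rw [div_le_iff₀ (by positivity)] at h1
  linarith

/-- The model for `act (truncZeta n N I) F`, independent of `N`. -/
noncomputable def modelStep (M : ℕ) (I : Finset (Fin n)) (F : (Fin n → ℝ) → ℝ) : (Fin n → ℝ) → ℝ :=
  act (truncZeta n M I) F + if Even I.card then tailInt (Real.log M) I F else 0

lemma act_truncZeta_apply (N : ℕ) (I : Finset (Fin n)) (F : (Fin n → ℝ) → ℝ) (u : Fin n → ℝ) :
    act (truncZeta n N I) F u =
      ∑ a ∈ Finset.Icc 1 N, subsetSign I a / a * F (u - Real.log a • indVec I) := by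
  rw [truncZeta, map_sum, LinearMap.sum_apply, Finset.sum_apply]
  refine Finset.sum_congr rfl fun a _ => ?_
  rw [map_smul, LinearMap.smul_apply, Pi.smul_apply, act_mon, smul_eq_mul]

lemma exists_abs_truncZeta_sub_modelStep_le (A B : ℕ) : ∃ C > 0, ∀ (n : ℕ) (I : Finset (Fin n)),
    I.Nonempty → ∀ (M N : ℕ), 2 ≤ M → M ≤ N → ∀ (L : ℝ), 0 ≤ L → L < Real.log (N + 1 : ℕ) →
    ∀ u : Fin n → ℝ, (∀ j, u j ≤ L) →
      |act (truncZeta n N I) (posPowProd A n) u - modelStep M I (posPowProd A n) u| ≤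
        C * L ^ (n * A) / Real.log M ^ B := by
  obtain ⟨C₁, hC₁, h₁⟩ := exists_sum_liouville_le B
  obtain ⟨C₂, hC₂, h₂⟩ := exists_inv_le_log_pow B
  refine ⟨C₁ + C₂, by positivity, fun n I hI M N hM hMN L hL hLN u hu => ?_⟩
  have hM0 : 0 < Real.log M := Real.log_pos (by exact_mod_cast hM)
  set ψ : ℝ → ℝ := fun x => posPowProd A n (u - x • indVec I) with hψd
  have hψ : Antitone ψ := fun x y hxy => posPowProd_mono A n fun j => by
    simp only [Pi.sub_apply, Pi.smul_apply, smul_eq_mul]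
    have := mul_le_mul_of_nonneg_right hxy (indVec_nonneg I j)
    linarith
  have hψ0 : ∀ x, 0 ≤ ψ x := fun x => posPowProd_nonneg A n _
  have hψL : ψ (Real.log M) ≤ L ^ (n * A) := posPowProd_le hL fun j => by
    simp only [Pi.sub_apply, Pi.smul_apply, smul_eq_mul]
    have := mul_nonneg hM0.le (indVec_nonneg I j)
    linarith [hu j]
  have hψN : ψ (Real.log (N + 1 : ℕ)) = 0 := by
    obtain ⟨j, hj⟩ := hI
    exact orthant_zero (orthantSupported_posPowProd A n) hj ((hu j).trans_lt hLN)
  have hsplit : act (truncZeta n N I) (posPowProd A n) u = act (truncZeta n M I) (posPowProd A n) u +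
      ∑ a ∈ Finset.Ioc M N, subsetSign I a / a * ψ (Real.log a) := by
    rw [act_truncZeta_apply, act_truncZeta_apply]
    exact (Finset.sum_Ioc_consecutive _ (Nat.zero_le M) hMN).symm
  rw [hsplit, modelStep, Pi.add_apply, add_sub_add_left_eq_sub]
  have hLA : 0 ≤ L ^ (n * A) := by positivity
  by_cases he : Even I.card
  · rw [if_pos he]
    have h3 := abs_sum_sub_integral_le hψ hψ0 (by omega : 1 ≤ M) hMN hψN
    have h4 : ∑ a ∈ Finset.Ioc M N, subsetSign I a / a * ψ (Real.log a) =
        ∑ a ∈ Finset.Ioc M N, ψ (Real.log a) / a :=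
      Finset.sum_congr rfl fun a _ => by rw [subsetSign, if_pos he]; ring
    rw [h4]
    refine h3.trans ?_
    calc ψ (Real.log M) / M = ψ (Real.log M) * (1 / M) := by ring
      _ ≤ L ^ (n * A) * (C₂ / Real.log M ^ B) := by
          exact mul_le_mul hψL (h₂ M hM) (by positivity) hLA
      _ ≤ L ^ (n * A) * ((C₁ + C₂) / Real.log M ^ B) := by gcongr; linarith
      _ = _ := by ring
  · rw [if_neg he, Pi.zero_apply, sub_zero]
    have h4 : ∑ a ∈ Finset.Ioc M N, subsetSign I a / a * ψ (Real.log a) =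
        ∑ a ∈ Finset.Ioc M N, ((ArithmeticFunction.liouville a : ℤ) : ℝ) / a * ψ (Real.log a) :=
      Finset.sum_congr rfl fun a _ => by rw [subsetSign, if_neg he]
    rw [h4]
    refine (abs_sum_mul_antitone_le (b := fun a : ℕ => ψ (Real.log a))
      (K := C₁ / Real.log M ^ B) (m := M) ?_ (fun a => hψ0 _) (fun N hN => h₁ M N hM hN) hMN).trans ?_
    · intro a ha b _ hab
      have ha' : M ≤ a := ha
      exact hψ (Real.log_le_log (by norm_cast; omega) (by exact_mod_cast hab))
    calc C₁ / Real.log M ^ B * ψ (Real.log M) ≤ (C₁ + C₂) / Real.log M ^ B * L ^ (n * A) := by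
          refine mul_le_mul ?_ hψL (hψ0 _) (by positivity)
          gcongr; linarith
      _ = _ := by ring

end Model

section Model

variable {n : ℕ}

lemma act_apply_translate (r : Shift n) (F : (Fin n → ℝ) → ℝ) (u : Fin n → ℝ) (I : Finset (Fin n))
    (x : ℝ) : act r F (u - x • indVec I) =
      ∑ v ∈ r.coeff.support, r.coeff v * F (u - (fun j => (v j : ℝ)) - x • indVec I) := by
  rw [act_apply]
  refine Finset.sum_congr rfl fun v _ => ?_
  congr 2; abel

lemma integrableOn_act {F : (Fin n → ℝ) → ℝ} {W : ℝ} {I : Finset (Fin n)}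
    (h : ∀ u, IntegrableOn (fun x => F (u - x • indVec I)) (Ioi W)) (r : Shift n) (u : Fin n → ℝ) :
    IntegrableOn (fun x => act r F (u - x • indVec I)) (Ioi W) := by
  simp_rw [act_apply_translate]
  exact integrable_finsetSum _ fun v _ => (h _).const_mul _

lemma tailInt_act {F : (Fin n → ℝ) → ℝ} {W : ℝ} {I : Finset (Fin n)}
    (h : ∀ u, IntegrableOn (fun x => F (u - x • indVec I)) (Ioi W)) (r : Shift n) :
    tailInt W I (act r F) = act r (tailInt W I F) := by
  funext u
  rw [tailInt, act_apply]
  simp_rw [act_apply_translate]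
  rw [integral_finsetSum _ fun v _ => (h _).const_mul _]
  simp_rw [integral_const_mul]
  rfl

lemma modelStep_act {F : (Fin n → ℝ) → ℝ} {M : ℕ} {I : Finset (Fin n)}
    (h : ∀ u, IntegrableOn (fun x => F (u - x • indVec I)) (Ioi (Real.log M))) (r : Shift n) :
    modelStep M I (act r F) = act r (modelStep M I F) := by
  rw [modelStep, modelStep, map_add, ← Module.End.mul_apply, ← Module.End.mul_apply, ← map_mul,
    ← map_mul, mul_comm]
  congr 1
  split_ifs
  · exact tailInt_act h r
  · simp

lemma abs_modelStep_sub_le {F G : (Fin n → ℝ) → ℝ} {M : ℕ} (hM : 1 ≤ M) {I : Finset (Fin n)}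
    (hI : I.Nonempty)
    (hF : ∀ u, IntegrableOn (fun x => F (u - x • indVec I)) (Ioi (Real.log M)))
    (hG : ∀ u, IntegrableOn (fun x => G (u - x • indVec I)) (Ioi (Real.log M)))
    (hF0 : OrthantSupported F) (hG0 : OrthantSupported G) {L K : ℝ} (hL : 0 ≤ L)
    (hML : Real.log M ≤ L) (hK : 0 ≤ K)
    {u : Fin n → ℝ} (hu : ∀ j, u j ≤ L) (h : ∀ w ≤ u, |F w - G w| ≤ K) :
    |modelStep M I F u - modelStep M I G u| ≤ 2 * (1 + L) * K := by
  have h1 : |act (truncZeta n M I) (F - G) u| ≤ (1 + L) * K :=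
    (abs_act_le h).trans (mul_le_mul_of_nonneg_right
      ((mass_truncZeta_le M hM I).trans (by linarith)) hK)
  have h0 : OrthantSupported (F - G) := fun w j hw => by
    rw [Pi.sub_apply, hF0 w j hw, hG0 w j hw, sub_zero]
  have h2 : |tailInt (Real.log M) I (F - G) u| ≤ K * L :=
    abs_tailInt_le h0 hI (Real.log_natCast_nonneg M) hL hK hu h
  have h3 : tailInt (Real.log M) I (F - G) u =
      tailInt (Real.log M) I F u - tailInt (Real.log M) I G u := integral_sub (hF u) (hG u)
  rw [modelStep, modelStep, Pi.add_apply, Pi.add_apply]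
  rw [map_sub, Pi.sub_apply] at h1
  by_cases he : Even I.card
  · rw [if_pos he, if_pos he]
    rw [h3] at h2
    have := abs_add_le (act (truncZeta n M I) F u - act (truncZeta n M I) G u)
      (tailInt (Real.log M) I F u - tailInt (Real.log M) I G u)
    rw [show ∀ a b c d : ℝ, a + b - (c + d) = (a - c) + (b - d) from fun _ _ _ _ => by ring]
    nlinarith
  · rw [if_neg he, if_neg he]
    change |_ + 0 - (_ + 0)| ≤ _
    rw [add_zero, add_zero]
    nlinarith

/-- The model for the full product. -/
noncomputable def model (A M : ℕ) (l : List (Finset (Fin n))) : (Fin n → ℝ) → ℝ :=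
  l.foldr (modelStep M) (posPowProd A n)

lemma exists_model_mem_translateSpan (A : ℕ) (l : List (Finset (Fin n)))
    (hl : ∀ I ∈ l, I.Nonempty) : ∃ 𝒯 : Set ((Fin n → ℝ) → ℝ), 𝒯.Finite ∧
      (∀ T ∈ 𝒯, T ∈ piecewisePoly (Fin n → ℝ) ∧ OrthantSupported T) ∧
      ∀ M : ℕ, 1 ≤ M → model A M l ∈ translateSpan 𝒯 (l.length * Real.log M) := by
  induction l with
  | nil =>
    refine ⟨{posPowProd A n}, finite_singleton _, ?_, fun M hM => ?_⟩
    · rintro T rfl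
      exact ⟨posPowProd_mem_piecewisePoly A n, orthantSupported_posPowProd A n⟩
    · refine Submodule.subset_span ⟨posPowProd A n, rfl, 0, fun j => by simp, ?_⟩
      funext u
      exact congrArg (posPowProd A n) (by ext j; simp)
  | cons I l ih =>
    obtain ⟨𝒯, hfin, h𝒯, hmem⟩ := ih fun J hJ => hl J (List.mem_cons_of_mem _ hJ)
    have hI := hl I List.mem_cons_self
    refine ⟨𝒯 ∪ tailInt 0 I '' 𝒯, hfin.union (hfin.image _), ?_, fun M hM => ?_⟩
    · rintro T (hT | ⟨T, hT, rfl⟩)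
      · exact h𝒯 T hT
      · exact ⟨tailInt_zero_mem (h𝒯 T hT).1 (h𝒯 T hT).2 hI, (h𝒯 T hT).2.tailInt le_rfl I⟩
    · have hW := Real.log_natCast_nonneg M
      have hR : (l.length : ℝ) * Real.log M + Real.log M = (I :: l).length * Real.log M := by
        rw [List.length_cons]; push_cast; ring
      have h1 := truncZeta_mem_translateSpan (hmem M hM) M I
      have h2 := (tailInt_mem_translateSpan hW h𝒯 (hmem M hM) hI).2
      rw [hR] at h1 h2
      change modelStep M I (model A M l) ∈ _
      refine add_mem (translateSpan_mono subset_union_left le_rfl h1) ?_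
      split_ifs
      · exact translateSpan_mono subset_union_right le_rfl h2
      · exact zero_mem _

lemma mass_prod_truncZeta_le {N : ℕ} (hN : 1 ≤ N) {L : ℝ} (hL : 0 ≤ L) (hNL : Real.log N ≤ L)
    (l : List (Finset (Fin n))) : mass 0 (l.map (truncZeta n N)).prod ≤ (1 + L) ^ l.length := by
  induction l with
  | nil => simp
  | cons J l ih =>
    rw [List.map_cons, List.prod_cons, List.length_cons, pow_succ']
    exact (mass_mul_le _ _ _).trans (mul_le_mul
      ((mass_truncZeta_le N hN J).trans (by linarith)) ih (mass_nonneg _ _) (by linarith))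

lemma exists_abs_sub_model_le (A B : ℕ) (l : List (Finset (Fin n))) (hl : ∀ I ∈ l, I.Nonempty) :
    ∃ C > 0, ∀ M N : ℕ, 2 ≤ M → M ≤ N → ∀ L : ℝ, 0 ≤ L → L < Real.log (N + 1 : ℕ) →
      Real.log N ≤ L → ∀ u : Fin n → ℝ, (∀ j, u j ≤ L) →
      |act (l.map (truncZeta n N)).prod (posPowProd A n) u - model A M l u| ≤
        C * (1 + L) ^ (n * A + l.length) / Real.log M ^ B := by
  induction l with
  | nil =>
    refine ⟨1, one_pos, fun M N hM hMN L hL _ hNL u hu => ?_⟩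
    have hM0 : 0 < Real.log M := Real.log_pos (by exact_mod_cast hM)
    rw [List.map_nil, List.prod_nil, map_one, model, List.foldr_nil, Module.End.one_apply, sub_self,
      abs_zero]
    positivity
  | cons I l ih =>
    have hl' : ∀ J ∈ l, J.Nonempty := fun J hJ => hl J (List.mem_cons_of_mem _ hJ)
    obtain ⟨C, hC, h⟩ := ih hl'
    obtain ⟨𝒯, -, h𝒯, hmem⟩ := exists_model_mem_translateSpan A l hl'
    have hI := hl I List.mem_cons_self
    obtain ⟨C₁, hC₁, h₁⟩ := exists_abs_truncZeta_sub_modelStep_le A B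
    refine ⟨C₁ + 2 * C, by positivity, fun M N hM hMN L hL hLN hNL u hu => ?_⟩
    have hM0 : 0 < Real.log M := Real.log_pos (by exact_mod_cast hM)
    have hML : Real.log M ≤ L :=
      (Real.log_le_log (by norm_cast; omega) (by exact_mod_cast hMN)).trans hNL
    have hW := hM0.le
    set r := (l.map (truncZeta n N)).prod with hr
    set F := act r (posPowProd A n) with hF
    have hΦ := integrableOn_translate (posPowProd_mem_piecewisePoly A n)
      (orthantSupported_posPowProd A n) hI hW
    have hmass : mass 0 r ≤ (1 + L) ^ l.length := mass_prod_truncZeta_le (by omega) hL hNL l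
    have hstep : |act (truncZeta n N I) F u - modelStep M I F u| ≤
        (1 + L) ^ l.length * (C₁ * L ^ (n * A) / Real.log M ^ B) := by
      rw [hF, modelStep_act hΦ, ← Module.End.mul_apply, ← map_mul, mul_comm, map_mul,
        Module.End.mul_apply, ← Pi.sub_apply, ← map_sub]
      refine (abs_act_le fun w hw => h₁ n I hI M N hM hMN L hL hLN w
        fun j => (hw j).trans (hu j)).trans ?_
      exact mul_le_mul_of_nonneg_right hmass (by positivity)
    have hmod : |modelStep M I F u - modelStep M I (model A M l) u| ≤
        2 * (1 + L) * (C * (1 + L) ^ (n * A + l.length) / Real.log M ^ B) :=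
      abs_modelStep_sub_le (by omega) hI (integrableOn_act hΦ r)
        (tailInt_mem_translateSpan hW h𝒯 (hmem M (by omega)) hI).1
        ((orthantSupported_posPowProd A n).act r)
        (orthantSupported_of_mem_translateSpan (fun T hT => (h𝒯 T hT).2) (hmem M (by omega)))
        hL hML (by positivity) hu
        fun w hw => h M N hM hMN L hL hLN hNL w fun j => (hw j).trans (hu j)
    rw [List.map_cons, List.prod_cons, map_mul, Module.End.mul_apply, List.length_cons]
    change |act (truncZeta n N I) F u - modelStep M I (model A M l) u| ≤ _
    have h3 : (1 + L) ^ l.length * (C₁ * L ^ (n * A) / Real.log M ^ B) ≤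
        C₁ * (1 + L) ^ (n * A + (l.length + 1)) / Real.log M ^ B := by
      rw [mul_div_assoc, mul_div_assoc, mul_left_comm, ← mul_div_assoc]
      refine mul_le_mul_of_nonneg_left ?_ hC₁.le
      refine div_le_div_of_nonneg_right ?_ (by positivity)
      calc (1 + L) ^ l.length * L ^ (n * A) ≤ (1 + L) ^ l.length * (1 + L) ^ (n * A) := by
            gcongr; linarith
        _ = (1 + L) ^ (n * A + l.length) * 1 := by rw [pow_add]; ring
        _ ≤ (1 + L) ^ (n * A + l.length) * (1 + L) := by gcongr; linarith
        _ = _ := by rw [← add_assoc, pow_succ]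
    calc _ ≤ _ := abs_sub_le _ (modelStep M I F u) _
      _ ≤ C₁ * (1 + L) ^ (n * A + (l.length + 1)) / Real.log M ^ B +
          2 * (1 + L) * (C * (1 + L) ^ (n * A + l.length) / Real.log M ^ B) :=
        add_le_add (hstep.trans h3) hmod
      _ = _ := by rw [← add_assoc, pow_succ]; ring

end Model

/-- `(log R)^{nA} · momentM (fA A) n R` as a function of `L = log R`. -/
noncomputable def logMoment (A n : ℕ) (L : ℝ) : ℝ :=
  sieveMoment A n ((Finset.Icc 1 ⌊Real.exp L⌋₊).filter Nat.Prime) L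

lemma momentM_mul_pow_eq_logMoment (A n : ℕ) {R : ℝ} (hR : 1 < R) :
    momentM (fA A) n R * Real.log R ^ (n * A) = logMoment A n (Real.log R) :=
  momentM_mul_pow A n hR (fun _ hp => (Finset.mem_filter.1 hp).2) fun p hp hpR =>
    Finset.mem_filter.2 ⟨Finset.mem_Icc.2 ⟨hp.one_lt.le, by
      rw [Real.exp_log (by linarith)]; exact Nat.le_floor hpR⟩, hp⟩

lemma sieveMoment_eq_logMoment (A n : ℕ) {L : ℝ} (hL : 0 < L) {P : Finset ℕ}
    (hP : ∀ p ∈ P, p.Prime) (hPL : ∀ p : ℕ, p.Prime → (p : ℝ) ≤ Real.exp L → p ∈ P) :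
    sieveMoment A n P L = logMoment A n L := by
  have h1 : 1 < Real.exp L := Real.one_lt_exp_iff.2 hL
  have h2 := momentM_mul_pow A n h1 hP hPL
  rw [momentM_mul_pow_eq_logMoment A n h1, Real.log_exp] at h2
  exact h2.symm

lemma exists_pow_mul_exp_le {δ : ℝ} (hδ : 0 < δ) (B : ℕ) : ∃ C > 0, ∀ W : ℝ, 0 < W →
    Real.exp (-δ * W) ≤ C / W ^ B := by
  refine ⟨B.factorial / δ ^ B, by positivity, fun W hW => ?_⟩
  have h1 := Real.pow_div_factorial_le_exp (δ * W) (by positivity) B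
  rw [neg_mul, Real.exp_neg, div_div, ← mul_pow, inv_le_comm₀ (Real.exp_pos _) (by positivity),
    inv_div]
  exact h1

lemma exists_polynomial_near_logMoment (A n : ℕ) : ∃ (κ : ℝ) (D : ℕ), 2 ≤ κ ∧ ∀ B : ℕ, ∃ C > 0,
    ∀ M : ℕ, 2 ≤ M → ∃ p : Polynomial ℝ, p.natDegree ≤ D ∧ ∀ L : ℝ, κ * Real.log M ≤ L →
      L ≤ 4 * κ * Real.log M → |logMoment A n L - p.eval L| ≤ C / Real.log M ^ B := by
  set l := (nonemptySubsets n).toList with hldef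
  have hl : ∀ I ∈ l, I.Nonempty := fun I hI =>
    Finset.nonempty_iff_ne_empty.2 (Finset.mem_erase.1 (Finset.mem_toList.1 hI)).1
  obtain ⟨𝒯, hfin, h𝒯, hmem⟩ := exists_model_mem_translateSpan A l hl
  obtain ⟨κ₀, D, hκ₀, hpoly⟩ := exists_polynomial_of_translateSpan hfin fun T hT => (h𝒯 T hT).1
  obtain ⟨δ, C₀, hδ, hC₀, hcorr⟩ := exists_mass_correction_le n
  set κ := 2 + κ₀ * (3 + l.length) with hκ
  have hκ2 : 2 ≤ κ := by rw [hκ]; linarith [mul_nonneg hκ₀ (by positivity : (0 : ℝ) ≤ 3 + l.length)]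
  refine ⟨κ, D, hκ2, fun B => ?_⟩
  set E := n * A + l.length with hE
  obtain ⟨C₁, hC₁, hmodel⟩ := exists_abs_sub_model_le (n := n) A (B + E) l hl
  obtain ⟨C₂, hC₂, hexp⟩ := exists_pow_mul_exp_le hδ (B + E)
  refine ⟨C₀ * ((C₁ + C₂) * (2 + 4 * κ) ^ E), by positivity, fun M hM => ?_⟩
  set W := Real.log M with hWdef
  have hW2 : 1 ≤ 2 * W := by
    have h1 : Real.log 2 ≤ W := Real.log_le_log (by norm_num) (by exact_mod_cast hM)
    linarith [Real.log_two_gt_d9]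
  have hW : 0 < W := by linarith
  set S := 4 * κ * W with hS
  have hWS : W ≤ S := by rw [hS]; nlinarith
  have hS0 : 0 ≤ S := hW.le.trans hWS
  set N := ⌊Real.exp S⌋₊ with hN
  have hMN : M ≤ N := Nat.le_floor (by
    rw [← Real.exp_log (by positivity : (0 : ℝ) < M)]; exact Real.exp_le_exp.2 hWS)
  have hNS : Real.log N ≤ S := by
    rw [Real.log_le_iff_le_exp (by exact_mod_cast (by omega : 0 < N))]
    exact Nat.floor_le (Real.exp_pos _).le
  have hSN : S < Real.log (N + 1 : ℕ) := by
    rw [Real.lt_log_iff_exp_lt (by positivity)]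
    push_cast
    exact Nat.lt_floor_add_one _
  set P := (Finset.Icc 1 N).filter Nat.Prime with hPdef
  have hP : ∀ p ∈ P, p.Prime := fun p hp => (Finset.mem_filter.1 hp).2
  have hPN : ∀ p : ℕ, p.Prime → p ≤ N → p ∈ P := fun p hp hpN =>
    Finset.mem_filter.2 ⟨Finset.mem_Icc.2 ⟨hp.one_lt.le, hpN⟩, hp⟩
  set g := correction n P with hg
  set F := act (l.map (truncZeta n N)).prod (posPowProd A n) with hF
  set G := model A M l with hG
  have hprod : (∏ I ∈ nonemptySubsets n, truncZeta n N I) = (l.map (truncZeta n N)).prod := by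
    rw [hldef, Finset.prod_map_toList]
  choose q hq hqL using hpoly (l.length * W) (by positivity) G (hmem M (by omega))
  set Θv : (Fin n → ℝ≥0) → ℝ := fun v => ∑ j, (v j : ℝ) with hΘ
  refine ⟨∑ v ∈ g.coeff.support with Θv v ≤ W, g.coeff v • q fun j => (v j : ℝ),
    Polynomial.natDegree_sum_le_of_forall_le _ _ fun v _ =>
      (Polynomial.natDegree_smul_le _ _).trans (hq _), fun L hL1 hL2 => ?_⟩
  have hL : 0 < L := lt_of_lt_of_le (by positivity) hL1
  have h1 : logMoment A n L = act g F fun _ => L := by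
    rw [← sieveMoment_eq_logMoment A n hL hP, sieveMoment_eq_act_correction hS0 hSN hP hPN hL2,
      hprod]
    intro p hp hpL
    exact hPN p hp (Nat.le_floor (hpL.trans (Real.exp_le_exp.2 hL2)))
  have h2 : (∑ v ∈ g.coeff.support with Θv v ≤ W, g.coeff v • q fun j => (v j : ℝ)).eval L =
      ∑ v ∈ g.coeff.support, if Θv v ≤ W then g.coeff v * G ((fun _ => L) - fun j => (v j : ℝ))
        else 0 := by
    rw [Polynomial.eval_finsetSum, Finset.sum_filter]
    refine Finset.sum_congr rfl fun v _ => ?_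
    split_ifs with hv
    · rw [Polynomial.eval_smul, smul_eq_mul, hqL]
      refine le_trans ?_ hL1
      have hnorm : ‖fun j => (v j : ℝ)‖ ≤ W := by
        refine (pi_norm_le_iff_of_nonneg hW.le).2 fun j => ?_
        refine (Real.norm_of_nonneg (v j).2).le.trans ?_
        exact (Finset.single_le_sum (f := fun j => (v j : ℝ)) (fun i _ => (v i).2)
          (Finset.mem_univ j)).trans hv
      calc κ₀ * (1 + l.length * W + ‖fun j => (v j : ℝ)‖) ≤ κ₀ * (2 * W + l.length * W + W) := by
            gcongr
        _ ≤ κ * W := by rw [hκ]; nlinarith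
    · rfl
  set X := (C₁ + C₂) * (2 + 4 * κ) ^ E / W ^ B with hX
  have hpow : (1 + S) ^ E / W ^ (B + E) ≤ (2 + 4 * κ) ^ E / W ^ B := by
    rw [div_le_div_iff₀ (by positivity) (by positivity)]
    calc (1 + S) ^ E * W ^ B ≤ ((2 + 4 * κ) * W) ^ E * W ^ B := by
          gcongr
          rw [hS]; linarith
      _ = _ := by rw [mul_pow, pow_add W]; ring
  have hFle : ∀ u : Fin n → ℝ, (∀ j, u j ≤ S) → |F u| ≤ (1 + S) ^ E := fun u hu => by
    refine (abs_act_le (K := S ^ (n * A)) fun w hw => ?_).trans ?_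
    · rw [abs_of_nonneg (posPowProd_nonneg A n w)]
      exact posPowProd_le hS0 fun j => (hw j).trans (hu j)
    · rw [hE, pow_add, mul_comm ((1 + S) ^ (n * A))]
      refine mul_le_mul (mass_prod_truncZeta_le (by omega) hS0 hNS l) ?_ (by positivity)
        (by positivity)
      gcongr; linarith
  have hterm : ∀ v ∈ g.coeff.support, |g.coeff v * F ((fun _ => L) - fun j => (v j : ℝ)) -
      if Θv v ≤ W then g.coeff v * G ((fun _ => L) - fun j => (v j : ℝ)) else 0| ≤
      |g.coeff v| * Real.exp (δ * Θv v) * X := by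
    intro v _
    have hu : ∀ j, ((fun _ => L) - fun j => (v j : ℝ) : Fin n → ℝ) j ≤ S := fun j => by
      simp only [Pi.sub_apply]
      linarith [(v j).2]
    have hΘ0 : 0 ≤ Θv v := Finset.sum_nonneg fun j _ => (v j).2
    split_ifs with hv
    · rw [← mul_sub, abs_mul, mul_assoc]
      refine mul_le_mul_of_nonneg_left ?_ (abs_nonneg _)
      calc _ ≤ C₁ * (1 + S) ^ E / W ^ (B + E) := hmodel M N hM hMN S hS0 hSN hNS _ hu
        _ = C₁ * ((1 + S) ^ E / W ^ (B + E)) := by ring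
        _ ≤ (C₁ + C₂) * ((2 + 4 * κ) ^ E / W ^ B) := by gcongr; linarith
        _ = 1 * X := by rw [hX]; ring
        _ ≤ _ := by
          gcongr
          exact Real.one_le_exp (by positivity)
    · rw [sub_zero, abs_mul, mul_assoc]
      refine mul_le_mul_of_nonneg_left ?_ (abs_nonneg _)
      have h3 : 1 ≤ Real.exp (δ * Θv v) * Real.exp (-δ * W) := by
        rw [← Real.exp_add]
        refine Real.one_le_exp ?_
        nlinarith [not_le.1 hv]
      calc _ ≤ (1 + S) ^ E := hFle _ hu
        _ ≤ (Real.exp (δ * Θv v) * Real.exp (-δ * W)) * (1 + S) ^ E :=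
          le_mul_of_one_le_left (by positivity) h3
        _ ≤ (Real.exp (δ * Θv v) * (C₂ / W ^ (B + E))) * (1 + S) ^ E := by
          gcongr
          exact hexp W hW
        _ = Real.exp (δ * Θv v) * (C₂ * ((1 + S) ^ E / W ^ (B + E))) := by ring
        _ ≤ Real.exp (δ * Θv v) * ((C₁ + C₂) * ((2 + 4 * κ) ^ E / W ^ B)) := by gcongr; linarith
        _ = _ := by rw [hX]; ring
  rw [h1, h2, act_apply, ← Finset.sum_sub_distrib]
  calc _ ≤ ∑ v ∈ g.coeff.support, |g.coeff v| * Real.exp (δ * Θv v) * X :=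
        (Finset.abs_sum_le_sum_abs _ _).trans (Finset.sum_le_sum hterm)
    _ = mass δ g * X := by rw [mass, Finsupp.sum, Finset.sum_mul]
    _ ≤ C₀ * X := by gcongr; exact hcorr P hP
    _ = _ := by rw [hX]; ring

section

open Filter Topology Polynomial

theorem exists_abs_coeff_le (D : ℕ) : ∃ K : ℝ, 0 < K ∧ ∀ (q : ℝ[X]), q.natDegree ≤ D →
    ∀ ε : ℝ, (∀ x ∈ Icc (2 : ℝ) 4, |q.eval x| ≤ ε) → ∀ j, |q.coeff j| ≤ K * ε := by
  set v : Fin (D + 1) → ℝ := fun i => 2 + (i : ℝ) / (D + 1) with hv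
  have hD : (0 : ℝ) < D + 1 := by positivity
  have hinj : Function.Injective v := fun a b hab => by
    have h1 : (a : ℝ) / (D + 1) = (b : ℝ) / (D + 1) := by simpa [hv] using hab
    rw [div_left_inj' hD.ne'] at h1
    exact Fin.ext (by exact_mod_cast h1)
  have hvmem : ∀ i, v i ∈ Icc (2 : ℝ) 4 := fun i => by
    have h1 : (i : ℝ) / (D + 1) ≤ 1 := by
      rw [div_le_one hD]
      exact_mod_cast i.2.le
    have h2 : 0 ≤ (i : ℝ) / (D + 1) := by positivity
    simp only [hv, mem_Icc]
    constructor <;> linarith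
  set K : ℝ := 1 + ∑ j ∈ Finset.range (D + 1), ∑ i, |(Lagrange.basis Finset.univ v i).coeff j|
    with hK
  have hK0 : 0 < K := by positivity
  refine ⟨K, hK0, fun q hq ε hε j => ?_⟩
  have hε0 : 0 ≤ ε := (abs_nonneg _).trans (hε 2 (by norm_num))
  by_cases hj : D < j
  · rw [coeff_eq_zero_of_natDegree_lt (hq.trans_lt hj), abs_zero]
    positivity
  have hqi : q = Lagrange.interpolate Finset.univ v fun i => q.eval (v i) := by
    refine Lagrange.eq_interpolate hinj.injOn ?_
    rw [Finset.card_univ, Fintype.card_fin]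
    exact (degree_le_natDegree).trans_lt (by exact_mod_cast Nat.lt_succ_of_le hq)
  have h1 : q.coeff j = ∑ i, q.eval (v i) * (Lagrange.basis Finset.univ v i).coeff j := by
    conv_lhs => rw [hqi]
    simp [Lagrange.interpolate_apply]
  rw [h1]
  calc _ ≤ ∑ i, ε * |(Lagrange.basis Finset.univ v i).coeff j| :=
        (Finset.abs_sum_le_sum_abs _ _).trans <| Finset.sum_le_sum fun i _ => by
          rw [abs_mul]
          exact mul_le_mul_of_nonneg_right (hε _ (hvmem i)) (abs_nonneg _)
    _ = (∑ i, |(Lagrange.basis Finset.univ v i).coeff j|) * ε := by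
        rw [← Finset.mul_sum, mul_comm]
    _ ≤ K * ε := by
        gcongr
        rw [hK]
        have := Finset.single_le_sum (s := Finset.range (D + 1))
          (f := fun j => ∑ i, |(Lagrange.basis Finset.univ v i).coeff j|)
          (fun _ _ => by positivity) (Finset.mem_range.2 (by omega : j < D + 1))
        linarith

/-- A function that is close to a polynomial of bounded degree on each dyadic scale is close to a
single polynomial. -/
theorem exists_polynomial_of_dyadic {h : ℝ → ℝ} {κ c C : ℝ} {D : ℕ} (hκ : 1 ≤ κ * c) (hc : 0 < c)
    (hC : 0 < C) (p : ℕ → ℝ[X]) (hp : ∀ i, (p i).natDegree ≤ D)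
    (hph : ∀ i L, κ * (2 ^ i * c) ≤ L → L ≤ 4 * κ * (2 ^ i * c) →
      |h L - (p i).eval L| ≤ C / (2 ^ i * c) ^ (D + 1)) :
    ∃ P : ℝ[X], ∃ C' : ℝ, 0 < C' ∧ ∀ L, κ * c ≤ L → |h L - P.eval L| ≤ C' / L := by
  have hκ0 : 0 < κ := by
    by_contra hcon
    nlinarith
  obtain ⟨K, hK, hcoeff⟩ := exists_abs_coeff_le D
  have hstep : ∀ i j, |(p (i + 1)).coeff j - (p i).coeff j| ≤
      2 * K * C / c ^ (D + 1) * ((1 / 2) ^ (D + 1)) ^ i := by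
    intro i j
    set s := κ * (2 ^ i * c) with hs
    have hs1 : 1 ≤ s := by
      have : (1 : ℝ) ≤ 2 ^ i := one_le_pow₀ (by norm_num)
      nlinarith
    set q := (p (i + 1) - p i).comp (Polynomial.C s * X) with hq
    have hqd : q.natDegree ≤ D := by
      refine natDegree_comp_le.trans ?_
      have h1 : (Polynomial.C s * X).natDegree ≤ 1 := (natDegree_C_mul_le _ _).trans natDegree_X_le
      have h2 : (p (i + 1) - p i).natDegree ≤ D :=
        (natDegree_sub_le _ _).trans (max_le (hp _) (hp _))
      nlinarith
    have h1 := hcoeff q hqd (2 * C / (2 ^ i * c) ^ (D + 1)) (fun x hx => ?_) j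
    · rw [hq, comp_C_mul_X_coeff, coeff_sub, abs_mul, abs_of_pos (by positivity : 0 < s ^ j)] at h1
      calc _ ≤ |(p (i + 1)).coeff j - (p i).coeff j| * s ^ j :=
            le_mul_of_one_le_right (abs_nonneg _) (one_le_pow₀ hs1)
        _ ≤ _ := h1
        _ = _ := by
          rw [mul_pow, ← pow_mul, one_div, inv_pow, inv_pow, ← pow_mul, mul_comm i]
          field_simp
    · have hx1 := hx.1
      have hx2 := hx.2
      have e1 := hph i (s * x) (by nlinarith) (by rw [show 4 * κ * (2 ^ i * c) = s * 4 by rw [hs]; ring]; gcongr)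
      have e2 := hph (i + 1) (s * x) (by rw [pow_succ]; nlinarith)
        (by rw [pow_succ]; nlinarith)
      have e3 : C / (2 ^ (i + 1) * c) ^ (D + 1) ≤ C / (2 ^ i * c) ^ (D + 1) := by
        gcongr
        · norm_num
        · omega
      have e4 : q.eval x = (p (i + 1)).eval (s * x) - (p i).eval (s * x) := by
        simp [hq]
      rw [e4, mul_div_assoc]
      rw [abs_le] at e1 e2 ⊢
      constructor <;> linarith
  have hr : ((1 : ℝ) / 2) ^ (D + 1) ≤ 1 / 2 := pow_le_of_le_one (by norm_num) (by norm_num) (by omega)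
  have hr1 : ((1 : ℝ) / 2) ^ (D + 1) < 1 := by linarith
  have hdist : ∀ j i, dist ((p i).coeff j) ((p (i + 1)).coeff j) ≤
      2 * K * C / c ^ (D + 1) * ((1 / 2) ^ (D + 1)) ^ i := fun j i => by
    rw [dist_comm, Real.dist_eq]
    exact hstep i j
  choose a ha using fun j => cauchySeq_tendsto_of_complete
    (cauchySeq_of_le_geometric _ _ hr1 (hdist j))
  have hlim : ∀ j i, |(p i).coeff j - a j| ≤ 4 * K * C / (2 ^ i * c) ^ (D + 1) := fun j i => by
    have h1 := dist_le_of_le_geometric_of_tendsto _ _ hr1 (hdist j) (ha j) i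
    rw [Real.dist_eq] at h1
    refine h1.trans ?_
    calc _ ≤ 2 * K * C / c ^ (D + 1) * ((1 / 2) ^ (D + 1)) ^ i / (1 / 2) := by
          gcongr
          linarith
      _ = _ := by
        rw [mul_pow, ← pow_mul, one_div, inv_pow, ← pow_mul, mul_comm i]
        field_simp
        ring
  refine ⟨∑ j ∈ Finset.range (D + 1), monomial j (a j),
    (C + (D + 1) * (4 * K * C)) * (2 * κ) ^ (D + 1), by positivity, fun L hL => ?_⟩
  have hL1 : 1 ≤ L := hκ.trans hL
  have hκc : 0 < κ * c := by positivity
  obtain ⟨m, hm1, hm2⟩ := exists_nat_pow_near (x := L / (κ * c)) (y := 2)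
    ((one_le_div hκc).2 hL) one_lt_two
  rw [le_div_iff₀ hκc] at hm1
  rw [div_lt_iff₀ hκc] at hm2
  set W := 2 ^ m * c with hW
  have hW0 : 0 < W := by positivity
  have hWL : L ≤ 2 * κ * W := by rw [hW]; rw [pow_succ] at hm2; nlinarith
  have e1 := hph m L (by rw [hW] at *; nlinarith) (by rw [← hW]; nlinarith)
  have e2 : |(p m).eval L - (∑ j ∈ Finset.range (D + 1), monomial j (a j)).eval L| ≤
      (D + 1) * (4 * K * C / W ^ (D + 1) * L ^ D) := by
    rw [eval_eq_sum_range' (Nat.lt_succ_of_le (hp m)), eval_finsetSum, ← Finset.sum_sub_distrib]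
    refine (Finset.abs_sum_le_sum_abs _ _).trans ?_
    calc _ ≤ ∑ j ∈ Finset.range (D + 1), 4 * K * C / W ^ (D + 1) * L ^ D :=
          Finset.sum_le_sum fun j hj => by
            rw [eval_monomial, ← sub_mul, abs_mul, abs_of_pos (by positivity : 0 < L ^ j)]
            refine mul_le_mul (hlim j m) (pow_le_pow_right₀ hL1 ?_) (by positivity) (by positivity)
            have := Finset.mem_range.1 hj
            omega
      _ = _ := by simp
  calc _ ≤ |h L - (p m).eval L| + |(p m).eval L -
        (∑ j ∈ Finset.range (D + 1), monomial j (a j)).eval L| := abs_sub_le _ _ _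
    _ ≤ C / W ^ (D + 1) * L ^ D + (D + 1) * (4 * K * C / W ^ (D + 1) * L ^ D) := by
        refine add_le_add (e1.trans ?_) e2
        exact le_mul_of_one_le_right (by positivity) (one_le_pow₀ hL1)
    _ = (C + (D + 1) * (4 * K * C)) * (L ^ D / W ^ (D + 1)) := by ring
    _ ≤ (C + (D + 1) * (4 * K * C)) * ((2 * κ) ^ (D + 1) / L) := by
        gcongr ?_ * ?_
        rw [div_le_div_iff₀ (by positivity) (by positivity), ← pow_succ, ← mul_pow]
        gcongr
    _ = _ := by ring

theorem exists_polynomial_abs_logMoment_sub_le (A n : ℕ) : ∃ P : ℝ[X], ∃ C L₀ : ℝ, 0 < C ∧ 1 ≤ L₀ ∧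
    ∀ L, L₀ ≤ L → |logMoment A n L - P.eval L| ≤ C / L := by
  obtain ⟨κ, D, hκ, h⟩ := exists_polynomial_near_logMoment A n
  obtain ⟨C, hC, hp⟩ := h (D + 1)
  choose p hpd hph using fun i : ℕ => hp (2 ^ 2 ^ i) (Nat.le_self_pow (by positivity) 2)
  have hlog : ∀ i : ℕ, Real.log ((2 ^ 2 ^ i : ℕ) : ℝ) = 2 ^ i * Real.log 2 := fun i => by
    push_cast
    rw [Real.log_pow]
    push_cast
    rfl
  simp only [hlog] at hph
  have hlog2 : 1 / 2 < Real.log 2 := by linarith [Real.log_two_gt_d9]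
  have hκ1 : 1 ≤ κ * Real.log 2 := by nlinarith
  obtain ⟨P, C', hC', hP⟩ := exists_polynomial_of_dyadic hκ1 (by linarith) hC p hpd hph
  exact ⟨P, C', κ * Real.log 2, hC', hκ1, hP⟩

end

/-- The real part of the prime zeta function at `1 + z`. -/
noncomputable def primeSum (z : ℂ) : ℝ := ∑' p : Nat.Primes, ((p : ℂ) ^ (-(1 + z))).re

lemma norm_prime_cpow {p : ℕ} (hp : 0 < p) (z : ℂ) :
    ‖(p : ℂ) ^ (-(1 + z))‖ = (p : ℝ) ^ (-(1 + z.re)) := by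
  rw [Complex.norm_natCast_cpow_of_pos hp]
  simp

lemma summable_norm_prime_cpow {z : ℂ} (hz : 0 < z.re) :
    Summable fun p : Nat.Primes => ‖(p : ℂ) ^ (-(1 + z))‖ := by
  simp_rw [fun p : Nat.Primes => norm_prime_cpow p.2.pos z]
  exact Nat.Primes.summable_rpow.2 (by linarith)

lemma summable_re_prime_cpow {z : ℂ} (hz : 0 < z.re) :
    Summable fun p : Nat.Primes => ((p : ℂ) ^ (-(1 + z))).re :=
  Summable.of_norm_bounded (summable_norm_prime_cpow hz) fun p => by
    rw [Real.norm_eq_abs]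
    exact Complex.abs_re_le_norm _

theorem exists_abs_primeSum_sub_log_zeta_le : ∃ C : ℝ, 0 < C ∧ ∀ z : ℂ, 0 < z.re →
    |primeSum z - Real.log ‖riemannZeta (1 + z)‖| ≤ C := by
  have hsum : Summable fun p : Nat.Primes => (p : ℝ) ^ (-2 : ℝ) :=
    Nat.Primes.summable_rpow.2 (by norm_num)
  refine ⟨1 + ∑' p : Nat.Primes, (p : ℝ) ^ (-2 : ℝ), ?_, fun z hz => ?_⟩
  · have : 0 ≤ ∑' p : Nat.Primes, (p : ℝ) ^ (-2 : ℝ) := tsum_nonneg fun p => by positivity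
    linarith
  have hs : 1 < (1 + z).re := by simpa using hz
  set f : Nat.Primes → ℂ := fun p => -Complex.log (1 - (p : ℂ) ^ (-(1 + z))) with hf
  have hfs : Summable f := by
    have := DirichletCharacter.summable_neg_log_one_sub_mul_prime_cpow (1 : DirichletCharacter ℂ 1) hs
    refine this.congr fun p => ?_
    rw [MulChar.one_apply (isUnit_of_subsingleton _), one_mul]
  have hlog : Real.log ‖riemannZeta (1 + z)‖ = ∑' p, (f p).re := by
    rw [← riemannZeta_eulerProduct_exp_log hs, Complex.norm_exp, Real.log_exp, Complex.re_tsum hfs]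
  have hfre : Summable fun p => (f p).re := (Complex.hasSum_re hfs.hasSum).summable
  have hterm : ∀ p : Nat.Primes, ‖((p : ℂ) ^ (-(1 + z))).re - (f p).re‖ ≤ (p : ℝ) ^ (-2 : ℝ) := by
    intro p
    set w := (p : ℂ) ^ (-(1 + z)) with hw
    have hp2 : (2 : ℝ) ≤ p := by exact_mod_cast p.2.two_le
    have hw1 : ‖w‖ ≤ (p : ℝ)⁻¹ := by
      rw [hw, norm_prime_cpow p.2.pos, ← Real.rpow_neg_one]
      exact Real.rpow_le_rpow_of_exponent_le (by linarith) (by linarith)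
    have hw2 : ‖w‖ ≤ 1 / 2 := hw1.trans (by rw [one_div]; gcongr)
    have h1 := Complex.norm_log_one_add_sub_self_le (z := -w) (by rw [norm_neg]; linarith)
    rw [norm_neg, ← sub_eq_add_neg, sub_neg_eq_add] at h1
    have h2 : w.re - (f p).re = (Complex.log (1 - w) + w).re := by
      have h3 : f p = -Complex.log (1 - w) := rfl
      rw [h3, Complex.neg_re, Complex.add_re]
      ring
    rw [h2, Real.norm_eq_abs]
    refine (Complex.abs_re_le_norm _).trans (h1.trans ?_)
    have h3 : (1 - ‖w‖)⁻¹ ≤ 2 := by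
      rw [inv_le_comm₀ (by linarith) (by norm_num)]
      linarith
    have h4 : (p : ℝ) ^ (-2 : ℝ) = ((p : ℝ)⁻¹) ^ 2 := by
      rw [Real.rpow_neg (by linarith), inv_pow]
      norm_cast
    rw [h4]
    calc _ ≤ ‖w‖ ^ 2 * 2 / 2 := by gcongr
      _ = ‖w‖ ^ 2 := by ring
      _ ≤ _ := by gcongr
  rw [hlog, primeSum, ← (summable_re_prime_cpow hz).tsum_sub hfre, ← Real.norm_eq_abs]
  have := tsum_of_norm_bounded hsum.hasSum hterm
  linarith

theorem exists_abs_primeSum_add_log_le {η : ℝ} (hη : 0 < η) (hη2 : η ≤ 1 / 2) :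
    ∃ C : ℝ, 0 < C ∧ ∀ z : ℂ, 0 < z.re → z.re ≤ 1 →
      |primeSum z + Real.log (min 1 ‖z‖)| ≤ C + η * Real.log (2 + |z.im|) := by
  obtain ⟨C₁, hC₁, h₁⟩ := exists_abs_primeSum_sub_log_zeta_le
  obtain ⟨C₂, hC₂, h₂⟩ := norm_riemannZeta₁_le (δ := η / 10) (by linarith) (by linarith)
  obtain ⟨c, hc, h₃⟩ := le_norm_riemannZeta₁ (δ := η / 10) (by linarith) (by linarith)
  refine ⟨C₁ + |Real.log C₂| + |Real.log c| + Real.log 3, by positivity, fun z hz hz1 => ?_⟩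
  have e1 := h₁ z hz
  have e2 := h₂ (1 + z) (by simp; linarith) (by simp; linarith)
  have e3 := h₃ (1 + z) (by simp; linarith) (by simp; linarith)
  have him : (1 + z).im = z.im := by simp
  rw [him] at e2 e3
  set X := 2 + |z.im| with hX
  have hX0 : 0 < X := by positivity
  have hX1 : 1 ≤ X := by rw [hX]; linarith [abs_nonneg z.im]
  have hz0 : z ≠ 0 := fun h => by simp [h] at hz
  have hnz : 0 < ‖z‖ := norm_pos_iff.2 hz0
  have hζ1 : 0 < ‖riemannZeta₁ (1 + z)‖ := lt_of_lt_of_le (by positivity) e3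
  have hζ : Real.log ‖riemannZeta (1 + z)‖ = Real.log ‖riemannZeta₁ (1 + z)‖ - Real.log ‖z‖ := by
    rw [riemannZeta₁_eq_mul (by simpa using hz0), norm_mul] at *
    simp only [add_sub_cancel_left] at *
    have h0 : ‖riemannZeta (1 + z)‖ ≠ 0 := fun h => by simp [h] at hζ1
    rw [Real.log_mul hnz.ne' h0]
    ring
  have f2 : Real.log ‖riemannZeta₁ (1 + z)‖ ≤ Real.log C₂ + (1 + 2 * (η / 10)) * Real.log X := by
    rw [← Real.log_rpow hX0, ← Real.log_mul hC₂.ne' (by positivity)]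
    exact Real.log_le_log hζ1 e2
  have f3 : Real.log c + (1 - 10 * (η / 10)) * Real.log X ≤ Real.log ‖riemannZeta₁ (1 + z)‖ := by
    rw [← Real.log_rpow hX0, ← Real.log_mul hc.ne' (by positivity)]
    exact Real.log_le_log (by positivity) e3
  have hlX : 0 ≤ Real.log X := Real.log_nonneg hX1
  have him2 := Complex.abs_im_le_norm z
  have hnle := Complex.norm_le_abs_re_add_abs_im z
  rw [abs_of_pos hz] at hnle
  have f4 : 0 ≤ Real.log X - Real.log ‖z‖ + Real.log (min 1 ‖z‖) ∧
      Real.log X - Real.log ‖z‖ + Real.log (min 1 ‖z‖) ≤ Real.log 3 := by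
    rcases le_total ‖z‖ 1 with h | h
    · rw [min_eq_right h]
      have : Real.log X ≤ Real.log 3 := Real.log_le_log hX0 (by linarith)
      constructor <;> linarith
    · rw [min_eq_left h, Real.log_one, add_zero, sub_nonneg]
      refine ⟨Real.log_le_log hnz (by linarith), ?_⟩
      rw [sub_le_iff_le_add, ← Real.log_mul (by norm_num) hnz.ne']
      exact Real.log_le_log hX0 (by linarith)
  have g1 := neg_abs_le (Real.log c)
  have g2 := le_abs_self (Real.log C₂)
  have g3 := abs_nonneg (Real.log c)
  have g4 := abs_nonneg (Real.log C₂)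
  have g5 : 0 ≤ η * Real.log X := by positivity
  rw [hζ] at e1
  rw [abs_le] at e1 ⊢
  constructor <;> nlinarith [e1.1, e1.2, f4.1, f4.2]

/-- The partial sum over a finite set of primes. -/
noncomputable def primeSumOn (P : Finset ℕ) (z : ℂ) : ℝ := ∑ p ∈ P, ((p : ℂ) ^ (-(1 + z))).re

theorem exists_abs_primeSumOn_sub_le {σ : ℝ} (hσ : 0 < σ) : ∃ N₀ : ℕ, ∀ N, N₀ ≤ N → ∀ z : ℂ,
    σ ≤ z.re → |primeSumOn ((Finset.Icc 1 N).filter Nat.Prime) z - primeSum z| ≤ 1 := by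
  have hs : Summable fun p : Nat.Primes => (p : ℝ) ^ (-(1 + σ)) :=
    Nat.Primes.summable_rpow.2 (by linarith)
  obtain ⟨T, hT⟩ := summable_iff_vanishing_norm.1 hs 1 one_pos
  refine ⟨T.sup fun p => (p : ℕ), fun N hN z hz => ?_⟩
  have hz0 : 0 < z.re := hσ.trans_le hz
  set f : Nat.Primes → ℝ := fun p => ((p : ℂ) ^ (-(1 + z))).re with hf
  have hfs : Summable f := summable_re_prime_cpow hz0
  set Q : Finset Nat.Primes := Finset.subtype Nat.Prime (Finset.Icc 1 N) with hQ
  have hTQ : T ⊆ Q := fun p hp => by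
    refine Finset.mem_subtype.2 (Finset.mem_Icc.2 ?_)
    exact ⟨p.2.one_lt.le, (Finset.le_sup (f := fun p : Nat.Primes => (p : ℕ)) hp).trans hN⟩
  have h1 : primeSumOn ((Finset.Icc 1 N).filter Nat.Prime) z = ∑ p ∈ Q, f p := by
    rw [primeSumOn, hQ, hf]
    exact (Finset.sum_subtype_eq_sum_filter (p := Nat.Prime) (s := Finset.Icc 1 N)
      fun p : ℕ => ((p : ℂ) ^ (-(1 + z))).re).symm
  have h2 : ∀ U : Finset Nat.Primes, Q ⊆ U → |∑ p ∈ Q, f p - ∑ p ∈ U, f p| ≤ 1 := fun U hU => by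
    rw [← Finset.sum_sdiff hU, sub_add_cancel_right, abs_neg]
    have h3 := (hT (U \ Q) (Finset.disjoint_of_subset_right hTQ Finset.sdiff_disjoint)).le
    refine (Finset.abs_sum_le_sum_abs _ _).trans (le_trans ?_ ((le_abs_self _).trans h3))
    refine Finset.sum_le_sum fun p _ => (Complex.abs_re_le_norm _).trans ?_
    rw [norm_prime_cpow p.2.pos]
    exact Real.rpow_le_rpow_of_exponent_le (by exact_mod_cast p.2.one_lt.le) (by linarith)
  rw [h1, primeSum]
  have h3 : Filter.Tendsto (fun U : Finset Nat.Primes => |∑ p ∈ Q, f p - ∑ p ∈ U, f p|) Filter.atTop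
      (nhds |∑ p ∈ Q, f p - ∑' p, f p|) := (tendsto_const_nhds.sub hfs.hasSum).abs
  exact le_of_tendsto h3 (Filter.eventually_atTop.2 ⟨Q, h2⟩)

section

open ComplexConjugate

/-- The partial Euler product of `1 / ζ` over the primes in `S`. -/
noncomputable def eulerFactor (S : Finset ℕ) (s : ℂ) : ℂ := ∏ p ∈ S, (1 - (p : ℂ) ^ (-s))

/-- The mixed moment of two Euler factors over a random set of primes. -/
noncomputable def starMoment (N : ℕ) (P : Finset ℕ) (s s' : ℂ) : ℝ :=
  ∑ S ∈ P.powerset, wt P S * (‖eulerFactor S s‖ ^ (2 * N) * ‖eulerFactor S s'‖ ^ 2)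

/-- The shifts occurring when `starMoment` is expanded: `s'` and its conjugate, together with `N`
copies of `s` and of its conjugate. -/
noncomputable def starShift {N : ℕ} (s s' : ℂ) (i : Bool × Fin (N + 1)) : ℂ :=
  if i.1 then (if i.2 = 0 then s' else s) else conj (if i.2 = 0 then s' else s)

lemma prod_starShift {N : ℕ} {f : ℂ → ℂ} (hf : ∀ z, f (conj z) = conj (f z)) (s s' : ℂ) :
    ∏ i : Bool × Fin (N + 1), f (starShift s s' i) = ((‖f s‖ ^ (2 * N) * ‖f s'‖ ^ 2 : ℝ) : ℂ) := by
  have h1 : ∀ z, f z * f (conj z) = ((‖f z‖ ^ 2 : ℝ) : ℂ) := fun z => by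
    rw [hf, Complex.mul_conj, Complex.normSq_eq_norm_sq]
  rw [Fintype.prod_prod_type, Fintype.prod_bool, ← Finset.prod_mul_distrib, Fin.prod_univ_succ]
  simp only [starShift, if_true, Bool.false_eq_true, if_false, Fin.succ_ne_zero, h1]
  rw [Finset.prod_const, Finset.card_univ, Fintype.card_fin, pow_mul]
  push_cast
  ring

lemma conj_natCast_cpow (p : ℕ) (z : ℂ) : (p : ℂ) ^ (-conj z) = conj ((p : ℂ) ^ (-z)) := by
  rw [← map_neg, Complex.cpow_conj _ _ (by simpa using Real.pi_pos.ne), Complex.conj_natCast]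

lemma exp_sub_le_one_add {x : ℝ} (hx : -(1 / 2) ≤ x) : Real.exp (x - 2 * x ^ 2) ≤ 1 + x := by
  have h1 := Real.add_one_le_exp (-(x - 2 * x ^ 2))
  have h2 : Real.exp (x - 2 * x ^ 2) * Real.exp (-(x - 2 * x ^ 2)) = 1 := by
    rw [← Real.exp_add, add_neg_cancel, Real.exp_zero]
  have h3 := Real.exp_pos (x - 2 * x ^ 2)
  have h4 : 0 ≤ x ^ 2 * (1 + 2 * x) := by
    have : 0 ≤ 1 + 2 * x := by linarith
    positivity
  have h5 : 0 < 1 - x + 2 * x ^ 2 := by nlinarith [sq_nonneg (x - 1 / 4)]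
  have h6 : Real.exp (x - 2 * x ^ 2) * (1 - x + 2 * x ^ 2) ≤ 1 := by
    rw [← h2]
    exact mul_le_mul_of_nonneg_left (by linarith) h3.le
  have h7 : 1 ≤ (1 + x) * (1 - x + 2 * x ^ 2) := by nlinarith
  by_contra hcon
  push Not at hcon
  nlinarith

/-- The exponent of the main term of `starMoment`. -/
noncomputable def starExponent (N : ℕ) (V : ℂ → ℝ) (s s' : ℂ) : ℝ :=
  ∑ I ∈ (Finset.univ : Finset (Finset (Bool × Fin (N + 1)))).erase ∅,
    (-1) ^ I.card * V (∑ i ∈ I, starShift s s' i)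

lemma starMoment_eq_prod (N : ℕ) (P : Finset ℕ) (s s' : ℂ) :
    starMoment N P s s' = ∏ p ∈ P, (1 + (1 / p : ℝ) *
      (‖1 - (p : ℂ) ^ (-s)‖ ^ (2 * N) * ‖1 - (p : ℂ) ^ (-s')‖ ^ 2 - 1)) := by
  have h := sum_wt_smul_prod (R := ℝ) P
    fun p => ‖1 - (p : ℂ) ^ (-s)‖ ^ (2 * N) * ‖1 - (p : ℂ) ^ (-s')‖ ^ 2
  simp only [smul_eq_mul] at h
  rw [← h, starMoment]
  refine Finset.sum_congr rfl fun S _ => ?_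
  rw [eulerFactor, eulerFactor, norm_prod, norm_prod, Finset.prod_mul_distrib, Finset.prod_pow,
    Finset.prod_pow]

lemma sum_star_term {N : ℕ} {p : ℕ} (hp : 0 < p) (s s' : ℂ) :
    (1 / p : ℝ) * (‖1 - (p : ℂ) ^ (-s)‖ ^ (2 * N) * ‖1 - (p : ℂ) ^ (-s')‖ ^ 2 - 1) =
      starExponent N (fun z => ((p : ℂ) ^ (-(1 + z))).re) s s' := by
  have hp0 : (p : ℂ) ≠ 0 := by exact_mod_cast hp.ne'
  have h1 := prod_starShift (N := N) (f := fun z => 1 - (p : ℂ) ^ (-z))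
    (fun z => by rw [conj_natCast_cpow, map_sub, map_one]) s s'
  have h2 := prod_one_sub_eq Finset.univ fun i : Bool × Fin (N + 1) =>
    (p : ℂ) ^ (-starShift s s' i)
  rw [h1, Finset.powerset_univ, ← Finset.add_sum_erase _ _ (Finset.mem_univ ∅)] at h2
  simp only [Finset.card_empty, pow_zero, Finset.prod_empty, mul_one] at h2
  have h3 : ∀ I : Finset (Bool × Fin (N + 1)), (1 / p : ℂ) * ∏ i ∈ I, (p : ℂ) ^ (-starShift s s' i) =
      (p : ℂ) ^ (-(1 + ∑ i ∈ I, starShift s s' i)) := fun I => by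
    rw [neg_add, Complex.cpow_add _ _ hp0, Complex.cpow_neg_one, ← Finset.sum_neg_distrib,
      one_div]
    simp only [Complex.cpow_def_of_ne_zero hp0, Finset.mul_sum, Complex.exp_sum]
  have h4 : (((1 / p : ℝ) * (‖1 - (p : ℂ) ^ (-s)‖ ^ (2 * N) * ‖1 - (p : ℂ) ^ (-s')‖ ^ 2 - 1) : ℝ) : ℂ) =
      ∑ I ∈ (Finset.univ : Finset (Finset (Bool × Fin (N + 1)))).erase ∅,
        (-1) ^ I.card * (p : ℂ) ^ (-(1 + ∑ i ∈ I, starShift s s' i)) := by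
    rw [Complex.ofReal_mul, Complex.ofReal_sub, h2]
    push_cast
    rw [add_sub_cancel_left, Finset.mul_sum]
    refine Finset.sum_congr rfl fun I _ => ?_
    rw [← h3]
    ring
  have h5 := congrArg Complex.re h4
  rw [Complex.ofReal_re] at h5
  rw [h5, starExponent, Complex.re_sum]
  refine Finset.sum_congr rfl fun I _ => ?_
  have : ((-1 : ℂ) ^ I.card) = (((-1 : ℝ) ^ I.card : ℝ) : ℂ) := by push_cast; rfl
  rw [this, Complex.re_ofReal_mul]

theorem exists_starMoment_bounds (N : ℕ) : ∃ K : ℝ, 0 < K ∧ ∀ (P : Finset ℕ), (∀ p ∈ P, p.Prime) →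
    ∀ s s' : ℂ, 0 ≤ s.re → 0 ≤ s'.re →
      Real.exp (starExponent N (primeSumOn P) s s' - K) ≤ starMoment N P s s' ∧
      starMoment N P s s' ≤ Real.exp (starExponent N (primeSumOn P) s s') := by
  set M : ℝ := 2 ^ (2 * N) * 2 ^ 2 with hM
  have hsum : Summable fun n : ℕ => 1 / (n : ℝ) ^ 2 := Real.summable_one_div_nat_pow.2 one_lt_two
  set Z := ∑' n : ℕ, 1 / (n : ℝ) ^ 2 with hZ
  have hZ0 : 0 ≤ Z := tsum_nonneg fun n => by positivity
  refine ⟨2 * M ^ 2 * Z + 1, by positivity, fun P hP s s' hs hs' => ?_⟩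
  set x : ℕ → ℝ := fun p => (1 / p : ℝ) *
    (‖1 - (p : ℂ) ^ (-s)‖ ^ (2 * N) * ‖1 - (p : ℂ) ^ (-s')‖ ^ 2 - 1) with hx
  have hexp : starExponent N (primeSumOn P) s s' = ∑ p ∈ P, x p := by
    rw [Finset.sum_congr rfl fun p hp => sum_star_term (hP p hp).pos s s']
    simp only [starExponent, primeSumOn, Finset.mul_sum]
    rw [Finset.sum_comm]
  have hn : ∀ p ∈ P, ∀ z : ℂ, 0 ≤ z.re → ‖1 - (p : ℂ) ^ (-z)‖ ≤ 2 := fun p hp z hz => by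
    refine (norm_sub_le _ _).trans ?_
    rw [norm_one, Complex.norm_natCast_cpow_of_pos (hP p hp).pos, Complex.neg_re]
    have : (p : ℝ) ^ (-z.re) ≤ 1 :=
      Real.rpow_le_one_of_one_le_of_nonpos (by exact_mod_cast (hP p hp).one_lt.le) (by linarith)
    linarith
  have hprod : ∀ p ∈ P, ‖1 - (p : ℂ) ^ (-s)‖ ^ (2 * N) * ‖1 - (p : ℂ) ^ (-s')‖ ^ 2 ≤ M :=
    fun p hp => by
      rw [hM]
      gcongr
      · exact hn p hp s hs
      · exact hn p hp s' hs'
  have hM1 : 1 ≤ M := by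
    have : (1 : ℝ) ≤ 2 ^ (2 * N) := one_le_pow₀ (by norm_num)
    rw [hM]
    nlinarith
  have hx1 : ∀ p ∈ P, -(1 / 2) ≤ x p := fun p hp => by
    have hp2 : (2 : ℝ) ≤ p := by exact_mod_cast (hP p hp).two_le
    have h1 : (1 / p : ℝ) ≤ 1 / 2 := by gcongr
    have h2 : (0 : ℝ) ≤ 1 / p := by positivity
    have h3 : 0 ≤ ‖1 - (p : ℂ) ^ (-s)‖ ^ (2 * N) * ‖1 - (p : ℂ) ^ (-s')‖ ^ 2 := by positivity
    rw [hx]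
    nlinarith
  have hx2 : ∀ p ∈ P, x p ^ 2 ≤ M ^ 2 * (1 / (p : ℝ) ^ 2) := fun p hp => by
    have h3 : 0 ≤ ‖1 - (p : ℂ) ^ (-s)‖ ^ (2 * N) * ‖1 - (p : ℂ) ^ (-s')‖ ^ 2 := by positivity
    have h4 := hprod p hp
    rw [hx, mul_pow, mul_comm, div_pow, one_pow]
    gcongr ?_ * _
    nlinarith
  have hx3 : ∑ p ∈ P, 2 * x p ^ 2 ≤ 2 * M ^ 2 * Z := by
    rw [← Finset.mul_sum, mul_assoc]
    gcongr
    calc _ ≤ ∑ p ∈ P, M ^ 2 * (1 / (p : ℝ) ^ 2) := Finset.sum_le_sum hx2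
      _ = M ^ 2 * ∑ p ∈ P, 1 / (p : ℝ) ^ 2 := by rw [Finset.mul_sum]
      _ ≤ _ := by
        gcongr
        exact hsum.sum_le_tsum P fun _ _ => by positivity
  rw [starMoment_eq_prod, hexp]
  constructor
  · calc _ ≤ Real.exp (∑ p ∈ P, (x p - 2 * x p ^ 2)) := by
          rw [Finset.sum_sub_distrib]
          exact Real.exp_le_exp.2 (by linarith)
      _ = ∏ p ∈ P, Real.exp (x p - 2 * x p ^ 2) := Real.exp_sum _ _
      _ ≤ _ := Finset.prod_le_prod (fun _ _ => (Real.exp_pos _).le)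
        fun p hp => exp_sub_le_one_add (hx1 p hp)
  · rw [Real.exp_sum]
    refine Finset.prod_le_prod (fun p hp => ?_) fun p _ => ?_
    · linarith [hx1 p hp]
    · linarith [Real.add_one_le_exp (x p)]

end

section

variable {N : ℕ}

/-- The number of unconjugated minus the number of conjugated shifts in `I`. -/
def imbalance (I : Finset (Bool × Fin (N + 1))) : ℤ := ∑ i ∈ I, if i.1 then 1 else -1

/-- The contribution of `s'` to the imbalance. -/
def centralImbalance (I : Finset (Bool × Fin (N + 1))) : ℤ :=
  (if (true, 0) ∈ I then 1 else 0) - if (false, 0) ∈ I then 1 else 0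

/-- The sets with zero imbalance. -/
def balancedSets (N : ℕ) : Finset (Finset (Bool × Fin (N + 1))) :=
  Finset.univ.filter fun I => imbalance I = 0

/-- The balanced sets consisting of one copy of `s'` and one of `s`. -/
def crossPairs (N : ℕ) : Finset (Finset (Bool × Fin (N + 1))) :=
  (Finset.univ : Finset (Bool × Fin N)).image fun x => {(x.1, 0), (!x.1, x.2.succ)}

lemma sum_eq_sum_univ_ite {ι M : Type*} [Fintype ι] [DecidableEq ι] [AddCommMonoid M]
    (I : Finset ι) (f : ι → M) : ∑ i ∈ I, f i = ∑ i, if i ∈ I then f i else 0 := by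
  rw [Finset.sum_ite_mem, Finset.univ_inter]

open scoped symmDiff in
lemma card_balancedSets (N : ℕ) : (balancedSets N).card = (2 * (N + 1)).choose (N + 1) := by
  set F : Finset (Bool × Fin (N + 1)) := Finset.univ.filter fun i => i.1 = false with hF
  have hFc : (F.card : ℤ) = N + 1 := by
    have : F = ({false} : Finset Bool) ×ˢ Finset.univ := by
      ext ⟨b, i⟩
      simp [hF]
    rw [this, Finset.card_product]
    simp
  have hcard : ∀ I, ((I ∆ F).card : ℤ) = N + 1 + imbalance I := fun I => by
    rw [imbalance, ← hFc, Finset.card_eq_sum_ones, Finset.card_eq_sum_ones, Nat.cast_sum,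
      Nat.cast_sum, sum_eq_sum_univ_ite (I ∆ F), sum_eq_sum_univ_ite F, sum_eq_sum_univ_ite I,
      ← Finset.sum_add_distrib]
    refine Finset.sum_congr rfl fun i _ => ?_
    obtain ⟨b, j⟩ := i
    by_cases hI : (b, j) ∈ I <;> cases b <;> simp [Finset.mem_symmDiff, hF, hI]
  have h2 : (Finset.univ : Finset (Bool × Fin (N + 1))).card = 2 * (N + 1) := by
    rw [Finset.card_univ, Fintype.card_prod]
    simp
  rw [← h2, ← Finset.card_powersetCard]
  refine Finset.card_bij' (fun I _ => I ∆ F) (fun J _ => J ∆ F) (fun I hI => ?_) (fun J hJ => ?_)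
    (fun I _ => symmDiff_symmDiff_cancel_right _ _) (fun J _ => symmDiff_symmDiff_cancel_right _ _)
  · have h3 := hcard I
    rw [(Finset.mem_filter.1 hI).2] at h3
    exact Finset.mem_powersetCard.2 ⟨Finset.subset_univ _, by omega⟩
  · have h3 := hcard (J ∆ F)
    rw [symmDiff_symmDiff_cancel_right, (Finset.mem_powersetCard.1 hJ).2] at h3
    exact Finset.mem_filter.2 ⟨Finset.mem_univ _, by omega⟩

lemma card_crossPairs (N : ℕ) : (crossPairs N).card = 2 * N := by
  rw [crossPairs, Finset.card_image_of_injective, Finset.card_univ, Fintype.card_prod]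
  · simp
  · rintro ⟨b, i⟩ ⟨c, j⟩ h
    have h' : ({(b, 0), (!b, i.succ)} : Finset (Bool × Fin (N + 1))) = {(c, 0), (!c, j.succ)} := h
    have h1 : (b, (0 : Fin (N + 1))) ∈ ({(c, 0), (!c, j.succ)} : Finset (Bool × Fin (N + 1))) := by
      rw [← h']
      simp
    have h2 : (!b, i.succ) ∈ ({(c, 0), (!c, j.succ)} : Finset (Bool × Fin (N + 1))) := by
      rw [← h']
      simp
    simp only [Finset.mem_insert, Finset.mem_singleton, Prod.mk.injEq, Fin.succ_ne_zero, and_true,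
      and_false, false_or, (Fin.succ_ne_zero _).symm, or_false, Fin.succ_inj] at h1 h2
    rw [h1, h2.2]

lemma crossPairs_subset (N : ℕ) : crossPairs N ⊆ (balancedSets N).erase ∅ := by
  intro I hI
  obtain ⟨⟨b, j⟩, -, rfl⟩ := Finset.mem_image.1 hI
  rw [Finset.mem_erase]
  refine ⟨Finset.insert_ne_empty _ _, Finset.mem_filter.2 ⟨Finset.mem_univ _, ?_⟩⟩
  rw [imbalance, Finset.sum_pair (by simp)]
  cases b <;> simp

lemma even_card_of_balanced {I : Finset (Bool × Fin (N + 1))} (h : imbalance I = 0) :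
    Even I.card := by
  have h1 : ((I.card : ℤ) : ZMod 2) = ((imbalance I : ℤ) : ZMod 2) := by
    rw [imbalance]
    push_cast
    rw [Finset.card_eq_sum_ones]
    push_cast
    refine Finset.sum_congr rfl fun i _ => ?_
    split_ifs
    · rfl
    · decide
  rw [h] at h1
  rw [← ZMod.natCast_eq_zero_iff_even]
  exact_mod_cast h1

lemma sum_neg_one_pow_unbalanced (N : ℕ) :
    ∑ I ∈ Finset.univ.filter (fun I : Finset (Bool × Fin (N + 1)) => ¬imbalance I = 0),
      (-1 : ℝ) ^ I.card = -((2 * (N + 1)).choose (N + 1) : ℕ) := by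
  have h1 : ∑ I : Finset (Bool × Fin (N + 1)), (-1 : ℝ) ^ I.card = 0 := by
    have h := prod_one_sub_eq (Finset.univ : Finset (Bool × Fin (N + 1))) fun _ => (1 : ℝ)
    simpa [eq_comm] using h
  rw [← Finset.sum_filter_add_sum_filter_not _ fun I => imbalance I = 0,
    Finset.sum_congr rfl fun I hI => (even_card_of_balanced (Finset.mem_filter.1 hI).2).neg_one_pow,
    Finset.sum_const, nsmul_one] at h1
  rw [← card_balancedSets, balancedSets]
  linarith

lemma re_sum_starShift {s s' : ℂ} (h : s'.re = s.re) (I : Finset (Bool × Fin (N + 1))) :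
    (∑ i ∈ I, starShift s s' i).re = I.card * s.re := by
  rw [Complex.re_sum, ← nsmul_eq_mul, ← Finset.sum_const]
  refine Finset.sum_congr rfl fun i _ => ?_
  unfold starShift
  split_ifs <;> simp [h]

lemma im_sum_starShift (s s' : ℂ) (I : Finset (Bool × Fin (N + 1))) :
    (∑ i ∈ I, starShift s s' i).im =
      (imbalance I - centralImbalance I) * s.im + centralImbalance I * s'.im := by
  have h1 : ∀ i : Bool × Fin (N + 1), (starShift s s' i).im =
      (if i.1 then 1 else -1) * s.im + if i.2 = 0 then (if i.1 then 1 else -1) * (s'.im - s.im) else 0 :=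
    fun i => by
      unfold starShift
      split_ifs <;> simp <;> ring
  have h2 : (∑ i ∈ I, if i.2 = 0 then ((if i.1 then 1 else -1) : ℝ) * (s'.im - s.im) else 0) =
      centralImbalance I * (s'.im - s.im) := by
    rw [sum_eq_sum_univ_ite, Fintype.sum_prod_type, Fintype.sum_bool, Fin.sum_univ_succ,
      Fin.sum_univ_succ]
    simp only [Fin.succ_ne_zero, if_false, ite_self, Finset.sum_const_zero, add_zero, if_true,
      centralImbalance]
    push_cast
    split_ifs <;> simp_all
  rw [Complex.im_sum, Finset.sum_congr rfl fun i _ => h1 i, Finset.sum_add_distrib, h2, imbalance,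
    ← Finset.sum_mul]
  push_cast
  ring

lemma abs_centralImbalance_le (I : Finset (Bool × Fin (N + 1))) :
    centralImbalance I = 0 ∨ centralImbalance I = 1 ∨ centralImbalance I = -1 := by
  unfold centralImbalance
  split_ifs <;> simp

end

section

variable {N : ℕ}

lemma log_min_one_le {K x y : ℝ} (hK : 1 ≤ K) (hx : 0 < x) (hy : 0 < y) (h : x ≤ K * y) :
    Real.log (min 1 x) ≤ Real.log K + Real.log (min 1 y) := by
  rw [← Real.log_mul (by positivity) (by positivity)]
  refine Real.log_le_log (by positivity) ?_
  rcases le_total 1 y with h1 | h1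
  · rw [min_eq_left h1, mul_one]
    exact (min_le_left _ _).trans hK
  · rw [min_eq_right h1]
    exact (min_le_right _ _).trans h

/-- The ordinates `t, t'` are of size `T`, up to the resolution `σ`. -/
structure SameScale (σ T t t' : ℝ) : Prop where
  nonneg : 0 ≤ t
  nonneg' : 0 ≤ t'
  le : t ≤ T
  le' : t' ≤ T
  scale_le : σ ≤ T
  lower : T = σ ∨ (2 * T / 3 ≤ t ∧ 2 * T / 3 ≤ t')

/-- `V` behaves like `z ↦ -log (min 1 ‖z‖)`. -/
def LogSingular (V : ℂ → ℝ) (C η : ℝ) : Prop :=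
  ∀ z : ℂ, 0 < z.re → z.re ≤ 1 → |V z + Real.log (min 1 ‖z‖)| ≤ C + η * Real.log (2 + |z.im|)

lemma card_le_two_mul (I : Finset (Bool × Fin (N + 1))) : (I.card : ℝ) ≤ 2 * N + 2 := by
  have h := Finset.card_le_univ I
  rw [Fintype.card_prod, Fintype.card_bool, Fintype.card_fin] at h
  have : (I.card : ℝ) ≤ (2 * (N + 1) : ℕ) := by exact_mod_cast h
  push_cast at this
  linarith

lemma abs_im_sum_starShift_le {s s' : ℂ} {T : ℝ} (h : |s.im| ≤ T) (h' : |s'.im| ≤ T)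
    (I : Finset (Bool × Fin (N + 1))) :
    |(∑ i ∈ I, starShift s s' i).im| ≤ (2 * N + 2) * T := by
  have hT : 0 ≤ T := (abs_nonneg _).trans h
  rw [Complex.im_sum]
  refine (Finset.abs_sum_le_sum_abs _ _).trans ?_
  calc _ ≤ ∑ i ∈ I, T := Finset.sum_le_sum fun i _ => by
        unfold starShift
        split_ifs <;> simpa
    _ = I.card * T := by rw [Finset.sum_const, nsmul_eq_mul]
    _ ≤ _ := by gcongr; exact card_le_two_mul I

lemma scale_le_of_unbalanced {σ T : ℝ} {s s' : ℂ} (hσ : 0 < σ) (hs : s.re = σ) (hs' : s'.re = σ)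
    (h : SameScale σ T s.im s'.im) {I : Finset (Bool × Fin (N + 1))} (hI : imbalance I ≠ 0) :
    T ≤ 3 * ‖∑ i ∈ I, starShift s s' i‖ := by
  have hne : I.Nonempty := Finset.nonempty_iff_ne_empty.2 fun h0 => hI (by simp [h0, imbalance])
  rcases h.lower with h1 | ⟨h1, h2⟩
  · have h3 := (le_abs_self _).trans (Complex.abs_re_le_norm (∑ i ∈ I, starShift s s' i))
    rw [re_sum_starShift (hs'.trans hs.symm), hs] at h3
    have h4 : (1 : ℝ) ≤ I.card := by exact_mod_cast hne.card_pos
    nlinarith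
  · have h3 := Complex.abs_im_le_norm (∑ i ∈ I, starShift s s' i)
    rw [im_sum_starShift] at h3
    set a := imbalance I - centralImbalance I with ha
    have hac : (imbalance I : ℝ) - centralImbalance I = a := by rw [ha]; push_cast; ring
    rw [hac] at h3
    have e1 := h.le
    have e2 := h.le'
    have e3 := h.nonneg
    have e4 := h.nonneg'
    have hT : 0 < T := hσ.trans_le h.scale_le
    have key : T / 3 ≤ |(a : ℝ) * s.im + centralImbalance I * s'.im| := by
      rcases abs_centralImbalance_le I with hc | hc | hc <;> rw [hc] at ha ⊢
      · have ha0 : a ≠ 0 := by omega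
        have : (1 : ℝ) ≤ |(a : ℝ)| := by exact_mod_cast Int.one_le_abs ha0
        push_cast
        rw [zero_mul, add_zero, abs_mul, abs_of_nonneg e3]
        nlinarith
      · rcases le_or_gt 0 a with h0 | h0
        · have : (0 : ℝ) ≤ a := by exact_mod_cast h0
          refine le_trans ?_ (le_abs_self _)
          push_cast
          nlinarith
        · have : (a : ℝ) ≤ -2 := by exact_mod_cast (by omega : a ≤ -2)
          refine le_trans ?_ (neg_le_abs _)
          push_cast
          nlinarith
      · rcases le_or_gt a 0 with h0 | h0
        · have : (a : ℝ) ≤ 0 := by exact_mod_cast h0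
          refine le_trans ?_ (neg_le_abs _)
          push_cast
          nlinarith
        · have : (2 : ℝ) ≤ a := by exact_mod_cast (by omega : 2 ≤ a)
          refine le_trans ?_ (le_abs_self _)
          push_cast
          nlinarith
    linarith

lemma norm_sum_starShift_le {σ T : ℝ} {s s' : ℂ} (hs : s.re = σ) (hs' : s'.re = σ) (hσ : 0 ≤ σ)
    (hσT : σ ≤ T) (h : |s.im| ≤ T) (h' : |s'.im| ≤ T) (I : Finset (Bool × Fin (N + 1))) :
    ‖∑ i ∈ I, starShift s s' i‖ ≤ (4 * N + 4) * T := by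
  refine (Complex.norm_le_abs_re_add_abs_im _).trans ?_
  have h1 := abs_im_sum_starShift_le h h' I
  rw [re_sum_starShift (hs'.trans hs.symm), hs, abs_of_nonneg (by positivity)]
  have h2 := card_le_two_mul I
  nlinarith

lemma le_norm_crossPair {σ : ℝ} {s s' : ℂ} (hσ : 0 < σ) (hs : s.re = σ) (hs' : s'.re = σ)
    {I : Finset (Bool × Fin (N + 1))} (hI : I ∈ crossPairs N) :
    σ + |s.im - s'.im| ≤ 2 * ‖∑ i ∈ I, starShift s s' i‖ := by
  obtain ⟨⟨b, j⟩, -, rfl⟩ := Finset.mem_image.1 hI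
  have h1 := Complex.abs_re_le_norm (∑ i ∈ {(b, 0), (!b, j.succ)}, starShift s s' i)
  have h2 := Complex.abs_im_le_norm (∑ i ∈ {(b, 0), (!b, j.succ)}, starShift s s' i)
  rw [Finset.sum_pair (by simp)] at h1 h2 ⊢
  have h3 : |(starShift s s' (b, (0 : Fin (N + 1))) + starShift s s' (!b, j.succ)).im| =
      |s.im - s'.im| := by
    cases b
    · simp [starShift, Fin.succ_ne_zero, neg_add_eq_sub]
    · simp [starShift, Fin.succ_ne_zero, ← sub_eq_add_neg, abs_sub_comm]
  have h4 : (starShift s s' (b, (0 : Fin (N + 1))) + starShift s s' (!b, j.succ)).re = 2 * σ := by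
    cases b <;> simp [starShift, Fin.succ_ne_zero, hs, hs'] <;> ring
  rw [h3] at h2
  rw [h4, abs_of_pos (by linarith)] at h1
  linarith

lemma abs_term_add_log_le {V : ℂ → ℝ} {C η σ T : ℝ} (hV : LogSingular V C η) (hη : 0 ≤ η)
    {s s' : ℂ} (hσ : 0 < σ) (hσ1 : (2 * N + 2) * σ ≤ 1) (hs : s.re = σ) (hs' : s'.re = σ)
    (h : |s.im| ≤ T) (h' : |s'.im| ≤ T) {I : Finset (Bool × Fin (N + 1))} (hI : I ≠ ∅) :
    |(-1) ^ I.card * V (∑ i ∈ I, starShift s s' i) +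
      (-1) ^ I.card * Real.log (min 1 ‖∑ i ∈ I, starShift s s' i‖)| ≤
      C + η * Real.log (2 * N + 2) + η * Real.log (2 + T) := by
  set z := ∑ i ∈ I, starShift s s' i with hz
  have hre : z.re = I.card * σ := by rw [hz, re_sum_starShift (hs'.trans hs.symm), hs]
  have hcard : (1 : ℝ) ≤ I.card := by
    exact_mod_cast (Finset.nonempty_iff_ne_empty.2 hI).card_pos
  have hcard2 := card_le_two_mul I
  have hT : 0 ≤ T := (abs_nonneg _).trans h
  have h1 := hV z (by rw [hre]; positivity) (by rw [hre]; nlinarith)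
  rw [← mul_add, abs_mul, abs_pow, abs_neg, abs_one, one_pow, one_mul, add_assoc, ← mul_add,
    ← Real.log_mul (by positivity) (by positivity)]
  refine h1.trans ?_
  gcongr
  have h2 := abs_im_sum_starShift_le h h' I
  rw [← hz] at h2
  have : (0 : ℝ) ≤ N := by positivity
  nlinarith

theorem starExponent_le {V : ℂ → ℝ} {C η σ T : ℝ} (hV : LogSingular V C η) (hC : 0 ≤ C) (hη : 0 ≤ η)
    {s s' : ℂ} (hσ : 0 < σ) (hσ1 : (2 * N + 2) * σ ≤ 1) (hs : s.re = σ) (hs' : s'.re = σ)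
    (h : SameScale σ T s.im s'.im) :
    starExponent N V s s' ≤
      (2 : ℝ) ^ (2 * (N + 1)) * (C + η * Real.log (2 * N + 2) + η * Real.log (2 + T) +
        Real.log (4 * N + 4)) +
      (((2 * (N + 1)).choose (N + 1) : ℕ) - 1 - 2 * N) * (-Real.log σ) +
      ((2 * (N + 1)).choose (N + 1) : ℕ) * Real.log (min 1 T) -
      2 * N * Real.log (min 1 (σ + |s.im - s'.im|)) := by
  classical
  have hT : 0 < T := hσ.trans_le h.scale_le
  have hN : (0 : ℝ) ≤ N := by positivity
  have hK : (1 : ℝ) ≤ 4 * N + 4 := by linarith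
  have ht : |s.im| ≤ T := by rw [abs_of_nonneg h.nonneg]; exact h.le
  have ht' : |s'.im| ≤ T := by rw [abs_of_nonneg h.nonneg']; exact h.le'
  have hσ2 : σ ≤ 1 := by nlinarith
  set b : ℕ := (2 * (N + 1)).choose (N + 1) with hb
  set y := σ + |s.im - s'.im| with hy
  have hy0 : 0 < y := by positivity
  set w : Finset (Bool × Fin (N + 1)) → ℝ := fun I =>
    if imbalance I = 0 then (if I ∈ crossPairs N then -Real.log (min 1 y) else -Real.log σ)
    else (-1) ^ I.card * -Real.log (min 1 T) with hw
  set D := C + η * Real.log (2 * N + 2) + η * Real.log (2 + T) + Real.log (4 * N + 4) with hD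
  have hD0 : 0 ≤ D := by
    have h1 : 0 ≤ Real.log (2 * N + 2) := Real.log_nonneg (by linarith)
    have h2 : 0 ≤ Real.log (2 + T) := Real.log_nonneg (by linarith)
    have h3 : 0 ≤ Real.log (4 * N + 4) := Real.log_nonneg hK
    positivity
  have hterm : ∀ I ∈ (Finset.univ : Finset (Finset (Bool × Fin (N + 1)))).erase ∅,
      (-1) ^ I.card * V (∑ i ∈ I, starShift s s' i) ≤ D + w I := by
    intro I hI
    have hI0 : I ≠ ∅ := (Finset.mem_erase.1 hI).1
    have h1 := (abs_le.1 (abs_term_add_log_le hV hη hσ hσ1 hs hs' ht ht' hI0)).2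
    set z := ∑ i ∈ I, starShift s s' i with hz
    have hzσ : σ ≤ ‖z‖ := by
      have h3 := (le_abs_self _).trans (Complex.abs_re_le_norm z)
      rw [hz, re_sum_starShift (hs'.trans hs.symm), hs, ← hz] at h3
      have h4 : (1 : ℝ) ≤ I.card := by
        exact_mod_cast (Finset.nonempty_iff_ne_empty.2 hI0).card_pos
      nlinarith
    have hz0 : 0 < ‖z‖ := hσ.trans_le hzσ
    suffices hsuff : -((-1) ^ I.card * Real.log (min 1 ‖z‖)) ≤ Real.log (4 * N + 4) + w I by
      linarith
    simp only [hw]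
    split_ifs with hbal hcross
    · rw [(even_card_of_balanced hbal).neg_one_pow, one_mul]
      have := log_min_one_le (K := 4 * N + 4) hK hy0 hz0
        ((le_norm_crossPair hσ hs hs' hcross).trans (by rw [← hz]; nlinarith))
      linarith
    · rw [(even_card_of_balanced hbal).neg_one_pow, one_mul]
      have := Real.log_le_log hσ (le_min hσ2 hzσ)
      have := Real.log_nonneg hK
      linarith
    · have h3 := log_min_one_le (K := 4 * N + 4) hK hT hz0
        ((scale_le_of_unbalanced hσ hs hs' h hbal).trans (by rw [← hz]; nlinarith))
      have h4 := log_min_one_le (K := 4 * N + 4) hK hz0 hT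
        (norm_sum_starShift_le hs hs' hσ.le h.scale_le ht ht' I)
      rcases neg_one_pow_eq_or ℝ I.card with h5 | h5 <;> rw [h5] <;> linarith
  have hsumw : ∑ I ∈ (Finset.univ : Finset (Finset (Bool × Fin (N + 1)))).erase ∅, w I =
      (b - 1 - 2 * N) * (-Real.log σ) + b * Real.log (min 1 T) - 2 * N * Real.log (min 1 y) := by
    have hempty : w ∅ = -Real.log σ := by
      have h1 : (∅ : Finset (Bool × Fin (N + 1))) ∉ crossPairs N := fun hcon =>
        (Finset.mem_erase.1 (crossPairs_subset N hcon)).1 rfl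
      simp only [hw]
      rw [if_pos (by simp [imbalance]), if_neg h1]
    have hcr : crossPairs N ⊆ balancedSets N :=
      (crossPairs_subset N).trans (Finset.erase_subset _ _)
    have hbalsum : ∑ I ∈ balancedSets N, (if I ∈ crossPairs N then -Real.log (min 1 y)
        else -Real.log σ) = 2 * N * (-Real.log (min 1 y)) + (b - 2 * N) * (-Real.log σ) := by
      rw [Finset.sum_ite, Finset.filter_mem_eq_inter, Finset.inter_eq_right.2 hcr,
        Finset.sum_const, Finset.sum_const, Finset.filter_notMem_eq_sdiff,
        Finset.card_sdiff_of_subset hcr, nsmul_eq_mul, nsmul_eq_mul,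
        Nat.cast_sub (Finset.card_le_card hcr), card_crossPairs, card_balancedSets]
      push_cast
      ring
    have hall : ∑ I, w I = 2 * N * (-Real.log (min 1 y)) + (b - 2 * N) * (-Real.log σ) +
        b * Real.log (min 1 T) := by
      simp only [hw]
      rw [Finset.sum_ite, ← Finset.sum_mul, sum_neg_one_pow_unbalanced]
      rw [balancedSets] at hbalsum
      rw [hbalsum]
      ring
    rw [← Finset.add_sum_erase _ _ (Finset.mem_univ ∅), hempty] at hall
    linarith
  have hcardU : (((Finset.univ : Finset (Finset (Bool × Fin (N + 1)))).erase ∅).card : ℝ) ≤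
      (2 : ℝ) ^ (2 * (N + 1)) := by
    have h1 : ((Finset.univ : Finset (Finset (Bool × Fin (N + 1)))).erase ∅).card ≤
        2 ^ (2 * (N + 1)) := by
      refine (Finset.card_erase_le).trans ?_
      rw [Finset.card_univ, Fintype.card_finset, Fintype.card_prod, Fintype.card_bool,
        Fintype.card_fin]
    exact_mod_cast h1
  calc starExponent N V s s' ≤ _ := Finset.sum_le_sum hterm
    _ = _ * D + _ := by rw [Finset.sum_add_distrib, Finset.sum_const, nsmul_eq_mul, hsumw]
    _ ≤ (2 : ℝ) ^ (2 * (N + 1)) * D + _ := by gcongr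
    _ = _ := by ring

end

section

variable {N : ℕ}

lemma card_erase_empty_le (N : ℕ) :
    (((Finset.univ : Finset (Finset (Bool × Fin (N + 1)))).erase ∅).card : ℝ) ≤
      (2 : ℝ) ^ (2 * (N + 1)) := by
  have h1 : ((Finset.univ : Finset (Finset (Bool × Fin (N + 1)))).erase ∅).card ≤
      2 ^ (2 * (N + 1)) := by
    refine (Finset.card_erase_le).trans ?_
    rw [Finset.card_univ, Fintype.card_finset, Fintype.card_prod, Fintype.card_bool,
      Fintype.card_fin]
  exact_mod_cast h1

lemma le_starExponent_of_terms {V : ℂ → ℝ} {s s' : ℂ} {D : ℝ}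
    {w : Finset (Bool × Fin (N + 1)) → ℝ} (hD : 0 ≤ D)
    (h : ∀ I : Finset (Bool × Fin (N + 1)), I ≠ ∅ →
      w I - D ≤ (-1) ^ I.card * V (∑ i ∈ I, starShift s s' i)) :
    ∑ I, w I - w ∅ - (2 : ℝ) ^ (2 * (N + 1)) * D ≤ starExponent N V s s' := by
  classical
  rw [← Finset.add_sum_erase _ _ (Finset.mem_univ (∅ : Finset (Bool × Fin (N + 1)))),
    add_sub_cancel_left]
  calc _ ≤ ∑ I ∈ (Finset.univ : Finset (Finset (Bool × Fin (N + 1)))).erase ∅, w I -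
        (((Finset.univ : Finset (Finset (Bool × Fin (N + 1)))).erase ∅).card : ℝ) * D := by
        gcongr
        exact card_erase_empty_le N
    _ = ∑ I ∈ (Finset.univ : Finset (Finset (Bool × Fin (N + 1)))).erase ∅, (w I - D) := by
        rw [Finset.sum_sub_distrib, Finset.sum_const, nsmul_eq_mul]
    _ ≤ _ := Finset.sum_le_sum fun I hI => h I (Finset.mem_erase.1 hI).1

/-- At a real point all the shifts are comparable to `σ`. -/
lemma le_starExponent_real {V : ℂ → ℝ} {C η σ : ℝ} (hV : LogSingular V C η) (hC : 0 ≤ C)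
    (hη : 0 ≤ η) (hσ : 0 < σ) (hσ1 : (2 * N + 2) * σ ≤ 1) :
    Real.log σ - (2 : ℝ) ^ (2 * (N + 1)) * (C + η * Real.log (2 * N + 2) + η * Real.log 4 +
        Real.log (2 * N + 2)) ≤ starExponent N V σ σ := by
  have hN : (0 : ℝ) ≤ N := by positivity
  have hl : 0 ≤ Real.log (2 * N + 2) := Real.log_nonneg (by linarith)
  have hl4 : 0 ≤ Real.log 4 := Real.log_nonneg (by norm_num)
  have h := le_starExponent_of_terms (N := N) (V := V) (s := (σ : ℂ)) (s' := (σ : ℂ))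
    (D := C + η * Real.log (2 * N + 2) + η * Real.log 4 + Real.log (2 * N + 2))
    (w := fun I => (-1) ^ I.card * -Real.log σ) (by positivity) fun I hI => ?_
  · rw [← Finset.sum_mul] at h
    have h1 : ∑ I : Finset (Bool × Fin (N + 1)), (-1 : ℝ) ^ I.card = 0 := by
      have h := prod_one_sub_eq (Finset.univ : Finset (Bool × Fin (N + 1))) fun _ => (1 : ℝ)
      simpa [eq_comm] using h
    rw [h1] at h
    simp only [Finset.card_empty, pow_zero, zero_mul, one_mul, zero_sub, neg_neg] at h
    exact h
  · have h1 := (abs_le.1 (abs_term_add_log_le (T := 2) hV hη hσ hσ1 (s := σ) (s' := σ) (by simp)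
      (by simp) (by simp) (by simp) hI)).1
    rw [show (2 + 2 : ℝ) = 4 by norm_num] at h1
    set z := ∑ i ∈ I, starShift (σ : ℂ) σ i with hz
    have hzre : z.re = I.card * σ := by rw [hz, re_sum_starShift rfl]; simp
    have hzim : z.im = 0 := by rw [hz, im_sum_starShift]; simp
    have hc1 : (1 : ℝ) ≤ I.card := by
      exact_mod_cast (Finset.nonempty_iff_ne_empty.2 hI).card_pos
    have hc2 := card_le_two_mul I
    have hzn : ‖z‖ = I.card * σ := by
      rw [← Complex.abs_re_eq_norm.2 hzim, hzre, abs_of_nonneg (by positivity)]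
    have h2 : min 1 ‖z‖ = I.card * σ := by
      rw [hzn, min_eq_right]; nlinarith
    rw [h2, Real.log_mul (by positivity) hσ.ne'] at h1
    have h3 : Real.log I.card ≤ Real.log (2 * N + 2) := Real.log_le_log (by linarith) hc2
    have h4 : 0 ≤ Real.log I.card := Real.log_nonneg hc1
    rcases neg_one_pow_eq_or ℝ I.card with h5 | h5 <;> rw [h5] at h1 ⊢ <;> linarith

/-- At a point of bounded ordinate exactly the balanced sets give a singularity. -/
lemma le_starExponent_diag {V : ℂ → ℝ} {C η σ t : ℝ} (hV : LogSingular V C η) (hC : 0 ≤ C)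
    (hη : 0 ≤ η) (hσ : 0 < σ) (hσ1 : (2 * N + 2) * σ ≤ 1) (ht : 1 ≤ t) (ht2 : t ≤ 2) :
    (((2 * (N + 1)).choose (N + 1) : ℕ) - 1) * -Real.log σ -
      (2 : ℝ) ^ (2 * (N + 1)) * (C + η * Real.log (2 * N + 2) + η * Real.log 4 +
        Real.log (2 * N + 2)) ≤ starExponent N V ⟨σ, t⟩ ⟨σ, t⟩ := by
  have hN : (0 : ℝ) ≤ N := by positivity
  have hl : 0 ≤ Real.log (2 * N + 2) := Real.log_nonneg (by linarith)
  have hl4 : 0 ≤ Real.log 4 := Real.log_nonneg (by norm_num)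
  have h := le_starExponent_of_terms (N := N) (V := V) (s := ⟨σ, t⟩) (s' := ⟨σ, t⟩)
    (D := C + η * Real.log (2 * N + 2) + η * Real.log 4 + Real.log (2 * N + 2))
    (w := fun I => if imbalance I = 0 then -Real.log σ else 0) (by positivity) fun I hI => ?_
  · rw [← Finset.sum_filter, Finset.sum_const, nsmul_eq_mul] at h
    rw [show (Finset.univ.filter fun I : Finset (Bool × Fin (N + 1)) => imbalance I = 0).card = _
      from card_balancedSets N, if_pos (by simp [imbalance])] at h
    linarith
  · have h1 := (abs_le.1 (abs_term_add_log_le (T := 2) hV hη hσ hσ1 (s := ⟨σ, t⟩) (s' := ⟨σ, t⟩)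
      rfl rfl (by rw [abs_of_pos] <;> simp <;> linarith)
      (by rw [abs_of_pos] <;> simp <;> linarith) hI)).1
    rw [show (2 + 2 : ℝ) = 4 by norm_num] at h1
    set z := ∑ i ∈ I, starShift (⟨σ, t⟩ : ℂ) ⟨σ, t⟩ i with hz
    have hzre : z.re = I.card * σ := by rw [hz, re_sum_starShift rfl]
    have hzim : z.im = imbalance I * t := by rw [hz, im_sum_starShift]; simp; ring
    have hc1 : (1 : ℝ) ≤ I.card := by
      exact_mod_cast (Finset.nonempty_iff_ne_empty.2 hI).card_pos
    have hc2 := card_le_two_mul I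
    change (if imbalance I = 0 then -Real.log σ else 0) - _ ≤ _
    split_ifs with hbal
    · have hzn : ‖z‖ = I.card * σ := by
        rw [← Complex.abs_re_eq_norm.2 (by rw [hzim, hbal]; simp), hzre,
          abs_of_nonneg (by positivity)]
      have h2 : min 1 ‖z‖ = I.card * σ := by
        rw [hzn, min_eq_right]; nlinarith
      rw [h2, Real.log_mul (by positivity) hσ.ne', (even_card_of_balanced hbal).neg_one_pow] at h1
      rw [(even_card_of_balanced hbal).neg_one_pow]
      have h3 : Real.log I.card ≤ Real.log (2 * N + 2) := Real.log_le_log (by linarith) hc2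
      linarith
    · have h2 : min 1 ‖z‖ = 1 := by
        refine min_eq_left (le_trans ?_ (Complex.abs_im_le_norm z))
        rw [hzim, abs_mul, abs_of_pos (by linarith : 0 < t)]
        have : (1 : ℝ) ≤ |(imbalance I : ℝ)| := by exact_mod_cast Int.one_le_abs hbal
        nlinarith
      rw [h2, Real.log_one, mul_zero] at h1
      linarith

lemma abs_starExponent_sub_le {V W : ℂ → ℝ} {σ : ℝ} {s s' : ℂ} (hσ : 0 ≤ σ) (hs : s.re = σ)
    (hs' : s'.re = σ) (h : ∀ z : ℂ, σ ≤ z.re → |V z - W z| ≤ 1) :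
    |starExponent N V s s' - starExponent N W s s'| ≤ (2 : ℝ) ^ (2 * (N + 1)) := by
  classical
  rw [starExponent, starExponent, ← Finset.sum_sub_distrib]
  refine (Finset.abs_sum_le_sum_abs _ _).trans ?_
  calc _ ≤ ∑ I ∈ (Finset.univ : Finset (Finset (Bool × Fin (N + 1)))).erase ∅, (1 : ℝ) := by
        refine Finset.sum_le_sum fun I hI => ?_
        rw [← mul_sub, abs_mul, abs_pow, abs_neg, abs_one, one_pow, one_mul]
        refine h _ ?_
        rw [re_sum_starShift (hs'.trans hs.symm), hs]
        have hc1 : (1 : ℝ) ≤ I.card := by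
          exact_mod_cast (Finset.nonempty_iff_ne_empty.2 (Finset.mem_erase.1 hI).1).card_pos
        nlinarith
    _ ≤ _ := by
        rw [Finset.sum_const, nsmul_eq_mul, mul_one]
        exact card_erase_empty_le N

/-- The primes up to `M`. -/
def primesUpTo (M : ℕ) : Finset ℕ := (Finset.Icc 1 M).filter Nat.Prime

lemma prime_of_mem_primesUpTo {M p : ℕ} (h : p ∈ primesUpTo M) : p.Prime := (Finset.mem_filter.1 h).2

/-- Upper and lower bounds for the mixed moments of the Euler factors over all small primes. -/
theorem exists_starMoment_le (N : ℕ) {ε : ℝ} (hε : 0 < ε) : ∃ C : ℝ, 0 < C ∧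
    ∀ σ : ℝ, 0 < σ → (2 * N + 2) * σ ≤ 1 → ∃ M₀ : ℕ, ∀ M, M₀ ≤ M → ∀ (s s' : ℂ) (T : ℝ),
      s.re = σ → s'.re = σ → SameScale σ T s.im s'.im →
      starMoment N (primesUpTo M) s s' ≤ C * (2 + T) ^ ε *
        ((min 1 T) ^ (2 * (N + 1)).choose (N + 1) *
          (σ ^ (2 * N + 1) / σ ^ (2 * (N + 1)).choose (N + 1))) /
        (min 1 (σ + |s.im - s'.im|)) ^ (2 * N) := by
  set B : ℝ := (2 : ℝ) ^ (2 * (N + 1)) with hB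
  have hB0 : 0 < B := by positivity
  set η := min (1 / 2) (ε / B) with hη
  have hη0 : 0 < η := by positivity
  obtain ⟨C, hC, hV⟩ := exists_abs_primeSum_add_log_le hη0 (min_le_left _ _)
  obtain ⟨K, hK, hmom⟩ := exists_starMoment_bounds N
  refine ⟨Real.exp (B * (C + η * Real.log (2 * N + 2) + Real.log (4 * N + 4)) + B),
    by positivity, fun σ hσ hσ1 => ?_⟩
  obtain ⟨M₀, hM₀⟩ := exists_abs_primeSumOn_sub_le hσ
  refine ⟨M₀, fun M hM s s' T hs hs' h => ?_⟩
  have hT : 0 < T := hσ.trans_le h.scale_le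
  refine (hmom (primesUpTo M) (fun p hp => prime_of_mem_primesUpTo hp) s s' (by rw [hs]; exact hσ.le)
    (by rw [hs']; exact hσ.le)).2.trans ?_
  have h1 := (abs_le.1 (abs_starExponent_sub_le (N := N) hσ.le hs hs' (hM₀ M hM))).2
  have h2 := starExponent_le (N := N) (V := primeSum) (fun z h0 h1 => hV z h0 h1) hC.le hη0.le hσ hσ1 hs hs' h
  set y := min 1 (σ + |s.im - s'.im|) with hy
  have hy0 : 0 < y := by positivity
  set b := (2 * (N + 1)).choose (N + 1) with hb
  have h3 : B * (η * Real.log (2 + T)) ≤ ε * Real.log (2 + T) := by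
    rw [← mul_assoc]
    refine mul_le_mul_of_nonneg_right ?_ (Real.log_nonneg (by linarith))
    rw [← le_div_iff₀' hB0]
    exact min_le_right _ _
  have hmT : 0 < min 1 T := by positivity
  have e1 : (2 + T) ^ ε = Real.exp (ε * Real.log (2 + T)) := by
    rw [Real.rpow_def_of_pos (by linarith), mul_comm]
  have hpow : ∀ {x : ℝ} (m : ℕ), 0 < x → x ^ m = Real.exp (m * Real.log x) := fun m hx => by
    rw [Real.exp_nat_mul, Real.exp_log hx]
  rw [e1, hpow b hmT, hpow (2 * N + 1) hσ, hpow b hσ, hpow (2 * N) hy0, ← Real.exp_sub,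
    ← Real.exp_add, ← Real.exp_add, ← Real.exp_add, ← Real.exp_sub]
  refine Real.exp_le_exp.2 ?_
  change starExponent N (primeSumOn (primesUpTo M)) s s' - starExponent N primeSum s s' ≤ B at h1
  push_cast
  nlinarith

theorem exists_le_starMoment (N : ℕ) : ∃ c : ℝ, 0 < c ∧
    ∀ σ : ℝ, 0 < σ → (2 * N + 2) * σ ≤ 1 → ∃ M₀ : ℕ, ∀ M, M₀ ≤ M →
      c * σ ≤ starMoment N (primesUpTo M) σ σ ∧
      ∀ t : ℝ, 1 ≤ t → t ≤ 2 → c * (σ / σ ^ (2 * (N + 1)).choose (N + 1)) ≤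
        starMoment N (primesUpTo M) ⟨σ, t⟩ ⟨σ, t⟩ := by
  set B : ℝ := (2 : ℝ) ^ (2 * (N + 1)) with hB
  obtain ⟨C, hC, hV⟩ := exists_abs_primeSum_add_log_le (η := 1 / 2) (by norm_num) le_rfl
  obtain ⟨K, hK, hmom⟩ := exists_starMoment_bounds N
  set D := C + 1 / 2 * Real.log (2 * N + 2) + 1 / 2 * Real.log 4 + Real.log (2 * N + 2) with hD
  refine ⟨Real.exp (-(B * D + B + K)), by positivity, fun σ hσ hσ1 => ?_⟩
  obtain ⟨M₀, hM₀⟩ := exists_abs_primeSumOn_sub_le hσ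
  have hpow : ∀ {x : ℝ} (m : ℕ), 0 < x → x ^ m = Real.exp (m * Real.log x) := fun m hx => by
    rw [Real.exp_nat_mul, Real.exp_log hx]
  refine ⟨M₀, fun M hM => ⟨?_, fun t ht ht2 => ?_⟩⟩
  · refine le_trans ?_ (hmom (primesUpTo M) (fun p hp => prime_of_mem_primesUpTo hp) σ σ
      (by simpa using hσ.le) (by simpa using hσ.le)).1
    have h1 := (abs_le.1 (abs_starExponent_sub_le (N := N) (s := σ) (s' := σ) hσ.le (by simp)
      (by simp) (hM₀ M hM))).1
    have h2 := le_starExponent_real (N := N) (V := primeSum) (fun z h0 h1 => hV z h0 h1) hC.le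
      (by norm_num) hσ hσ1
    rw [← hD, ← hB] at h2
    change -B ≤ starExponent N (primeSumOn (primesUpTo M)) σ σ - starExponent N primeSum σ σ at h1
    have e : σ = Real.exp (Real.log σ) := (Real.exp_log hσ).symm
    refine (congrArg (Real.exp (-(B * D + B + K)) * ·) e).le.trans ?_
    rw [← Real.exp_add]
    refine Real.exp_le_exp.2 ?_
    linarith
  · refine le_trans ?_ (hmom (primesUpTo M) (fun p hp => prime_of_mem_primesUpTo hp) ⟨σ, t⟩ ⟨σ, t⟩
      hσ.le hσ.le).1
    have h1 := (abs_le.1 (abs_starExponent_sub_le (N := N) (s := ⟨σ, t⟩) (s' := ⟨σ, t⟩) hσ.le rfl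
      rfl (hM₀ M hM))).1
    have h2 := le_starExponent_diag (N := N) (V := primeSum) (fun z h0 h1 => hV z h0 h1) hC.le
      (by norm_num) hσ hσ1 ht ht2
    rw [← hD, ← hB] at h2
    change -B ≤ starExponent N (primeSumOn (primesUpTo M)) ⟨σ, t⟩ ⟨σ, t⟩ - _ at h1
    have e : σ / σ ^ (2 * (N + 1)).choose (N + 1) =
        Real.exp (Real.log σ - ((2 * (N + 1)).choose (N + 1) : ℕ) * Real.log σ) := by
      rw [Real.exp_sub, ← hpow _ hσ, Real.exp_log hσ]
    rw [e, ← Real.exp_add]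
    refine Real.exp_le_exp.2 ?_
    linarith

end

lemma lap_pow (A : ℕ) : ∀ {s : ℂ}, 0 < s.re →
    lap (fun u => (u : ℂ) ^ A) s = A.factorial / s ^ (A + 1) := by
  induction A with
  | zero =>
    intro s hs
    have h := integral_exp_mul_complex_Ioi (a := -s) (by simpa using hs) 0
    simp only [lap, pow_zero, one_mul]
    rw [h]
    simp
  | succ A ih =>
    intro s hs
    have hs0 : s ≠ 0 := by rintro rfl; simp at hs
    have h1 := hasDerivAt_lap (f := fun u : ℝ => (u : ℂ) ^ A) (by fun_prop) (C := 1) (K := A)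
      (fun u hu => by
        rw [norm_pow, Complex.norm_real, Real.norm_of_nonneg hu.le, one_mul]
        exact pow_le_pow_left₀ hu.le (by linarith) A) hs
    have h2 : HasDerivAt (fun s : ℂ => (A.factorial : ℂ) * (s ^ (A + 1))⁻¹)
        (A.factorial * (-((A + 1 : ℕ) * s ^ A) / (s ^ (A + 1)) ^ 2)) s := by
      have := ((hasDerivAt_pow (A + 1) s).inv (pow_ne_zero _ hs0)).const_mul (A.factorial : ℂ)
      exact this
    have h3 : (fun s : ℂ => (A.factorial : ℂ) * (s ^ (A + 1))⁻¹) =ᶠ[nhds s]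
        lap (fun u => (u : ℂ) ^ A) := by
      filter_upwards [(isOpen_lt continuous_const Complex.continuous_re).mem_nhds hs] with z hz
      rw [ih hz, div_eq_mul_inv]
    have h4 := (h1.congr_of_eventuallyEq h3).unique h2
    have h5 : lap (fun u : ℝ => -(u : ℂ) * (u : ℂ) ^ A) s = -lap (fun u => (u : ℂ) ^ (A + 1)) s := by
      rw [lap, lap, ← integral_neg]
      refine integral_congr_ae (.of_forall fun u => ?_)
      simp only
      ring
    rw [h5] at h4
    rw [← neg_inj, h4, Nat.factorial_succ]
    push_cast
    field_simp
    ring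

lemma posPow_eq_zero {A : ℕ} {u : ℝ} (hu : u < 0) : posPow A u = 0 := by
  rw [posPow, if_neg (not_le.2 hu)]

lemma posPow_eq_pow {A : ℕ} {u : ℝ} (hu : 0 ≤ u) : posPow A u = u ^ A := by
  rw [posPow, if_pos hu]

lemma integrable_posPow_mul_exp (A : ℕ) {s : ℂ} (hs : 0 < s.re) :
    Integrable fun u : ℝ => (posPow A u : ℂ) * Complex.exp (-s * u) := by
  rw [← integrableOn_univ, ← Iio_union_Ici (a := (0 : ℝ)), integrableOn_union]
  constructor
  · refine integrableOn_zero.congr_fun (fun u hu => ?_) measurableSet_Iio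
    simp [posPow_eq_zero hu]
  · rw [integrableOn_Ici_iff_integrableOn_Ioi]
    refine (integrableOn_lap (f := fun u : ℝ => (u : ℂ) ^ A) (by fun_prop) (C := 1) (K := A)
      (fun u hu => ?_) hs).congr_fun (fun u hu => ?_) measurableSet_Ioi
    · rw [norm_pow, Complex.norm_real, Real.norm_of_nonneg hu.le, one_mul]
      exact pow_le_pow_left₀ hu.le (by linarith) A
    · simp [posPow_eq_pow (le_of_lt (mem_Ioi.1 hu))]

lemma integral_posPow_mul_exp (A : ℕ) {s : ℂ} (hs : 0 < s.re) :
    ∫ u : ℝ, (posPow A u : ℂ) * Complex.exp (-s * u) = A.factorial / s ^ (A + 1) := by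
  rw [← lap_pow A hs, lap, ← setIntegral_univ,
    ← integral_Ici_eq_integral_Ioi]
  symm
  refine (setIntegral_congr_fun measurableSet_Ici (g := fun u : ℝ => (posPow A u : ℂ) *
    Complex.exp (-s * u)) fun u hu => ?_).trans ?_
  · simp [posPow_eq_pow (mem_Ici.1 hu)]
  · symm
    refine setIntegral_eq_of_subset_of_forall_sdiff_eq_zero MeasurableSet.univ (subset_univ _)
      fun u hu => ?_
    simp [posPow_eq_zero (not_le.1 fun h => hu.2 h)]

lemma measurable_posPow (A : ℕ) : Measurable (posPow A) := (posPow_mono A).measurable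

lemma measurable_sieveSum (A : ℕ) (S : Finset ℕ) : Measurable (sieveSum A S) := by
  unfold sieveSum
  exact Finset.measurable_sum _ fun T _ =>
    ((measurable_posPow A).comp (measurable_id.sub_const _)).const_mul _

lemma sum_log_nonneg (T : Finset ℕ) : 0 ≤ ∑ p ∈ T, Real.log (p : ℝ) :=
  Finset.sum_nonneg fun p _ => Real.log_natCast_nonneg p

lemma abs_sieveSum_le (A : ℕ) (S : Finset ℕ) (u : ℝ) :
    |sieveSum A S u| ≤ 2 ^ S.card * posPow A u := by
  refine (Finset.abs_sum_le_sum_abs _ _).trans ?_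
  calc _ ≤ ∑ T ∈ S.powerset, posPow A u := Finset.sum_le_sum fun T _ => by
        rw [abs_mul, abs_pow, abs_neg, abs_one, one_pow, one_mul, abs_of_nonneg (posPow_nonneg _ _)]
        exact posPow_mono A (by linarith [sum_log_nonneg T])
    _ = _ := by rw [Finset.sum_const, Finset.card_powerset, nsmul_eq_mul]; push_cast; rfl

lemma sieveSum_eq_zero {A : ℕ} {S : Finset ℕ} {u : ℝ} (hu : u < 0) : sieveSum A S u = 0 := by
  have := abs_sieveSum_le A S u
  rw [posPow_eq_zero hu, mul_zero] at this
  exact abs_eq_zero.1 (le_antisymm this (abs_nonneg _))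

lemma exp_neg_mul_sum_log {S : Finset ℕ} (hS : ∀ p ∈ S, p.Prime) (s : ℂ) :
    Complex.exp (-s * (∑ p ∈ S, Real.log p : ℝ)) = ∏ p ∈ S, (p : ℂ) ^ (-s) := by
  push_cast
  rw [Finset.mul_sum, Complex.exp_sum]
  refine Finset.prod_congr rfl fun p hp => ?_
  rw [Complex.cpow_def_of_ne_zero (by exact_mod_cast (hS p hp).ne_zero), mul_comm]

lemma integrable_posPow_sub_mul_exp (A : ℕ) {s : ℂ} (hs : 0 < s.re) (a : ℝ) :
    Integrable fun u : ℝ => (posPow A (u - a) : ℂ) * Complex.exp (-s * u) := by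
  have h := ((integrable_posPow_mul_exp A hs).comp_sub_right a).const_mul (Complex.exp (-s * a))
  refine h.congr (.of_forall fun u => ?_)
  simp only
  rw [mul_left_comm, ← Complex.exp_add]
  congr 2
  push_cast
  ring

lemma integral_posPow_sub_mul_exp (A : ℕ) {s : ℂ} (hs : 0 < s.re) (a : ℝ) :
    ∫ u : ℝ, (posPow A (u - a) : ℂ) * Complex.exp (-s * u) =
      Complex.exp (-s * a) * (A.factorial / s ^ (A + 1)) := by
  rw [← integral_posPow_mul_exp A hs, ← integral_sub_right_eq_self
    (fun u : ℝ => (posPow A u : ℂ) * Complex.exp (-s * u)) a, ← integral_const_mul]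
  refine integral_congr_ae (.of_forall fun u => ?_)
  simp only
  rw [mul_left_comm, ← Complex.exp_add]
  congr 2
  push_cast
  ring

lemma sieveSum_mul_exp_eq (A : ℕ) (S : Finset ℕ) (s : ℂ) (u : ℝ) :
    (sieveSum A S u : ℂ) * Complex.exp (-s * u) = ∑ T ∈ S.powerset, (-1) ^ T.card *
      ((posPow A (u - ∑ p ∈ T, Real.log p) : ℂ) * Complex.exp (-s * u)) := by
  rw [sieveSum]
  push_cast
  rw [Finset.sum_mul]
  exact Finset.sum_congr rfl fun T _ => by ring

lemma integrable_sieveSum_mul_exp (A : ℕ) (S : Finset ℕ) {s : ℂ} (hs : 0 < s.re) :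
    Integrable fun u : ℝ => (sieveSum A S u : ℂ) * Complex.exp (-s * u) := by
  simp only [sieveSum_mul_exp_eq]
  exact integrable_finsetSum _ fun T _ => (integrable_posPow_sub_mul_exp A hs _).const_mul _

/-- The Laplace transform of the sieve weight is an Euler factor. -/
theorem integral_sieveSum_mul_exp (A : ℕ) {S : Finset ℕ} (hS : ∀ p ∈ S, p.Prime) {s : ℂ}
    (hs : 0 < s.re) : ∫ u : ℝ, (sieveSum A S u : ℂ) * Complex.exp (-s * u) =
      A.factorial / s ^ (A + 1) * eulerFactor S s := by
  simp only [sieveSum_mul_exp_eq]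
  rw [integral_finsetSum _ fun T _ => (integrable_posPow_sub_mul_exp A hs _).const_mul _,
    eulerFactor, prod_one_sub_eq, Finset.mul_sum]
  refine Finset.sum_congr rfl fun T hT => ?_
  rw [integral_const_mul, integral_posPow_sub_mul_exp A hs,
    exp_neg_mul_sum_log fun p hp => hS p (Finset.mem_powerset.1 hT hp)]
  ring

lemma pow_integral_mul_le {α : Type*} [MeasurableSpace α] {μ : Measure α} {φ ω : α → ℝ} {m : ℕ}
    (hm : 1 ≤ m) (hφ : ∀ x, 0 ≤ φ x) (hω : ∀ᵐ x ∂μ, 0 ≤ ω x) (hW : 0 < ∫ x, ω x ∂μ)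
    (h0 : Integrable ω μ) (h1 : Integrable (fun x => φ x * ω x) μ)
    (h2 : Integrable (fun x => φ x ^ m * ω x) μ) :
    (∫ x, φ x * ω x ∂μ) ^ m ≤ (∫ x, ω x ∂μ) ^ (m - 1) * ∫ x, φ x ^ m * ω x ∂μ := by
  set W := ∫ x, ω x ∂μ with hWdef
  set c := (∫ x, φ x * ω x ∂μ) / W with hc
  have hcW : ∫ x, φ x * ω x ∂μ = c * W := by rw [hc, div_mul_cancel₀ _ hW.ne']
  have hφω : 0 ≤ ∫ x, φ x * ω x ∂μ := integral_nonneg_of_ae (by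
    filter_upwards [hω] with x hx using mul_nonneg (hφ x) hx)
  have hc0 : 0 ≤ c := div_nonneg hφω hW.le
  have hpt : ∀ x, c ^ m + m * c ^ (m - 1) * (φ x - c) ≤ φ x ^ m := by
    intro x
    obtain ⟨j, rfl⟩ : ∃ j, m = j + 1 := ⟨m - 1, by omega⟩
    rw [Nat.add_sub_cancel]
    rcases hc0.eq_or_lt with h | h
    · rw [← h]
      rcases Nat.eq_zero_or_pos j with rfl | hj
      · simp
      · simp [hj.ne', pow_nonneg (hφ x)]
    · have hb := one_add_mul_le_pow (a := (φ x - c) / c) (by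
        rw [le_div_iff₀ h]; linarith [hφ x]) (j + 1)
      have h3 : 1 + (φ x - c) / c = φ x / c := by field_simp; ring
      rw [h3, div_pow, le_div_iff₀ (by positivity)] at hb
      refine le_trans (le_of_eq ?_) hb
      field_simp
      ring
  have h1' : Integrable (fun x => φ x * ω x - c * ω x) μ := h1.sub (h0.const_mul c)
  have key : c ^ m * W ≤ ∫ x, φ x ^ m * ω x ∂μ := by
    have e : ∫ x, (c ^ m * ω x + m * c ^ (m - 1) * (φ x * ω x - c * ω x)) ∂μ = c ^ m * W := by
      rw [integral_add (h0.const_mul _) (h1'.const_mul _),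
        integral_const_mul, integral_const_mul, integral_sub h1 (h0.const_mul _),
        integral_const_mul, hcW]
      ring
    rw [← e]
    refine integral_mono_ae ((h0.const_mul _).add (h1'.const_mul _)) h2 ?_
    filter_upwards [hω] with x hx
    have := mul_le_mul_of_nonneg_right (hpt x) hx
    linarith
  obtain ⟨j, rfl⟩ : ∃ j, m = j + 1 := ⟨m - 1, by omega⟩
  rw [hcW, mul_pow, Nat.add_sub_cancel]
  calc c ^ (j + 1) * W ^ (j + 1) = W ^ j * (c ^ (j + 1) * W) := by ring
    _ ≤ _ := by gcongr

/-- The Fourier transform, without normalization. -/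
noncomputable def fhat (G : ℝ → ℂ) (t : ℝ) : ℂ :=
  ∫ v : ℝ, G v * Complex.exp (-(Complex.I * t * v))

lemma norm_exp_I_mul_mul (t v : ℝ) : ‖Complex.exp (Complex.I * t * v)‖ = 1 := by
  rw [Complex.norm_exp]; simp

lemma norm_exp_neg_I_mul_mul (t v : ℝ) : ‖Complex.exp (-(Complex.I * t * v))‖ = 1 := by
  rw [Complex.norm_exp]; simp

lemma norm_fhat_le (G : ℝ → ℂ) (t : ℝ) : ‖fhat G t‖ ≤ ∫ v, ‖G v‖ := by
  refine (norm_integral_le_integral_norm _).trans_eq ?_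
  simp only [norm_mul, norm_exp_neg_I_mul_mul, mul_one]

lemma continuous_fhat {G : ℝ → ℂ} (hG : Integrable G) : Continuous (fhat G) := by
  refine continuous_of_dominated (bound := fun v => ‖G v‖) (fun t => ?_) (fun t => ?_) hG.norm ?_
  · exact hG.aestronglyMeasurable.mul (by fun_prop)
  · exact .of_forall fun v => by rw [norm_mul, norm_exp_neg_I_mul_mul, mul_one]
  · exact .of_forall fun v => by fun_prop

lemma integrable_gaussian_sub {b : ℝ} (hb : 0 < b) :
    Integrable fun x : ℝ => Real.exp (-x ^ 2 / (4 * b)) := by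
  refine (integrable_exp_neg_mul_sq (b := 1 / (4 * b)) (by positivity)).congr (.of_forall fun x => ?_)
  simp only
  congr 1
  ring

lemma integral_gaussian_sub {b : ℝ} (hb : 0 < b) :
    √(Real.pi / b) * ∫ x : ℝ, Real.exp (-x ^ 2 / (4 * b)) = 2 * Real.pi := by
  have e : ∫ x : ℝ, Real.exp (-x ^ 2 / (4 * b)) = √(Real.pi / (1 / (4 * b))) := by
    rw [← integral_gaussian]
    refine integral_congr_ae (.of_forall fun x => ?_)
    simp only
    congr 1
    ring
  rw [e, ← Real.sqrt_mul (by positivity), show Real.pi / b * (Real.pi / (1 / (4 * b))) =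
    (2 * Real.pi) ^ 2 by field_simp; ring, Real.sqrt_sq (by positivity)]

/-- Bessel's inequality for the Fourier transform, with a Gaussian weight. -/
theorem integral_norm_fhat_sq_le {G : ℝ → ℂ} (hG : Integrable G)
    (hG2 : Integrable fun v => ‖G v‖ ^ 2) {b : ℝ} (hb : 0 < b) :
    ∫ t : ℝ, ‖fhat G t‖ ^ 2 * Real.exp (-b * t ^ 2) ≤ 2 * Real.pi * ∫ v, ‖G v‖ ^ 2 := by
  set g : ℝ → ℝ := fun x => Real.exp (-x ^ 2 / (4 * b)) with hg
  have hgi : Integrable g := integrable_gaussian_sub hb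
  have hg0 : ∀ x, 0 < g x := fun x => Real.exp_pos _
  have hgeven : ∀ x y, g (x - y) = g (y - x) := fun x y => by
    simp only [hg]; congr 3; ring
  set F : ℝ → ℝ → ℂ := fun u t => (starRingEnd ℂ) (G u) *
    (fhat G t * ((Real.exp (-b * t ^ 2) : ℂ) * Complex.exp (Complex.I * t * u))) with hF
  have hFint : Integrable (Function.uncurry F) (volume.prod volume) := by
    have h1 : Integrable fun t : ℝ => fhat G t * (Real.exp (-b * t ^ 2) : ℂ) := by
      refine (integrable_exp_neg_mul_sq hb).ofReal.bdd_mul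
        (continuous_fhat hG).aestronglyMeasurable (c := ∫ v, ‖G v‖) ?_
      exact .of_forall fun t => norm_fhat_le G t
    have h2 : Integrable fun u => (starRingEnd ℂ) (G u) := by
      simpa using (Complex.conjLIE.integrable_comp_iff (φ := G)).2 hG
    have h3 := (h2.mul_prod h1).bdd_mul (c := 1)
      (f := fun p : ℝ × ℝ => Complex.exp (Complex.I * p.2 * p.1)) (by fun_prop)
      (.of_forall fun p => (norm_exp_I_mul_mul p.2 p.1).le)
    refine h3.congr (.of_forall fun p => ?_)
    simp only [Function.uncurry, hF]
    ring
  have hswap : ∫ t : ℝ, ((‖fhat G t‖ ^ 2 * Real.exp (-b * t ^ 2) : ℝ) : ℂ) =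
      ∫ u, (starRingEnd ℂ) (G u) * (√(Real.pi / b) * ∫ v : ℝ, G v * (g (u - v) : ℂ)) := by
    have h1 : ∀ u, (starRingEnd ℂ) (G u) * (√(Real.pi / b) * ∫ v : ℝ, G v * (g (u - v) : ℂ)) =
        ∫ t, F u t := fun u => by
      rw [← integral_fourier_mul_gaussian hG hb u, ← integral_const_mul]
      rfl
    simp only [h1]
    rw [integral_integral_swap hFint]
    refine integral_congr_ae (.of_forall fun t => ?_)
    have h2 : (starRingEnd ℂ) (fhat G t) =
        ∫ u, (starRingEnd ℂ) (G u) * Complex.exp (Complex.I * t * u) := by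
      rw [fhat, ← integral_conj]
      refine integral_congr_ae (.of_forall fun u => ?_)
      simp only [map_mul, ← Complex.exp_conj, map_neg, Complex.conj_I, Complex.conj_ofReal]
      congr 2
      ring
    have h3 : ∀ u, F u t = (fhat G t * (Real.exp (-b * t ^ 2) : ℂ)) *
        ((starRingEnd ℂ) (G u) * Complex.exp (Complex.I * t * u)) := fun u => by
      simp only [hF]; ring
    simp only [h3]
    rw [integral_const_mul, ← h2]
    push_cast
    rw [← Complex.mul_conj']
    ring
  rw [integral_complex_ofReal] at hswap
  have hleft : Integrable (Function.uncurry fun u v : ℝ => ‖G u‖ ^ 2 * g (u - v))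
      (volume.prod volume) := by
    have h := (hG2.convolution_integrand (ContinuousLinearMap.mul ℝ ℝ) hgi).swap
    refine h.congr (.of_forall fun p => ?_)
    simp [Function.uncurry, hgeven]
  have hright : Integrable (Function.uncurry fun u v : ℝ => ‖G v‖ ^ 2 * g (u - v))
      (volume.prod volume) := by
    refine hleft.swap.congr (.of_forall fun p => ?_)
    simp [Function.uncurry, hgeven]
  have hsum := (hleft.add hright).const_mul (1 / 2)
  have hbound : ‖∫ u, (starRingEnd ℂ) (G u) * (√(Real.pi / b) * ∫ v : ℝ, G v * (g (u - v) : ℂ))‖ ≤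
      ∫ u, √(Real.pi / b) * ∫ v, (1 / 2 * (‖G u‖ ^ 2 * g (u - v) + ‖G v‖ ^ 2 * g (u - v))) := by
    refine norm_integral_le_of_norm_le (hsum.integral_prod_left.const_mul _) ?_
    filter_upwards [hsum.prod_right_ae] with u hu
    rw [norm_mul, RCLike.norm_conj, norm_mul, Complex.norm_real,
      Real.norm_of_nonneg (Real.sqrt_nonneg _), mul_left_comm, ← norm_mul, ← integral_const_mul]
    refine mul_le_mul_of_nonneg_left ?_ (Real.sqrt_nonneg _)
    refine norm_integral_le_of_norm_le hu (.of_forall fun v => ?_)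
    simp only [norm_mul, Complex.norm_real, Real.norm_of_nonneg (hg0 _).le]
    have := mul_nonneg (sq_nonneg (‖G u‖ - ‖G v‖)) (hg0 (u - v)).le
    nlinarith
  have heval : ∫ u, √(Real.pi / b) * ∫ v, (1 / 2 * (‖G u‖ ^ 2 * g (u - v) + ‖G v‖ ^ 2 * g (u - v))) =
      2 * Real.pi * ∫ v, ‖G v‖ ^ 2 := by
    have e1 : ∫ u, ∫ v, ‖G u‖ ^ 2 * g (u - v) = (∫ v, ‖G v‖ ^ 2) * ∫ x, g x := by
      rw [← integral_mul_const]
      refine integral_congr_ae (.of_forall fun u => ?_)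
      simp only
      rw [integral_const_mul, integral_sub_left_eq_self g volume u]
    have e2 : ∫ u, ∫ v, ‖G v‖ ^ 2 * g (u - v) = (∫ v, ‖G v‖ ^ 2) * ∫ x, g x := by
      rw [integral_integral_swap hright, ← e1]
      simp only [hgeven]
    have e3 : ∫ u, ∫ v, (1 / 2 * (‖G u‖ ^ 2 * g (u - v) + ‖G v‖ ^ 2 * g (u - v))) =
        (∫ v, ‖G v‖ ^ 2) * ∫ x, g x := by
      have h4 : ∫ u, ∫ v, (1 / 2 * (‖G u‖ ^ 2 * g (u - v) + ‖G v‖ ^ 2 * g (u - v))) =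
          1 / 2 * ((∫ u, ∫ v, ‖G u‖ ^ 2 * g (u - v)) + ∫ u, ∫ v, ‖G v‖ ^ 2 * g (u - v)) := by
        have h5 : ∫ u, ∫ v, (‖G u‖ ^ 2 * g (u - v) + ‖G v‖ ^ 2 * g (u - v)) =
            (∫ u, ∫ v, ‖G u‖ ^ 2 * g (u - v)) + ∫ u, ∫ v, ‖G v‖ ^ 2 * g (u - v) :=
          integral_integral_add hleft hright
        rw [← h5, ← integral_const_mul]
        simp only [integral_const_mul]
      rw [h4, e1, e2]
      ring
    rw [integral_const_mul, e3, ← integral_gaussian_sub hb]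
    ring
  have hnn : 0 ≤ ∫ t : ℝ, ‖fhat G t‖ ^ 2 * Real.exp (-b * t ^ 2) :=
    integral_nonneg fun t => by positivity
  rw [← hswap, heval, Complex.norm_real, Real.norm_of_nonneg hnn] at hbound
  exact hbound

lemma abs_sieveSum_pow_le (A m : ℕ) (S : Finset ℕ) {u : ℝ} (hu : 0 ≤ u) :
    |sieveSum A S u| ^ m ≤ 2 ^ (S.card * m) * (1 + u) ^ (A * m) := by
  refine (pow_le_pow_left₀ (abs_nonneg _) (abs_sieveSum_le A S u) m).trans ?_
  rw [posPow_eq_pow hu, mul_pow, ← pow_mul, ← pow_mul]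
  gcongr
  linarith

lemma integrableOn_abs_sieveSum_pow (A m : ℕ) (S : Finset ℕ) {σ : ℝ} (hσ : 0 < σ) :
    IntegrableOn (fun u : ℝ => |sieveSum A S u| ^ m * Real.exp (-σ * u)) (Ioi 0) := by
  refine Integrable.mono' ((integrableOn_pow_mul_exp (A * m) hσ).const_mul (2 ^ (S.card * m))) ?_ ?_
  · have := measurable_sieveSum A S
    exact Measurable.aestronglyMeasurable (by fun_prop)
  · filter_upwards [ae_restrict_mem measurableSet_Ioi] with u hu
    rw [Real.norm_of_nonneg (by positivity), ← mul_assoc]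
    exact mul_le_mul_of_nonneg_right (abs_sieveSum_pow_le A m S (le_of_lt hu)) (Real.exp_pos _).le

/-- The sieve weight damped by an exponential. -/
noncomputable def dampedSum (A : ℕ) (S : Finset ℕ) (σ u : ℝ) : ℝ :=
  sieveSum A S u * Real.exp (-σ * u)

lemma integrable_dampedSum (A : ℕ) (S : Finset ℕ) {σ : ℝ} (hσ : 0 < σ) :
    Integrable fun u : ℝ => (dampedSum A S σ u : ℂ) := by
  refine (integrable_sieveSum_mul_exp A S (s := σ) (by simpa)).congr (.of_forall fun u => ?_)
  simp [dampedSum]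

lemma fhat_dampedSum (A : ℕ) {S : Finset ℕ} (hS : ∀ p ∈ S, p.Prime) {σ : ℝ} (hσ : 0 < σ) (t : ℝ) :
    fhat (fun u => (dampedSum A S σ u : ℂ)) t =
      A.factorial / (⟨σ, t⟩ : ℂ) ^ (A + 1) * eulerFactor S ⟨σ, t⟩ := by
  rw [← integral_sieveSum_mul_exp A hS (s := ⟨σ, t⟩) hσ, fhat]
  refine integral_congr_ae (.of_forall fun u => ?_)
  simp only [dampedSum]
  push_cast
  rw [mul_assoc, ← Complex.exp_add, Complex.mk_eq_add_mul_I]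
  congr 2
  ring

lemma integral_comp_sieveSum (A : ℕ) (S : Finset ℕ) {φ : ℝ → ℝ → ℝ} (hφ : ∀ u, φ 0 u = 0) :
    ∫ u, φ (sieveSum A S u) u = ∫ u in Ioi 0, φ (sieveSum A S u) u := by
  rw [← integral_Ici_eq_integral_Ioi, ← setIntegral_univ]
  refine setIntegral_eq_of_subset_of_forall_sdiff_eq_zero MeasurableSet.univ (subset_univ _)
    fun u hu => ?_
  rw [sieveSum_eq_zero (not_le.1 fun h => hu.2 h), hφ]

lemma integrable_norm_sq_dampedSum (A : ℕ) (S : Finset ℕ) {σ : ℝ} (hσ : 0 < σ) :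
    Integrable fun u : ℝ => ‖(dampedSum A S σ u : ℂ)‖ ^ 2 := by
  have e : ∀ u, ‖(dampedSum A S σ u : ℂ)‖ ^ 2 =
      |sieveSum A S u| ^ 2 * Real.exp (-(2 * σ) * u) := fun u => by
    rw [Complex.norm_real, Real.norm_eq_abs, dampedSum, abs_mul, mul_pow, Real.abs_exp,
      ← Real.exp_nat_mul]
    congr 2
    push_cast
    ring
  simp only [e]
  rw [← integrableOn_univ, ← Iio_union_Ici (a := (0 : ℝ)), integrableOn_union]
  constructor
  · refine integrableOn_zero.congr_fun (fun u hu => ?_) measurableSet_Iio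
    simp [sieveSum_eq_zero hu]
  · rw [integrableOn_Ici_iff_integrableOn_Ioi]
    exact integrableOn_abs_sieveSum_pow A 2 S (by linarith)

lemma integral_norm_dampedSum (A : ℕ) (S : Finset ℕ) (σ : ℝ) :
    ∫ u, ‖(dampedSum A S σ u : ℂ)‖ = ∫ u in Ioi 0, |sieveSum A S u| * Real.exp (-σ * u) := by
  rw [← integral_comp_sieveSum A S (φ := fun d u => |d| * Real.exp (-σ * u)) (by simp)]
  refine integral_congr_ae (.of_forall fun u => ?_)
  simp only
  rw [Complex.norm_real, Real.norm_eq_abs, dampedSum, abs_mul, Real.abs_exp]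

lemma integral_exp_neg_mul_Ioi {σ : ℝ} (hσ : 0 < σ) :
    ∫ u in Ioi (0 : ℝ), Real.exp (-σ * u) = 1 / σ := by
  rw [integral_exp_mul_Ioi (by linarith) 0]
  simp

lemma norm_fhat_pow_le (A N : ℕ) (S : Finset ℕ) {σ : ℝ} (hσ : 0 < σ) (t : ℝ) :
    ‖fhat (fun u => (dampedSum A S σ u : ℂ)) t‖ ^ (2 * (N + 1)) ≤
      (1 / σ) ^ (2 * N + 1) *
        ∫ u in Ioi 0, |sieveSum A S u| ^ (2 * (N + 1)) * Real.exp (-σ * u) := by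
  refine (pow_le_pow_left₀ (norm_nonneg _) (norm_fhat_le _ t) _).trans ?_
  rw [integral_norm_dampedSum]
  have h := pow_integral_mul_le (μ := volume.restrict (Ioi (0 : ℝ))) (m := 2 * (N + 1))
    (φ := fun u => |sieveSum A S u|) (ω := fun u => Real.exp (-σ * u)) (by omega)
    (fun u => abs_nonneg _) (.of_forall fun u => (Real.exp_pos _).le)
    (by rw [integral_exp_neg_mul_Ioi hσ]; positivity)
    (by simpa [IntegrableOn] using integrableOn_abs_sieveSum_pow A 0 S hσ)
    (by simpa [IntegrableOn] using integrableOn_abs_sieveSum_pow A 1 S hσ)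
    (integrableOn_abs_sieveSum_pow A _ S hσ)
  rw [integral_exp_neg_mul_Ioi hσ, show 2 * (N + 1) - 1 = 2 * N + 1 by omega] at h
  exact h

lemma integral_norm_fhat_pow_le (A N : ℕ) (S : Finset ℕ) {σ : ℝ} (hσ : 0 < σ) :
    ∫ t in Icc (1 : ℝ) 2, ‖fhat (fun u => (dampedSum A S σ u : ℂ)) t‖ ^ (2 * (N + 1)) ≤
      Real.exp 4 * (2 * Real.pi) * ((1 / σ) ^ (2 * N) *
        ∫ u in Ioi 0, |sieveSum A S u| ^ (2 * (N + 1)) * Real.exp (-σ * u)) := by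
  set G : ℝ → ℂ := fun u => (dampedSum A S σ u : ℂ) with hG
  have hGi : Integrable G := integrable_dampedSum A S hσ
  have hc := continuous_fhat hGi
  set a := ∫ u in Ioi 0, |sieveSum A S u| * Real.exp (-σ * u) with ha
  set q := ∫ u in Ioi 0, |sieveSum A S u| ^ 2 * Real.exp (-σ * u) with hq
  set Y := ∫ u in Ioi 0, |sieveSum A S u| ^ (2 * (N + 1)) * Real.exp (-σ * u) with hY
  have ha0 : 0 ≤ a := integral_nonneg fun u => by positivity
  have hq0 : 0 ≤ q := integral_nonneg fun u => by positivity
  have hW : 0 < ∫ u in Ioi (0 : ℝ), Real.exp (-σ * u) := by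
    rw [integral_exp_neg_mul_Ioi hσ]; positivity
  have h0 : IntegrableOn (fun u : ℝ => Real.exp (-σ * u)) (Ioi 0) := by
    simpa using integrableOn_abs_sieveSum_pow A 0 S hσ
  have haq : a ^ 2 ≤ 1 / σ * q := by
    have h := pow_integral_mul_le (μ := volume.restrict (Ioi (0 : ℝ))) (m := 2)
      (φ := fun u => |sieveSum A S u|) (ω := fun u => Real.exp (-σ * u)) (by omega)
      (fun u => abs_nonneg _) (.of_forall fun u => (Real.exp_pos _).le) hW h0
      (by simpa [IntegrableOn] using integrableOn_abs_sieveSum_pow A 1 S hσ)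
      (integrableOn_abs_sieveSum_pow A _ S hσ)
    rw [integral_exp_neg_mul_Ioi hσ] at h
    rw [show 2 - 1 = 1 from rfl, pow_one] at h
    exact h
  have hqY : q ^ (N + 1) ≤ (1 / σ) ^ N * Y := by
    have h := pow_integral_mul_le (μ := volume.restrict (Ioi (0 : ℝ))) (m := N + 1)
      (φ := fun u => |sieveSum A S u| ^ 2) (ω := fun u => Real.exp (-σ * u)) (by omega)
      (fun u => by positivity) (.of_forall fun u => (Real.exp_pos _).le) hW h0
      (integrableOn_abs_sieveSum_pow A 2 S hσ)
      (by simpa only [← pow_mul, IntegrableOn] using integrableOn_abs_sieveSum_pow A (2 * (N + 1)) S hσ)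
    rw [integral_exp_neg_mul_Ioi hσ] at h
    simpa only [← pow_mul, Nat.add_sub_cancel] using h
  have hbessel : ∫ t in Icc (1 : ℝ) 2, ‖fhat G t‖ ^ 2 ≤ Real.exp 4 * (2 * Real.pi * q) := by
    have hi : Integrable fun t : ℝ => ‖fhat G t‖ ^ 2 * Real.exp (-1 * t ^ 2) := by
      refine (integrable_exp_neg_mul_sq one_pos).bdd_mul (c := (∫ v, ‖G v‖) ^ 2)
        (by fun_prop) (.of_forall fun t => ?_)
      rw [norm_pow, norm_norm]
      exact pow_le_pow_left₀ (norm_nonneg _) (norm_fhat_le G t) 2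
    calc ∫ t in Icc (1 : ℝ) 2, ‖fhat G t‖ ^ 2
        ≤ ∫ t in Icc (1 : ℝ) 2, Real.exp 4 * (‖fhat G t‖ ^ 2 * Real.exp (-1 * t ^ 2)) := by
          refine setIntegral_mono_on (Continuous.integrableOn_Icc (by fun_prop))
            (hi.const_mul _).integrableOn measurableSet_Icc fun t ht => ?_
          rw [mul_left_comm, ← Real.exp_add]
          refine le_mul_of_one_le_right (by positivity) (Real.one_le_exp ?_)
          nlinarith [ht.1, ht.2]
      _ = Real.exp 4 * ∫ t in Icc (1 : ℝ) 2, ‖fhat G t‖ ^ 2 * Real.exp (-1 * t ^ 2) :=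
          integral_const_mul _ _
      _ ≤ Real.exp 4 * ∫ t, ‖fhat G t‖ ^ 2 * Real.exp (-1 * t ^ 2) := by
          exact mul_le_mul_of_nonneg_left
            (setIntegral_le_integral hi (.of_forall fun t => by positivity)) (by positivity)
      _ ≤ Real.exp 4 * (2 * Real.pi * ∫ v, ‖G v‖ ^ 2) := by
          gcongr
          exact integral_norm_fhat_sq_le hGi (integrable_norm_sq_dampedSum A S hσ) one_pos
      _ ≤ Real.exp 4 * (2 * Real.pi * q) := by
          have e : ∫ v, ‖G v‖ ^ 2 = ∫ u in Ioi 0, |sieveSum A S u| ^ 2 * Real.exp (-(2 * σ) * u) := by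
            rw [← integral_comp_sieveSum A S (φ := fun d u => |d| ^ 2 * Real.exp (-(2 * σ) * u))
              (by simp)]
            refine integral_congr_ae (.of_forall fun u => ?_)
            simp only [hG]
            rw [Complex.norm_real, Real.norm_eq_abs, dampedSum, abs_mul, mul_pow, Real.abs_exp,
              ← Real.exp_nat_mul]
            congr 2
            push_cast
            ring
          rw [e]
          gcongr
          refine setIntegral_mono_on (integrableOn_abs_sieveSum_pow A 2 S (by linarith))
            (integrableOn_abs_sieveSum_pow A 2 S hσ) measurableSet_Ioi fun u hu => ?_
          have : 0 ≤ σ * u := mul_nonneg hσ.le (le_of_lt hu)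
          exact mul_le_mul_of_nonneg_left (Real.exp_le_exp.2 (by linarith)) (by positivity)
  calc ∫ t in Icc (1 : ℝ) 2, ‖fhat G t‖ ^ (2 * (N + 1))
      ≤ ∫ t in Icc (1 : ℝ) 2, a ^ (2 * N) * ‖fhat G t‖ ^ 2 := by
        refine setIntegral_mono_on (Continuous.integrableOn_Icc (by fun_prop))
          (Continuous.integrableOn_Icc (by fun_prop)) measurableSet_Icc fun t _ => ?_
        rw [show 2 * (N + 1) = 2 * N + 2 by ring, pow_add]
        gcongr
        rw [ha, ← integral_norm_dampedSum]
        exact norm_fhat_le G t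
    _ = a ^ (2 * N) * ∫ t in Icc (1 : ℝ) 2, ‖fhat G t‖ ^ 2 := integral_const_mul _ _
    _ ≤ (1 / σ * q) ^ N * (Real.exp 4 * (2 * Real.pi * q)) := by
        rw [pow_mul]
        gcongr
    _ = Real.exp 4 * (2 * Real.pi) * ((1 / σ) ^ N * q ^ (N + 1)) := by ring
    _ ≤ Real.exp 4 * (2 * Real.pi) * ((1 / σ) ^ N * ((1 / σ) ^ N * Y)) := by gcongr
    _ = _ := by ring

lemma integral_sieveMoment_eq (A N : ℕ) (P : Finset ℕ) {σ : ℝ} (hσ : 0 < σ) :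
    ∫ u in Ioi 0, sieveMoment A (2 * (N + 1)) P u * Real.exp (-σ * u) =
      ∑ S ∈ P.powerset, wt P S *
        ∫ u in Ioi 0, |sieveSum A S u| ^ (2 * (N + 1)) * Real.exp (-σ * u) := by
  simp only [← integral_const_mul]
  rw [← integral_finsetSum _ fun S _ => (integrableOn_abs_sieveSum_pow A _ S hσ).const_mul _]
  refine integral_congr_ae (.of_forall fun u => ?_)
  simp only [sieveMoment, Finset.sum_mul]
  refine Finset.sum_congr rfl fun S _ => ?_
  rw [(even_two_mul (N + 1)).pow_abs, mul_assoc]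

lemma sum_wt_norm_fhat_pow (A N : ℕ) {P : Finset ℕ} (hP : ∀ p ∈ P, p.Prime) {σ : ℝ} (hσ : 0 < σ)
    (t t' : ℝ) :
    ∑ S ∈ P.powerset, wt P S * (‖fhat (fun u => (dampedSum A S σ u : ℂ)) t‖ ^ (2 * N) *
        ‖fhat (fun u => (dampedSum A S σ u : ℂ)) t'‖ ^ 2) =
      (A.factorial / ‖(⟨σ, t⟩ : ℂ)‖ ^ (A + 1)) ^ (2 * N) *
        (A.factorial / ‖(⟨σ, t'⟩ : ℂ)‖ ^ (A + 1)) ^ 2 * starMoment N P ⟨σ, t⟩ ⟨σ, t'⟩ := by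
  rw [starMoment, Finset.mul_sum]
  refine Finset.sum_congr rfl fun S hS => ?_
  have hS' : ∀ p ∈ S, p.Prime := fun p hp => hP p (Finset.mem_powerset.1 hS hp)
  rw [fhat_dampedSum A hS' hσ, fhat_dampedSum A hS' hσ]
  simp only [norm_mul, norm_div, norm_pow, Complex.norm_natCast]
  ring

/-- Lower bounds for the Laplace transform of the moment. -/
theorem exists_le_integral_sieveMoment (A N : ℕ) : ∃ c : ℝ, 0 < c ∧
    ∀ σ : ℝ, 0 < σ → (2 * N + 2) * σ ≤ 1 → ∃ M₀ : ℕ, ∀ M, M₀ ≤ M →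
      c * (1 / σ) ^ (2 * (N + 1) * A) ≤
        ∫ u in Ioi 0, sieveMoment A (2 * (N + 1)) (primesUpTo M) u * Real.exp (-σ * u) ∧
      c * (σ ^ (2 * N + 1) / σ ^ (2 * (N + 1)).choose (N + 1)) ≤
        ∫ u in Ioi 0, sieveMoment A (2 * (N + 1)) (primesUpTo M) u * Real.exp (-σ * u) := by
  obtain ⟨c, hc, hstar⟩ := exists_le_starMoment N
  set f : ℝ := (A.factorial : ℝ) with hf
  have hf0 : 0 < f := by rw [hf]; exact_mod_cast A.factorial_pos
  set K := Real.exp 4 * (2 * Real.pi) with hK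
  have hK0 : 0 < K := by positivity
  set c₂ := (f / 3 ^ (A + 1)) ^ (2 * (N + 1)) * c / K with hc₂
  refine ⟨min (f ^ (2 * (N + 1)) * c) c₂, by positivity, fun σ hσ hσ1 => ?_⟩
  obtain ⟨M₀, hM₀⟩ := hstar σ hσ hσ1
  have hσ2 : σ ≤ 1 := by
    have : (0 : ℝ) ≤ N := by positivity
    nlinarith
  refine ⟨M₀, fun M hM => ?_⟩
  obtain ⟨h1, h2⟩ := hM₀ M hM
  have hP : ∀ p ∈ primesUpTo M, p.Prime := fun p hp => prime_of_mem_primesUpTo hp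
  rw [integral_sieveMoment_eq A N _ hσ]
  constructor
  · have h3 := sum_wt_norm_fhat_pow A N hP hσ 0 0
    have e : (⟨σ, 0⟩ : ℂ) = (σ : ℂ) := rfl
    rw [e, Complex.norm_real, Real.norm_of_nonneg hσ.le, ← pow_add] at h3
    have h4 : (f / σ ^ (A + 1)) ^ (2 * N + 2) * (c * σ) ≤ (1 / σ) ^ (2 * N + 1) *
        ∑ S ∈ (primesUpTo M).powerset, wt (primesUpTo M) S *
          ∫ u in Ioi 0, |sieveSum A S u| ^ (2 * (N + 1)) * Real.exp (-σ * u) := by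
      refine (mul_le_mul_of_nonneg_left h1 (by positivity)).trans ?_
      rw [← h3, Finset.mul_sum]
      refine Finset.sum_le_sum fun S _ => ?_
      rw [← pow_add, mul_left_comm]
      exact mul_le_mul_of_nonneg_left (norm_fhat_pow_le A N S hσ 0) (wt_nonneg _ _)
    rw [one_div, inv_pow, ← div_eq_inv_mul, le_div_iff₀ (by positivity)] at h4
    refine le_trans ?_ h4
    calc _ ≤ f ^ (2 * (N + 1)) * c * (1 / σ) ^ (2 * (N + 1) * A) := by
          gcongr
          exact min_le_left _ _
      _ = _ := by
          rw [div_pow f, ← pow_mul σ, one_div, inv_pow,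
            show (A + 1) * (2 * N + 2) = 2 * (N + 1) * A + (2 * N + 1) + 1 by ring,
            pow_add _ (2 * (N + 1) * A + (2 * N + 1)), pow_add _ (2 * (N + 1) * A)]
          field_simp
          ring
  · have hlow : (f / 3 ^ (A + 1)) ^ (2 * (N + 1)) * (c * (σ / σ ^ (2 * (N + 1)).choose (N + 1))) ≤
        ∑ S ∈ (primesUpTo M).powerset, wt (primesUpTo M) S * ∫ t in Icc (1 : ℝ) 2,
          ‖fhat (fun u => (dampedSum A S σ u : ℂ)) t‖ ^ (2 * (N + 1)) := by
      have hcont : ∀ S, Continuous fun t : ℝ =>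
          wt (primesUpTo M) S * ‖fhat (fun u => (dampedSum A S σ u : ℂ)) t‖ ^ (2 * (N + 1)) :=
        fun S => by
          have := continuous_fhat (integrable_dampedSum A S hσ)
          fun_prop
      simp only [← integral_const_mul]
      rw [← integral_finsetSum _ fun S _ => (hcont S).integrableOn_Icc]
      have e : ∀ x : ℝ, x = ∫ t in Icc (1 : ℝ) 2, x := fun x => by
        simp [Real.volume_real_Icc]; norm_num
      refine (e _).le.trans (setIntegral_mono_on (integrableOn_const (by simp))
        (Continuous.integrableOn_Icc (continuous_finsetSum _ fun S _ => hcont S))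
        measurableSet_Icc fun t ht => ?_)
      have h3 := sum_wt_norm_fhat_pow A N hP hσ t t
      simp only [← pow_add] at h3
      rw [show 2 * (N + 1) = 2 * N + 2 by ring, h3]
      have hn : ‖(⟨σ, t⟩ : ℂ)‖ ≤ 3 := by
        refine (Complex.norm_le_abs_re_add_abs_im _).trans ?_
        simp only
        rw [abs_of_pos hσ, abs_of_pos (by linarith [ht.1])]
        linarith [ht.2]
      have hn0 : 0 < ‖(⟨σ, t⟩ : ℂ)‖ := norm_pos_iff.2 fun h => hσ.ne' (congrArg Complex.re h)
      have h5 := h2 t ht.1 ht.2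
      rw [show 2 * (N + 1) = 2 * N + 2 by ring] at h5
      refine mul_le_mul ?_ h5 (by positivity) (by positivity)
      gcongr
    have hup : ∑ S ∈ (primesUpTo M).powerset, wt (primesUpTo M) S * ∫ t in Icc (1 : ℝ) 2,
          ‖fhat (fun u => (dampedSum A S σ u : ℂ)) t‖ ^ (2 * (N + 1)) ≤
        K * (1 / σ) ^ (2 * N) * ∑ S ∈ (primesUpTo M).powerset, wt (primesUpTo M) S *
          ∫ u in Ioi 0, |sieveSum A S u| ^ (2 * (N + 1)) * Real.exp (-σ * u) := by
      rw [Finset.mul_sum]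
      refine Finset.sum_le_sum fun S _ => ?_
      rw [mul_left_comm]
      refine mul_le_mul_of_nonneg_left ?_ (wt_nonneg _ _)
      rw [mul_assoc]
      exact integral_norm_fhat_pow_le A N S hσ
    have h6 := hlow.trans hup
    have h7 : (f / 3 ^ (A + 1)) ^ (2 * (N + 1)) * (c * (σ / σ ^ (2 * (N + 1)).choose (N + 1))) *
        (σ ^ (2 * N) / K) ≤ ∑ S ∈ (primesUpTo M).powerset, wt (primesUpTo M) S *
          ∫ u in Ioi 0, |sieveSum A S u| ^ (2 * (N + 1)) * Real.exp (-σ * u) := by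
      refine (mul_le_mul_of_nonneg_right h6 (by positivity)).trans_eq ?_
      rw [one_div, inv_pow]
      field_simp
    refine le_trans ?_ h7
    calc _ ≤ c₂ * (σ ^ (2 * N + 1) / σ ^ (2 * (N + 1)).choose (N + 1)) := by
          gcongr
          exact min_le_right _ _
      _ = _ := by rw [hc₂]; ring

/-- The kernel `min 1 (σ + |x|)` measuring the correlation between two points at distance `x`. -/
noncomputable def gap (σ x : ℝ) : ℝ := min 1 (σ + |x|)

lemma gap_pos {σ : ℝ} (hσ : 0 < σ) (x : ℝ) : 0 < gap σ x :=
  lt_min one_pos (by positivity)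

lemma continuous_gap (σ : ℝ) : Continuous (gap σ) := by
  unfold gap
  fun_prop

lemma continuous_inv_gap_sub {σ : ℝ} (hσ : 0 < σ) (t' : ℝ) :
    Continuous fun t : ℝ => 1 / gap σ (t - t') :=
  continuous_const.div ((continuous_gap σ).comp (by fun_prop)) fun t => (gap_pos hσ _).ne'

lemma integral_inv_add {σ a : ℝ} (hσ : 0 < σ) (ha : 0 ≤ a) :
    ∫ x in (0 : ℝ)..a, 1 / (σ + x) = Real.log ((σ + a) / σ) := by
  have h := intervalIntegral.integral_comp_add_left (fun x : ℝ => 1 / x) (a := 0) (b := a) σ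
  rw [h, add_zero, integral_one_div]
  rw [uIcc_of_le (by linarith)]
  exact fun h => by linarith [h.1]

lemma integral_inv_gap_le {σ T a b : ℝ} (hσ : 0 < σ) (ha : 0 ≤ a) (hbT : b ≤ T)
    {t' : ℝ} (ht' : t' ∈ Icc a b) :
    ∫ t in Icc a b, 1 / gap σ (t - t') ≤ max 1 T * (3 + 2 * Real.log (1 + 1 / σ)) := by
  have hT : 0 ≤ T := ha.trans ((ht'.1.trans ht'.2).trans hbT)
  have hab := ht'.1.trans ht'.2
  have hℓ : 0 ≤ Real.log (1 + 1 / σ) := Real.log_nonneg (by have := one_div_pos.2 hσ; linarith)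
  have hden : ∀ t : ℝ, 0 < σ + |t - t'| := fun t => by positivity
  have hc : Continuous fun t : ℝ => 1 / (σ + |t - t'|) :=
    continuous_const.div (by fun_prop) fun t => (hden t).ne'
  have hlog : ∀ x : ℝ, 0 ≤ x → x ≤ T → Real.log ((σ + x) / σ) ≤ T + Real.log (1 + 1 / σ) := by
    intro x hx hxT
    calc Real.log ((σ + x) / σ) ≤ Real.log ((1 + T) * (1 + 1 / σ)) := by
          refine Real.log_le_log (by positivity) ?_
          rw [div_le_iff₀ hσ]
          field_simp
          nlinarith
      _ = Real.log (1 + T) + Real.log (1 + 1 / σ) :=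
          Real.log_mul (by positivity) (by positivity)
      _ ≤ _ := by
          have := Real.log_le_sub_one_of_pos (show 0 < 1 + T by linarith)
          linarith
  have h1 : ∫ t in a..t', 1 / (σ + |t - t'|) ≤ T + Real.log (1 + 1 / σ) := by
    have e : ∫ t in a..t', 1 / (σ + |t - t'|) = ∫ x in (0 : ℝ)..(t' - a), 1 / (σ + x) := by
      have h := intervalIntegral.integral_comp_sub_left (fun x : ℝ => 1 / (σ + x)) (a := a)
        (b := t') t'
      rw [sub_self] at h
      rw [← h]
      refine intervalIntegral.integral_congr fun t ht => ?_
      rw [uIcc_of_le ht'.1] at ht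
      rw [abs_of_nonpos (by linarith [ht.2]), neg_sub]
    rw [e, integral_inv_add hσ (by linarith [ht'.1])]
    exact hlog _ (by linarith [ht'.1]) (by linarith [ht'.2])
  have h2 : ∫ t in t'..b, 1 / (σ + |t - t'|) ≤ T + Real.log (1 + 1 / σ) := by
    have e : ∫ t in t'..b, 1 / (σ + |t - t'|) = ∫ x in (0 : ℝ)..(b - t'), 1 / (σ + x) := by
      have h := intervalIntegral.integral_comp_sub_right (fun x : ℝ => 1 / (σ + x)) (a := t')
        (b := b) t'
      rw [sub_self] at h
      rw [← h]
      refine intervalIntegral.integral_congr fun t ht => ?_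
      rw [uIcc_of_le ht'.2] at ht
      rw [abs_of_nonneg (by linarith [ht.1])]
    rw [e, integral_inv_add hσ (by linarith [ht'.2])]
    exact hlog _ (by linarith [ht'.2]) (by linarith [ht'.1])
  have h3 : ∫ t in Icc a b, 1 / gap σ (t - t') ≤ ∫ t in Icc a b, (1 + 1 / (σ + |t - t'|)) := by
    refine setIntegral_mono_on (continuous_inv_gap_sub hσ t').integrableOn_Icc
      (Continuous.integrableOn_Icc (by fun_prop)) measurableSet_Icc fun t _ => ?_
    have := one_div_pos.2 (hden t)
    unfold gap
    rcases min_choice 1 (σ + |t - t'|) with h | h <;> rw [h]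
    · linarith
    · linarith
  refine h3.trans ?_
  rw [integral_Icc_eq_integral_Ioc, ← intervalIntegral.integral_of_le hab,
    intervalIntegral.integral_add (by simp) (hc.intervalIntegrable _ _),
    ← intervalIntegral.integral_add_adjacent_intervals (hc.intervalIntegrable a t')
      (hc.intervalIntegrable t' b)]
  simp only [intervalIntegral.integral_const, smul_eq_mul, mul_one]
  have h4 : T ≤ max 1 T := le_max_right _ _
  have h5 : 1 ≤ max 1 T := le_max_left _ _
  nlinarith

lemma sum_mul_pow_integral_le {ι : Type*} (s : Finset ι) {w : ι → ℝ} (hw : ∀ i ∈ s, 0 ≤ w i)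
    {F : ι → ℝ → ℝ} (hF : ∀ i, Continuous (F i)) (hF0 : ∀ i t, 0 ≤ F i t) {a b σ K Q : ℝ}
    (hab : a < b) (hσ : 0 < σ) (hK : 0 ≤ K) (N : ℕ)
    (h : ∀ t ∈ Icc a b, ∀ t' ∈ Icc a b,
      ∑ i ∈ s, w i * (F i t ^ (2 * N) * F i t' ^ 2) ≤ K / gap σ (t - t') ^ (2 * N))
    (hQ : ∀ t' ∈ Icc a b, ∫ t in Icc a b, 1 / gap σ (t - t') ≤ Q) :
    ∑ i ∈ s, w i * ((∫ t in Icc a b, F i t) ^ (2 * N) * ∫ t in Icc a b, F i t ^ 2) ≤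
      K * Q ^ (2 * N) * (b - a) := by
  have key : ∀ t' ∈ Icc a b,
      ∑ i ∈ s, w i * ((∫ t in Icc a b, F i t) ^ (2 * N) * F i t' ^ 2) ≤ K * Q ^ (2 * N) := by
    intro t' ht'
    rcases Nat.eq_zero_or_pos N with rfl | hN
    · simpa using h t' ht' t' ht'
    have hg := fun t => gap_pos hσ (t - t')
    have hgc : Continuous fun t => gap σ (t - t') := (continuous_gap σ).comp (by fun_prop)
    have hgi := continuous_inv_gap_sub hσ t'
    set q := ∫ t in Icc a b, 1 / gap σ (t - t') with hq
    have hq0 : 0 < q := by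
      rw [hq, integral_Icc_eq_integral_Ioc, ← intervalIntegral.integral_of_le hab.le]
      exact intervalIntegral.intervalIntegral_pos_of_pos (hgi.intervalIntegrable _ _)
        (fun t => one_div_pos.2 (hg t)) hab
    have hcF : ∀ i, Continuous fun t => (F i t * gap σ (t - t')) ^ (2 * N) * (1 / gap σ (t - t')) :=
      fun i => (((hF i).mul hgc).pow _).mul hgi
    have hi : ∀ i, (∫ t in Icc a b, F i t) ^ (2 * N) ≤ q ^ (2 * N - 1) *
        ∫ t in Icc a b, (F i t * gap σ (t - t')) ^ (2 * N) * (1 / gap σ (t - t')) := by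
      intro i
      have e : ∀ t, F i t * gap σ (t - t') * (1 / gap σ (t - t')) = F i t := fun t => by
        rw [mul_assoc, mul_one_div_cancel (hg t).ne', mul_one]
      have := pow_integral_mul_le (μ := volume.restrict (Icc a b)) (m := 2 * N)
        (φ := fun t => F i t * gap σ (t - t')) (ω := fun t => 1 / gap σ (t - t')) (by omega)
        (fun t => mul_nonneg (hF0 i t) (hg t).le)
        (.of_forall fun t => (one_div_pos.2 (hg t)).le) hq0 hgi.integrableOn_Icc
        (by simp only [e]; exact (hF i).integrableOn_Icc) (hcF i).integrableOn_Icc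
      simpa only [e] using this
    calc ∑ i ∈ s, w i * ((∫ t in Icc a b, F i t) ^ (2 * N) * F i t' ^ 2)
        ≤ ∑ i ∈ s, w i * ((q ^ (2 * N - 1) *
          ∫ t in Icc a b, (F i t * gap σ (t - t')) ^ (2 * N) * (1 / gap σ (t - t'))) *
            F i t' ^ 2) :=
          Finset.sum_le_sum fun i hi' => mul_le_mul_of_nonneg_left
            (mul_le_mul_of_nonneg_right (hi i) (by positivity)) (hw i hi')
      _ = q ^ (2 * N - 1) * ∫ t in Icc a b, ∑ i ∈ s, w i * F i t' ^ 2 *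
            ((F i t * gap σ (t - t')) ^ (2 * N) * (1 / gap σ (t - t'))) := by
          rw [integral_finsetSum _ fun i _ => ((hcF i).integrableOn_Icc).const_mul _,
            Finset.mul_sum]
          refine Finset.sum_congr rfl fun i _ => ?_
          rw [integral_const_mul]
          ring
      _ ≤ q ^ (2 * N - 1) * ∫ t in Icc a b, K * (1 / gap σ (t - t')) := by
          refine mul_le_mul_of_nonneg_left (setIntegral_mono_on
            (Continuous.integrableOn_Icc (continuous_finsetSum _ fun i _ => (hcF i).const_mul _))
            (hgi.const_mul K).integrableOn_Icc measurableSet_Icc fun t ht => ?_) (by positivity)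
          have h1 := h t ht t' ht'
          rw [le_div_iff₀ (pow_pos (hg t) _)] at h1
          refine le_trans (le_of_eq ?_)
            (mul_le_mul_of_nonneg_right h1 (one_div_pos.2 (hg t)).le)
          rw [Finset.sum_mul, Finset.sum_mul]
          refine Finset.sum_congr rfl fun i _ => ?_
          ring
      _ = K * q ^ (2 * N) := by
          rw [integral_const_mul, ← hq]
          conv_rhs => rw [show 2 * N = 2 * N - 1 + 1 by omega, pow_succ]
          ring
      _ ≤ K * Q ^ (2 * N) := by
          gcongr
          exact hQ t' ht'
  calc ∑ i ∈ s, w i * ((∫ t in Icc a b, F i t) ^ (2 * N) * ∫ t in Icc a b, F i t ^ 2)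
      = ∫ t' in Icc a b, ∑ i ∈ s, w i * ((∫ t in Icc a b, F i t) ^ (2 * N) * F i t' ^ 2) := by
        rw [integral_finsetSum _ fun i _ => Continuous.integrableOn_Icc
          (by have := hF i; fun_prop)]
        refine Finset.sum_congr rfl fun i _ => ?_
        rw [integral_const_mul, integral_const_mul]
    _ ≤ ∫ t' in Icc a b, K * Q ^ (2 * N) := by
        refine setIntegral_mono_on (Continuous.integrableOn_Icc
          (continuous_finsetSum _ fun i _ => by have := hF i; fun_prop))
          (integrableOn_const (by simp)) measurableSet_Icc key
    _ = _ := by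
        rw [setIntegral_const, Real.volume_real_Icc, max_eq_left (by linarith), smul_eq_mul]
        ring

lemma integral_pow_norm_piece_le {F : ℝ → ℂ} (hF : Continuous F) {a b β L : ℝ} (hab : a ≤ b)
    (hβ : 0 ≤ β) (hL : 0 < L) (N : ℕ) :
    ∫ u in Ioc 0 L, ‖∫ t in a..b, F t * ((Real.exp (-β * t ^ 2) : ℂ) *
        Complex.exp (Complex.I * t * u))‖ ^ (2 * (N + 1)) ≤
      Real.exp 1 * (2 * Real.pi) *
        ((∫ t in Icc a b, ‖F t‖) ^ (2 * N) * ∫ t in Icc a b, ‖F t‖ ^ 2) := by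
  set f : ℝ → ℂ := fun t => F t * (Real.exp (-β * t ^ 2) : ℂ) with hf
  have hfc : Continuous f := by fun_prop
  have hfle : ∀ t, ‖f t‖ ≤ ‖F t‖ := fun t => by
    rw [hf, norm_mul, Complex.norm_real, Real.norm_of_nonneg (Real.exp_pos _).le]
    exact mul_le_of_le_one_right (norm_nonneg _)
      (Real.exp_le_one_iff.2 (by nlinarith [mul_nonneg hβ (sq_nonneg t)]))
  set G : ℝ → ℂ := (Icc a b).indicator f with hG
  have hGi : Integrable G := (integrable_indicator_iff measurableSet_Icc).2 hfc.integrableOn_Icc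
  have hn : ∀ v, ‖G v‖ = (Icc a b).indicator (fun t => ‖f t‖) v := fun v =>
    norm_indicator_eq_indicator_norm _ _
  have hn2 : ∀ v, ‖G v‖ ^ 2 = (Icc a b).indicator (fun t => ‖f t‖ ^ 2) v := fun v => by
    rw [hn]
    by_cases hv : v ∈ Icc a b <;> simp [hv]
  have hG2 : Integrable fun v => ‖G v‖ ^ 2 := by
    simp only [hn2]
    exact (integrable_indicator_iff measurableSet_Icc).2
      (Continuous.integrableOn_Icc (by fun_prop))
  have e : ∀ u : ℝ, ∫ t in a..b, F t * ((Real.exp (-β * t ^ 2) : ℂ) *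
      Complex.exp (Complex.I * t * u)) = fhat G (-u) := fun u => by
    rw [intervalIntegral.integral_of_le hab, ← integral_Icc_eq_integral_Ioc, fhat,
      ← integral_indicator measurableSet_Icc]
    refine integral_congr_ae (.of_forall fun t => ?_)
    by_cases ht : t ∈ Icc a b
    · simp only [hG, hf, indicator_of_mem ht]
      rw [← mul_assoc]
      congr 2
      push_cast
      ring
    · simp [hG, ht]
  simp only [e]
  set X := ∫ t in Icc a b, ‖F t‖ with hX
  have hX1 : ∀ u, ‖fhat G u‖ ≤ X := fun u => by
    refine (norm_fhat_le G u).trans ?_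
    simp only [hn]
    rw [integral_indicator measurableSet_Icc]
    exact setIntegral_mono_on (Continuous.integrableOn_Icc (by fun_prop))
      (Continuous.integrableOn_Icc (by fun_prop)) measurableSet_Icc fun t _ => hfle t
  have hX0 : 0 ≤ X := (norm_nonneg _).trans (hX1 0)
  have hc := continuous_fhat hGi
  set b' : ℝ := 1 / L ^ 2 with hb'
  have hb'0 : 0 < b' := by positivity
  have hint : Integrable fun u => ‖fhat G u‖ ^ 2 * Real.exp (-b' * u ^ 2) := by
    refine (integrable_exp_neg_mul_sq hb'0).bdd_mul (c := X ^ 2)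
      (by fun_prop) (.of_forall fun t => ?_)
    rw [norm_pow, norm_norm]
    exact pow_le_pow_left₀ (norm_nonneg _) (hX1 t) 2
  have hint' : Integrable fun u => ‖fhat G (-u)‖ ^ 2 * Real.exp (-b' * u ^ 2) := by
    simpa using hint.comp_neg
  calc ∫ u in Ioc 0 L, ‖fhat G (-u)‖ ^ (2 * (N + 1))
      ≤ ∫ u in Ioc 0 L, X ^ (2 * N) * Real.exp 1 *
          (‖fhat G (-u)‖ ^ 2 * Real.exp (-b' * u ^ 2)) := by
        refine setIntegral_mono_on ?_ (hint'.const_mul _).integrableOn measurableSet_Ioc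
          fun u hu => ?_
        · exact (Continuous.integrableOn_Icc (by fun_prop)).mono_set Ioc_subset_Icc_self
        have h1 : 1 ≤ Real.exp 1 * Real.exp (-b' * u ^ 2) := by
          rw [← Real.exp_add]
          refine Real.one_le_exp ?_
          have : b' * u ^ 2 ≤ b' * L ^ 2 := by
            gcongr
            · exact hu.1.le
            · exact hu.2
          rw [hb', one_div_mul_cancel (by positivity)] at this
          linarith
        have h2 : ‖fhat G (-u)‖ ^ (2 * (N + 1)) ≤ X ^ (2 * N) * ‖fhat G (-u)‖ ^ 2 := by
          rw [show 2 * (N + 1) = 2 * N + 2 by ring, pow_add]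
          exact mul_le_mul_of_nonneg_right (pow_le_pow_left₀ (norm_nonneg _) (hX1 _) _)
            (by positivity)
        calc _ ≤ X ^ (2 * N) * ‖fhat G (-u)‖ ^ 2 * 1 := by rwa [mul_one]
          _ ≤ X ^ (2 * N) * ‖fhat G (-u)‖ ^ 2 * (Real.exp 1 * Real.exp (-b' * u ^ 2)) :=
              mul_le_mul_of_nonneg_left h1 (by positivity)
          _ = _ := by ring
    _ = X ^ (2 * N) * Real.exp 1 *
          ∫ u in Ioc 0 L, ‖fhat G (-u)‖ ^ 2 * Real.exp (-b' * u ^ 2) := integral_const_mul _ _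
    _ ≤ X ^ (2 * N) * Real.exp 1 * ∫ u, ‖fhat G (-u)‖ ^ 2 * Real.exp (-b' * u ^ 2) :=
        mul_le_mul_of_nonneg_left (setIntegral_le_integral hint'
          (.of_forall fun t => by positivity)) (by positivity)
    _ = X ^ (2 * N) * Real.exp 1 * ∫ u, ‖fhat G u‖ ^ 2 * Real.exp (-b' * u ^ 2) := by
        congr 1
        rw [← integral_neg_eq_self]
        simp
    _ ≤ X ^ (2 * N) * Real.exp 1 * (2 * Real.pi * ∫ v, ‖G v‖ ^ 2) :=
        mul_le_mul_of_nonneg_left (integral_norm_fhat_sq_le hGi hG2 hb'0) (by positivity)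
    _ ≤ X ^ (2 * N) * Real.exp 1 * (2 * Real.pi * ∫ t in Icc a b, ‖F t‖ ^ 2) := by
        gcongr
        simp only [hn2]
        rw [integral_indicator measurableSet_Icc]
        exact setIntegral_mono_on (Continuous.integrableOn_Icc (by fun_prop))
          (Continuous.integrableOn_Icc (by fun_prop)) measurableSet_Icc fun t _ =>
          pow_le_pow_left₀ (norm_nonneg _) (hfle t) 2
    _ = _ := by ring

section

open Filter Topology

lemma lintegral_le_of_tendsto_ae {α : Type*} [MeasurableSpace α] {μ : Measure α}
    {φ : ℕ → α → ENNReal} {ψ : α → ENNReal} {B : ENNReal} (hφ : ∀ m, Measurable (φ m))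
    (hlim : ∀ᵐ x ∂μ, Tendsto (fun m => φ m x) atTop (𝓝 (ψ x))) (hB : ∀ m, ∫⁻ x, φ m x ∂μ ≤ B) :
    ∫⁻ x, ψ x ∂μ ≤ B :=
  calc ∫⁻ x, ψ x ∂μ = ∫⁻ x, liminf (fun m => φ m x) atTop ∂μ :=
        lintegral_congr_ae (hlim.mono fun x hx => hx.liminf_eq.symm)
    _ ≤ liminf (fun m => ∫⁻ x, φ m x ∂μ) atTop := lintegral_liminf_le hφ
    _ ≤ liminf (fun _ : ℕ => B) atTop := liminf_le_liminf (.of_forall hB)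
    _ = B := liminf_const _

/-- The integrand of the Gaussian-regularised Fourier inversion formula. -/
noncomputable def inversionKernel (f : ℝ → ℂ) (β u t : ℝ) : ℂ :=
  fhat f t * ((Real.exp (-β * t ^ 2) : ℂ) * Complex.exp (Complex.I * t * u))

lemma continuous_uncurry_inversionKernel {f : ℝ → ℂ} (hf : Integrable f) (β : ℝ) :
    Continuous (Function.uncurry (inversionKernel f β)) := by
  have := continuous_fhat hf
  unfold inversionKernel Function.uncurry
  fun_prop

lemma continuous_inversionKernel {f : ℝ → ℂ} (hf : Integrable f) (β u : ℝ) :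
    Continuous (inversionKernel f β u) := by
  have := continuous_fhat hf
  unfold inversionKernel
  fun_prop

lemma integrable_inversionKernel {f : ℝ → ℂ} (hf : Integrable f) {β : ℝ} (hβ : 0 < β) (u : ℝ) :
    Integrable (inversionKernel f β u) := by
  refine Integrable.mono' ((integrable_exp_neg_mul_sq hβ).const_mul (∫ v, ‖f v‖))
    (continuous_inversionKernel hf β u).aestronglyMeasurable (.of_forall fun t => ?_)
  rw [inversionKernel, norm_mul, norm_mul, Complex.norm_real, Real.norm_of_nonneg (Real.exp_pos _).le,
    show Complex.I * (t : ℂ) * u = ((t * u : ℝ) : ℂ) * Complex.I by push_cast; ring,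
    Complex.norm_exp_ofReal_mul_I, mul_one]
  exact mul_le_mul_of_nonneg_right (norm_fhat_le f t) (Real.exp_pos _).le

lemma continuous_integral_inversionKernel {f : ℝ → ℂ} (hf : Integrable f) {β : ℝ} (hβ : 0 < β) :
    Continuous fun u => ∫ t, inversionKernel f β u t := by
  have h := continuous_fhat (integrable_inversionKernel hf hβ 0)
  refine (h.comp continuous_neg).congr fun u => ?_
  simp only [Function.comp, fhat]
  refine integral_congr_ae (.of_forall fun t => ?_)
  simp only [inversionKernel]
  rw [mul_assoc, mul_assoc, ← Complex.exp_add]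
  congr 3
  push_cast
  ring

lemma tendsto_integral_inversionKernel {f : ℝ → ℂ} (hf : Integrable f) {u : ℝ}
    (hu : ContinuousAt f u) :
    Tendsto (fun c : ℝ => ∫ t, inversionKernel f (1 / (4 * Real.pi ^ 2 * c)) u t) atTop
      (𝓝 (2 * Real.pi * f u)) := by
  refine ((Real.tendsto_integral_gaussian_smul' hf hu).const_mul (2 * Real.pi : ℂ)).congr' ?_
  filter_upwards [Ioi_mem_atTop 0] with c hc
  have hc : 0 < c := hc
  have hpi := Real.pi_pos
  simp only [inversionKernel, fhat]
  rw [integral_fourier_mul_gaussian hf (by positivity) u, ← integral_const_mul,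
    ← integral_const_mul]
  refine integral_congr_ae (.of_forall fun v => ?_)
  have h1 : √(Real.pi / (1 / (4 * Real.pi ^ 2 * c))) = 2 * Real.pi * √(Real.pi * c) := by
    rw [show Real.pi / (1 / (4 * Real.pi ^ 2 * c)) = (2 * Real.pi) ^ 2 * (Real.pi * c) by
      field_simp; ring, Real.sqrt_mul (by positivity), Real.sqrt_sq (by positivity)]
  have h2 : ((Real.pi : ℂ) * c) ^ ((Module.finrank ℝ ℝ : ℂ) / 2) = (√(Real.pi * c) : ℝ) := by
    rw [Real.sqrt_eq_rpow, Complex.ofReal_cpow (by positivity)]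
    simp
  have h3 : Complex.exp (-Real.pi ^ 2 * c * (‖u - v‖ : ℂ) ^ 2) =
      (Real.exp (-(u - v) ^ 2 / (4 * (1 / (4 * Real.pi ^ 2 * c)))) : ℂ) := by
    rw [← Complex.ofReal_pow ‖u - v‖, Real.norm_eq_abs, sq_abs]
    push_cast
    congr 1
    have : (c : ℂ) ≠ 0 := by exact_mod_cast hc.ne'
    have : (Real.pi : ℂ) ≠ 0 := by exact_mod_cast hpi.ne'
    field_simp
  simp only [smul_eq_mul]
  rw [h1, h2, h3]
  push_cast
  ring

lemma fhat_ofReal_neg (g : ℝ → ℝ) (t : ℝ) :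
    fhat (fun u => (g u : ℂ)) (-t) = starRingEnd ℂ (fhat (fun u => (g u : ℂ)) t) := by
  rw [fhat, fhat, ← integral_conj]
  refine integral_congr_ae (.of_forall fun v => ?_)
  simp [← Complex.exp_conj]

lemma norm_integral_inversionKernel_le {g : ℝ → ℝ} (hg : Integrable fun u => (g u : ℂ)) {β : ℝ}
    (hβ : 0 < β) (u : ℝ) :
    ‖∫ t, inversionKernel (fun u => (g u : ℂ)) β u t‖ ≤
      2 * ‖∫ t in Ioi 0, inversionKernel (fun u => (g u : ℂ)) β u t‖ := by
  have hi := integrable_inversionKernel hg hβ u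
  have h : ∫ t in Iic 0, inversionKernel (fun u => (g u : ℂ)) β u t =
      starRingEnd ℂ (∫ t in Ioi 0, inversionKernel (fun u => (g u : ℂ)) β u t) := by
    have := integral_comp_neg_Ioi (0 : ℝ) (inversionKernel (fun u => (g u : ℂ)) β u)
    rw [neg_zero] at this
    rw [← this, ← integral_conj]
    refine integral_congr_ae (.of_forall fun t => ?_)
    simp only [inversionKernel, fhat_ofReal_neg, map_mul, ← Complex.exp_conj, Complex.conj_ofReal,
      Complex.conj_I, Complex.ofReal_neg, neg_sq, mul_neg, neg_mul]
  rw [← integral_add_compl (measurableSet_Ioi (a := (0 : ℝ))) hi, compl_Ioi, h, two_mul]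
  refine (norm_add_le _ _).trans ?_
  rw [RCLike.norm_conj]

/-- Fatou transfer of moment bounds from truncated Fourier inversion integrals to the function. -/
theorem integral_sum_abs_pow_le {ι : Type*} (s : Finset ι) {w : ι → ℝ} (hw : ∀ i ∈ s, 0 ≤ w i)
    {g : ι → ℝ → ℝ} (hg : ∀ i, Integrable fun u => (g i u : ℂ))
    (hcont : ∀ i, ∀ᵐ u, ContinuousAt (g i) u) (n : ℕ) {L X : ℝ} (hX0 : 0 ≤ X) {a : ℕ → ℝ}
    (ha : Tendsto a atTop atTop)
    (hX : ∀ β > 0, ∀ I, ∫ u in Ioc 0 L, ∑ i ∈ s,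
      w i * ‖∫ t in (0 : ℝ)..a I, inversionKernel (fun u => (g i u : ℂ)) β u t‖ ^ n ≤ X)
    (hint : IntegrableOn (fun u => ∑ i ∈ s, w i * |g i u| ^ n) (Ioc 0 L)) :
    ∫ u in Ioc 0 L, ∑ i ∈ s, w i * |g i u| ^ n ≤ X := by
  set K : ι → ℝ → ℝ → ℝ → ℂ := fun i => inversionKernel (fun u => (g i u : ℂ)) with hK
  have h1 : ∀ β > 0, ∀ I, ∫⁻ u in Ioc 0 L, ENNReal.ofReal (∑ i ∈ s,
      w i * ‖∫ t in (0 : ℝ)..a I, K i β u t‖ ^ n) ≤ ENNReal.ofReal X := fun β hβ I => by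
    rw [← ofReal_integral_eq_lintegral_ofReal]
    · exact ENNReal.ofReal_le_ofReal (hX β hβ I)
    · refine (Continuous.integrableOn_Icc ?_).mono_set Ioc_subset_Icc_self
      refine continuous_finsetSum _ fun i _ => ?_
      have := intervalIntegral.continuous_parametric_intervalIntegral_of_continuous' (μ := volume)
        (continuous_uncurry_inversionKernel (hg i) β) 0 (a I)
      exact ((this.norm).pow n).const_mul _ |>.congr fun u => rfl
    · exact .of_forall fun u => Finset.sum_nonneg fun i hi =>
        mul_nonneg (hw i hi) (by positivity)
  have h2 : ∀ β > 0, ∫⁻ u in Ioc 0 L, ENNReal.ofReal (∑ i ∈ s,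
      w i * ‖∫ t in Ioi 0, K i β u t‖ ^ n) ≤ ENNReal.ofReal X := fun β hβ => by
    refine lintegral_le_of_tendsto_ae (fun I => ?_) (.of_forall fun u => ?_) (h1 β hβ)
    · refine ENNReal.measurable_ofReal.comp (Continuous.measurable ?_)
      refine continuous_finsetSum _ fun i _ => ?_
      have := intervalIntegral.continuous_parametric_intervalIntegral_of_continuous' (μ := volume)
        (continuous_uncurry_inversionKernel (hg i) β) 0 (a I)
      exact ((this.norm).pow n).const_mul _ |>.congr fun u => rfl
    · refine ENNReal.tendsto_ofReal (tendsto_finsetSum _ fun i _ => ?_)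
      refine (Tendsto.pow (Tendsto.norm ?_) n).const_mul _
      exact intervalIntegral_tendsto_integral_Ioi 0
        (integrable_inversionKernel (hg i) hβ u).integrableOn ha
  have h3 : ∀ β > 0, ∫⁻ u in Ioc 0 L, ENNReal.ofReal (∑ i ∈ s,
      w i * ‖(∫ t, K i β u t) / 2‖ ^ n) ≤ ENNReal.ofReal X := fun β hβ => by
    refine (lintegral_mono fun u => ENNReal.ofReal_le_ofReal ?_).trans (h2 β hβ)
    refine Finset.sum_le_sum fun i hi => mul_le_mul_of_nonneg_left
      (pow_le_pow_left₀ (norm_nonneg _) ?_ n) (hw i hi)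
    have := norm_integral_inversionKernel_le (hg i) hβ u
    rw [norm_div, Complex.norm_ofNat]
    linarith
  have h4 : ∫⁻ u in Ioc 0 L, ENNReal.ofReal (∑ i ∈ s, w i * ‖2 * Real.pi * (g i u : ℂ) / 2‖ ^ n) ≤
      ENNReal.ofReal X := by
    have hb : ∀ m : ℕ, 0 < 1 / (4 * Real.pi ^ 2 * ((m : ℝ) + 1)) := fun m => by positivity
    refine lintegral_le_of_tendsto_ae (φ := fun m u => ENNReal.ofReal (∑ i ∈ s,
      w i * ‖(∫ t, K i (1 / (4 * Real.pi ^ 2 * ((m : ℝ) + 1))) u t) / 2‖ ^ n)) (fun m => ?_) ?_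
      (fun m => h3 _ (hb m))
    · refine ENNReal.measurable_ofReal.comp (Continuous.measurable ?_)
      refine continuous_finsetSum _ fun i _ => ?_
      have := continuous_integral_inversionKernel (hg i) (hb m)
      exact (((this.div_const 2).norm).pow n).const_mul _
    · refine ae_restrict_of_ae ?_
      have hall : ∀ᵐ u, ∀ i ∈ s, ContinuousAt (g i) u :=
        (Filter.eventually_all_finset s).2 fun i _ => hcont i
      filter_upwards [hall] with u hu
      refine ENNReal.tendsto_ofReal (tendsto_finsetSum _ fun i hi => ?_)
      refine (Tendsto.pow (Tendsto.norm (Tendsto.div_const ?_ 2)) n).const_mul _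
      have hc : ContinuousAt (fun u => (g i u : ℂ)) u :=
        Complex.continuous_ofReal.continuousAt.comp (hu i hi)
      exact (tendsto_integral_inversionKernel (hg i) hc).comp
        (tendsto_atTop_add_const_right _ 1 tendsto_natCast_atTop_atTop)
  have h5 : ∫⁻ u in Ioc 0 L, ENNReal.ofReal (∑ i ∈ s, w i * |g i u| ^ n) ≤ ENNReal.ofReal X := by
    refine (lintegral_mono fun u => ENNReal.ofReal_le_ofReal ?_).trans h4
    refine Finset.sum_le_sum fun i hi => mul_le_mul_of_nonneg_left
      (pow_le_pow_left₀ (abs_nonneg _) ?_ n) (hw i hi)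
    rw [mul_assoc, mul_div_cancel_left₀ _ two_ne_zero, norm_mul, Complex.norm_real,
      Complex.norm_real, Real.norm_of_nonneg Real.pi_pos.le, Real.norm_eq_abs]
    exact le_mul_of_one_le_left (abs_nonneg _) (by linarith [Real.pi_gt_three])
  rw [← ofReal_integral_eq_lintegral_ofReal hint (.of_forall fun u => Finset.sum_nonneg fun i hi =>
    mul_nonneg (hw i hi) (by positivity))] at h5
  exact (ENNReal.ofReal_le_ofReal_iff hX0).1 h5

end

lemma scale_bound {σ T : ℝ} (hσ : 0 < σ) (hσ1 : σ ≤ 1) (hσT : σ ≤ T) {A N B D : ℕ}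
    (hB : B ≤ D + 2 * N + 1) (hD : 2 * (N + 1) * A ≤ D) :
    (1 / T ^ (A + 1)) ^ (2 * (N + 1)) * (2 + T) ^ (1 / 2 : ℝ) *
      ((min 1 T) ^ B * (σ ^ (2 * N + 1) / σ ^ B)) * max 1 T ^ (2 * N) * T ≤
      2 * ((1 / σ) ^ D * T ^ (-(1 / 4) : ℝ)) := by
  have hT : 0 < T := hσ.trans_le hσT
  rw [div_pow, one_pow, ← pow_mul, one_div_pow]
  set m := (A + 1) * (2 * (N + 1)) with hm
  have hmA : m = 2 * (N + 1) * A + (2 * N + 1) + 1 := by rw [hm]; ring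
  have hσpow : σ ^ (2 * N + 1) / σ ^ B ≤ 1 / σ ^ D := by
    rw [div_le_div_iff₀ (by positivity) (by positivity), one_mul, ← pow_add]
    exact pow_le_pow_of_le_one hσ.le hσ1 (by omega)
  rcases le_total T 1 with h1 | h1
  · rw [min_eq_right h1, max_eq_left h1, one_pow, mul_one]
    have h2 : (2 + T) ^ (1 / 2 : ℝ) ≤ 2 := by
      rw [← Real.sqrt_eq_rpow, Real.sqrt_le_left (by norm_num)]
      linarith
    have h3 : 1 ≤ T ^ (-(1 / 4) : ℝ) :=
      Real.one_le_rpow_of_pos_of_le_one_of_nonpos hT h1 (by norm_num)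
    have h4 : 1 / T ^ m * (T ^ B * (σ ^ (2 * N + 1) / σ ^ B)) * T ≤ 1 / σ ^ D := by
      rcases le_total m (B + 1) with h | h
      · have h5 : T ^ (B + 1) / T ^ m ≤ 1 := by
          rw [div_le_one (by positivity)]
          exact pow_le_pow_of_le_one hT.le h1 h
        calc _ = T ^ (B + 1) / T ^ m * (σ ^ (2 * N + 1) / σ ^ B) := by rw [pow_succ]; ring
          _ ≤ 1 * (σ ^ (2 * N + 1) / σ ^ B) := by gcongr
          _ ≤ _ := by rwa [one_mul]
      · obtain ⟨e, he⟩ := Nat.exists_eq_add_of_le h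
        calc _ = σ ^ (2 * N + 1) / σ ^ B / T ^ e := by
              rw [he, pow_add _ (B + 1)]
              field_simp
              ring
          _ ≤ σ ^ (2 * N + 1) / σ ^ B / σ ^ e := by gcongr
          _ = σ ^ (2 * N + 1) / σ ^ (B + e) := by rw [div_div, ← pow_add]
          _ ≤ 1 / σ ^ D := by
              rw [div_le_div_iff₀ (by positivity) (by positivity), one_mul, ← pow_add]
              exact pow_le_pow_of_le_one hσ.le hσ1 (by omega)
    calc _ = (2 + T) ^ (1 / 2 : ℝ) * (1 / T ^ m * (T ^ B * (σ ^ (2 * N + 1) / σ ^ B)) * T) := by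
          ring
      _ ≤ 2 * (1 / σ ^ D) := mul_le_mul h2 h4 (by positivity) (by norm_num)
      _ ≤ 2 * (1 / σ ^ D * T ^ (-(1 / 4) : ℝ)) := by
          have : 0 ≤ 1 / σ ^ D := by positivity
          nlinarith
  · rw [min_eq_left h1, max_eq_right h1, one_pow, one_mul]
    have h2 : (2 + T) ^ (1 / 2 : ℝ) ≤ 2 * T ^ (1 / 2 : ℝ) := by
      rw [← Real.sqrt_eq_rpow, ← Real.sqrt_eq_rpow, Real.sqrt_le_left (by positivity), mul_pow,
        Real.sq_sqrt hT.le]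
      linarith
    have h3 : 1 / T ^ m * T ^ (2 * N) * T ≤ T⁻¹ := by
      rw [mul_assoc, ← pow_succ, one_div_mul_eq_div, div_le_iff₀ (by positivity),
        inv_mul_eq_div, le_div_iff₀ hT, ← pow_succ]
      exact pow_le_pow_right₀ h1 (by omega)
    have h4 : T ^ (1 / 2 : ℝ) * T⁻¹ ≤ T ^ (-(1 / 4) : ℝ) := by
      rw [← Real.rpow_neg_one, ← Real.rpow_add hT]
      exact Real.rpow_le_rpow_of_exponent_le h1 (by norm_num)
    calc _ = (2 + T) ^ (1 / 2 : ℝ) * (1 / T ^ m * T ^ (2 * N) * T) *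
          (σ ^ (2 * N + 1) / σ ^ B) := by ring
      _ ≤ (2 * T ^ (1 / 2 : ℝ)) * T⁻¹ * (1 / σ ^ D) := by gcongr
      _ = 2 * (T ^ (1 / 2 : ℝ) * T⁻¹) * (1 / σ ^ D) := by ring
      _ ≤ 2 * T ^ (-(1 / 4) : ℝ) * (1 / σ ^ D) := by gcongr
      _ = _ := by ring

lemma continuous_intervalIntegral_inversionKernel {f : ℝ → ℂ} (hf : Integrable f) (β a b : ℝ) :
    Continuous fun u => ∫ t in a..b, inversionKernel f β u t :=
  intervalIntegral.continuous_parametric_intervalIntegral_of_continuous'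
    (continuous_uncurry_inversionKernel hf β) a b

/-- The contribution of frequencies of a given scale to the moment. -/
theorem exists_integral_piece_le (A N : ℕ) : ∃ C : ℝ, 0 < C ∧
    ∀ σ : ℝ, 0 < σ → (2 * N + 2) * σ ≤ 1 → ∃ M₀ : ℕ, ∀ M, M₀ ≤ M → ∀ (D : ℕ),
      (2 * (N + 1)).choose (N + 1) ≤ D + 2 * N + 1 → 2 * (N + 1) * A ≤ D →
      ∀ (a b T β L : ℝ), a < b → 0 ≤ β → 0 < L →
      (∀ t ∈ Icc a b, ∀ t' ∈ Icc a b, SameScale σ T t t') →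
      ∫ u in Ioc 0 L, ∑ S ∈ (primesUpTo M).powerset, wt (primesUpTo M) S *
        ‖∫ t in a..b, inversionKernel (fun u => (dampedSum A S σ u : ℂ)) β u t‖ ^ (2 * (N + 1)) ≤
      C * (3 + 2 * Real.log (1 + 1 / σ)) ^ (2 * N) * ((1 / σ) ^ D * T ^ (-(1 / 4) : ℝ)) := by
  obtain ⟨C, hC, hstar⟩ := exists_starMoment_le N (ε := 1 / 2) (by norm_num)
  set f : ℝ := (A.factorial : ℝ) with hf
  have hf0 : 0 < f := by rw [hf]; exact_mod_cast A.factorial_pos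
  refine ⟨Real.exp 1 * (2 * Real.pi) * (C * (f * (3 / 2) ^ (A + 1)) ^ (2 * (N + 1)) * 2),
    by positivity, fun σ hσ hσ1 => ?_⟩
  obtain ⟨M₀, hM₀⟩ := hstar σ hσ hσ1
  have hσ2 : σ ≤ 1 := by
    have : (0 : ℝ) ≤ N := by positivity
    nlinarith
  refine ⟨M₀, fun M hM D hB hD a b T β L hab hβ hL hsame => ?_⟩
  have hP : ∀ p ∈ primesUpTo M, p.Prime := fun p hp => prime_of_mem_primesUpTo hp
  set P := primesUpTo M with hPdef
  have hs := hsame a ⟨le_rfl, hab.le⟩ b ⟨hab.le, le_rfl⟩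
  have ha0 : 0 ≤ a := hs.nonneg
  have hbT : b ≤ T := hs.le'
  have hσT : σ ≤ T := hs.scale_le
  have hT : 0 < T := hσ.trans_le hσT
  set F : Finset ℕ → ℝ → ℂ := fun S => fhat (fun u => (dampedSum A S σ u : ℂ)) with hF
  have hFc : ∀ S, Continuous (F S) := fun S => continuous_fhat (integrable_dampedSum A S hσ)
  set Λ := 3 + 2 * Real.log (1 + 1 / σ) with hΛ
  have hΛ0 : 0 ≤ Λ := by
    have := Real.log_nonneg (show 1 ≤ 1 + 1 / σ by have := one_div_pos.2 hσ; linarith)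
    rw [hΛ]; linarith
  set q := (2 * (N + 1)).choose (N + 1) with hq
  set K := C * (f * (3 / 2) ^ (A + 1)) ^ (2 * (N + 1)) * ((1 / T ^ (A + 1)) ^ (2 * (N + 1)) *
    (2 + T) ^ (1 / 2 : ℝ) * ((min 1 T) ^ q * (σ ^ (2 * N + 1) / σ ^ q))) with hK
  have hmin : 0 < min 1 T := lt_min one_pos hT
  have hK0 : 0 ≤ K := by positivity
  have hnorm : ∀ t, (T = σ ∨ 2 * T / 3 ≤ t) →
      f / ‖(⟨σ, t⟩ : ℂ)‖ ^ (A + 1) ≤ f * (3 / 2) ^ (A + 1) * (1 / T ^ (A + 1)) := by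
    intro t ht
    have h1 : 2 * T / 3 ≤ ‖(⟨σ, t⟩ : ℂ)‖ := by
      rcases ht with h | h
      · have := Complex.abs_re_le_norm (⟨σ, t⟩ : ℂ)
        simp only [abs_of_pos hσ] at this
        linarith
      · have := (le_abs_self _).trans (Complex.abs_im_le_norm (⟨σ, t⟩ : ℂ))
        simp only at this
        linarith
    calc f / ‖(⟨σ, t⟩ : ℂ)‖ ^ (A + 1) ≤ f / (2 * T / 3) ^ (A + 1) := by gcongr
      _ = _ := by
          rw [show 2 * T / 3 = T / (3 / 2) by ring, div_pow]
          field_simp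
  have hKb : ∀ t ∈ Icc a b, ∀ t' ∈ Icc a b, ∑ S ∈ P.powerset,
      wt P S * (‖F S t‖ ^ (2 * N) * ‖F S t'‖ ^ 2) ≤ K / gap σ (t - t') ^ (2 * N) := by
    intro t ht t' ht'
    have hss := hsame t ht t' ht'
    have h1 := hM₀ M hM ⟨σ, t⟩ ⟨σ, t'⟩ T rfl rfl hss
    have h2 := hnorm t (hss.lower.imp_right fun h => h.1)
    have h3 := hnorm t' (hss.lower.imp_right fun h => h.2)
    rw [sum_wt_norm_fhat_pow A N hP hσ]
    calc _ ≤ (f * (3 / 2) ^ (A + 1) * (1 / T ^ (A + 1))) ^ (2 * N) *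
          (f * (3 / 2) ^ (A + 1) * (1 / T ^ (A + 1))) ^ 2 * (C * (2 + T) ^ (1 / 2 : ℝ) *
            ((min 1 T) ^ q * (σ ^ (2 * N + 1) / σ ^ q)) / (min 1 (σ + |t - t'|)) ^ (2 * N)) := by
          refine mul_le_mul ?_ h1 ?_ (by positivity)
          · gcongr
          · exact Finset.sum_nonneg fun S _ => mul_nonneg (wt_nonneg _ _) (by positivity)
      _ = K / gap σ (t - t') ^ (2 * N) := by
          rw [hK, gap]
          ring
  have hQ : ∀ t' ∈ Icc a b, ∫ t in Icc a b, 1 / gap σ (t - t') ≤ max 1 T * Λ := fun t' ht' =>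
    integral_inv_gap_le hσ ha0 hbT ht'
  have hsum := sum_mul_pow_integral_le P.powerset (w := wt P) (fun S _ => wt_nonneg P S)
    (F := fun S t => ‖F S t‖) (fun S => (hFc S).norm) (fun S t => norm_nonneg _) hab hσ hK0 N hKb hQ
  have hcont : ∀ S, Continuous fun u => wt P S *
      ‖∫ t in a..b, inversionKernel (fun u => (dampedSum A S σ u : ℂ)) β u t‖ ^ (2 * (N + 1)) :=
    fun S => (((continuous_intervalIntegral_inversionKernel (integrable_dampedSum A S hσ)
      β a b).norm).pow _).const_mul _
  rw [integral_finsetSum _ fun S _ =>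
    ((hcont S).integrableOn_Icc (a := 0) (b := L)).mono_set Ioc_subset_Icc_self]
  calc _ ≤ ∑ S ∈ P.powerset, Real.exp 1 * (2 * Real.pi) * (wt P S *
        ((∫ t in Icc a b, ‖F S t‖) ^ (2 * N) * ∫ t in Icc a b, ‖F S t‖ ^ 2)) := by
        refine Finset.sum_le_sum fun S _ => ?_
        rw [integral_const_mul, mul_left_comm]
        exact mul_le_mul_of_nonneg_left (integral_pow_norm_piece_le (hFc S) hab.le hβ hL N)
          (wt_nonneg _ _)
    _ = Real.exp 1 * (2 * Real.pi) * ∑ S ∈ P.powerset, wt P S *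
        ((∫ t in Icc a b, ‖F S t‖) ^ (2 * N) * ∫ t in Icc a b, ‖F S t‖ ^ 2) :=
        (Finset.mul_sum _ _ _).symm
    _ ≤ Real.exp 1 * (2 * Real.pi) * (K * (max 1 T * Λ) ^ (2 * N) * (b - a)) := by gcongr
    _ ≤ Real.exp 1 * (2 * Real.pi) * (K * (max 1 T * Λ) ^ (2 * N) * T) := by
        gcongr
        linarith
    _ = Real.exp 1 * (2 * Real.pi) * (C * (f * (3 / 2) ^ (A + 1)) ^ (2 * (N + 1)) * Λ ^ (2 * N) *
        ((1 / T ^ (A + 1)) ^ (2 * (N + 1)) * (2 + T) ^ (1 / 2 : ℝ) *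
      ((min 1 T) ^ q * (σ ^ (2 * N + 1) / σ ^ q)) * max 1 T ^ (2 * N) * T)) := by
        rw [hK, mul_pow (max 1 T)]
        ring
    _ ≤ Real.exp 1 * (2 * Real.pi) * (C * (f * (3 / 2) ^ (A + 1)) ^ (2 * (N + 1)) * Λ ^ (2 * N) *
        (2 * ((1 / σ) ^ D * T ^ (-(1 / 4) : ℝ)))) :=
        mul_le_mul_of_nonneg_left (mul_le_mul_of_nonneg_left
          (scale_bound hσ hσ2 hσT hB hD) (by positivity)) (by positivity)
    _ = _ := by ring

section

open Filter Topology

lemma norm_sum_pow_le {n : ℕ} (hn : n ≠ 0) {r : ℝ} (hr : 0 < r) (hr1 : r < 1) (x : ℕ → ℂ) (I : ℕ) :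
    ‖∑ i ∈ Finset.range I, x i‖ ^ n ≤
      (1 / (1 - r)) ^ n * ∑ i ∈ Finset.range I, (1 / r) ^ (i * n) * ‖x i‖ ^ n := by
  have h1r : 0 < 1 - r := by linarith
  rcases Nat.eq_zero_or_pos I with rfl | hI
  · simp [hn]
  obtain ⟨j, hj, hmax⟩ := (Finset.range I).exists_max_image (fun i => (1 / r) ^ i * ‖x i‖)
    ⟨0, Finset.mem_range.2 hI⟩
  set m := (1 / r) ^ j * ‖x j‖ with hm
  have hm0 : 0 ≤ m := by positivity
  have h1 : ‖∑ i ∈ Finset.range I, x i‖ ≤ 1 / (1 - r) * m := by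
    calc _ ≤ ∑ i ∈ Finset.range I, ‖x i‖ := norm_sum_le _ _
      _ ≤ ∑ i ∈ Finset.range I, r ^ i * m := Finset.sum_le_sum fun i hi => by
          have := hmax i hi
          rw [one_div_pow, one_div_mul_eq_div, div_le_iff₀ (by positivity)] at this
          linarith
      _ = (∑ i ∈ Finset.range I, r ^ i) * m := (Finset.sum_mul _ _ _).symm
      _ ≤ _ := by
          refine mul_le_mul_of_nonneg_right ?_ hm0
          rw [one_div, ← tsum_geometric_of_lt_one hr.le hr1]
          exact (summable_geometric_of_lt_one hr.le hr1).sum_le_tsum _ fun i _ => by positivity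
  calc _ ≤ (1 / (1 - r) * m) ^ n := pow_le_pow_left₀ (norm_nonneg _) h1 n
    _ = (1 / (1 - r)) ^ n * ((1 / r) ^ (j * n) * ‖x j‖ ^ n) := by
        rw [mul_pow, hm, mul_pow, ← pow_mul]
    _ ≤ _ := by
        refine mul_le_mul_of_nonneg_left ?_ (by positivity)
        exact Finset.single_le_sum (f := fun i => (1 / r) ^ (i * n) * ‖x i‖ ^ n)
          (fun i _ => by positivity) hj

lemma ae_continuousAt_dampedSum (A : ℕ) (S : Finset ℕ) (σ : ℝ) :
    ∀ᵐ u, ContinuousAt (dampedSum A S σ) u := by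
  have h : ∀ᵐ u : ℝ, ∀ T ∈ S.powerset, u ≠ ∑ p ∈ T, Real.log p :=
    (Filter.eventually_all_finset _).2 fun T _ => compl_mem_ae_iff.2 (measure_singleton _)
  filter_upwards [h] with u hu
  have hp : ∀ x : ℝ, x ≠ 0 → ContinuousAt (posPow A) x := fun x hx => by
    rcases lt_or_gt_of_ne hx with h | h
    · refine (continuousAt_const (y := (0 : ℝ))).congr ?_
      filter_upwards [Iio_mem_nhds h] with y hy
      exact (posPow_eq_zero hy).symm
    · refine (continuous_pow A).continuousAt.congr ?_
      filter_upwards [Ioi_mem_nhds h] with y hy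
      exact (posPow_eq_pow (le_of_lt hy)).symm
  have hs : ContinuousAt (sieveSum A S) u := by
    unfold sieveSum
    refine tendsto_finsetSum _ fun T hT => (Tendsto.const_mul _ ?_)
    exact (hp _ (sub_ne_zero.2 (hu T hT))).comp
      (f := fun u => u - ∑ p ∈ T, Real.log p) (by fun_prop)
  exact hs.mul (by fun_prop)

/-- The endpoints of a lacunary partition of the positive half line. -/
noncomputable def breakpoint (σ : ℝ) : ℕ → ℝ
  | 0 => 0
  | i + 1 => σ * (3 / 2) ^ i

lemma breakpoint_lt {σ : ℝ} (hσ : 0 < σ) (i : ℕ) : breakpoint σ i < breakpoint σ (i + 1) := by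
  cases i with
  | zero => simpa [breakpoint]
  | succ i =>
    simp only [breakpoint, pow_succ]
    have : 0 < σ * (3 / 2) ^ i := by positivity
    linarith

lemma tendsto_breakpoint {σ : ℝ} (hσ : 0 < σ) : Tendsto (breakpoint σ) atTop atTop := by
  rw [← tendsto_add_atTop_iff_nat 1]
  exact (tendsto_pow_atTop_atTop_of_one_lt (by norm_num)).const_mul_atTop hσ

lemma sameScale_breakpoint {σ : ℝ} (hσ : 0 < σ) (i : ℕ) :
    ∀ t ∈ Icc (breakpoint σ i) (breakpoint σ (i + 1)),
      ∀ t' ∈ Icc (breakpoint σ i) (breakpoint σ (i + 1)), SameScale σ (σ * (3 / 2) ^ i) t t' := by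
  intro t ht t' ht'
  have h0 : 0 ≤ breakpoint σ i := by
    cases i with
    | zero => exact le_rfl
    | succ i => simp only [breakpoint]; positivity
  refine ⟨h0.trans ht.1, h0.trans ht'.1, ht.2, ht'.2,
    le_mul_of_one_le_right hσ.le (one_le_pow₀ (by norm_num)), ?_⟩
  cases i with
  | zero => left; simp
  | succ i =>
    right
    have e : 2 * (σ * (3 / 2) ^ (i + 1)) / 3 = breakpoint σ (i + 1) := by
      simp only [breakpoint, pow_succ]
      ring
    exact ⟨e.trans_le ht.1, e.trans_le ht'.1⟩

lemma exists_log_pow_le (N : ℕ) : ∃ C : ℝ, 0 < C ∧ ∀ L : ℝ, 1 ≤ L →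
    (3 + 2 * Real.log (1 + L)) ^ (2 * N) ≤ C * L ^ (1 / 4 : ℝ) := by
  set ε : ℝ := 1 / (8 * (N + 1)) with hε
  have hε0 : 0 < ε := by positivity
  refine ⟨(3 + 2 * (2 ^ ε / ε)) ^ (2 * N), by positivity, fun L hL => ?_⟩
  have hL0 : 0 < L := by linarith
  have h1 : 1 ≤ L ^ ε := Real.one_le_rpow hL hε0.le
  have h2 : Real.log (1 + L) ≤ 2 ^ ε / ε * L ^ ε := by
    calc Real.log (1 + L) ≤ Real.log (2 * L) := Real.log_le_log (by linarith) (by linarith)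
      _ ≤ (2 * L) ^ ε / ε := Real.log_le_rpow_div (by linarith) hε0
      _ = _ := by
          rw [Real.mul_rpow (by norm_num) hL0.le]
          ring
  have h3 : 0 ≤ Real.log (1 + L) := Real.log_nonneg (by linarith)
  calc (3 + 2 * Real.log (1 + L)) ^ (2 * N) ≤ ((3 + 2 * (2 ^ ε / ε)) * L ^ ε) ^ (2 * N) := by
        gcongr
        nlinarith
    _ = (3 + 2 * (2 ^ ε / ε)) ^ (2 * N) * L ^ (ε * (2 * N : ℕ)) := by
        rw [mul_pow, Real.rpow_mul_natCast hL0.le]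
    _ ≤ _ := by
        refine mul_le_mul_of_nonneg_left (Real.rpow_le_rpow_of_exponent_le hL ?_) (by positivity)
        rw [hε, div_mul_eq_mul_div, div_le_div_iff₀ (by positivity) (by norm_num)]
        push_cast
        linarith

lemma sum_wt_dampedSum_pow (A N : ℕ) (P : Finset ℕ) (σ u : ℝ) :
    ∑ S ∈ P.powerset, wt P S * |dampedSum A S σ u| ^ (2 * (N + 1)) =
      sieveMoment A (2 * (N + 1)) P u * Real.exp (-((2 * (N + 1) : ℕ) * σ) * u) := by
  rw [sieveMoment, Finset.sum_mul]
  refine Finset.sum_congr rfl fun S _ => ?_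
  rw [(even_two_mul (N + 1)).pow_abs, dampedSum, mul_pow, ← Real.exp_nat_mul, mul_assoc]
  congr 3
  ring

lemma sieveMoment_nonneg (A N : ℕ) (P : Finset ℕ) (u : ℝ) :
    0 ≤ sieveMoment A (2 * (N + 1)) P u :=
  Finset.sum_nonneg fun _ _ => mul_nonneg (wt_nonneg _ _) ((even_two_mul (N + 1)).pow_nonneg _)

lemma integrableOn_sieveMoment_mul_exp (A N : ℕ) (P : Finset ℕ) {σ : ℝ} (hσ : 0 < σ) :
    IntegrableOn (fun u => sieveMoment A (2 * (N + 1)) P u * Real.exp (-σ * u)) (Ioi 0) := by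
  simp only [sieveMoment, Finset.sum_mul]
  refine integrable_finsetSum _ fun S _ => ?_
  refine ((integrableOn_abs_sieveSum_pow A (2 * (N + 1)) S hσ).const_mul (wt P S)).congr
    (.of_forall fun u => ?_)
  simp only
  rw [(even_two_mul (N + 1)).pow_abs, mul_assoc]

/-- Upper bound for the mean of the moment. -/
theorem exists_integral_sieveMoment_le (A N D : ℕ)
    (hB : (2 * (N + 1)).choose (N + 1) ≤ D + 2 * N + 1) (hD : 2 * (N + 1) * A ≤ D) :
    ∃ C : ℝ, 0 < C ∧ ∀ L : ℝ, 2 * N + 2 ≤ L → ∃ M₀ : ℕ, ∀ M, M₀ ≤ M →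
      ∫ u in Ioc 0 L, sieveMoment A (2 * (N + 1)) (primesUpTo M) u ≤
        C * (L ^ D * L ^ (1 / 2 : ℝ)) := by
  obtain ⟨C₁, hC₁, hpiece⟩ := exists_integral_piece_le A N
  obtain ⟨C₂, hC₂, hlog⟩ := exists_log_pow_le N
  set n := 2 * (N + 1) with hn
  have hn0 : n ≠ 0 := by omega
  have hnR : (0 : ℝ) < n := by positivity
  set r : ℝ := (3 / 2 : ℝ) ^ (-(1 / (8 * n)) : ℝ) with hr
  have hr0 : 0 < r := by positivity
  have hr1 : r < 1 := Real.rpow_lt_one_of_one_lt_of_neg (by norm_num)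
    (neg_neg_of_pos (by positivity))
  have hr2 : r ^ (2 * n) = (3 / 2 : ℝ) ^ (-(1 / 4) : ℝ) := by
    rw [hr, ← Real.rpow_mul_natCast (by norm_num)]
    congr 1
    push_cast
    field_simp
    norm_num
  have hrn1 : r ^ n < 1 := pow_lt_one₀ hr0.le hr1 hn0
  have hrn : 0 < 1 - r ^ n := by linarith
  have h1r : 0 < 1 - r := by linarith
  refine ⟨Real.exp n * ((1 / (1 - r)) ^ n * (C₁ * C₂ * (1 / (1 - r ^ n)))), by positivity,
    fun L hL => ?_⟩
  have hL1 : 1 ≤ L := by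
    have : (0 : ℝ) ≤ N := by positivity
    linarith
  have hL0 : 0 < L := by linarith
  set σ := 1 / L with hσdef
  have hσ : 0 < σ := by positivity
  have hσL : 1 / σ = L := by rw [hσdef, one_div_one_div]
  obtain ⟨M₀, hM₀⟩ := hpiece σ hσ (by rw [hσdef, mul_one_div, div_le_one hL0]; exact hL)
  refine ⟨M₀, fun M hM => ?_⟩
  set P := primesUpTo M with hP
  set B := C₁ * (3 + 2 * Real.log (1 + L)) ^ (2 * N) * (L ^ D * L ^ (1 / 4 : ℝ)) with hBdef
  have hlog0 : 0 ≤ Real.log (1 + L) := Real.log_nonneg (by linarith)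
  have hB0 : 0 ≤ B := by positivity
  have hi : ∀ S, Integrable fun u => (dampedSum A S σ u : ℂ) := fun S =>
    integrable_dampedSum A S hσ
  have hpieceB : ∀ β > 0, ∀ i, ∫ u in Ioc 0 L, ∑ S ∈ P.powerset, wt P S *
      ‖∫ t in (breakpoint σ i)..(breakpoint σ (i + 1)),
        inversionKernel (fun u => (dampedSum A S σ u : ℂ)) β u t‖ ^ n ≤ B * r ^ (i * (2 * n)) := by
    intro β hβ i
    refine (hM₀ M hM D hB hD _ _ _ β L (breakpoint_lt hσ i) (le_of_lt hβ) hL0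
      (sameScale_breakpoint hσ i)).trans_eq ?_
    rw [hσL, Real.mul_rpow hσ.le (by positivity), hσdef, one_div L, Real.inv_rpow hL0.le,
      Real.rpow_neg hL0.le, inv_inv, ← Real.rpow_natCast_mul (by norm_num), mul_comm (i : ℝ),
      Real.rpow_mul_natCast (by norm_num), ← hr2, ← pow_mul, mul_comm (2 * n) i, hBdef]
    ring
  set X := (1 / (1 - r)) ^ n * (B * (1 / (1 - r ^ n))) with hX
  have hcont : ∀ (β a b : ℝ) S, Continuous fun u => wt P S *
      ‖∫ t in a..b, inversionKernel (fun u => (dampedSum A S σ u : ℂ)) β u t‖ ^ n :=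
    fun β a b S => (((continuous_intervalIntegral_inversionKernel (hi S) β a b).norm).pow
      _).const_mul _
  have hcont' : ∀ β a b : ℝ, IntegrableOn (fun u => ∑ S ∈ P.powerset, wt P S *
      ‖∫ t in a..b, inversionKernel (fun u => (dampedSum A S σ u : ℂ)) β u t‖ ^ n) (Ioc 0 L) :=
    fun β a b => (Continuous.integrableOn_Icc
      (continuous_finsetSum _ fun S _ => hcont β a b S)).mono_set Ioc_subset_Icc_self
  have hfin : ∀ β > 0, ∀ I, ∫ u in Ioc 0 L, ∑ S ∈ P.powerset, wt P S *
      ‖∫ t in (0 : ℝ)..(breakpoint σ I),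
        inversionKernel (fun u => (dampedSum A S σ u : ℂ)) β u t‖ ^ n ≤ X := by
    intro β hβ I
    have hsplit : ∀ S u, ∫ t in (0 : ℝ)..(breakpoint σ I),
        inversionKernel (fun u => (dampedSum A S σ u : ℂ)) β u t =
        ∑ i ∈ Finset.range I, ∫ t in (breakpoint σ i)..(breakpoint σ (i + 1)),
          inversionKernel (fun u => (dampedSum A S σ u : ℂ)) β u t := fun S u =>
      (intervalIntegral.sum_integral_adjacent_intervals (a := breakpoint σ) fun i _ =>
        (continuous_inversionKernel (hi S) β u).intervalIntegrable _ _).symm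
    calc _ ≤ ∫ u in Ioc 0 L, (1 / (1 - r)) ^ n * ∑ i ∈ Finset.range I, (1 / r) ^ (i * n) *
          ∑ S ∈ P.powerset, wt P S * ‖∫ t in (breakpoint σ i)..(breakpoint σ (i + 1)),
            inversionKernel (fun u => (dampedSum A S σ u : ℂ)) β u t‖ ^ n := by
          refine setIntegral_mono_on (hcont' β 0 _)
            ((integrable_finsetSum _ fun i _ => (hcont' β _ _).const_mul _).const_mul _)
            measurableSet_Ioc fun u _ => ?_
          calc _ ≤ ∑ S ∈ P.powerset, wt P S * ((1 / (1 - r)) ^ n * ∑ i ∈ Finset.range I,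
                (1 / r) ^ (i * n) * ‖∫ t in (breakpoint σ i)..(breakpoint σ (i + 1)),
                  inversionKernel (fun u => (dampedSum A S σ u : ℂ)) β u t‖ ^ n) := by
                refine Finset.sum_le_sum fun S _ =>
                  mul_le_mul_of_nonneg_left ?_ (wt_nonneg _ _)
                rw [hsplit]
                exact norm_sum_pow_le hn0 hr0 hr1 _ I
            _ = _ := by
                simp only [Finset.mul_sum]
                rw [Finset.sum_comm]
                refine Finset.sum_congr rfl fun i _ => Finset.sum_congr rfl fun S _ => ?_
                ring
      _ = (1 / (1 - r)) ^ n * ∑ i ∈ Finset.range I, (1 / r) ^ (i * n) *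
          ∫ u in Ioc 0 L, ∑ S ∈ P.powerset, wt P S *
            ‖∫ t in (breakpoint σ i)..(breakpoint σ (i + 1)),
            inversionKernel (fun u => (dampedSum A S σ u : ℂ)) β u t‖ ^ n := by
          rw [integral_const_mul, integral_finsetSum _ fun i _ => (hcont' β _ _).const_mul _]
          simp only [integral_const_mul]
      _ ≤ (1 / (1 - r)) ^ n * ∑ i ∈ Finset.range I, B * (r ^ n) ^ i := by
          refine mul_le_mul_of_nonneg_left (Finset.sum_le_sum fun i _ => ?_) (by positivity)
          refine (mul_le_mul_of_nonneg_left (hpieceB β hβ i) (by positivity)).trans_eq ?_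
          rw [one_div_pow, show i * (2 * n) = i * n + n * i by ring, pow_add, ← pow_mul]
          field_simp
      _ ≤ X := by
          rw [hX, ← Finset.mul_sum]
          refine mul_le_mul_of_nonneg_left (mul_le_mul_of_nonneg_left ?_ hB0) (by positivity)
          rw [one_div, ← tsum_geometric_of_lt_one (by positivity) hrn1]
          exact (summable_geometric_of_lt_one (by positivity) hrn1).sum_le_tsum _
            fun i _ => by positivity
  have hint : IntegrableOn (fun u => ∑ S ∈ P.powerset, wt P S * |dampedSum A S σ u| ^ n)
      (Ioc 0 L) := by
    simp only [hn, sum_wt_dampedSum_pow]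
    exact (integrableOn_sieveMoment_mul_exp A N P (by positivity)).mono_set Ioc_subset_Ioi_self
  have hmain := integral_sum_abs_pow_le P.powerset (w := wt P) (fun S _ => wt_nonneg P S)
    (g := fun S => dampedSum A S σ) hi (fun S => ae_continuousAt_dampedSum A S σ) n
    (by positivity) (tendsto_breakpoint hσ) hfin hint
  calc ∫ u in Ioc 0 L, sieveMoment A n P u
      ≤ ∫ u in Ioc 0 L, Real.exp n * ∑ S ∈ P.powerset, wt P S * |dampedSum A S σ u| ^ n := by
        refine integral_mono_of_nonneg (.of_forall fun u => sieveMoment_nonneg A N P u)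
          (hint.const_mul _) ?_
        filter_upwards [ae_restrict_mem measurableSet_Ioc] with u hu
        simp only [hn, sum_wt_dampedSum_pow]
        rw [mul_left_comm, ← Real.exp_add]
        refine le_mul_of_one_le_right (sieveMoment_nonneg A N P u) (Real.one_le_exp ?_)
        have : σ * u ≤ 1 := by
          rw [hσdef, one_div_mul_eq_div, div_le_one hL0]
          exact hu.2
        rw [← hn]
        nlinarith
    _ = Real.exp n * ∫ u in Ioc 0 L, ∑ S ∈ P.powerset, wt P S * |dampedSum A S σ u| ^ n :=
        integral_const_mul _ _
    _ ≤ Real.exp n * X := by gcongr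
    _ ≤ Real.exp n * ((1 / (1 - r)) ^ n * ((C₁ * (C₂ * L ^ (1 / 4 : ℝ)) *
          (L ^ D * L ^ (1 / 4 : ℝ))) * (1 / (1 - r ^ n)))) := by
        rw [hX, hBdef]
        gcongr
        exact hlog L hL1
    _ = _ := by
        rw [show (1 / 2 : ℝ) = 1 / 4 + 1 / 4 by norm_num, Real.rpow_add hL0]
        ring

end

section

open Filter Topology Polynomial

lemma re_prime_cpow_ofReal {p : ℕ} (x : ℝ) :
    ((p : ℂ) ^ (-(1 + (x : ℂ)))).re = (p : ℝ) ^ (-(1 + x)) := by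
  rw [show (-(1 + (x : ℂ))) = ((-(1 + x) : ℝ) : ℂ) by push_cast; ring, ← Complex.ofReal_natCast,
    ← Complex.ofReal_cpow (Nat.cast_nonneg p), Complex.ofReal_re]

/-- A Mertens-type bound for the sum of reciprocals of primes. -/
lemma exists_sum_one_div_prime_le : ∃ C : ℝ, 0 < C ∧ ∀ M : ℕ, 3 ≤ M →
    ∑ p ∈ primesUpTo M, (1 / p : ℝ) ≤ C + 3 * Real.log (Real.log M) := by
  obtain ⟨C, hC, h⟩ := exists_abs_primeSum_add_log_le (η := 1 / 2) (by norm_num) le_rfl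
  refine ⟨3 * (C + 1 / 2 * Real.log 2), by positivity, fun M hM => ?_⟩
  have hM1 : (3 : ℝ) ≤ M := by exact_mod_cast hM
  have hlog : 1 ≤ Real.log M := by
    rw [Real.le_log_iff_exp_le (by linarith)]
    linarith [Real.exp_one_lt_three]
  set x := 1 / Real.log M with hx
  have hx0 : 0 < x := by positivity
  have hx1 : x ≤ 1 := (div_le_one (by linarith)).2 hlog
  have h1 := (abs_le.1 (h x (by simpa) (by simpa))).2
  rw [Complex.norm_real, Real.norm_of_nonneg hx0.le, min_eq_right hx1, Complex.ofReal_im, abs_zero,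
    add_zero, hx, one_div, Real.log_inv, ← one_div, ← hx] at h1
  have hs := summable_re_prime_cpow (z := (x : ℂ)) (by simpa)
  have h2 : ∑ p ∈ primesUpTo M, (p : ℝ) ^ (-(1 + x)) ≤ primeSum x := by
    rw [primeSum]
    simp only [re_prime_cpow_ofReal] at hs ⊢
    have e : ∑ p ∈ primesUpTo M, (p : ℝ) ^ (-(1 + x)) =
        ∑ p ∈ (primesUpTo M).subtype Nat.Prime, ((p : ℕ) : ℝ) ^ (-(1 + x)) :=
      (Finset.sum_subtype_of_mem (fun p : ℕ => (p : ℝ) ^ (-(1 + x)))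
        fun p hp => prime_of_mem_primesUpTo hp).symm
    rw [e]
    let s : Finset Nat.Primes := (primesUpTo M).subtype Nat.Prime
    exact Summable.sum_le_tsum s (fun p _ => by positivity) hs
  calc ∑ p ∈ primesUpTo M, (1 / p : ℝ) ≤ ∑ p ∈ primesUpTo M, 3 * (p : ℝ) ^ (-(1 + x)) := by
        refine Finset.sum_le_sum fun p hp => ?_
        have hp0 : (0 : ℝ) < p := by exact_mod_cast (prime_of_mem_primesUpTo hp).pos
        have hpM : (p : ℝ) ≤ M := by
          exact_mod_cast (Finset.mem_Icc.1 (Finset.mem_filter.1 hp).1).2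
        have h3 : (p : ℝ) ^ x ≤ 3 := by
          calc (p : ℝ) ^ x ≤ (M : ℝ) ^ x := Real.rpow_le_rpow hp0.le hpM hx0.le
            _ = Real.exp 1 := by
                rw [Real.rpow_def_of_pos (by linarith), hx, mul_one_div_cancel (by linarith)]
            _ ≤ 3 := Real.exp_one_lt_three.le
        rw [neg_add, Real.rpow_add hp0, Real.rpow_neg_one, Real.rpow_neg hp0.le, one_div,
          mul_left_comm]
        refine le_mul_of_one_le_right (by positivity) ?_
        rw [← div_eq_mul_inv, one_le_div (by positivity)]
        exact h3
    _ = 3 * ∑ p ∈ primesUpTo M, (p : ℝ) ^ (-(1 + x)) := (Finset.mul_sum _ _ _).symm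
    _ ≤ _ := by linarith

lemma sieveMoment_le (A n : ℕ) {P : Finset ℕ} {u : ℝ} (hu : 0 ≤ u) :
    sieveMoment A n P u ≤ u ^ (A * n) * Real.exp (2 ^ n * ∑ p ∈ P, (1 / p : ℝ)) := by
  have h := sum_wt_smul_prod P (fun _ => (2 ^ n : ℝ))
  calc sieveMoment A n P u ≤ ∑ S ∈ P.powerset, u ^ (A * n) * (wt P S • ∏ p ∈ S, (2 ^ n : ℝ)) := by
        refine Finset.sum_le_sum fun S _ => ?_
        rw [smul_eq_mul, mul_left_comm]
        refine mul_le_mul_of_nonneg_left ((le_abs_self _).trans ?_) (wt_nonneg _ _)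
        rw [abs_pow]
        refine (pow_le_pow_left₀ (abs_nonneg _) (abs_sieveSum_le A S u) n).trans_eq ?_
        rw [posPow_eq_pow hu, mul_pow, Finset.prod_const, ← pow_mul, ← pow_mul, ← pow_mul]
        ring
    _ = u ^ (A * n) * ∏ p ∈ P, (1 + (1 / p : ℝ) • ((2 ^ n : ℝ) - 1)) := by
        rw [← Finset.mul_sum, h]
    _ ≤ u ^ (A * n) * ∏ p ∈ P, Real.exp (2 ^ n * (1 / p : ℝ)) := by
        have h2 : (1 : ℝ) ≤ 2 ^ n := one_le_pow₀ (by norm_num)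
        refine mul_le_mul_of_nonneg_left (Finset.prod_le_prod (fun p _ => ?_) fun p _ => ?_)
          (by positivity)
        · have : 0 ≤ (1 / p : ℝ) • ((2 ^ n : ℝ) - 1) := smul_nonneg (by positivity) (by linarith)
          linarith
        · have h3 := Real.add_one_le_exp (2 ^ n * (1 / p : ℝ))
          have h4 : (0 : ℝ) ≤ 1 / p := by positivity
          rw [smul_eq_mul]
          linarith
    _ = _ := by rw [← Real.exp_sum, Finset.mul_sum]

/-- A crude bound for the moment beyond the range of the primes involved. -/
lemma exists_sieveMoment_le_pow (A n : ℕ) : ∃ C : ℝ, 0 < C ∧ ∃ G : ℕ, ∀ M : ℕ, 3 ≤ M → ∀ u : ℝ,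
    Real.log M ≤ u → sieveMoment A n (primesUpTo M) u ≤ C * u ^ G := by
  obtain ⟨C, hC, h⟩ := exists_sum_one_div_prime_le
  refine ⟨Real.exp (2 ^ n * C), by positivity, A * n + 2 ^ n * 3, fun M hM u hu => ?_⟩
  have hM1 : (3 : ℝ) ≤ M := by exact_mod_cast hM
  have hlog : 0 < Real.log M := Real.log_pos (by linarith)
  have hu0 : 0 < u := hlog.trans_le hu
  refine (sieveMoment_le A n hu0.le).trans ?_
  have e : u ^ (2 ^ n * 3) = Real.exp (2 ^ n * (3 * Real.log u)) := by
    conv_lhs => rw [← Real.exp_log hu0]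
    rw [← Real.exp_nat_mul]
    congr 1
    push_cast
    ring
  rw [pow_add, e, mul_left_comm, ← Real.exp_add, ← mul_add]
  refine mul_le_mul_of_nonneg_left (Real.exp_le_exp.2 ?_) (by positivity)
  refine mul_le_mul_of_nonneg_left ((h M hM).trans ?_) (by positivity)
  have := Real.log_le_log hlog hu
  linarith

lemma sieveMoment_primesUpTo_eq (A n : ℕ) {M : ℕ} {u : ℝ} (hu : 0 < u) (hM : Real.exp u ≤ M) :
    sieveMoment A n (primesUpTo M) u = logMoment A n u :=
  sieveMoment_eq_logMoment A n hu (fun _ hp => prime_of_mem_primesUpTo hp) fun _ hp hpu =>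
    Finset.mem_filter.2 ⟨Finset.mem_Icc.2 ⟨hp.one_lt.le, by exact_mod_cast hpu.trans hM⟩, hp⟩

lemma exists_logMoment_le (A n : ℕ) {L : ℝ} (hL : 0 < L) : ∃ H : ℝ, 0 < H ∧
    ∀ u, 0 < u → u ≤ L → logMoment A n u ≤ H := by
  set M := ⌈Real.exp L⌉₊
  refine ⟨L ^ (A * n) * Real.exp (2 ^ n * ∑ p ∈ primesUpTo M, (1 / p : ℝ)), by positivity,
    fun u hu huL => ?_⟩
  rw [← sieveMoment_primesUpTo_eq A n hu ((Real.exp_le_exp.2 huL).trans (Nat.le_ceil _))]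
  refine (sieveMoment_le A n hu.le).trans ?_
  gcongr

lemma logMoment_nonneg (A N : ℕ) (u : ℝ) : 0 ≤ logMoment A (2 * (N + 1)) u :=
  sieveMoment_nonneg A N _ u

lemma tendsto_eval_div_pow {P : ℝ[X]} {m : ℕ} (hP : P.natDegree ≤ m) :
    Tendsto (fun u : ℝ => P.eval u / u ^ m) atTop (𝓝 (P.coeff m)) := by
  have h1 : ∀ i ∈ Finset.range m, Tendsto (fun u : ℝ => P.coeff i * u ^ i / u ^ m) atTop (𝓝 0) := by
    intro i hi
    have := (tendsto_pow_div_pow_atTop_zero (𝕜 := ℝ) (Finset.mem_range.1 hi)).const_mul (P.coeff i)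
    rw [mul_zero] at this
    exact this.congr fun u => by ring
  have h2 := (tendsto_finsetSum _ h1).add (tendsto_const_nhds (x := P.coeff m))
  rw [Finset.sum_const_zero, zero_add] at h2
  refine h2.congr' ?_
  filter_upwards [eventually_gt_atTop 0] with u hu
  rw [P.eval_eq_sum_range' (Nat.lt_succ_of_le hP), Finset.sum_range_succ, add_div,
    Finset.sum_div, mul_div_assoc (P.coeff m), div_self (by positivity), mul_one]

lemma exists_abs_eval_sub_le {P : ℝ[X]} {m : ℕ} (hP : P.natDegree ≤ m) : ∃ K : ℝ, 0 < K ∧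
    ∀ u : ℝ, 1 ≤ u → |P.eval u - P.coeff m * u ^ m| ≤ K * (u ^ m / u) := by
  refine ⟨∑ i ∈ Finset.range m, |P.coeff i| + 1, by positivity, fun u hu => ?_⟩
  have hu0 : 0 < u := by linarith
  rw [P.eval_eq_sum_range' (Nat.lt_succ_of_le hP), Finset.sum_range_succ, add_sub_cancel_right]
  calc _ ≤ ∑ i ∈ Finset.range m, |P.coeff i| * (u ^ m / u) := by
        refine (Finset.abs_sum_le_sum_abs _ _).trans (Finset.sum_le_sum fun i hi => ?_)
        rw [abs_mul, abs_of_pos (pow_pos hu0 i)]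
        refine mul_le_mul_of_nonneg_left ?_ (abs_nonneg _)
        rw [le_div_iff₀ hu0, ← pow_succ]
        exact pow_le_pow_right₀ hu (Finset.mem_range.1 hi)
    _ ≤ _ := by
        rw [← Finset.sum_mul]
        refine mul_le_mul_of_nonneg_right (by linarith) (by positivity)

end

section

open Filter Topology Polynomial

/-- The degree of growth of the moment after multiplication by `(log R) ^ (2 * (N + 1) * A)`,
plus one. -/
def momentOrder (A N : ℕ) : ℕ :=
  max ((2 * (N + 1)).choose (N + 1) - (2 * N + 1)) (2 * (N + 1) * A)

lemma le_choose (N : ℕ) : 2 * N + 2 ≤ (2 * (N + 1)).choose (N + 1) := by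
  have h := Nat.choose_le_centralBinom 1 (N + 1)
  rw [Nat.centralBinom, Nat.choose_one_right] at h
  omega

lemma one_le_momentOrder (A N : ℕ) : 1 ≤ momentOrder A N := by
  have := le_choose N
  exact le_max_of_le_left (by omega)

lemma integrableOn_sieveMoment_Ioc (A N : ℕ) (P : Finset ℕ) (L : ℝ) :
    IntegrableOn (sieveMoment A (2 * (N + 1)) P) (Ioc 0 L) := by
  have h := (integrableOn_sieveMoment_mul_exp A N P one_pos).mono_set
    (Ioc_subset_Ioi_self : Ioc 0 L ⊆ Ioi 0)
  have h2 : Measurable (sieveMoment A (2 * (N + 1)) P) :=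
    Finset.measurable_sum _ fun S _ => ((measurable_sieveSum A S).pow_const _).const_mul _
  refine (h.const_mul (Real.exp L)).mono' h2.aestronglyMeasurable ?_
  filter_upwards [ae_restrict_mem measurableSet_Ioc] with u hu
  rw [Real.norm_of_nonneg (sieveMoment_nonneg _ _ _ _), mul_left_comm, ← Real.exp_add]
  exact le_mul_of_one_le_right (sieveMoment_nonneg _ _ _ _)
    (Real.one_le_exp (by linarith [hu.2]))

lemma natDegree_lt_momentOrder (A N : ℕ) {P : ℝ[X]} {C L₀ : ℝ}
    (hP : ∀ L, L₀ ≤ L → |logMoment A (2 * (N + 1)) L - P.eval L| ≤ C / L) :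
    P.natDegree < momentOrder A N := by
  set D := momentOrder A N with hD
  by_contra! hdeg
  have hD1 := one_le_momentOrder A N
  have ha : 0 < |P.leadingCoeff| := abs_pos.2 <| leadingCoeff_ne_zero.2 <| by
    rintro rfl
    simp at hdeg
    omega
  set a := |P.leadingCoeff| with hadef
  obtain ⟨B, hB, hup⟩ := exists_integral_sieveMoment_le A N D
    (by have := le_max_left ((2 * (N + 1)).choose (N + 1) - (2 * N + 1)) (2 * (N + 1) * A)
        rw [hD, momentOrder]
        omega) (le_max_right _ _)
  have h1 : ∀ᶠ u : ℝ in atTop, a / 4 * u ^ D ≤ logMoment A (2 * (N + 1)) u := by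
    have h2 : ∀ᶠ u : ℝ in atTop, a / 2 < |P.eval u / u ^ P.natDegree| :=
      (tendsto_eval_div_pow le_rfl).abs.eventually_const_lt (by
        rw [coeff_natDegree]
        linarith)
    filter_upwards [h2, eventually_ge_atTop L₀, eventually_ge_atTop 1,
      eventually_ge_atTop (4 * C / a)] with u hu hu0 hu1 huC
    have hup : 0 < u := by linarith
    rw [abs_div, abs_of_pos (pow_pos hup P.natDegree), lt_div_iff₀ (by positivity)] at hu
    have h3 := hP u hu0
    have h4 : |P.eval u| ≤ logMoment A (2 * (N + 1)) u + C / u := by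
      rw [abs_sub_comm] at h3
      have := abs_sub_abs_le_abs_sub (P.eval u) (logMoment A (2 * (N + 1)) u)
      rw [abs_of_nonneg (logMoment_nonneg A N u)] at this
      linarith
    have h5 : u ^ D ≤ u ^ P.natDegree := pow_le_pow_right₀ hu1 hdeg
    have h6 : C / u ≤ a / 4 := by
      rw [div_le_iff₀ ha] at huC
      rw [div_le_iff₀ hup]
      linarith
    have h7 : (1 : ℝ) ≤ u ^ D := one_le_pow₀ hu1
    nlinarith
  obtain ⟨L₁, hL₁⟩ := eventually_atTop.1 h1
  obtain ⟨L, h2, h3, h4, h5⟩ := ((eventually_ge_atTop (2 * L₁)).and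
    ((eventually_ge_atTop (2 * N + 2 : ℝ)).and ((eventually_gt_atTop 0).and
      ((tendsto_rpow_atTop (y := 1 / 2) (by norm_num)).eventually_gt_atTop
        (B * 2 ^ (D + 1) * 4 / a))))).exists
  obtain ⟨M₀, hM₀⟩ := hup L h3
  set M := max M₀ ⌈Real.exp L⌉₊
  have h6 := hM₀ M (le_max_left _ _)
  have hM : Real.exp L ≤ M :=
    (Nat.le_ceil _).trans (by exact_mod_cast le_max_right M₀ ⌈Real.exp L⌉₊)
  have h7 : (L / 2) * (a / 4 * (L / 2) ^ D) ≤
      ∫ u in Ioc 0 L, sieveMoment A (2 * (N + 1)) (primesUpTo M) u := by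
    have hsub : Ioc (L / 2) L ⊆ Ioc 0 L := Ioc_subset_Ioc_left (by linarith)
    calc (L / 2) * (a / 4 * (L / 2) ^ D) = ∫ _ in Ioc (L / 2) L, a / 4 * (L / 2) ^ D := by
          rw [setIntegral_const, Real.volume_real_Ioc_of_le (by linarith), smul_eq_mul]
          ring
      _ ≤ ∫ u in Ioc (L / 2) L, sieveMoment A (2 * (N + 1)) (primesUpTo M) u := by
          refine setIntegral_mono_on (integrableOn_const (by simp))
            ((integrableOn_sieveMoment_Ioc A N _ L).mono_set hsub) measurableSet_Ioc fun u hu => ?_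
          rw [sieveMoment_primesUpTo_eq _ _ (by linarith [hu.1])
            ((Real.exp_le_exp.2 hu.2).trans hM)]
          refine le_trans ?_ (hL₁ u (by linarith [hu.1]))
          exact mul_le_mul_of_nonneg_left (pow_le_pow_left₀ (by linarith) hu.1.le _)
            (by positivity)
      _ ≤ _ := setIntegral_mono_set (integrableOn_sieveMoment_Ioc A N _ L)
          (.of_forall fun u => sieveMoment_nonneg A N _ u) hsub.eventuallyLE
  have h8 := h7.trans h6
  set s := L ^ (1 / 2 : ℝ) with hs
  have hss : s * s = L := by
    rw [hs, ← Real.rpow_add h4]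
    norm_num
  have hs0 : 0 < s := by positivity
  have h9 : L ^ D * s * (s * a) ≤ L ^ D * s * (B * 2 ^ (D + 1) * 4) := by
    have e : (L / 2) * (a / 4 * (L / 2) ^ D) = L ^ D * s * (s * a) / (2 ^ (D + 1) * 4) := by
      rw [show L ^ D * s * (s * a) = L ^ D * (s * s) * a by ring, hss, div_pow, pow_succ]
      field_simp
    rw [e, div_le_iff₀ (by positivity)] at h8
    linarith
  rw [div_lt_iff₀ ha] at h5
  linarith [le_of_mul_le_mul_left h9 (by positivity)]

lemma exists_le_integral_sieveMoment' (A N : ℕ) : ∃ c : ℝ, 0 < c ∧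
    ∀ σ : ℝ, 0 < σ → (2 * N + 2) * σ ≤ 1 → ∃ M₀ : ℕ, ∀ M, M₀ ≤ M →
      c * (1 / σ) ^ momentOrder A N ≤
        ∫ u in Ioi 0, sieveMoment A (2 * (N + 1)) (primesUpTo M) u * Real.exp (-σ * u) := by
  obtain ⟨c, hc, h⟩ := exists_le_integral_sieveMoment A N
  refine ⟨c, hc, fun σ hσ hσ1 => ?_⟩
  obtain ⟨M₀, hM₀⟩ := h σ hσ hσ1
  refine ⟨M₀, fun M hM => ?_⟩
  obtain ⟨h1, h2⟩ := hM₀ M hM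
  rw [momentOrder]
  rcases max_choice ((2 * (N + 1)).choose (N + 1) - (2 * N + 1)) (2 * (N + 1) * A) with e | e
  · rw [e]
    convert h2 using 2
    have hb : 2 * N + 1 ≤ (2 * (N + 1)).choose (N + 1) := by
      have := le_choose N
      omega
    rw [div_pow, one_pow, div_eq_div_iff (by positivity) (by positivity), one_mul, ← pow_add,
      Nat.add_sub_cancel' hb]
  · rwa [e]

lemma integral_pow_mul_exp_neg_mul_Ioi (m : ℕ) {σ : ℝ} (hσ : 0 < σ) :
    ∫ u in Ioi (0 : ℝ), u ^ m * Real.exp (-σ * u) = m.factorial * (1 / σ) ^ (m + 1) := by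
  have h := Real.integral_rpow_mul_exp_neg_mul_Ioi (a := (m + 1 : ℝ)) (by positivity) hσ
  rw [Real.Gamma_nat_eq_factorial, mul_comm, add_sub_cancel_right] at h
  simp only [Real.rpow_natCast, ← neg_mul] at h
  rw [h]
  congr 1
  exact_mod_cast Real.rpow_natCast (1 / σ) (m + 1)

lemma integrableOn_pow_mul_exp_neg_mul_Ioi (m : ℕ) {σ : ℝ} (hσ : 0 < σ) :
    IntegrableOn (fun u : ℝ => u ^ m * Real.exp (-σ * u)) (Ioi 0) := by
  refine (integrableOn_pow_mul_exp m hσ).mono' (by fun_prop) ?_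
  filter_upwards [ae_restrict_mem measurableSet_Ioi] with u hu
  have hu' : (0 : ℝ) < u := hu
  rw [Real.norm_of_nonneg (by positivity)]
  gcongr
  linarith

lemma coeff_momentOrder_pos (A N : ℕ) {P : ℝ[X]} {C L₀ : ℝ}
    (hP : ∀ L, L₀ ≤ L → |logMoment A (2 * (N + 1)) L - P.eval L| ≤ C / L)
    {m : ℕ} (hm : m + 1 = momentOrder A N) (hdeg : P.natDegree ≤ m) :
    0 < P.coeff m := by
  by_contra! hp
  obtain ⟨c, hc, hlow⟩ := exists_le_integral_sieveMoment' A N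
  rw [← hm] at hlow
  obtain ⟨C', hC', G, hG⟩ := exists_sieveMoment_le_pow A (2 * (N + 1))
  have hf : (0 : ℝ) < m.factorial := by exact_mod_cast m.factorial_pos
  set δ := c / (4 * m.factorial) with hδ
  have hδ0 : 0 < δ := by positivity
  have h1 : ∀ᶠ u : ℝ in atTop, logMoment A (2 * (N + 1)) u ≤ δ * u ^ m := by
    filter_upwards [(tendsto_eval_div_pow hdeg).eventually_lt_const
      (show P.coeff m < δ / 2 by linarith [half_pos hδ0]), eventually_ge_atTop L₀,
      eventually_ge_atTop 1, eventually_ge_atTop (2 * C / δ)] with u hu hu0 hu1 huC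
    have hup : 0 < u := by linarith
    rw [div_lt_iff₀ (by positivity)] at hu
    have h3 := (abs_le.1 (hP u hu0)).2
    have h6 : C / u ≤ δ / 2 := by
      rw [div_le_iff₀ hδ0] at huC
      rw [div_le_iff₀ hup]
      linarith
    have h7 : (1 : ℝ) ≤ u ^ m := one_le_pow₀ hu1
    nlinarith
  obtain ⟨L₁, hL₁⟩ := eventually_atTop.1 h1
  obtain ⟨L, hL⟩ : ∃ L, L = max L₁ 1 := ⟨_, rfl⟩
  have hL0 : 0 < L := hL ▸ lt_max_of_lt_right one_pos
  obtain ⟨H, hH, hsmall⟩ := exists_logMoment_le A (2 * (N + 1)) hL0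
  have hbound : ∀ σ : ℝ, 0 < σ → (2 * N + 2) * σ ≤ 1 → c / 2 * (1 / σ) ^ (m + 1) ≤ H * L := by
    intro σ hσ hσ1
    obtain ⟨M₀, hM₀⟩ := hlow σ hσ hσ1
    set T := C' * ((G + 1).factorial * (1 / σ) ^ (G + 2)) with hT
    have hT0 : 0 < T := by positivity
    have hc4 : 0 < c / 4 * (1 / σ) ^ (m + 1) := by positivity
    obtain ⟨M, hMM₀, hM3, hMT⟩ := ((eventually_ge_atTop M₀).and ((eventually_ge_atTop 3).and
      ((Real.tendsto_log_atTop.comp tendsto_natCast_atTop_atTop).eventually_ge_atTop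
        (T / (c / 4 * (1 / σ) ^ (m + 1)))))).exists
    have hM1 : (3 : ℝ) ≤ M := by exact_mod_cast hM3
    have hlog : 0 < Real.log M := Real.log_pos (by linarith)
    have h2 := hM₀ M hMM₀
    simp only [Function.comp_apply] at hMT
    rw [div_le_iff₀ hc4, ← div_le_iff₀' hlog] at hMT
    have hi1 : IntegrableOn ((Ioc 0 L).indicator fun _ => H) (Ioi 0) :=
      ((integrable_indicator_iff measurableSet_Ioc).2
        (integrableOn_const (by simp))).integrableOn
    have hi2 := (integrableOn_pow_mul_exp_neg_mul_Ioi m hσ).const_mul δ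
    have hi3 := (integrableOn_pow_mul_exp_neg_mul_Ioi (G + 1) hσ).const_mul (C' / Real.log M)
    have h3 : ∫ u in Ioi 0, sieveMoment A (2 * (N + 1)) (primesUpTo M) u * Real.exp (-σ * u) ≤
        ∫ u in Ioi 0, ((Ioc 0 L).indicator (fun _ => H) u + δ * (u ^ m * Real.exp (-σ * u)) +
          C' / Real.log M * (u ^ (G + 1) * Real.exp (-σ * u))) := by
      refine setIntegral_mono_on (integrableOn_sieveMoment_mul_exp A N _ hσ)
        ((hi1.add hi2).add hi3) measurableSet_Ioi fun u hu => ?_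
      have hu0 : (0 : ℝ) < u := hu
      have ha : 0 ≤ (Ioc 0 L).indicator (fun _ => H) u := indicator_nonneg (fun _ _ => hH.le) u
      have hb : 0 ≤ δ * (u ^ m * Real.exp (-σ * u)) := by positivity
      have hd : 0 ≤ C' / Real.log M * (u ^ (G + 1) * Real.exp (-σ * u)) := by positivity
      rcases le_total u (Real.log M) with huM | huM
      · rw [sieveMoment_primesUpTo_eq _ _ hu0
          ((Real.le_log_iff_exp_le (by linarith)).1 huM)]
        rcases le_or_gt u L with huL | huL
        · have h4 : logMoment A (2 * (N + 1)) u * Real.exp (-σ * u) ≤ H * 1 :=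
            mul_le_mul (hsmall u hu0 huL) (Real.exp_le_one_iff.2 (by nlinarith))
              (Real.exp_pos _).le hH.le
          rw [indicator_of_mem (show u ∈ Ioc 0 L from ⟨hu0, huL⟩)]
          linarith
        · have h4 := mul_le_mul_of_nonneg_right
            (hL₁ u ((le_max_left L₁ 1).trans (hL ▸ huL.le))) (Real.exp_pos (-σ * u)).le
          rw [mul_assoc] at h4
          linarith
      · have h4 : sieveMoment A (2 * (N + 1)) (primesUpTo M) u ≤
            C' / Real.log M * u ^ (G + 1) := by
          refine (hG M hM3 u huM).trans ?_
          rw [div_mul_eq_mul_div, le_div_iff₀ hlog, pow_succ, mul_assoc]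
          exact mul_le_mul_of_nonneg_left
            (mul_le_mul_of_nonneg_left huM (by positivity)) hC'.le
        have h5 := mul_le_mul_of_nonneg_right h4 (Real.exp_pos (-σ * u)).le
        rw [mul_assoc] at h5
        linarith
    have h4 : ∫ u in Ioi (0 : ℝ), (Ioc 0 L).indicator (fun _ => H) u = H * L := by
      rw [setIntegral_indicator measurableSet_Ioc,
        inter_eq_self_of_subset_right Ioc_subset_Ioi_self, setIntegral_const,
        Real.volume_real_Ioc_of_le hL0.le, smul_eq_mul]
      ring
    have h5 := integral_add (hi1.add hi2) hi3
    simp only [Pi.add_apply] at h5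
    rw [h5, integral_add hi1 hi2, integral_const_mul,
      integral_const_mul, integral_pow_mul_exp_neg_mul_Ioi m hσ,
      integral_pow_mul_exp_neg_mul_Ioi (G + 1) hσ, h4] at h3
    have e1 : δ * (m.factorial * (1 / σ) ^ (m + 1)) = c / 4 * (1 / σ) ^ (m + 1) := by
      rw [hδ]
      field_simp
    have e2 : C' / Real.log M * ((G + 1).factorial * (1 / σ) ^ (G + 2)) = T / Real.log M := by
      rw [hT]
      ring
    rw [e1, e2] at h3
    linarith
  have hN : (0 : ℝ) < 2 * N + 2 := by positivity
  obtain ⟨x, hx1, hx2, hx3⟩ := ((eventually_ge_atTop (2 * N + 2 : ℝ)).and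
    ((eventually_ge_atTop (1 : ℝ)).and (eventually_gt_atTop (H * L / (c / 2))))).exists
  have hx0 : 0 < x := by linarith
  have h2 := hbound (1 / x) (by positivity) (by rwa [mul_one_div, div_le_one hx0])
  rw [one_div_one_div] at h2
  rw [div_lt_iff₀ (by positivity)] at hx3
  have h3 : x ≤ x ^ (m + 1) := le_self_pow₀ hx2 (by omega)
  nlinarith

/-- The leading asymptotics of the moment in logarithmic scale. -/
lemma exists_abs_logMoment_sub_le (A N : ℕ) {m : ℕ} (hm : m + 1 = momentOrder A N) :
    ∃ c C : ℝ, 0 < c ∧ 0 < C ∧ ∀ L, 1 ≤ L →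
      |logMoment A (2 * (N + 1)) L - c * L ^ m| ≤ C * (L ^ m / L) := by
  obtain ⟨P, C, L₀, hC, hL₀, hP⟩ := exists_polynomial_abs_logMoment_sub_le A (2 * (N + 1))
  have hdeg : P.natDegree ≤ m := by
    have := natDegree_lt_momentOrder A N hP
    omega
  have hp := coeff_momentOrder_pos A N hP hm hdeg
  obtain ⟨K, hK, hKle⟩ := exists_abs_eval_sub_le hdeg
  have hL₀0 : 0 < L₀ := by linarith
  obtain ⟨H, hH, hsmall⟩ := exists_logMoment_le A (2 * (N + 1)) hL₀0
  refine ⟨P.coeff m, C + K + (H + P.coeff m * L₀ ^ m) * L₀, hp, by positivity, fun L hL => ?_⟩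
  have hL0 : 0 < L := by linarith
  have hLm : 1 / L ≤ L ^ m / L := by
    have : (1 : ℝ) ≤ L ^ m := one_le_pow₀ hL
    gcongr
  have hX : 0 < L ^ m / L := by positivity
  rcases le_total L₀ L with h | h
  · have h1 := abs_sub_le (logMoment A (2 * (N + 1)) L) (P.eval L) (P.coeff m * L ^ m)
    have h2 := hP L h
    have h3 : C / L ≤ C * (L ^ m / L) := by
      rw [div_eq_mul_one_div]
      exact mul_le_mul_of_nonneg_left hLm hC.le
    have h4 : 0 ≤ (H + P.coeff m * L₀ ^ m) * L₀ * (L ^ m / L) := by positivity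
    linarith [hKle L hL]
  · have h1 := hsmall L hL0 h
    have h2 : P.coeff m * L ^ m ≤ P.coeff m * L₀ ^ m := by gcongr
    have h3 := logMoment_nonneg A N L
    have h4 : |logMoment A (2 * (N + 1)) L - P.coeff m * L ^ m| ≤ H + P.coeff m * L₀ ^ m := by
      rw [abs_le]
      have : 0 ≤ P.coeff m * L ^ m := by positivity
      constructor <;> linarith
    have h5 : 1 ≤ L₀ * (L ^ m / L) := by
      calc (1 : ℝ) = L * (1 / L) := by field_simp
        _ ≤ L₀ * (L ^ m / L) := mul_le_mul h hLm (by positivity) hL₀0.le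
    have h6 : 0 ≤ (C + K) * (L ^ m / L) := by positivity
    have h7 := mul_le_mul_of_nonneg_left h5 (show 0 ≤ H + P.coeff m * L₀ ^ m by positivity)
    linarith

end

end

/-- For fixed integers `k ≥ 1` and `A ≥ 0`, there is a constant `c_{k,A} > 0` such that
`𝓜_{f_A,2k}(R) = c_{k,A}·(log R)^{𝓔_{k,A}} + O((log R)^{𝓔_{k,A}−1})`, where
`𝓔_{k,A} = max{binom(2k,k) − 2k(A+1), −1}`. -/
theorem momentM_fA_asymp (k A : ℕ) (hk : 1 ≤ k) :
    ∃ c C : ℝ, 0 < c ∧ 0 < C ∧ ∀ R : ℝ, 3 ≤ R →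
      |momentM (fA A) (2 * k) R -
          c * Real.log R ^ max ((Nat.choose (2 * k) k : ℤ) - ((2 * k * (A + 1) : ℕ) : ℤ)) (-1)| ≤
        C * Real.log R ^
          (max ((Nat.choose (2 * k) k : ℤ) - ((2 * k * (A + 1) : ℕ) : ℤ)) (-1) - 1) := by
  obtain ⟨N, rfl⟩ : ∃ N, k = N + 1 := ⟨k - 1, by omega⟩
  obtain ⟨m, hm⟩ : ∃ m, m + 1 = momentOrder A N := ⟨momentOrder A N - 1, by
    have := one_le_momentOrder A N
    omega⟩
  obtain ⟨c, C, hc, hC, h⟩ := exists_abs_logMoment_sub_le A N hm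
  refine ⟨c, C, hc, hC, fun R hR => ?_⟩
  have hlog : 1 ≤ Real.log R := by
    rw [Real.le_log_iff_exp_le (by linarith)]
    linarith [Real.exp_one_lt_three]
  have hexp : max (((2 * (N + 1)).choose (N + 1) : ℤ) - ((2 * (N + 1) * (A + 1) : ℕ) : ℤ)) (-1) =
      (m : ℤ) - ((2 * (N + 1) * A : ℕ) : ℤ) := by
    have hb := le_choose N
    rw [momentOrder] at hm
    rw [mul_add_one (2 * (N + 1)) A]
    generalize 2 * (N + 1) * A = t at *
    omega
  have h1 := h (Real.log R) hlog
  rw [← momentM_mul_pow_eq_logMoment A (2 * (N + 1)) (by linarith)] at h1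
  set L := Real.log R
  have hL0 : 0 < L := by linarith
  rw [hexp, zpow_sub_one₀ hL0.ne', zpow_sub₀ hL0.ne', zpow_natCast, zpow_natCast]
  set q := L ^ (2 * (N + 1) * A)
  have hq : 0 < q := by positivity
  refine le_of_mul_le_mul_right ?_ hq
  rw [← abs_of_pos hq, ← abs_mul, abs_of_pos hq]
  calc _ = |momentM (fA A) (2 * (N + 1)) R * q - c * L ^ m| := by
        congr 1
        field_simp
    _ ≤ C * (L ^ m / L) := h1
    _ = _ := by field_simp
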